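/- For every positive integer k, all partial derivatives of order k of the matter distribution function f are bounded on (t_p,t_i] × ℝ × ℝ³, and all partial derivatives of order k of the metric functions U, A, ν, α, J, K are bounded on (t_p,t_i] × ℝ. -/

import Mathlib

open MeasureTheory Set

noncomputable section

set_option linter.unusedVariables false

/-- the velocity space `ℝ³` -/
abbrev V3 : Type := ℝ × ℝ × ℝ

/-- partial derivative with respect to the time variable `t` -/
def pt (F : ℝ → ℝ → ℝ) : ℝ → ℝ → ℝ := fun t θ => deriv (fun s => F s θ) t

/-- partial derivative with respect to the space variable `θ` -/
def pθ (F : ℝ → ℝ → ℝ) : ℝ → ℝ → ℝ := fun t θ => deriv (fun x => F t x) θ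

/-- time derivative within `Ici tp` (one-sided at the left endpoint `tp`) -/
def ptW (tp : ℝ) (F : ℝ → ℝ → ℝ) : ℝ → ℝ → ℝ :=
  fun t θ => derivWithin (fun s => F s θ) (Set.Ici tp) t

/-- time derivative of the matter distribution function -/
def ptf (f : ℝ → ℝ → V3 → ℝ) (t θ : ℝ) (v : V3) : ℝ := deriv (fun s => f s θ v) t

/-- one-sided time derivative of the matter distribution function -/
def ptWf (tp : ℝ) (f : ℝ → ℝ → V3 → ℝ) (t θ : ℝ) (v : V3) : ℝ :=
  derivWithin (fun s => f s θ v) (Set.Ici tp) t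

/-- `θ`-derivative of the matter distribution function -/
def pθf (f : ℝ → ℝ → V3 → ℝ) (t θ : ℝ) (v : V3) : ℝ := deriv (fun x => f t x v) θ

/-- derivative in the first velocity variable `v₁` -/
def pv1 (g : V3 → ℝ) (v : V3) : ℝ := deriv (fun y => g (y, v.2.1, v.2.2)) v.1

/-- derivative in the second velocity variable `v₂` -/
def pv2 (g : V3 → ℝ) (v : V3) : ℝ := deriv (fun y => g (v.1, y, v.2.2)) v.2.1

/-- derivative in the third velocity variable `v₃` -/
def pv3 (g : V3 → ℝ) (v : V3) : ℝ := deriv (fun y => g (v.1, v.2.1, y)) v.2.2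

/-- the velocity component `v₀ = −√(α e^{2ν−2U} + α v₁² + α e^{2ν−4U} v₂² + α t⁻² e^{2ν} (v₃ − A v₂)²)` -/
def v0 (α ν U A : ℝ → ℝ → ℝ) (t θ : ℝ) (v : V3) : ℝ :=
  - Real.sqrt (α t θ * Real.exp (2 * ν t θ - 2 * U t θ)
    + α t θ * v.1 ^ 2
    + α t θ * Real.exp (2 * ν t θ - 4 * U t θ) * v.2.1 ^ 2
    + α t θ * (t ^ 2)⁻¹ * Real.exp (2 * ν t θ) * (v.2.2 - A t θ * v.2.1) ^ 2)

/-- `β = ν + (ln α)/2` -/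
def betaF (ν α : ℝ → ℝ → ℝ) : ℝ → ℝ → ℝ := fun t θ => ν t θ + Real.log (α t θ) / 2

/-- the energy `𝓔̃(t) = ∫₀¹ ν_t/(√α t) dθ` -/
def Etilde (ν α : ℝ → ℝ → ℝ) (t : ℝ) : ℝ :=
  ∫ θ in (0:ℝ)..1, pt ν t θ / (Real.sqrt (α t θ) * t)

section

open Filter Topology Metric

set_option linter.unusedSectionVars false

variable {tp ti : ℝ}

/-- First-crossing principle: functions `h i` that start (at time `b`) strictly below barriers `y i` and
whose time derivative at any first contact exceeds that of the barrier stay below for all earlier times. -/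
theorem barrier {ι Z : Type*} [Finite ι] [TopologicalSpace Z] {a b : ℝ} {Kc : Set Z}
    (hK : IsCompact Kc) (h : ι → ℝ → Z → ℝ) (y : ι → ℝ → ℝ)
    (hc : ∀ i, ContinuousOn (fun p : ℝ × Z => h i p.1 p.2) (Icc a b ×ˢ Kc))
    (yc : ∀ i, ContinuousOn (y i) (Icc a b))
    (start : ∀ i, ∀ z ∈ Kc, h i b z < y i b)
    (step : ∀ t ∈ Ico a b, ∀ i, ∀ z ∈ Kc, (∀ j, ∀ z' ∈ Kc, h j t z' ≤ y j t) → h i t z = y i t →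
      ∃ h' y', HasDerivAt (fun s => h i s z) h' t ∧ HasDerivAt (y i) y' t ∧ y' < h') :
    ∀ t ∈ Icc a b, ∀ i, ∀ z ∈ Kc, h i t z < y i t := by
  by_contra! hcon
  obtain ⟨t₁, ht₁, i₁, z₁, hz₁, hbad₁⟩ := hcon
  set Bad : Set ℝ := ⋃ i, Prod.fst '' {p : ℝ × Z | p ∈ Icc a b ×ˢ Kc ∧ y i p.1 ≤ h i p.1 p.2} with hBad
  have hcb : ∀ (i : ι) (c : ℝ) (_ : c ∈ Icc a b), ContinuousOn (fun p : ℝ × Z => h i p.1 p.2 - y i p.1) (Icc a b ×ˢ Kc) := by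
    intro i c _
    exact (hc i).sub ((yc i).comp continuousOn_fst (fun p hp => hp.1))
  have hcomp : IsCompact Bad := by
    refine isCompact_iUnion fun i => ?_
    obtain ⟨u, hu, hu2⟩ := continuousOn_iff_isClosed.1 (hcb i t₁ ht₁) (Ici 0) isClosed_Ici
    have : {p : ℝ × Z | p ∈ Icc a b ×ˢ Kc ∧ y i p.1 ≤ h i p.1 p.2} = u ∩ Icc a b ×ˢ Kc := by
      rw [← hu2]; ext p; simp [and_comm]
    rw [this]
    exact (((isCompact_Icc.prod hK).inter_left hu)).image continuous_fst
  have hne : Bad.Nonempty := ⟨t₁, mem_iUnion.2 ⟨i₁, (t₁, z₁), ⟨⟨ht₁, hz₁⟩, hbad₁⟩, rfl⟩⟩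
  obtain ⟨hmem⟩ := And.intro (hcomp.sSup_mem hne) trivial
  set T := sSup Bad with hT
  obtain ⟨i, ⟨T', z⟩, ⟨⟨hTab, hzK⟩, hbad⟩, hT'⟩ := mem_iUnion.1 hmem
  simp only at hT' hTab hzK hbad
  subst hT'
  have hTb : T < b := by
    rcases hTab.2.lt_or_eq with h1 | h1
    · exact h1
    · rw [h1] at hbad; exact absurd (start i z hzK) (not_lt.2 hbad)
  have hlate : ∀ s ∈ Ioc T b, ∀ j, ∀ z' ∈ Kc, h j s z' < y j s := by
    intro s hs j z' hz'
    by_contra! hcc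
    have : s ∈ Bad := mem_iUnion.2 ⟨j, (s, z'), ⟨⟨⟨hTab.1.trans hs.1.le, hs.2⟩, hz'⟩, hcc⟩, rfl⟩
    have := le_csSup hcomp.bddAbove this
    rw [← hT] at this
    exact absurd hs.1 (not_lt.2 this)
  have hle : ∀ j, ∀ z' ∈ Kc, h j T z' ≤ y j T := by
    intro j z' hz'
    have hcs : ContinuousOn (fun s => h j s z' - y j s) (Icc a b) :=
      (hcb j T hTab).comp (f := fun s : ℝ => ((s, z') : ℝ × Z)) (by fun_prop) (fun s hs => ⟨hs, hz'⟩)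
    have h1 : Tendsto (fun s => h j s z' - y j s) (𝓝[Ioc T b] T) (𝓝 (h j T z' - y j T)) :=
      (hcs T hTab).mono_left (nhdsWithin_mono _ fun s hs => ⟨hTab.1.trans hs.1.le, hs.2⟩)
    have hnb : (𝓝[Ioc T b] T).NeBot := by
      rw [nhdsWithin_Ioc_eq_nhdsGT hTb]; infer_instance
    have := le_of_tendsto h1 (eventually_mem_nhdsWithin.mono fun s hs => (sub_neg.2 (hlate s hs j z' hz')).le)
    linarith
  have heq : h i T z = y i T := le_antisymm (hle i z hzK) hbad
  obtain ⟨h', y', hh, hy, hlt⟩ := step T ⟨hTab.1, hTb⟩ i z hzK hle heq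
  have hd := (hh.sub hy).hasDerivWithinAt (s := Ioi T)
  have hpos : 0 < h' - y' := by linarith
  have hslope := (hasDerivWithinAt_iff_tendsto_slope' (by simp)).1 hd
  have hev := hslope.eventually (lt_mem_nhds hpos)
  have hev2 : ∀ᶠ s in 𝓝[>] T, s ∈ Ioc T b := by
    rw [← nhdsWithin_Ioc_eq_nhdsGT hTb]; exact eventually_mem_nhdsWithin
  obtain ⟨s, hs1, hs2⟩ := (hev.and hev2).exists
  have h3 := hlate s hs2 i z hzK
  rw [slope_def_field] at hs1
  have h4 : 0 < s - T := by linarith [hs2.1]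
  have h5 := (div_pos_iff_of_pos_right h4).1 hs1
  simp only [Pi.sub_apply] at h5
  linarith [heq]

/-- space-time-velocity space -/
abbrev E5 : Type := ℝ × ℝ × V3

/-- the open region `(tp, ti) × ℝ × ℝ³` -/
def strip (tp ti : ℝ) : Set E5 := Ioo tp ti ×ˢ univ

theorem mem_strip {p : E5} : p ∈ strip tp ti ↔ p.1 ∈ Ioo tp ti := by simp [strip]

theorem isOpen_strip : IsOpen (strip tp ti) := isOpen_Ioo.prod isOpen_univ

open Classical in
/-- extension by zero of a function on the strip -/
def extz (g : strip tp ti → ℝ) (p : E5) : ℝ := if h : p ∈ strip tp ti then g ⟨p, h⟩ else 0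

theorem extz_of_mem (g : strip tp ti → ℝ) {p : E5} (h : p ∈ strip tp ti) : extz g p = g ⟨p, h⟩ := by
  simp [extz, h]

theorem extz_add (g h : strip tp ti → ℝ) (p : E5) : extz (g + h) p = extz g p + extz h p := by
  unfold extz; split_ifs <;> simp

theorem extz_mul (g h : strip tp ti → ℝ) (p : E5) : extz (g * h) p = extz g p * extz h p := by
  unfold extz; split_ifs <;> simp

/-- the algebra of smooth functions on the strip that are `1`-periodic in `θ` -/
def SF (tp ti : ℝ) : Subalgebra ℝ (strip tp ti → ℝ) where
  carrier := {g | ContDiffOn ℝ (⊤ : ℕ∞) (extz g) (strip tp ti) ∧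
    ∀ t θ v, extz g (t, θ + 1, v) = extz g (t, θ, v)}
  mul_mem' := by
    rintro g h ⟨hg, hg'⟩ ⟨hh, hh'⟩
    refine ⟨(hg.mul hh).congr fun p _ => extz_mul g h p, fun t θ v => ?_⟩
    rw [extz_mul, extz_mul, hg', hh']
  add_mem' := by
    rintro g h ⟨hg, hg'⟩ ⟨hh, hh'⟩
    refine ⟨(hg.add hh).congr fun p _ => extz_add g h p, fun t θ v => ?_⟩
    rw [extz_add, extz_add, hg', hh']
  algebraMap_mem' := by
    intro r
    refine ⟨(contDiffOn_const (c := r)).congr fun p hp => ?_, fun t θ v => ?_⟩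
    · rw [extz_of_mem _ hp]; rfl
    · simp only [extz, mem_strip]; rfl

/-- value of an element of the algebra, as a function on the whole space (zero off the strip) -/
def ev (G : SF tp ti) (p : E5) : ℝ := extz G.1 p

theorem ev_of_mem (G : SF tp ti) {p : E5} (h : p ∈ strip tp ti) : ev G p = G.1 ⟨p, h⟩ :=
  extz_of_mem _ h

theorem SF_ext {G H : SF tp ti} (h : ∀ p ∈ strip tp ti, ev G p = ev H p) : G = H := by
  apply Subtype.ext
  funext p
  have := h p.1 p.2
  rwa [ev_of_mem _ p.2, ev_of_mem _ p.2] at this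

@[simp] theorem ev_add (G H : SF tp ti) (p : E5) : ev (G + H) p = ev G p + ev H p := extz_add _ _ p
@[simp] theorem ev_mul (G H : SF tp ti) (p : E5) : ev (G * H) p = ev G p * ev H p := extz_mul _ _ p
@[simp] theorem ev_smul (c : ℝ) (G : SF tp ti) (p : E5) : ev (c • G) p = c * ev G p := by
  unfold ev extz; split_ifs <;> simp
@[simp] theorem ev_neg (G : SF tp ti) (p : E5) : ev (-G) p = - ev G p := by
  unfold ev extz; split_ifs <;> simp
@[simp] theorem ev_sub (G H : SF tp ti) (p : E5) : ev (G - H) p = ev G p - ev H p := by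
  unfold ev extz; split_ifs <;> simp
@[simp] theorem ev_zero (p : E5) : ev (0 : SF tp ti) p = 0 := by
  unfold ev extz; split_ifs <;> simp
theorem ev_one {p : E5} (h : p ∈ strip tp ti) : ev (1 : SF tp ti) p = 1 := by
  rw [ev_of_mem _ h]; rfl
theorem ev_pow (G : SF tp ti) (n : ℕ) {p : E5} (h : p ∈ strip tp ti) : ev (G ^ n) p = ev G p ^ n := by
  induction n with
  | zero => simp [ev_one h]
  | succ n ih => rw [pow_succ, pow_succ, ev_mul, ih]
theorem ev_algebraMap (c : ℝ) {p : E5} (h : p ∈ strip tp ti) :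
    ev (algebraMap ℝ (SF tp ti) c) p = c := by
  rw [ev_of_mem _ h]; rfl
theorem ev_sum {ι : Type*} (s : Finset ι) (G : ι → SF tp ti) (p : E5) :
    ev (∑ i ∈ s, G i) p = ∑ i ∈ s, ev (G i) p := by
  classical
  induction s using Finset.induction_on with
  | empty => simp
  | insert a s ha ih => simp [Finset.sum_insert ha, ih]

theorem ev_contDiffOn (G : SF tp ti) : ContDiffOn ℝ (⊤ : ℕ∞) (ev G) (strip tp ti) := G.2.1

theorem ev_per (G : SF tp ti) (t θ : ℝ) (v : V3) : ev G (t, θ + 1, v) = ev G (t, θ, v) := G.2.2 t θ v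

theorem ev_contDiffAt (G : SF tp ti) {p : E5} (h : p ∈ strip tp ti) : ContDiffAt ℝ (⊤ : ℕ∞) (ev G) p :=
  (ev_contDiffOn G).contDiffAt (isOpen_strip.mem_nhds h)

theorem ev_differentiableAt (G : SF tp ti) {p : E5} (h : p ∈ strip tp ti) :
    DifferentiableAt ℝ (ev G) p := (ev_contDiffAt G h).differentiableAt (by simp)

theorem ev_continuousOn (G : SF tp ti) : ContinuousOn (ev G) (strip tp ti) :=
  (ev_contDiffOn G).continuousOn

/-- element of the algebra given by a function on the whole space -/
def mkR (g : E5 → ℝ) (hg : ContDiffOn ℝ (⊤ : ℕ∞) g (strip tp ti))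
    (hp : ∀ t ∈ Ioo tp ti, ∀ θ v, g (t, θ + 1, v) = g (t, θ, v)) : SF tp ti :=
  ⟨fun p => g p.1, by
    have hh : ∀ p ∈ strip tp ti, extz (fun p : strip tp ti => g p.1) p = g p := fun p hp => by
      rw [extz_of_mem _ hp]
    refine ⟨hg.congr hh, fun t θ v => ?_⟩
    by_cases ht : t ∈ Ioo tp ti
    · rw [hh _ (mem_strip.2 ht), hh _ (mem_strip.2 ht), hp t ht]
    · simp only [extz, mem_strip]; rw [dif_neg ht, dif_neg ht]⟩

theorem ev_mkR (g : E5 → ℝ) (hg : ContDiffOn ℝ (⊤ : ℕ∞) g (strip tp ti))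
    (hp : ∀ t ∈ Ioo tp ti, ∀ θ v, g (t, θ + 1, v) = g (t, θ, v)) {p : E5} (h : p ∈ strip tp ti) :
    ev (mkR g hg hp) p = g p := ev_of_mem _ h

/-- directional derivative on the algebra, as a plain function -/
def ddf (e : E5) (G : SF tp ti) : SF tp ti :=
  mkR (fun p => fderiv ℝ (ev G) p e)
    (((ev_contDiffOn G).fderiv_of_isOpen isOpen_strip (by simp)).clm_apply contDiffOn_const) (by
      intro t ht θ v
      have : ev G = fun p => ev G (p + ((0 : ℝ), (1 : ℝ), (0 : V3))) := by
        funext p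
        obtain ⟨a, b, c⟩ := p
        have := ev_per G a b c
        simp only [Prod.mk_add_mk, add_zero]
        exact this.symm
      conv_rhs => rw [this]
      rw [fderiv_comp_add_right]
      simp)

theorem ev_ddf (e : E5) (G : SF tp ti) {p : E5} (h : p ∈ strip tp ti) :
    ev (ddf e G) p = fderiv ℝ (ev G) p e := ev_mkR _ _ _ h

/-- directional derivative as a derivation of the algebra -/
def dd (e : E5) : Derivation ℝ (SF tp ti) (SF tp ti) :=
  Derivation.mk'
    { toFun := ddf e
      map_add' := fun G H => SF_ext fun p hp => by
        rw [ev_add, ev_ddf _ _ hp, ev_ddf _ _ hp, ev_ddf _ _ hp]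
        have : ev (G + H) = ev G + ev H := funext fun q => ev_add G H q
        rw [this, fderiv_add (ev_differentiableAt G hp) (ev_differentiableAt H hp)]; rfl
      map_smul' := fun c G => SF_ext fun p hp => by
        rw [RingHom.id_apply, ev_smul, ev_ddf _ _ hp, ev_ddf _ _ hp]
        have : ev (c • G) = fun q => c • ev G q := funext fun q => ev_smul c G q
        rw [this, fderiv_fun_const_smul (ev_differentiableAt G hp)]; rfl }
    (fun G H => SF_ext fun p hp => by
      simp only [LinearMap.coe_mk, AddHom.coe_mk, smul_eq_mul, ev_add, ev_mul]
      rw [ev_ddf _ _ hp, ev_ddf _ _ hp, ev_ddf _ _ hp]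
      have : ev (G * H) = ev G * ev H := funext fun q => ev_mul G H q
      rw [this, fderiv_mul (ev_differentiableAt G hp) (ev_differentiableAt H hp)]
      simp)

theorem ev_dd (e : E5) (G : SF tp ti) {p : E5} (h : p ∈ strip tp ti) :
    ev (dd e G) p = fderiv ℝ (ev G) p e := ev_ddf _ _ h

theorem dd_comm (e e' : E5) (G : SF tp ti) : dd e (dd e' G) = dd e' (dd e G) := by
  have key : ∀ (e e' : E5) {p : E5} (_ : p ∈ strip tp ti),
      ev (dd e (dd e' G)) p = fderiv ℝ (fderiv ℝ (ev G)) p e e' := by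
    intro e e' p hp
    rw [ev_dd _ _ hp]
    have h1 : ev (dd e' G) =ᶠ[𝓝 p] fun q => fderiv ℝ (ev G) q e' := by
      filter_upwards [isOpen_strip.mem_nhds hp] with q hq using ev_dd _ _ hq
    rw [h1.fderiv_eq]
    have h2 : DifferentiableAt ℝ (fderiv ℝ (ev G)) p :=
      ((ev_contDiffAt G hp).fderiv_right (m := (⊤ : ℕ∞)) (by simp)).differentiableAt (by simp)
    rw [fderiv_clm_apply h2 (differentiableAt_const _)]
    simp
  refine SF_ext fun p hp => ?_
  rw [key e e' hp, key e' e hp]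
  exact ((ev_contDiffAt G hp).isSymmSndFDerivAt (by
    rw [minSmoothness_of_isRCLikeNormedField]; exact WithTop.coe_le_coe.2 (le_top : (2 : ℕ∞) ≤ ⊤))) e e'

/-- derivative of `ev G` along a curve -/
theorem hasDerivAt_ev_comp (G : SF tp ti) {c : ℝ → E5} {e : E5} {s : ℝ} (hc : HasDerivAt c e s)
    (h : c s ∈ strip tp ti) : HasDerivAt (fun r => ev G (c r)) (ev (dd e G) (c s)) s := by
  rw [ev_dd _ _ h]
  exact (ev_differentiableAt G h).hasFDerivAt.comp_hasDerivAt s hc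

def eT : E5 := (1, 0, 0, 0, 0)
def eθ : E5 := (0, 1, 0, 0, 0)
def e1 : E5 := (0, 0, 1, 0, 0)
theorem hasDerivAt_ev_t (G : SF tp ti) {t θ : ℝ} {v : V3} (h : t ∈ Ioo tp ti) :
    HasDerivAt (fun s => ev G (s, θ, v)) (ev (dd eT G) (t, θ, v)) t :=
  hasDerivAt_ev_comp G (c := fun s => (s, θ, v)) ((hasDerivAt_id t).prodMk (hasDerivAt_const t (θ, v)))
    (mem_strip.2 h)

theorem hasDerivAt_ev_θ (G : SF tp ti) {t θ : ℝ} {v : V3} (h : t ∈ Ioo tp ti) :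
    HasDerivAt (fun s => ev G (t, s, v)) (ev (dd eθ G) (t, θ, v)) θ :=
  hasDerivAt_ev_comp G (c := fun s => (t, s, v))
    ((hasDerivAt_const θ t).prodMk ((hasDerivAt_id θ).prodMk (hasDerivAt_const θ v)))
    (mem_strip.2 h)

theorem hasDerivAt_ev_1 (G : SF tp ti) {t θ x y z : ℝ} (h : t ∈ Ioo tp ti) :
    HasDerivAt (fun s => ev G (t, θ, s, y, z)) (ev (dd e1 G) (t, θ, x, y, z)) x :=
  hasDerivAt_ev_comp G (c := fun s => (t, θ, s, y, z))
    ((hasDerivAt_const x t).prodMk ((hasDerivAt_const x θ).prodMk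
      ((hasDerivAt_id x).prodMk (hasDerivAt_const x (y, z)))))
    (mem_strip.2 h)

theorem ev_per_int (G : SF tp ti) (t θ : ℝ) (v : V3) (n : ℤ) : ev G (t, θ + n, v) = ev G (t, θ, v) := by
  have : Function.Periodic (fun θ => ev G (t, θ, v)) 1 := fun θ => ev_per G t θ v
  simpa using this.int_mul n θ

theorem ev_fract (G : SF tp ti) (t θ : ℝ) (v : V3) : ev G (t, Int.fract θ, v) = ev G (t, θ, v) := by
  have := ev_per_int G t (Int.fract θ) v ⌊θ⌋
  rwa [Int.fract_add_floor, eq_comm] at this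

/-- composition with a smooth function of one variable -/
def compR (φ : ℝ → ℝ) (hφ : ContDiff ℝ (⊤ : ℕ∞) φ) (G : SF tp ti) : SF tp ti :=
  mkR (fun p => φ (ev G p)) (hφ.comp_contDiffOn (ev_contDiffOn G))
    (fun t _ θ v => by rw [ev_per])

theorem ev_compR (φ : ℝ → ℝ) (hφ : ContDiff ℝ (⊤ : ℕ∞) φ) (G : SF tp ti) {p : E5}
    (h : p ∈ strip tp ti) : ev (compR φ hφ G) p = φ (ev G p) := ev_mkR _ _ _ h

theorem ev_dd_compR (φ : ℝ → ℝ) (hφ : ContDiff ℝ (⊤ : ℕ∞) φ) (G : SF tp ti) (e : E5) {p : E5}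
    (h : p ∈ strip tp ti) : ev (dd e (compR φ hφ G)) p = deriv φ (ev G p) * ev (dd e G) p := by
  rw [ev_dd _ _ h, ev_dd _ _ h]
  have h1 : ev (compR φ hφ G) =ᶠ[𝓝 p] fun q => φ (ev G q) := by
    filter_upwards [isOpen_strip.mem_nhds h] with q hq using ev_compR _ _ _ hq
  rw [h1.fderiv_eq]
  have h2 : HasDerivAt φ (deriv φ (ev G p)) (ev G p) :=
    ((hφ.differentiable (by simp)) _).hasDerivAt
  have h3 := h2.comp_hasFDerivAt p (ev_differentiableAt G h).hasFDerivAt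
  have h4 : HasFDerivAt (fun q => φ (ev G q)) (deriv φ (ev G p) • fderiv ℝ (ev G) p) p := h3
  rw [h4.fderiv]; simp

def expR (G : SF tp ti) : SF tp ti := compR Real.exp Real.contDiff_exp G

theorem ev_expR (G : SF tp ti) {p : E5} (h : p ∈ strip tp ti) : ev (expR G) p = Real.exp (ev G p) :=
  ev_compR _ _ _ h

theorem dd_expR (e : E5) (G : SF tp ti) : dd e (expR G) = expR G * dd e G := SF_ext fun p hp => by
  rw [expR, ev_dd_compR _ _ _ _ hp, ev_mul, ev_compR _ _ _ hp, Real.deriv_exp]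

theorem expR_add (G H : SF tp ti) : expR (G + H) = expR G * expR H := SF_ext fun p hp => by
  rw [ev_mul, ev_expR _ hp, ev_expR _ hp, ev_expR _ hp, ev_add, Real.exp_add]

theorem expR_pos (G : SF tp ti) {p : E5} (h : p ∈ strip tp ti) : 0 < ev (expR G) p := by
  rw [ev_expR _ h]; exact Real.exp_pos _

/-- `1/√G` for a positive element -/
def rsq (G : SF tp ti) (hG : ∀ p ∈ strip tp ti, 0 < ev G p) : SF tp ti :=
  mkR (fun p => (Real.sqrt (ev G p))⁻¹)
    (((ev_contDiffOn G).sqrt fun p hp => (hG p hp).ne').inv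
      fun p hp => (Real.sqrt_pos.2 (hG p hp)).ne')
    (fun t _ θ v => by simp only [ev_per])

theorem ev_rsq (G : SF tp ti) (hG : ∀ p ∈ strip tp ti, 0 < ev G p) {p : E5} (h : p ∈ strip tp ti) :
    ev (rsq G hG) p = (Real.sqrt (ev G p))⁻¹ := ev_mkR _ _ _ h

theorem rsq_sq (G : SF tp ti) (hG : ∀ p ∈ strip tp ti, 0 < ev G p) : G * rsq G hG ^ 2 = 1 :=
  SF_ext fun p hp => by
    rw [ev_mul, ev_pow _ _ hp, ev_rsq _ _ hp, ev_one hp, inv_pow, Real.sq_sqrt (hG p hp).le,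
      mul_inv_cancel₀ (hG p hp).ne']

theorem deriv_of_sq_inv {R : Type*} [CommRing R] [Algebra ℝ R] (D : Derivation ℝ R R) {G r : R}
    (h : G * r ^ 2 = 1) : D r = (-1/2 : ℝ) • (r ^ 3 * D G) := by
  have h1 := congrArg D h
  simp only [Derivation.leibniz, Derivation.leibniz_pow, Derivation.map_one_eq_zero, smul_eq_mul] at h1
  have h2 : D r + D r = - (r ^ 3 * D G) := by
    simp only [nsmul_eq_mul, Nat.cast_ofNat, Nat.add_one_sub_one, pow_one] at h1
    linear_combination r * h1 - 2 * D r * h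
  have : D r = (1/2 : ℝ) • (D r + D r) := by rw [← two_smul ℝ (D r), smul_smul]; norm_num
  rw [this, h2, smul_neg, ← neg_smul]; norm_num

theorem hasDerivAt_setIntegral {Y : Type*} [TopologicalSpace Y] [T2Space Y] [MeasurableSpace Y]
    [TopologicalSpace.PseudoMetrizableSpace Y]
    [BorelSpace Y] {μ : Measure Y} [IsFiniteMeasureOnCompacts μ] {S : Set Y} (hS : IsCompact S)
    (h h' : ℝ → Y → ℝ) {a b t : ℝ} (ht : t ∈ Ioo a b)
    (hc : ContinuousOn (fun p : ℝ × Y => h p.1 p.2) (Icc a b ×ˢ S))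
    (hc' : ContinuousOn (fun p : ℝ × Y => h' p.1 p.2) (Icc a b ×ˢ S))
    (hd : ∀ s ∈ Ioo a b, ∀ y ∈ S, HasDerivAt (fun r => h r y) (h' s y) s) :
    HasDerivAt (fun s => ∫ y in S, h s y ∂μ) (∫ y in S, h' t y ∂μ) t := by
  obtain ⟨C, hC⟩ := (isCompact_Icc.prod hS).exists_bound_of_continuousOn hc'
  have hSm := hS.measurableSet
  have cs : ∀ (g : ℝ → Y → ℝ), ContinuousOn (fun p : ℝ × Y => g p.1 p.2) (Icc a b ×ˢ S) →
      ∀ s ∈ Ioo a b, ContinuousOn (g s) S := fun g hg s hs =>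
    hg.comp (f := fun y : Y => ((s, y) : ℝ × Y)) (by fun_prop) (fun y hy => ⟨Ioo_subset_Icc_self hs, hy⟩)
  refine (hasDerivAt_integral_of_dominated_loc_of_deriv_le (s := Ioo a b) (bound := fun _ => C)
    (isOpen_Ioo.mem_nhds ht) ?_ ?_ ?_ ?_ ?_ ?_).2
  · filter_upwards [isOpen_Ioo.mem_nhds ht] with s hs
    exact (cs h hc s hs).aestronglyMeasurable_of_isCompact hS hSm
  · exact (cs h hc t ht).integrableOn_compact hS
  · exact (cs h' hc' t ht).aestronglyMeasurable_of_isCompact hS hSm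
  · exact (ae_restrict_iff' hSm).2 (Eventually.of_forall fun y hy s hs => hC (s, y) ⟨Ioo_subset_Icc_self hs, hy⟩)
  · exact integrableOn_const (hS.measure_lt_top.ne)
  · exact (ae_restrict_iff' hSm).2 (Eventually.of_forall fun y hy s hs => hd s hs y hy)

theorem exists_Icc_nhds {t : ℝ} (h : t ∈ Ioo tp ti) :
    ∃ a b, t ∈ Ioo a b ∧ Icc a b ⊆ Ioo tp ti := by
  obtain ⟨a, ha⟩ := exists_between h.1
  obtain ⟨b, hb⟩ := exists_between h.2
  exact ⟨a, b, ⟨ha.2, hb.1⟩, fun s hs => ⟨ha.1.trans_le hs.1, hs.2.trans_lt hb.2⟩⟩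

/-- integration over a velocity ball preserves smoothness -/
theorem contDiffOn_ballInt (R : ℝ) (G : SF tp ti) :
    ContDiffOn ℝ (⊤ : ℕ∞) (fun p : E5 => ∫ v in closedBall (0 : V3) R, ev G (p.1, p.2.1, v)) (strip tp ti) := by
  let χ : ContDiffBump (0 : V3) := ⟨|R| + 1, |R| + 2, by positivity, by linarith⟩
  let g : ℝ × ℝ → V3 → ℝ := fun p x => ev G (p.1, p.2, -x) * χ x
  have hsm := contDiffOn_convolution_right_with_param (𝕜 := ℝ) (μ := (volume : Measure V3))
    (f := (closedBall (0 : V3) R).indicator (fun _ => (1 : ℝ))) (n := ⊤) (ContinuousLinearMap.mul ℝ ℝ)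
    (g := g) (s := Ioo tp ti ×ˢ (univ : Set ℝ)) (k := closedBall (0 : V3) (|R| + 2))
    (isOpen_Ioo.prod isOpen_univ) (isCompact_closedBall _ _) ?_ ?_ ?_
  · have h2 : ContDiffOn ℝ (⊤ : ℕ∞) (fun p : E5 => (((p.1, p.2.1), (0 : V3)) : (ℝ × ℝ) × V3)) (strip tp ti) := by
      fun_prop
    refine (hsm.comp h2 fun p hp => ⟨⟨mem_strip.1 hp, trivial⟩, trivial⟩).congr fun p hp => ?_
    simp only [Function.comp_def, convolution, ContinuousLinearMap.mul_apply', zero_sub, g]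
    rw [← integral_indicator measurableSet_closedBall]
    refine integral_congr_ae (Eventually.of_forall fun v => ?_)
    by_cases hv : v ∈ closedBall (0 : V3) R
    · have : χ (-v) = 1 := χ.one_of_mem_closedBall (by
        rw [mem_closedBall_zero_iff] at hv ⊢
        rw [norm_neg]; exact hv.trans ((le_abs_self R).trans (by simp [χ])))
      simp [hv, this]
    · simp [hv]
  · intro p x _ hx
    have : χ x = 0 := χ.zero_of_le_dist (by
      rw [mem_closedBall, not_le] at hx; exact hx.le)
    simp [g, this]
  · exact ((integrable_indicator_iff measurableSet_closedBall).2
      (integrableOn_const (isCompact_closedBall _ _).measure_lt_top.ne)).locallyIntegrable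
  · have h3 : ContDiffOn ℝ (⊤ : ℕ∞) (fun q : (ℝ × ℝ) × V3 => ev G (q.1.1, q.1.2, -q.2))
        ((Ioo tp ti ×ˢ (univ : Set ℝ)) ×ˢ univ) :=
      (ev_contDiffOn G).comp (f := fun q : (ℝ × ℝ) × V3 => ((q.1.1, q.1.2, -q.2) : E5)) (by fun_prop)
        (fun q hq => mem_strip.2 hq.1.1)
    exact h3.mul ((χ.contDiff.comp contDiff_snd).contDiffOn)

/-- integral over a velocity ball, as an operator on the algebra -/
def MR (R : ℝ) (G : SF tp ti) : SF tp ti :=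
  mkR (fun p => ∫ v in closedBall (0 : V3) R, ev G (p.1, p.2.1, v)) (contDiffOn_ballInt R G)
    (fun t _ θ v => by simp only [ev_per])

theorem ev_MR (R : ℝ) (G : SF tp ti) {p : E5} (h : p ∈ strip tp ti) :
    ev (MR R G) p = ∫ v in closedBall (0 : V3) R, ev G (p.1, p.2.1, v) := ev_mkR _ _ _ h

theorem ev_cont_v (G : SF tp ti) {t : ℝ} (h : t ∈ Ioo tp ti) (θ : ℝ) :
    Continuous (fun v : V3 => ev G (t, θ, v)) :=
  continuousOn_univ.1 ((ev_continuousOn G).comp (f := fun v : V3 => ((t, θ, v) : E5)) (by fun_prop)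
    (fun v _ => mem_strip.2 h))

theorem ev_cont_θ (G : SF tp ti) {t : ℝ} (h : t ∈ Ioo tp ti) (v : V3) :
    Continuous (fun θ : ℝ => ev G (t, θ, v)) :=
  continuousOn_univ.1 ((ev_continuousOn G).comp (f := fun θ : ℝ => ((t, θ, v) : E5)) (by fun_prop)
    (fun v _ => mem_strip.2 h))

theorem ev_integrableOn (R : ℝ) (G : SF tp ti) {t : ℝ} (h : t ∈ Ioo tp ti) (θ : ℝ) :
    IntegrableOn (fun v : V3 => ev G (t, θ, v)) (closedBall 0 R) :=
  (ev_cont_v G h θ).continuousOn.integrableOn_compact (isCompact_closedBall _ _)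

theorem MR_add (R : ℝ) (G H : SF tp ti) : MR R (G + H) = MR R G + MR R H := SF_ext fun p hp => by
  rw [ev_add, ev_MR _ _ hp, ev_MR _ _ hp, ev_MR _ _ hp,
    ← integral_add (ev_integrableOn R G (mem_strip.1 hp) _) (ev_integrableOn R H (mem_strip.1 hp) _)]
  simp

theorem fderiv_eq_of_hasDerivAt_line {g : E5 → ℝ} {p e : E5} {d : ℝ} (hg : DifferentiableAt ℝ g p)
    {c : ℝ → E5} {s : ℝ} (hc : HasDerivAt c e s) (hs : c s = p) (h : HasDerivAt (fun r => g (c r)) d s) :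
    fderiv ℝ g p e = d := by
  subst hs
  exact (hg.hasFDerivAt.comp_hasDerivAt s hc).unique h

theorem dd_eT_MR (R : ℝ) (G : SF tp ti) : dd eT (MR R G) = MR R (dd eT G) := SF_ext fun p hp => by
  obtain ⟨t, θ, v⟩ := p
  have ht := mem_strip.1 hp
  obtain ⟨a, b, hab, hsub⟩ := exists_Icc_nhds ht
  rw [ev_MR _ _ hp, ev_dd _ _ hp]
  have hc : HasDerivAt (fun s : ℝ => ((s, θ, v) : E5)) eT t := (hasDerivAt_id t).prodMk (hasDerivAt_const t (θ, v))
  refine fderiv_eq_of_hasDerivAt_line (ev_differentiableAt _ hp) hc rfl ?_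
  have h0 := hasDerivAt_setIntegral (μ := volume) (isCompact_closedBall (0 : V3) R) (fun s v => ev G (s, θ, v))
    (fun s v => ev (dd eT G) (s, θ, v)) hab
    ((ev_continuousOn G).comp (f := fun q : ℝ × V3 => ((q.1, θ, q.2) : E5)) (by fun_prop) fun q hq => mem_strip.2 (hsub hq.1))
    ((ev_continuousOn _).comp (f := fun q : ℝ × V3 => ((q.1, θ, q.2) : E5)) (by fun_prop) fun q hq => mem_strip.2 (hsub hq.1))
    (fun s hs y _ => hasDerivAt_ev_t G (hsub (Ioo_subset_Icc_self hs)))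
  refine h0.congr_of_eventuallyEq ?_
  filter_upwards [isOpen_Ioo.mem_nhds ht] with s hs using ev_MR _ _ (mem_strip.2 hs)

theorem dd_eθ_MR (R : ℝ) (G : SF tp ti) : dd eθ (MR R G) = MR R (dd eθ G) := SF_ext fun p hp => by
  obtain ⟨t, θ, v⟩ := p
  have ht := mem_strip.1 hp
  rw [ev_MR _ _ hp, ev_dd _ _ hp]
  have hc : HasDerivAt (fun s : ℝ => ((t, s, v) : E5)) eθ θ :=
    (hasDerivAt_const θ t).prodMk ((hasDerivAt_id θ).prodMk (hasDerivAt_const θ v))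
  refine fderiv_eq_of_hasDerivAt_line (ev_differentiableAt _ hp) hc rfl ?_
  have h0 := hasDerivAt_setIntegral (μ := volume) (isCompact_closedBall (0 : V3) R) (fun s v => ev G (t, s, v))
    (fun s v => ev (dd eθ G) (t, s, v)) (a := θ - 1) (b := θ + 1) (t := θ) (by constructor <;> linarith)
    ((ev_continuousOn G).comp (f := fun q : ℝ × V3 => ((t, q.1, q.2) : E5)) (by fun_prop) fun q hq => hp)
    ((ev_continuousOn _).comp (f := fun q : ℝ × V3 => ((t, q.1, q.2) : E5)) (by fun_prop) fun q hq => hp)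
    (fun s hs y _ => hasDerivAt_ev_θ G ht)
  refine h0.congr_of_eventuallyEq ?_
  exact Eventually.of_forall fun s => ev_MR (p := (t, s, v)) _ _ (mem_strip.2 ht)

/-- integral over a period of an element of the algebra restricted to zero velocity -/
def Iθ (G : SF tp ti) (t : ℝ) : ℝ := ∫ θ in Icc (0:ℝ) 1, ev G (t, θ, 0)

theorem hasDerivAt_Iθ (G : SF tp ti) {t : ℝ} (ht : t ∈ Ioo tp ti) : HasDerivAt (Iθ G) (Iθ (dd eT G) t) t := by
  obtain ⟨a, b, hab, hsub⟩ := exists_Icc_nhds ht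
  exact hasDerivAt_setIntegral (μ := volume) isCompact_Icc (fun s θ => ev G (s, θ, 0))
    (fun s θ => ev (dd eT G) (s, θ, 0)) hab
    ((ev_continuousOn G).comp (f := fun q : ℝ × ℝ => ((q.1, q.2, 0) : E5)) (by fun_prop) fun q hq => mem_strip.2 (hsub hq.1))
    ((ev_continuousOn _).comp (f := fun q : ℝ × ℝ => ((q.1, q.2, 0) : E5)) (by fun_prop) fun q hq => mem_strip.2 (hsub hq.1))
    (fun s hs y _ => hasDerivAt_ev_t G (hsub (Ioo_subset_Icc_self hs)))

theorem Iθ_integrable (G : SF tp ti) {t : ℝ} (ht : t ∈ Ioo tp ti) :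
    IntegrableOn (fun θ => ev G (t, θ, 0)) (Icc (0:ℝ) 1) :=
  (ev_cont_θ G ht 0).continuousOn.integrableOn_compact isCompact_Icc

theorem Iθ_add (G H : SF tp ti) {t : ℝ} (ht : t ∈ Ioo tp ti) : Iθ (G + H) t = Iθ G t + Iθ H t := by
  unfold Iθ
  rw [← integral_add (Iθ_integrable G ht) (Iθ_integrable H ht)]; simp

theorem Iθ_neg (G : SF tp ti) {t : ℝ} : Iθ (-G) t = - Iθ G t := by
  unfold Iθ
  rw [← integral_neg]; simp

theorem Iθ_mono (G H : SF tp ti) {t : ℝ} (ht : t ∈ Ioo tp ti)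
    (h : ∀ θ, ev G (t, θ, 0) ≤ ev H (t, θ, 0)) : Iθ G t ≤ Iθ H t :=
  setIntegral_mono (Iθ_integrable G ht) (Iθ_integrable H ht) h

theorem Iθ_dθ (G : SF tp ti) {t : ℝ} (ht : t ∈ Ioo tp ti) : Iθ (dd eθ G) t = 0 := by
  unfold Iθ
  rw [integral_Icc_eq_integral_Ioc, ← intervalIntegral.integral_of_le zero_le_one,
    intervalIntegral.integral_eq_sub_of_hasDerivAt (f := fun θ => ev G (t, θ, 0))
      (fun θ _ => hasDerivAt_ev_θ G ht) ((ev_cont_θ _ ht 0).intervalIntegrable _ _)]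
  have := ev_per G t 0 0
  simp only [zero_add] at this
  rw [this, sub_self]

/-- independence of the velocity variables -/
def Base (G : SF tp ti) : Prop := ∀ t θ v w, ev G (t, θ, v) = ev G (t, θ, w)

theorem MR_mul_base (R : ℝ) {G : SF tp ti} (hG : Base G) (H : SF tp ti) : MR R (G * H) = G * MR R H :=
  SF_ext fun p hp => by
    rw [ev_mul, ev_MR _ _ hp, ev_MR _ _ hp, ← integral_const_mul]
    congr 1; funext v
    rw [ev_mul, hG p.1 p.2.1 v p.2.2]

theorem base_MR (R : ℝ) (G : SF tp ti) : Base (MR R G) := fun t θ v w => by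
  by_cases h : t ∈ Ioo tp ti
  · rw [ev_MR _ _ (mem_strip.2 h), ev_MR _ _ (mem_strip.2 h)]
  · have : ∀ v : V3, (t, θ, v) ∉ strip tp ti := fun v h' => h (mem_strip.1 h')
    simp [ev, extz, this]

theorem Base.add {G H : SF tp ti} (hG : Base G) (hH : Base H) : Base (G + H) := fun t θ v w => by
  rw [ev_add, ev_add, hG t θ v w, hH t θ v w]
theorem Base.mul {G H : SF tp ti} (hG : Base G) (hH : Base H) : Base (G * H) := fun t θ v w => by
  rw [ev_mul, ev_mul, hG t θ v w, hH t θ v w]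
theorem Base.sub {G H : SF tp ti} (hG : Base G) (hH : Base H) : Base (G - H) := fun t θ v w => by
  rw [ev_sub, ev_sub, hG t θ v w, hH t θ v w]
theorem Base.smul {G : SF tp ti} (c : ℝ) (hG : Base G) : Base (c • G) := fun t θ v w => by
  rw [ev_smul, ev_smul, hG t θ v w]
theorem base_of_strip {G : SF tp ti} (h : ∀ t ∈ Ioo tp ti, ∀ θ v w, ev G (t, θ, v) = ev G (t, θ, w)) :
    Base G := fun t θ v w => by
  by_cases ht : t ∈ Ioo tp ti
  · exact h t ht θ v w
  · have : ∀ v : V3, (t, θ, v) ∉ strip tp ti := fun v h' => ht (mem_strip.1 h')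
    simp [ev, extz, this]
theorem base_one : Base (1 : SF tp ti) := base_of_strip fun t ht θ v w => by
  rw [ev_one (mem_strip.2 ht), ev_one (mem_strip.2 ht)]
theorem Base.pow {G : SF tp ti} (hG : Base G) (n : ℕ) : Base (G ^ n) := by
  induction n with
  | zero => simpa using base_one
  | succ n ih => rw [pow_succ]; exact ih.mul hG
theorem Base.comp {G : SF tp ti} (hG : Base G) (φ : ℝ → ℝ) (hφ) : Base (compR φ hφ G) :=
  base_of_strip fun t ht θ v w => by
    rw [ev_compR _ _ _ (mem_strip.2 ht), ev_compR _ _ _ (mem_strip.2 ht), hG t θ v w]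
theorem Base.exp {G : SF tp ti} (hG : Base G) : Base (expR G) := hG.comp _ _

theorem Base.dd_T {G : SF tp ti} (hG : Base G) : Base (dd eT G) := base_of_strip fun t ht θ v w => by
  have h1 := hasDerivAt_ev_t G (θ := θ) (v := v) ht
  have h2 := hasDerivAt_ev_t G (θ := θ) (v := w) ht
  simp only [hG _ _ v w] at h1
  exact h1.unique h2
theorem Base.dd_θ {G : SF tp ti} (hG : Base G) : Base (dd eθ G) := base_of_strip fun t ht θ v w => by
  have h1 := hasDerivAt_ev_θ G (θ := θ) (v := v) ht
  have h2 := hasDerivAt_ev_θ G (θ := θ) (v := w) ht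
  simp only [hG _ _ v w] at h1
  exact h1.unique h2
theorem Base.dd_v {G : SF tp ti} (hG : Base G) (e : V3) : dd (0, 0, e) G = 0 := SF_ext fun p hp => by
  obtain ⟨t, θ, v⟩ := p
  have hc : HasDerivAt (fun s : ℝ => ((t, θ, v + s • e) : E5)) (0, 0, e) 0 :=
    (hasDerivAt_const _ t).prodMk ((hasDerivAt_const _ θ).prodMk (by
      simpa using ((hasDerivAt_id (0:ℝ)).smul_const e).const_add v))
  have h1 := hasDerivAt_ev_comp G hc (by simpa [mem_strip] using mem_strip.1 hp)
  simp only [hG _ _ (v + _ • e) v] at h1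
  have := h1.unique (hasDerivAt_const _ _)
  simpa using this

theorem barrierR {ι : Type*} [Finite ι] (ε : ℝ) (G : ι → SF tp ti) (y y' : ι → ℝ → ℝ) {a b R : ℝ}
    (hab : ∀ s ∈ Icc a b, ε * s ∈ Ioo tp ti)
    (hy : ∀ i, ∀ s ∈ Icc a b, HasDerivAt (y i) (y' i s) s)
    (hsup : ∀ s ∈ Icc a b, ∀ i θ v, R < ‖v‖ → ∃ w : V3, ‖w‖ ≤ R ∧ ev (G i) (ε * s, θ, v) ≤ ev (G i) (ε * s, θ, w))
    (start : ∀ i θ v, ev (G i) (ε * b, θ, v) < y i b)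
    (step : ∀ s ∈ Ico a b, ∀ i θ v, (∀ j θ' v', ev (G j) (ε * s, θ', v') ≤ y j s) →
      ev (G i) (ε * s, θ, v) = y i s →
      (∀ e : ℝ × V3, ev (dd (0, e) (G i)) (ε * s, θ, v) = 0) →
      y' i s < ε * ev (dd eT (G i)) (ε * s, θ, v)) :
    ∀ s ∈ Icc a b, ∀ i θ v, ev (G i) (ε * s, θ, v) < y i s := by
  have red : ∀ s ∈ Icc a b, ∀ i θ v, ∃ z ∈ (Icc (0:ℝ) 1 ×ˢ closedBall (0 : V3) R),
      ev (G i) (ε * s, θ, v) ≤ ev (G i) (ε * s, z.1, z.2) := by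
    intro s hs i θ v
    have hf : Int.fract θ ∈ Icc (0:ℝ) 1 := ⟨Int.fract_nonneg _, (Int.fract_lt_one _).le⟩
    rcases le_or_gt ‖v‖ R with hv | hv
    · exact ⟨(Int.fract θ, v), ⟨hf, by simpa using hv⟩, by rw [ev_fract]⟩
    · obtain ⟨w, hw, hle⟩ := hsup s hs i θ v hv
      exact ⟨(Int.fract θ, w), ⟨hf, by simpa using hw⟩, by rw [ev_fract]; exact hle⟩
  have main := barrier (Kc := Icc (0:ℝ) 1 ×ˢ closedBall (0 : V3) R) (a := a) (b := b)
    (isCompact_Icc.prod (isCompact_closedBall _ _))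
    (fun i s z => ev (G i) (ε * s, z.1, z.2)) y
    (fun i => (ev_continuousOn (G i)).comp (f := fun p : ℝ × ℝ × V3 => ((ε * p.1, p.2.1, p.2.2) : E5))
      (by fun_prop) (fun p hp => mem_strip.2 (hab _ hp.1)))
    (fun i s hs => (hy i s hs).continuousAt.continuousWithinAt)
    (fun i z _ => start i _ _) (by
      intro s hs i z _ hle heq
      have hs' := Ico_subset_Icc_self hs
      have hin := hab s hs'
      have hall : ∀ j θ' v', ev (G j) (ε * s, θ', v') ≤ y j s := fun j θ' v' => by
        obtain ⟨w, hw, h⟩ := red s hs' j θ' v'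
        exact h.trans (hle j w hw)
      refine ⟨ε * ev (dd eT (G i)) (ε * s, z.1, z.2), y' i s, ?_, hy i s hs', ?_⟩
      · have h1 := (hasDerivAt_ev_t (G i) (θ := z.1) (v := z.2) hin).comp s ((hasDerivAt_id s).const_mul ε)
        simpa [mul_comm, Function.comp_def] using h1
      · refine step s hs i z.1 z.2 hall heq fun e => ?_
        have hc : HasDerivAt (fun r : ℝ => ((ε * s, (z.1, z.2) + r • e) : E5)) (0, e) 0 :=
          (hasDerivAt_const _ _).prodMk (by
            simpa using ((hasDerivAt_id (0:ℝ)).smul_const e).const_add ((z.1, z.2) : ℝ × V3))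
        have h1 := hasDerivAt_ev_comp (G i) hc (mem_strip.2 hin)
        have h2 : IsLocalMax (fun r : ℝ => ev (G i) (ε * s, (z.1, z.2) + r • e)) 0 :=
          Eventually.of_forall fun r => by
            have := hall i ((z.1, z.2) + r • e).1 ((z.1, z.2) + r • e).2
            simp only [zero_smul, add_zero]
            exact this.trans heq.ge
        simpa using h2.hasDerivAt_eq_zero h1)
  intro s hs i θ v
  obtain ⟨z, hz, hle⟩ := red s hs i θ v
  exact hle.trans_lt (main s hs i z hz)

/-- the transport derivation -/
def Tr (c b : SF tp ti) : Derivation ℝ (SF tp ti) (SF tp ti) :=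
  dd eT + c • dd eθ + b • dd e1

theorem Tr_apply (c b G : SF tp ti) : Tr c b G = dd eT G + c * dd eθ G + b * dd e1 G := by
  simp [Tr]

theorem transport_vanish (ε : ℝ) (c b F χ : SF tp ti) (hF : Tr c b F = 0) {s0 s1 R : ℝ} (hR : 0 ≤ R)
    (hab : ∀ s ∈ Icc s0 s1, ε * s ∈ Ioo tp ti)
    (hF0 : ∀ p ∈ strip tp ti, 0 ≤ ev F p) (hχ0 : ∀ p ∈ strip tp ti, 0 ≤ ev χ p)
    (hχ : ∀ s ∈ Icc s0 s1, ∀ θ v, ev F (ε * s, θ, v) ≠ 0 → ev χ (ε * s, θ, v) ≠ 0 → 0 ≤ ε * ev (Tr c b χ) (ε * s, θ, v))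
    (hχR : ∀ s ∈ Icc s0 s1, ∀ θ v, R ≤ ‖v‖ → ev χ (ε * s, θ, v) = 0)
    (start : ∀ θ v, ev (F * χ) (ε * s1, θ, v) = 0) :
    ∀ s ∈ Icc s0 s1, ∀ θ v, ev (F * χ) (ε * s, θ, v) = 0 := by
  intro s hs θ v
  refine le_antisymm (le_of_forall_pos_le_add fun δ hδ => ?_)
    (by rw [ev_mul]; exact mul_nonneg (hF0 _ (mem_strip.2 (hab s hs))) (hχ0 _ (mem_strip.2 (hab s hs))))
  have hlen : 0 ≤ s1 - s0 := by linarith [hs.1, hs.2]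
  set η := δ / (1 + (s1 - s0)) with hη
  have hη0 : 0 < η := by positivity
  have key := barrierR (ι := Unit) ε (fun _ => F * χ) (fun _ s => η * (1 + (s1 - s))) (fun _ _ => - η)
    (a := s0) (b := s1) (R := R) hab
    (fun _ s _ => by
      have := (((hasDerivAt_id s).const_sub s1).const_add 1).const_mul η
      simpa using this)
    (fun s hs _ θ v hv => ⟨(R, 0, 0), by simp [Prod.norm_def, abs_of_nonneg hR, hR], by
      rw [ev_mul, ev_mul, hχR s hs θ v hv.le,
        hχR s hs θ (R, 0, 0) (by simp [Prod.norm_def, abs_of_nonneg hR, hR]), mul_zero, mul_zero]⟩)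
    (fun _ θ v => by rw [start]; simp [hη0])
    (fun s hs _ θ v _ heq hgrad => by
      have hs' := Ico_subset_Icc_self hs
      have hin := mem_strip (p := (ε * s, θ, v)) |>.2 (hab s hs')
      have h0 : 0 < ev (F * χ) (ε * s, θ, v) := by
        rw [heq]; have := hs.2; have : 0 < s1 - s := by linarith
        positivity
      rw [ev_mul] at h0
      have e1' : ev (dd eT (F * χ)) (ε * s, θ, v) = ev (Tr c b (F * χ)) (ε * s, θ, v) := by
        rw [Tr_apply, ev_add, ev_add, ev_mul, ev_mul]
        have h1 := hgrad (1, 0, 0, 0)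
        have h2 := hgrad (0, 1, 0, 0)
        rw [show dd eθ (F * χ) = dd (0, 1, 0, 0, 0) (F * χ) from rfl,
          show dd e1 (F * χ) = dd (0, 0, 1, 0, 0) (F * χ) from rfl, h1, h2]
        simp
      rw [e1', Derivation.leibniz, hF, smul_zero, add_zero, smul_eq_mul, ev_mul]
      have := hχ s hs' θ v (fun h => by simp [h] at h0) (fun h => by simp [h] at h0)
      have hf := hF0 _ hin
      nlinarith)
    s hs () θ v
  have h3 : η * (1 + (s1 - s)) ≤ δ := by
    rw [hη, div_mul_eq_mul_div, div_le_iff₀ (by positivity)]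
    have := hs.1
    nlinarith
  linarith

/-- restriction of a linear functional -/
def linR (L : E5 →L[ℝ] ℝ) (hL : L eθ = 0) : SF tp ti :=
  mkR (fun p => L p) L.contDiff.contDiffOn (fun t _ θ v => by
    have : ((t, θ + 1, v) : E5) = (t, θ, v) + eθ := by simp [eθ]
    rw [this, map_add, hL, add_zero])

theorem ev_linR (L : E5 →L[ℝ] ℝ) (hL : L eθ = 0) {p : E5} (h : p ∈ strip tp ti) :
    ev (linR L hL : SF tp ti) p = L p := ev_mkR _ _ _ h

theorem dd_mkR (g : E5 → ℝ) (hg : ContDiffOn ℝ (⊤ : ℕ∞) g (strip tp ti)) (hp) (e : E5) {p : E5}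
    (h : p ∈ strip tp ti) : ev (dd e (mkR g hg hp)) p = fderiv ℝ g p e := by
  rw [ev_dd _ _ h]
  have h1 : ev (mkR g hg hp) =ᶠ[𝓝 p] g := by
    filter_upwards [isOpen_strip.mem_nhds h] with q hq using ev_mkR _ _ _ hq
  rw [h1.fderiv_eq]

theorem dd_linR (L : E5 →L[ℝ] ℝ) (hL : L eθ = 0) (e : E5) :
    dd e (linR L hL : SF tp ti) = algebraMap ℝ (SF tp ti) (L e) := SF_ext fun p hp => by
  rw [linR, dd_mkR _ _ _ _ hp, ev_algebraMap _ hp]; simp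

open ContinuousLinearMap in
def tR : SF tp ti := linR (fst ℝ ℝ (ℝ × V3)) rfl
open ContinuousLinearMap in
def qR : SF tp ti := linR ((fst ℝ ℝ (ℝ × ℝ)).comp ((snd ℝ ℝ V3).comp (snd ℝ ℝ (ℝ × V3)))) rfl
open ContinuousLinearMap in
def v2R : SF tp ti :=
  linR ((fst ℝ ℝ ℝ).comp ((snd ℝ ℝ (ℝ × ℝ)).comp ((snd ℝ ℝ V3).comp (snd ℝ ℝ (ℝ × V3))))) rfl
open ContinuousLinearMap in
def v3R : SF tp ti :=
  linR ((snd ℝ ℝ ℝ).comp ((snd ℝ ℝ (ℝ × ℝ)).comp ((snd ℝ ℝ V3).comp (snd ℝ ℝ (ℝ × V3))))) rfl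

theorem ev_tR {p : E5} (h : p ∈ strip tp ti) : ev (tR : SF tp ti) p = p.1 := ev_linR _ _ h
theorem ev_qR {p : E5} (h : p ∈ strip tp ti) : ev (qR : SF tp ti) p = p.2.2.1 := ev_linR _ _ h
theorem ev_v2R {p : E5} (h : p ∈ strip tp ti) : ev (v2R : SF tp ti) p = p.2.2.2.1 := ev_linR _ _ h
theorem ev_v3R {p : E5} (h : p ∈ strip tp ti) : ev (v3R : SF tp ti) p = p.2.2.2.2 := ev_linR _ _ h
theorem dd_tR (e : E5) : dd e (tR : SF tp ti) = algebraMap ℝ _ e.1 := dd_linR _ _ _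
theorem dd_qR (e : E5) : dd e (qR : SF tp ti) = algebraMap ℝ _ e.2.2.1 := dd_linR _ _ _
theorem dd_v2R (e : E5) : dd e (v2R : SF tp ti) = algebraMap ℝ _ e.2.2.2.1 := dd_linR _ _ _
theorem dd_v3R (e : E5) : dd e (v3R : SF tp ti) = algebraMap ℝ _ e.2.2.2.2 := dd_linR _ _ _

/-- `1/t` -/
def tI [h : Fact (0 < tp)] : SF tp ti :=
  mkR (fun p => (p.1)⁻¹) (contDiffOn_fst.inv fun _ hp => (h.out.trans (mem_strip.1 hp).1).ne')
    (fun _ _ _ _ => rfl)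

theorem ev_tI [Fact (0 < tp)] {p : E5} (h : p ∈ strip tp ti) : ev (tI : SF tp ti) p = (p.1)⁻¹ :=
  ev_mkR _ _ _ h

theorem tR_mul_tI [h : Fact (0 < tp)] : (tR * tI : SF tp ti) = 1 := SF_ext fun p hp => by
  rw [ev_mul, ev_tR hp, ev_tI hp, ev_one hp, mul_inv_cancel₀ (h.out.trans (mem_strip.1 hp).1).ne']

theorem dd_tI [Fact (0 < tp)] (e : E5) : dd e (tI : SF tp ti) = - (e.1 • tI ^ 2) := by
  have := (dd e : Derivation ℝ (SF tp ti) (SF tp ti)).leibniz_of_mul_eq_one (a := tI) (b := tR)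
    (by rw [mul_comm]; exact tR_mul_tI)
  rw [this, dd_tR, smul_eq_mul, Algebra.smul_def]; ring

theorem base_tI [Fact (0 < tp)] : Base (tI : SF tp ti) := base_of_strip fun t ht θ v w => by
  rw [ev_tI (mem_strip.2 ht), ev_tI (mem_strip.2 ht)]

/-- a base element is bounded on compact time intervals -/
theorem Base.bdd {G : SF tp ti} (hG : Base G) {a b : ℝ} (hab : Icc a b ⊆ Ioo tp ti) :
    ∃ C, 0 ≤ C ∧ ∀ t ∈ Icc a b, ∀ θ v, |ev G (t, θ, v)| ≤ C := by
  obtain ⟨C, hC⟩ := (isCompact_Icc (a := a) (b := b)).prod (isCompact_Icc (a := (0:ℝ)) (b := 1)) |>.exists_bound_of_continuousOn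
    (f := fun q : ℝ × ℝ => ev G (q.1, q.2, 0))
    ((ev_continuousOn G).comp (f := fun q : ℝ × ℝ => ((q.1, q.2, 0) : E5)) (by fun_prop) fun q hq => mem_strip.2 (hab hq.1))
  refine ⟨max C 0, le_max_right _ _, fun t ht θ v => ?_⟩
  have := hC (t, Int.fract θ) ⟨ht, Int.fract_nonneg _, (Int.fract_lt_one _).le⟩
  rw [hG t θ v 0, ← ev_fract]
  exact le_max_of_le_left this

/-- any element is bounded on compact time intervals and velocity balls -/
theorem ev_bdd (G : SF tp ti) {a b : ℝ} (hab : Icc a b ⊆ Ioo tp ti) (R : ℝ) :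
    ∃ C, 0 ≤ C ∧ ∀ t ∈ Icc a b, ∀ θ v, ‖v‖ ≤ R → |ev G (t, θ, v)| ≤ C := by
  obtain ⟨C, hC⟩ := (isCompact_Icc (a := a) (b := b)).prod ((isCompact_Icc (a := (0:ℝ)) (b := 1)).prod
      (isCompact_closedBall (0 : V3) R)) |>.exists_bound_of_continuousOn
    (f := ev G) ((ev_continuousOn G).mono fun q hq => mem_strip.2 (hab hq.1))
  refine ⟨max C 0, le_max_right _ _, fun t ht θ v hv => ?_⟩
  have := hC (t, Int.fract θ, v) ⟨ht, ⟨Int.fract_nonneg _, (Int.fract_lt_one _).le⟩, by simpa using hv⟩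
  rw [← ev_fract]
  exact le_max_of_le_left this

theorem ev_Tr_compR (c b : SF tp ti) (φ : ℝ → ℝ) (hφ : ContDiff ℝ (⊤ : ℕ∞) φ) (G : SF tp ti) {p : E5}
    (h : p ∈ strip tp ti) : ev (Tr c b (compR φ hφ G)) p = deriv φ (ev G p) * ev (Tr c b G) p := by
  rw [Tr_apply, Tr_apply]
  simp only [ev_add, ev_mul, ev_dd_compR φ hφ G _ h]
  ring

/-- smooth cutoff of the positive part -/
def glue (G : SF tp ti) : SF tp ti := compR expNegInvGlue expNegInvGlue.contDiff G

theorem ev_glue (G : SF tp ti) {p : E5} (h : p ∈ strip tp ti) : ev (glue G) p = expNegInvGlue (ev G p) :=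
  ev_compR _ _ _ h

theorem glue_nonneg (G : SF tp ti) {p : E5} (h : p ∈ strip tp ti) : 0 ≤ ev (glue G) p := by
  rw [ev_glue _ h]; exact expNegInvGlue.nonneg _

theorem glue_Tr_nonneg (c b G : SF tp ti) {p : E5} (h : p ∈ strip tp ti) {ε : ℝ}
    (hG : 0 ≤ ε * ev (Tr c b G) p) : 0 ≤ ε * ev (Tr c b (glue G)) p := by
  rw [glue, ev_Tr_compR _ _ _ _ _ h]
  have : 0 ≤ deriv expNegInvGlue (ev G p) := expNegInvGlue.monotone.deriv_nonneg
  calc 0 ≤ deriv expNegInvGlue (ev G p) * (ε * ev (Tr c b G) p) := mul_nonneg this hG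
    _ = _ := by ring

theorem contDiff_logq : ContDiff ℝ (⊤ : ℕ∞) (fun q : ℝ => Real.log (1 + q ^ 2)) :=
  ContDiff.log (by fun_prop) (fun x => by positivity)

/-- `log (1 + q²)` -/
def yR : SF tp ti := compR (fun q => Real.log (1 + q ^ 2)) contDiff_logq qR

theorem ev_yR {p : E5} (h : p ∈ strip tp ti) : ev (yR : SF tp ti) p = Real.log (1 + p.2.2.1 ^ 2) := by
  rw [yR, ev_compR _ _ _ h, ev_qR h]

theorem ev_Tr_yR (c b : SF tp ti) {p : E5} (h : p ∈ strip tp ti) :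
    ev (Tr c b yR) p = 2 * p.2.2.1 / (1 + p.2.2.1 ^ 2) * ev b p := by
  rw [yR, ev_Tr_compR _ _ _ _ _ h, ev_qR h, Tr_apply]
  have h1 : HasDerivAt (fun q : ℝ => Real.log (1 + q ^ 2)) (2 * p.2.2.1 / (1 + p.2.2.1 ^ 2)) p.2.2.1 := by
    have := ((hasDerivAt_pow 2 p.2.2.1).const_add 1).log (by positivity)
    simpa using this
  rw [h1.deriv]
  simp [dd_qR, eT, eθ, e1]

theorem abs_Tr_yR_le (c b : SF tp ti) {p : E5} (h : p ∈ strip tp ti) {Λ : ℝ} (hΛ : 0 ≤ Λ)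
    (hb : |ev b p| ≤ Λ * (1 + |p.2.2.1|)) : |ev (Tr c b yR) p| ≤ 4 * Λ := by
  rw [ev_Tr_yR _ _ h]
  set q := p.2.2.1
  rw [abs_mul, abs_div, abs_mul, abs_two, abs_of_pos (by positivity : 0 < 1 + q ^ 2)]
  rw [div_mul_eq_mul_div, div_le_iff₀ (by positivity)]
  have h2 : q ^ 2 = |q| ^ 2 := (sq_abs q).symm
  rw [h2]
  have h0 := abs_nonneg q
  calc 2 * |q| * |ev b p| ≤ 2 * |q| * (Λ * (1 + |q|)) := by gcongr
    _ ≤ 4 * Λ * (1 + |q| ^ 2) := by nlinarith [mul_nonneg hΛ (sq_nonneg (|q| - 1)), mul_nonneg hΛ h0]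

/-- `V₂² + V₃²` -/
def vvR : SF tp ti := v2R ^ 2 + v3R ^ 2

theorem Tr_vvR (c b : SF tp ti) : Tr c b (vvR : SF tp ti) = 0 := by
  rw [Tr_apply]
  simp [vvR, Derivation.leibniz_pow, dd_v2R, dd_v3R, eT, eθ, e1]

theorem ev_vvR {p : E5} (h : p ∈ strip tp ti) :
    ev (vvR : SF tp ti) p = p.2.2.2.1 ^ 2 + p.2.2.2.2 ^ 2 := by
  rw [vvR, ev_add, ev_pow _ _ h, ev_pow _ _ h, ev_v2R h, ev_v3R h]

theorem ev_Tr_algebraMap (c b : SF tp ti) (r : ℝ) (p : E5) : ev (Tr c b (algebraMap ℝ _ r)) p = 0 := by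
  rw [Derivation.map_algebraMap, ev_zero]

theorem ev_Tr_tR (c b : SF tp ti) {p : E5} (h : p ∈ strip tp ti) : ev (Tr c b tR) p = 1 := by
  rw [Tr_apply]
  simp [dd_tR, eT, eθ, e1, ev_one h]

/-- propagation of the inequality `G ≤ 0` on the support of a transported density -/
theorem propagate (ε : ℝ) (hε : ε * ε = 1) (c b F G : SF tp ti) (hF : Tr c b F = 0) {s0 s1 : ℝ}
    (hab : ∀ s ∈ Icc s0 s1, ε * s ∈ Ioo tp ti)
    (hF0 : ∀ p ∈ strip tp ti, 0 ≤ ev F p)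
    (hb : ∀ R : ℝ, ∃ Λ, 0 ≤ Λ ∧ ∀ s ∈ Icc s0 s1, ∀ θ v, v.2.1 ^ 2 + v.2.2 ^ 2 ≤ R →
      |ev b (ε * s, θ, v)| ≤ Λ * (1 + |v.1|))
    (hG : ∀ s ∈ Icc s0 s1, ∀ θ v, ev F (ε * s, θ, v) ≠ 0 → 0 ≤ ε * ev (Tr c b G) (ε * s, θ, v))
    (start : ∀ θ v, ev F (ε * s1, θ, v) ≠ 0 → ev G (ε * s1, θ, v) ≤ 0) :
    ∀ s ∈ Icc s0 s1, ∀ θ v, ev F (ε * s, θ, v) ≠ 0 → ev G (ε * s, θ, v) ≤ 0 := by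
  intro s hs θ v hne
  by_contra! hpos
  set R2 := v.2.1 ^ 2 + v.2.2 ^ 2 + 1 with hR2
  obtain ⟨Λ, hΛ, hb⟩ := hb R2
  set y2 := Real.log (1 + v.1 ^ 2) + 4 * Λ * (s1 - s) + 1 with hy2
  let G2 : SF tp ti := algebraMap ℝ _ (y2 - 4 * Λ * s1) + (4 * Λ * ε) • tR - yR
  let G3 : SF tp ti := algebraMap ℝ _ R2 - vvR
  have hG2 : ∀ s ∈ Icc s0 s1, ∀ θ v, ev G2 (ε * s, θ, v) = y2 - 4 * Λ * (s1 - s) - Real.log (1 + v.1 ^ 2) := by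
    intro s hs θ v
    have hp := mem_strip (p := (ε * s, θ, v)) |>.2 (hab s hs)
    simp only [G2, ev_sub, ev_add, ev_algebraMap _ hp, ev_smul, ev_tR hp, ev_yR hp]
    linear_combination (4 * Λ * s) * hε
  have hG3 : ∀ s ∈ Icc s0 s1, ∀ θ v, ev G3 (ε * s, θ, v) = R2 - (v.2.1 ^ 2 + v.2.2 ^ 2) := by
    intro s hs θ v
    have hp := mem_strip (p := (ε * s, θ, v)) |>.2 (hab s hs)
    simp only [G3, ev_sub, ev_algebraMap _ hp, ev_vvR hp]
  set Rb := Real.exp (|y2|) + R2 with hRb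
  have hR20 : 1 ≤ R2 := by rw [hR2]; nlinarith [sq_nonneg v.2.1, sq_nonneg v.2.2]
  have key := transport_vanish ε c b F (glue G * glue G2 * glue G3) hF (s0 := s0) (s1 := s1) (R := Rb + 1)
    (by positivity) hab hF0
    (fun p hp => by
      rw [ev_mul, ev_mul]
      exact mul_nonneg (mul_nonneg (glue_nonneg _ hp) (glue_nonneg _ hp)) (glue_nonneg _ hp))
    (fun s hs θ v hFne hχne => by
      have hp := mem_strip (p := (ε * s, θ, v)) |>.2 (hab s hs)
      rw [ev_mul, ev_mul] at hχne
      have h3 : v.2.1 ^ 2 + v.2.2 ^ 2 ≤ R2 := by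
        by_contra! hlt
        apply hχne
        rw [ev_glue G3 hp, hG3 s hs, expNegInvGlue.zero_of_nonpos (by linarith), mul_zero]
      have hbb := abs_Tr_yR_le c b hp hΛ (hb s hs θ v h3)
      have hεabs : |ε| = 1 := by
        have : |ε| * |ε| = 1 := by rw [← abs_mul, hε, abs_one]
        nlinarith [abs_nonneg ε]
      have d1 := glue_Tr_nonneg c b G hp (hG s hs θ v hFne)
      have d2 : 0 ≤ ε * ev (Tr c b (glue G2)) (ε * s, θ, v) := by
        refine glue_Tr_nonneg c b G2 hp ?_
        simp only [G2, map_sub, map_add, Derivation.map_smul, ev_sub, ev_add, ev_smul, ev_Tr_algebraMap,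
          ev_Tr_tR _ _ hp]
        have : |ε * ev (Tr c b yR) (ε * s, θ, v)| ≤ 4 * Λ := by rw [abs_mul, hεabs, one_mul]; exact hbb
        have := (abs_le.1 this).2
        nlinarith
      have d3 : 0 ≤ ε * ev (Tr c b (glue G3)) (ε * s, θ, v) := by
        refine glue_Tr_nonneg c b G3 hp ?_
        simp [G3, Tr_vvR]
      rw [Derivation.leibniz, Derivation.leibniz]
      simp only [smul_eq_mul, ev_add, ev_mul]
      have n1 := glue_nonneg G hp
      have n2 := glue_nonneg G2 hp
      have n3 := glue_nonneg G3 hp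
      have := mul_nonneg (mul_nonneg n1 n2) d3
      have := mul_nonneg (mul_nonneg n3 n1) d2
      have := mul_nonneg (mul_nonneg n3 n2) d1
      linarith)
    (fun s hs θ v hv => by
      have hp := mem_strip (p := (ε * s, θ, v)) |>.2 (hab s hs)
      rw [ev_mul, ev_mul, ev_glue G2 hp, ev_glue G3 hp, hG2 s hs, hG3 s hs]
      by_contra hne
      have h2 : 0 < y2 - 4 * Λ * (s1 - s) - Real.log (1 + v.1 ^ 2) := by
        by_contra! h; exact hne (by rw [expNegInvGlue.zero_of_nonpos h]; ring)
      have h3 : 0 < R2 - (v.2.1 ^ 2 + v.2.2 ^ 2) := by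
        by_contra! h; exact hne (by rw [expNegInvGlue.zero_of_nonpos h]; ring)
      have h4 : 1 + v.1 ^ 2 < Real.exp |y2| := by
        rw [← Real.log_lt_iff_lt_exp (by positivity)]
        have : 0 ≤ 4 * Λ * (s1 - s) := mul_nonneg (by positivity) (by linarith [hs.2])
        linarith [le_abs_self y2]
      have a1 : |v.1| < Rb + 1 := by
        rw [abs_lt]; constructor <;> nlinarith
      have a2 : |v.2.1| < Rb + 1 := by
        have := Real.exp_pos |y2|
        rw [abs_lt]; constructor <;> nlinarith [sq_nonneg v.2.2]
      have a3 : |v.2.2| < Rb + 1 := by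
        have := Real.exp_pos |y2|
        rw [abs_lt]; constructor <;> nlinarith [sq_nonneg v.2.1]
      refine absurd hv (not_le.2 ?_)
      simp only [Prod.norm_def, Real.norm_eq_abs]
      exact max_lt a1 (max_lt a2 a3))
    (fun θ v => by
      rcases le_or_gt s0 s1 with h | h
      · have hp := mem_strip (p := (ε * s1, θ, v)) |>.2 (hab s1 ⟨h, le_rfl⟩)
        rw [ev_mul, ev_mul, ev_mul, ev_glue G hp]
        by_cases h0 : ev F (ε * s1, θ, v) = 0
        · rw [h0]; ring
        · rw [expNegInvGlue.zero_of_nonpos (start θ v h0)]; ring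
      · linarith [hs.1, hs.2])
    s hs θ v
  have hp := mem_strip (p := (ε * s, θ, v)) |>.2 (hab s hs)
  rw [ev_mul, ev_mul, ev_mul, ev_glue G hp, ev_glue G2 hp, ev_glue G3 hp, hG2 s hs, hG3 s hs] at key
  have p1 := expNegInvGlue.pos_of_pos hpos
  have p2 : 0 < expNegInvGlue (y2 - 4 * Λ * (s1 - s) - Real.log (1 + v.1 ^ 2)) :=
    expNegInvGlue.pos_of_pos (by rw [hy2]; linarith)
  have p3 : 0 < expNegInvGlue (R2 - (v.2.1 ^ 2 + v.2.2 ^ 2)) := expNegInvGlue.pos_of_pos (by rw [hR2]; linarith)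
  exact mul_ne_zero hne (mul_pos (mul_pos p1 p2) p3).ne' key

/-- control of the support in the first velocity variable -/
theorem propagate_q (ε : ℝ) (hε : ε * ε = 1) (c b F : SF tp ti) (hF : Tr c b F = 0) {s0 s1 Λ R Q : ℝ}
    (hab : ∀ s ∈ Icc s0 s1, ε * s ∈ Ioo tp ti) (hΛ : 0 ≤ Λ)
    (hF0 : ∀ p ∈ strip tp ti, 0 ≤ ev F p)
    (hb : ∀ R : ℝ, ∃ Λ, 0 ≤ Λ ∧ ∀ s ∈ Icc s0 s1, ∀ θ v, v.2.1 ^ 2 + v.2.2 ^ 2 ≤ R →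
      |ev b (ε * s, θ, v)| ≤ Λ * (1 + |v.1|))
    (hv : ∀ p ∈ strip tp ti, ev F p ≠ 0 → p.2.2.2.1 ^ 2 + p.2.2.2.2 ^ 2 ≤ R)
    (hbR : ∀ s ∈ Icc s0 s1, ∀ θ v, v.2.1 ^ 2 + v.2.2 ^ 2 ≤ R → |ev b (ε * s, θ, v)| ≤ Λ * (1 + |v.1|))
    (start : ∀ θ v, ev F (ε * s1, θ, v) ≠ 0 → Real.log (1 + v.1 ^ 2) ≤ Q) :
    ∀ s ∈ Icc s0 s1, ∀ θ v, ev F (ε * s, θ, v) ≠ 0 → Real.log (1 + v.1 ^ 2) ≤ Q + 4 * Λ * (s1 - s) := by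
  intro s hs θ v hne
  let G : SF tp ti := yR - algebraMap ℝ _ (Q + 4 * Λ * s1) + (4 * Λ * ε) • tR
  have hG : ∀ s ∈ Icc s0 s1, ∀ θ v, ev G (ε * s, θ, v) = Real.log (1 + v.1 ^ 2) - (Q + 4 * Λ * (s1 - s)) := by
    intro s hs θ v
    have hp := mem_strip (p := (ε * s, θ, v)) |>.2 (hab s hs)
    simp only [G, ev_sub, ev_add, ev_algebraMap _ hp, ev_smul, ev_tR hp, ev_yR hp]
    linear_combination (4 * Λ * s) * hε
  have := propagate ε hε c b F G hF hab hF0 hb (fun s hs θ v hFne => by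
      have hp := mem_strip (p := (ε * s, θ, v)) |>.2 (hab s hs)
      have hbb := abs_Tr_yR_le c b hp hΛ (hbR s hs θ v (hv _ hp hFne))
      have hεabs : |ε| = 1 := by
        have : |ε| * |ε| = 1 := by rw [← abs_mul, hε, abs_one]
        nlinarith [abs_nonneg ε]
      simp only [G, map_sub, map_add, Derivation.map_smul, ev_sub, ev_add, ev_smul, ev_Tr_algebraMap,
        ev_Tr_tR _ _ hp]
      have : |ε * ev (Tr c b yR) (ε * s, θ, v)| ≤ 4 * Λ := by rw [abs_mul, hεabs, one_mul]; exact hbb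
      have := (abs_le.1 this).1
      nlinarith)
    (fun θ v hne => by
      rw [hG s1 ⟨hs.1.trans hs.2, le_rfl⟩]
      have := start θ v hne
      linarith) s hs θ v hne
  rw [hG s hs] at this
  linarith

/-- the unknowns: metric functions, `L = log α`, `β`, and the density `F` in rescaled velocities -/
structure Fld (tp ti : ℝ) where
  U : SF tp ti
  A : SF tp ti
  L : SF tp ti
  β : SF tp ti
  J : SF tp ti
  K : SF tp ti
  F : SF tp ti

namespace Fld

variable [hfact : Fact (0 < tp)] (S : Fld tp ti)

/-- `√α` -/
def σ : SF tp ti := expR ((1/2 : ℝ) • S.L)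
/-- `1/√α` -/
def a : SF tp ti := expR ((-1/2 : ℝ) • S.L)
/-- `X = √α ∂_θ` -/
def X : Derivation ℝ (SF tp ti) (SF tp ti) := S.σ • dd eθ
/-- `e^{4U}/(4t²)` -/
def h : SF tp ti := (1/4 : ℝ) • (expR ((4 : ℝ) • S.U) * tI ^ 2)
def E2 : SF tp ti := expR ((2 : ℝ) • S.β - (2 : ℝ) • S.U)
def E4 : SF tp ti := expR ((2 : ℝ) • S.β - (4 : ℝ) • S.U)
def E0 : SF tp ti := expR ((2 : ℝ) • S.β)
def κ : SF tp ti := S.K - S.A * S.J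
def w : SF tp ti := v3R - S.A * v2R
def m2 : SF tp ti := S.E2 + S.E4 * v2R ^ 2 + tI ^ 2 * S.E0 * S.w ^ 2
def P : SF tp ti := qR ^ 2 + S.m2
def ν : SF tp ti := S.β - (1/2 : ℝ) • S.L
def Ut : SF tp ti := dd eT S.U
def At : SF tp ti := dd eT S.A
def XU : SF tp ti := S.X S.U
def XA : SF tp ti := S.X S.A
def Lt : SF tp ti := dd eT S.L

theorem m2_ge {p : E5} (hp : p ∈ strip tp ti) : ev S.E2 p ≤ ev S.m2 p := by
  simp only [m2, ev_add, ev_mul, ev_pow _ _ hp]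
  have h4 : 0 < ev S.E4 p := expR_pos _ hp
  have h0 : 0 < ev S.E0 p := expR_pos _ hp
  have : 0 ≤ ev S.E4 p * ev (v2R : SF tp ti) p ^ 2 := by positivity
  have : 0 ≤ ev (tI : SF tp ti) p ^ 2 * ev S.E0 p * ev S.w p ^ 2 := by positivity
  linarith

theorem m2_pos {p : E5} (hp : p ∈ strip tp ti) : 0 < ev S.m2 p :=
  (expR_pos _ hp).trans_le (S.m2_ge hp)

theorem ev_P {p : E5} (hp : p ∈ strip tp ti) : ev S.P p = p.2.2.1 ^ 2 + ev S.m2 p := by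
  rw [P, ev_add, ev_pow _ _ hp, ev_qR hp]

theorem P_pos {p : E5} (hp : p ∈ strip tp ti) : 0 < ev S.P p := by
  rw [S.ev_P hp]
  have := S.m2_pos hp
  positivity

/-- `1/p⁰` -/
def rp : SF tp ti := rsq S.P fun _ hp => S.P_pos hp

theorem P_rp : S.P * S.rp ^ 2 = 1 := rsq_sq _ _

/-- characteristic speed in `θ` -/
def c : SF tp ti := qR * S.rp * S.σ
/-- force without the term `½ L_t q` -/
def b1 : SF tp ti := (-1/2 : ℝ) • (S.X S.m2 * S.rp) + tI ^ 3 * S.E0 * S.κ * S.w + tI * S.E4 * S.J * v2R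
/-- force -/
def b : SF tp ti := (1/2 : ℝ) • (S.Lt * qR) + S.b1

/-- momentum integral of the density -/
def mom (φ : SF tp ti) (p : E5) : ℝ := ∫ v : V3, ev S.F (p.1, p.2.1, v) * ev φ (p.1, p.2.1, v)

end Fld

/-- bounded on a set -/
def Bd {tp ti : ℝ} (W : Set E5) (G : SF tp ti) : Prop := ∃ C, 0 ≤ C ∧ ∀ p ∈ W, |ev G p| ≤ C

open Fld in
/-- the evolution and constraint equations in rescaled variables -/
structure Sys (tp ti : ℝ) [hfact : Fact (0 < tp)] extends Fld tp ti where
  bU : Base U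
  bA : Base A
  bL : Base L
  bβ : Base β
  bJ : Base J
  bK : Base K
  F_nonneg : ∀ p ∈ strip tp ti, 0 ≤ ev F p
  F_supp : ∀ t ∈ Ioo tp ti, ∃ R, ∀ θ v, R < ‖v‖ → ev F (t, θ, v) = 0
  F_ne : ∃ p ∈ strip tp ti, ev F p ≠ 0
  late : ∀ t1 ∈ Ioo tp ti, ∀ G ∈ ({U, A, L, β, J, K} : Set (SF tp ti)),
    Bd (Ico t1 ti ×ˢ univ) G ∧ Bd (Ico t1 ti ×ˢ univ) (dd eT G) ∧ Bd (Ico t1 ti ×ˢ univ) (dd eθ G)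
  eV : Tr toFld.c toFld.b F = 0
  eν : ∀ p ∈ strip tp ti, ev (dd eT toFld.ν) p =
    ev (tR * (toFld.Ut ^ 2 + toFld.XU ^ 2 + toFld.h * (toFld.At ^ 2 + toFld.XA ^ 2))
      + (1/4 : ℝ) • (tI * toFld.E4 * J ^ 2) + (1/4 : ℝ) • (tI ^ 3 * toFld.E0 * toFld.κ ^ 2)) p
      + toFld.mom (toFld.P * toFld.rp) p
  eXβ : ∀ p ∈ strip tp ti, ev (toFld.X β) p =
    ev ((2 : ℝ) • (tR * (toFld.Ut * toFld.XU + toFld.h * toFld.At * toFld.XA))) p - toFld.mom qR p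
  eL : ∀ p ∈ strip tp ti, ev toFld.Lt p =
    - ev (tI * toFld.E4 * J ^ 2 + tI ^ 3 * toFld.E0 * toFld.κ ^ 2) p - 2 * toFld.mom (toFld.m2 * toFld.rp) p
  eJt : ∀ p ∈ strip tp ti, ev (dd eT J) p = -2 * toFld.mom (qR * v2R * toFld.rp) p
  eXJ : ∀ p ∈ strip tp ti, ev (toFld.X J) p = 2 * toFld.mom v2R p
  eKt : ∀ p ∈ strip tp ti, ev (dd eT K) p = -2 * toFld.mom (qR * v3R * toFld.rp) p
  eXK : ∀ p ∈ strip tp ti, ev (toFld.X K) p = 2 * toFld.mom v3R p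
  eU : ∀ p ∈ strip tp ti, ev (dd eT toFld.Ut) p =
    ev (toFld.X toFld.XU - tI * toFld.Ut + (1/2 : ℝ) • (toFld.Lt * toFld.Ut)
      + (2 : ℝ) • (toFld.h * (toFld.At ^ 2 - toFld.XA ^ 2)) + (1/2 : ℝ) • (tI ^ 2 * toFld.E4 * J ^ 2)) p
      + (1/2) * ev (tI * toFld.E2) p
        * toFld.mom ((1 + (2 : ℝ) • (expR ((-2 : ℝ) • U) * v2R ^ 2)) * toFld.rp) p
  eA : ∀ p ∈ strip tp ti, ev (dd eT toFld.At) p =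
    ev (toFld.X toFld.XA + tI * toFld.At + (1/2 : ℝ) • (toFld.Lt * toFld.At)
      - (4 : ℝ) • (toFld.At * toFld.Ut - toFld.XA * toFld.XU) + tI ^ 2 * toFld.E4 * J * toFld.κ) p
      + 2 * ev (tI * toFld.E4) p * toFld.mom (v2R * toFld.w * toFld.rp) p
  eνν : ∀ p ∈ strip tp ti, ev (dd eT (dd eT toFld.ν)) p =
    ev (toFld.X (toFld.X β) + (1/2 : ℝ) • (toFld.Lt * dd eT toFld.ν) - toFld.Ut ^ 2 + toFld.XU ^ 2
      + toFld.h * (toFld.At ^ 2 - toFld.XA ^ 2) - (1/4 : ℝ) • (tI ^ 2 * toFld.E4 * J ^ 2)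
      - (3/4 : ℝ) • (tI ^ 4 * toFld.E0 * toFld.κ ^ 2)) p
      - ev (tI ^ 3 * toFld.E0) p * toFld.mom (toFld.w ^ 2 * toFld.rp) p

namespace Bd

variable {W W' : Set E5} {G H : SF tp ti}

theorem mono (h : Bd W G) (hW : W' ⊆ W) : Bd W' G := by
  obtain ⟨C, h0, hC⟩ := h
  exact ⟨C, h0, fun p hp => hC p (hW hp)⟩

theorem add (hG : Bd W G) (hH : Bd W H) : Bd W (G + H) := by
  obtain ⟨C, h0, hC⟩ := hG
  obtain ⟨D, k0, hD⟩ := hH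
  exact ⟨C + D, by positivity, fun p hp => by
    rw [ev_add]; exact (abs_add_le _ _).trans (add_le_add (hC p hp) (hD p hp))⟩

theorem neg (hG : Bd W G) : Bd W (-G) := by
  obtain ⟨C, h0, hC⟩ := hG
  exact ⟨C, h0, fun p hp => by rw [ev_neg, abs_neg]; exact hC p hp⟩

theorem sub (hG : Bd W G) (hH : Bd W H) : Bd W (G - H) := by
  rw [sub_eq_add_neg]; exact hG.add hH.neg

theorem mul (hG : Bd W G) (hH : Bd W H) : Bd W (G * H) := by
  obtain ⟨C, h0, hC⟩ := hG
  obtain ⟨D, k0, hD⟩ := hH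
  exact ⟨C * D, by positivity, fun p hp => by
    rw [ev_mul, abs_mul]; exact mul_le_mul (hC p hp) (hD p hp) (abs_nonneg _) h0⟩

theorem smul (c : ℝ) (hG : Bd W G) : Bd W (c • G) := by
  obtain ⟨C, h0, hC⟩ := hG
  exact ⟨|c| * C, by positivity, fun p hp => by
    rw [ev_smul, abs_mul]; exact mul_le_mul_of_nonneg_left (hC p hp) (abs_nonneg _)⟩

theorem zero : Bd W (0 : SF tp ti) := ⟨0, le_rfl, fun p _ => by simp⟩

theorem one : Bd W (1 : SF tp ti) := ⟨1, zero_le_one, fun p _ => by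
  by_cases hp : p ∈ strip tp ti
  · simp [ev_one hp]
  · simp [ev, extz, hp]⟩

theorem algebraMap (c : ℝ) : Bd W (algebraMap ℝ (SF tp ti) c) := by
  rw [Algebra.algebraMap_eq_smul_one]; exact one.smul c

theorem pow (hG : Bd W G) (n : ℕ) : Bd W (G ^ n) := by
  induction n with
  | zero => simpa using one
  | succ n ih => rw [pow_succ]; exact ih.mul hG

theorem expR (hG : Bd W G) : Bd W (expR G) := by
  obtain ⟨C, h0, hC⟩ := hG
  refine ⟨Real.exp C, (Real.exp_pos _).le, fun p hp => ?_⟩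
  by_cases hs : p ∈ strip tp ti
  · rw [ev_expR _ hs, abs_of_pos (Real.exp_pos _)]
    exact Real.exp_le_exp.2 ((le_abs_self _).trans (hC p hp))
  · simp [ev, extz, hs, (Real.exp_pos C).le]

theorem of_le (hH : Bd W H) (h : ∀ p ∈ W, |ev G p| ≤ |ev H p|) : Bd W G := by
  obtain ⟨C, h0, hC⟩ := hH
  exact ⟨C, h0, fun p hp => (h p hp).trans (hC p hp)⟩

theorem tI [hf : Fact (0 < tp)] : Bd W (tI : SF tp ti) := ⟨tp⁻¹, inv_nonneg.2 hf.out.le, fun p _ => by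
  by_cases hs : p ∈ strip tp ti
  · have := (mem_strip.1 hs).1
    have h0 := hf.out
    rw [ev_tI hs, abs_of_pos (inv_pos.2 (h0.trans this))]
    exact inv_anti₀ h0 this.le
  · simp [ev, extz, hs, hf.out.le]⟩

theorem tR [hf : Fact (0 < tp)] : Bd W (tR : SF tp ti) := ⟨|ti|, abs_nonneg _, fun p _ => by
  by_cases hs : p ∈ strip tp ti
  · have := (mem_strip.1 hs)
    have h0 := hf.out
    rw [ev_tR hs, abs_of_pos (h0.trans this.1)]
    exact this.2.le.trans (le_abs_self _)
  · simp [ev, extz, hs]⟩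

end Bd

/-- bounded together with a directional derivative -/
def Bd' (e : E5) (W : Set E5) (G : SF tp ti) : Prop := Bd W G ∧ Bd W (dd e G)

namespace Bd'

variable {W W' : Set E5} {G H : SF tp ti} {e : E5}

theorem add (hG : Bd' e W G) (hH : Bd' e W H) : Bd' e W (G + H) :=
  ⟨hG.1.add hH.1, by rw [map_add]; exact hG.2.add hH.2⟩
theorem sub (hG : Bd' e W G) (hH : Bd' e W H) : Bd' e W (G - H) :=
  ⟨hG.1.sub hH.1, by rw [map_sub]; exact hG.2.sub hH.2⟩
theorem smul (c : ℝ) (hG : Bd' e W G) : Bd' e W (c • G) :=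
  ⟨hG.1.smul c, by rw [Derivation.map_smul]; exact hG.2.smul c⟩
theorem mul (hG : Bd' e W G) (hH : Bd' e W H) : Bd' e W (G * H) :=
  ⟨hG.1.mul hH.1, by
    rw [Derivation.leibniz, smul_eq_mul, smul_eq_mul]; exact (hG.1.mul hH.2).add (hH.1.mul hG.2)⟩
theorem one : Bd' e W (1 : SF tp ti) := ⟨Bd.one, by rw [Derivation.map_one_eq_zero]; exact Bd.zero⟩
theorem pow (hG : Bd' e W G) (n : ℕ) : Bd' e W (G ^ n) := by
  induction n with
  | zero => simpa using one
  | succ n ih => rw [pow_succ]; exact ih.mul hG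
theorem expR (hG : Bd' e W G) : Bd' e W (expR G) :=
  ⟨hG.1.expR, by rw [dd_expR]; exact hG.1.expR.mul hG.2⟩
theorem tI [hf : Fact (0 < tp)] : Bd' e W (tI : SF tp ti) :=
  ⟨Bd.tI, by rw [dd_tI]; exact ((Bd.tI.pow 2).smul _).neg⟩
theorem v2R (h : Bd W (v2R : SF tp ti)) : Bd' e W (v2R : SF tp ti) :=
  ⟨h, by rw [dd_v2R]; exact Bd.algebraMap _⟩
theorem v3R (h : Bd W (v3R : SF tp ti)) : Bd' e W (v3R : SF tp ti) :=
  ⟨h, by rw [dd_v3R]; exact Bd.algebraMap _⟩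

end Bd'

namespace Fld

variable [hfact : Fact (0 < tp)] (S : Fld tp ti)

theorem rp_pos {p : E5} (hp : p ∈ strip tp ti) : 0 < ev S.rp p := by
  rw [rp, ev_rsq _ _ hp]
  have := S.P_pos hp
  positivity

theorem ev_P_rp {p : E5} (hp : p ∈ strip tp ti) : ev S.P p * ev S.rp p ^ 2 = 1 := by
  rw [← ev_pow _ _ hp, ← ev_mul, S.P_rp, ev_one hp]

theorem rp_le {p : E5} (hp : p ∈ strip tp ti) : ev S.rp p ≤ ev (expR (S.U - S.β)) p := by
  have h1 := S.ev_P_rp hp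
  have h2 : ev S.E2 p * ev (expR (S.U - S.β)) p ^ 2 = 1 := by
    rw [E2, ev_expR _ hp, ev_expR _ hp, ← Real.exp_nat_mul, ← Real.exp_add]
    simp only [ev_sub, ev_smul]
    rw [← Real.exp_zero]; congr 1; push_cast; ring
  have h3 : ev S.E2 p ≤ ev S.P p := by
    rw [S.ev_P hp]; nlinarith [S.m2_ge hp]
  have h4 := S.rp_pos hp
  have h5 := expR_pos (S.U - S.β) hp
  by_contra! hlt
  have : ev (expR (S.U - S.β)) p ^ 2 < ev S.rp p ^ 2 := by nlinarith
  have h6 : 0 < ev S.E2 p := expR_pos _ hp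
  nlinarith

/-- `|q| ≤ p⁰` -/
theorem abs_q_le {p : E5} (hp : p ∈ strip tp ti) : |p.2.2.1| ≤ ev (S.P * S.rp) p := by
  have h1 := S.ev_P_rp hp
  have h2 := S.rp_pos hp
  have h3 := S.ev_P hp
  have h4 := S.m2_pos hp
  rw [ev_mul]
  refine abs_le_of_sq_le_sq ?_ (mul_pos (S.P_pos hp) h2).le
  have : (ev S.P p * ev S.rp p) ^ 2 = ev S.P p := by linear_combination ev S.P p * h1
  rw [this]; linarith

theorem bd_m2 {e : E5} {W : Set E5} {R : ℝ} (hR : ∀ p ∈ W, p.2.2.2.1 ^ 2 + p.2.2.2.2 ^ 2 ≤ R)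
    (hW : W ⊆ strip tp ti)
    (hU : Bd' e W S.U) (hA : Bd' e W S.A) (hβ : Bd' e W S.β) :
    Bd W (v2R : SF tp ti) ∧ Bd W (v3R : SF tp ti) ∧ Bd' e W S.m2 := by
  have h2 : Bd W (v2R : SF tp ti) := ⟨|R| + 1, by positivity, fun p hp => by
    rw [ev_v2R (hW hp)]
    refine abs_le_of_sq_le_sq ?_ (by positivity)
    nlinarith [hR p hp, sq_nonneg p.2.2.2.2, le_abs_self R, abs_nonneg R]⟩
  have h3 : Bd W (v3R : SF tp ti) := ⟨|R| + 1, by positivity, fun p hp => by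
    rw [ev_v3R (hW hp)]
    refine abs_le_of_sq_le_sq ?_ (by positivity)
    nlinarith [hR p hp, sq_nonneg p.2.2.2.1, le_abs_self R, abs_nonneg R]⟩
  refine ⟨h2, h3, ?_⟩
  have v2 : Bd' e W (v2R : SF tp ti) := Bd'.v2R h2
  have v3 : Bd' e W (v3R : SF tp ti) := Bd'.v3R h3
  unfold m2 E2 E4 E0 w
  exact (((hβ.smul 2).sub (hU.smul 2)).expR.add (((hβ.smul 2).sub (hU.smul 4)).expR.mul (v2.pow 2))).add
    (((Bd'.tI.pow 2).mul (hβ.smul 2).expR).mul ((v3.sub (hA.mul v2)).pow 2))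

theorem bd_rp {W : Set E5} (hW : W ⊆ strip tp ti) (hU : Bd W S.U) (hβ : Bd W S.β) : Bd W S.rp :=
  (hU.sub hβ).expR.of_le fun p hp => by
    rw [abs_of_pos (S.rp_pos (hW hp)), abs_of_pos (expR_pos _ (hW hp))]
    exact S.rp_le (hW hp)

theorem X_apply (G : SF tp ti) : S.X G = S.σ * dd eθ G := rfl

theorem b_lin {I : Set ℝ} (hI : I ⊆ Ioo tp ti)
    (h : ∀ G ∈ ({S.U, S.A, S.L, S.β, S.J, S.K} : Set (SF tp ti)),
      Bd (I ×ˢ univ) G ∧ Bd (I ×ˢ univ) (dd eT G) ∧ Bd (I ×ˢ univ) (dd eθ G)) (R : ℝ) :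
    ∃ Λ, 0 ≤ Λ ∧ ∀ t ∈ I, ∀ θ (v : V3), v.2.1 ^ 2 + v.2.2 ^ 2 ≤ R → |ev S.b (t, θ, v)| ≤ Λ * (1 + |v.1|) := by
  set W : Set E5 := {p | p.1 ∈ I ∧ p.2.2.2.1 ^ 2 + p.2.2.2.2 ^ 2 ≤ R} with hWdef
  have hWs : W ⊆ strip tp ti := fun p hp => mem_strip.2 (hI hp.1)
  have hWI : W ⊆ I ×ˢ univ := fun p hp => ⟨hp.1, trivial⟩
  have hU := h S.U (by simp)
  have hA := h S.A (by simp)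
  have hL := h S.L (by simp)
  have hβ := h S.β (by simp)
  have hJ := h S.J (by simp)
  have hK := h S.K (by simp)
  obtain ⟨h2, h3, hm⟩ := S.bd_m2 (e := eθ) (W := W) (R := R) (fun p hp => hp.2) hWs
    ⟨hU.1.mono hWI, hU.2.2.mono hWI⟩ ⟨hA.1.mono hWI, hA.2.2.mono hWI⟩ ⟨hβ.1.mono hWI, hβ.2.2.mono hWI⟩
  have hrp := S.bd_rp hWs (hU.1.mono hWI) (hβ.1.mono hWI)
  have hb1 : Bd W S.b1 := by
    unfold b1 E0 κ w E4
    rw [X_apply]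
    exact ((((hL.1.mono hWI).smul _).expR.mul hm.2).mul hrp |>.smul _).add
      ((((Bd.tI.pow 3).mul ((hβ.1.mono hWI).smul 2).expR).mul
        ((hK.1.sub (hA.1.mul hJ.1)).mono hWI)).mul (h3.sub ((hA.1.mono hWI).mul h2))) |>.add
      (((Bd.tI.mul (((hβ.1.smul 2).sub (hU.1.smul 4)).mono hWI).expR).mul (hJ.1.mono hWI)).mul h2)
  obtain ⟨C, C0, hC⟩ := hb1
  obtain ⟨D, D0, hD⟩ := hL.2.1
  refine ⟨C + D, by positivity, fun t ht θ v hv => ?_⟩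
  have hp : ((t, θ, v) : E5) ∈ strip tp ti := mem_strip.2 (hI ht)
  have a1 := hC (t, θ, v) ⟨ht, hv⟩
  have a2 := hD (t, θ, v) ⟨ht, trivial⟩
  rw [b, ev_add, ev_smul, ev_mul, ev_qR hp]
  refine (abs_add_le _ _).trans ?_
  rw [abs_mul, abs_mul, abs_of_pos (by norm_num : (0:ℝ) < 1/2)]
  have q0 := abs_nonneg v.1
  have : |ev S.Lt (t, θ, v)| * |v.1| ≤ D * |v.1| := mul_le_mul_of_nonneg_right a2 q0
  show 1 / 2 * (|ev S.Lt (t, θ, v)| * |v.1|) + |ev S.b1 (t, θ, v)| ≤ _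
  nlinarith [mul_nonneg C0 q0, mul_nonneg D0 q0]

end Fld

namespace Sys

variable [hfact : Fact (0 < tp)] (S : Sys tp ti)

theorem b_lin_late {t1 : ℝ} (h : t1 ∈ Ioo tp ti) (R : ℝ) :
    ∃ Λ, 0 ≤ Λ ∧ ∀ t ∈ Ico t1 ti, ∀ θ (v : V3), v.2.1 ^ 2 + v.2.2 ^ 2 ≤ R →
      |ev S.b (t, θ, v)| ≤ Λ * (1 + |v.1|) :=
  S.b_lin (fun t ht => ⟨h.1.trans_le ht.1, ht.2⟩) (S.late t1 h) R

/-- the supports in the last two velocity variables do not change -/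
theorem exists_supp23 : ∃ R, 0 ≤ R ∧ ∀ p ∈ strip tp ti, ev S.F p ≠ 0 → p.2.2.2.1 ^ 2 + p.2.2.2.2 ^ 2 ≤ R := by
  obtain ⟨p0, hp0, -⟩ := S.F_ne
  obtain ⟨R, hR⟩ := S.F_supp p0.1 (mem_strip.1 hp0)
  have ht0 := mem_strip.1 hp0
  set t0 := p0.1
  set Q : ℝ := 2 * |R| ^ 2
  have start : ∀ θ (v : V3), ev S.F (t0, θ, v) ≠ 0 → v.2.1 ^ 2 + v.2.2 ^ 2 ≤ Q := fun θ v hv => by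
    have : ‖v‖ ≤ |R| := by
      by_contra! hlt
      exact hv (hR θ v ((le_abs_self R).trans_lt hlt))
    simp only [Prod.norm_def, Real.norm_eq_abs, max_le_iff] at this
    have h1 := sq_le_sq' (by linarith [neg_abs_le v.2.1, this.2.1]) ((le_abs_self v.2.1).trans this.2.1)
    have h2 := sq_le_sq' (by linarith [neg_abs_le v.2.2, this.2.2]) ((le_abs_self v.2.2).trans this.2.2)
    simp only [Q]; linarith
  refine ⟨Q, by positivity, fun p hp hne => ?_⟩
  obtain ⟨t, θ, v⟩ := p
  have ht := mem_strip.1 hp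
  simp only at ht
  have core : ∀ ε : ℝ, ε * ε = 1 → ∀ t', ε * t' = t → ∀ t0', ε * t0' = t0 → t' ≤ t0' →
      v.2.1 ^ 2 + v.2.2 ^ 2 ≤ Q := by
    intro ε hε t' h1 t0' h2 hle
    have hεt : ∀ s ∈ Icc t' t0', ε * s ∈ Icc (min t t0) (max t t0) := by
      intro s hs
      have : ε = 1 ∨ ε = -1 := mul_self_eq_one_iff.1 hε
      rw [mem_Icc, min_le_iff, le_max_iff]
      rcases this with h | h <;> subst h
      · exact ⟨Or.inl (by linarith [hs.1]), Or.inr (by linarith [hs.2])⟩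
      · exact ⟨Or.inr (by linarith [hs.2]), Or.inl (by linarith [hs.1])⟩
    have hsub : Icc (min t t0) (max t t0) ⊆ Ioo tp ti := fun s hs =>
      ⟨(lt_min ht.1 ht0.1).trans_le hs.1, hs.2.trans_lt (max_lt ht.2 ht0.2)⟩
    have := propagate ε hε S.c S.b S.F (vvR - algebraMap ℝ _ Q) S.eV (s0 := t') (s1 := t0')
      (fun s hs => hsub (hεt s hs)) S.F_nonneg
      (fun R => by
        obtain ⟨Λ, h0, hΛ⟩ := S.b_lin_late (t1 := min t t0) (hsub ⟨le_rfl, min_le_max⟩) R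
        exact ⟨Λ, h0, fun s hs θ v hv => hΛ _ ⟨(hεt s hs).1, (hsub (hεt s hs)).2⟩ θ v hv⟩)
      (fun s hs θ v _ => by
        rw [map_sub, Tr_vvR, Derivation.map_algebraMap]; simp)
      (fun θ v hne => by
        have hp : ((ε * t0', θ, v) : E5) ∈ strip tp ti := mem_strip.2 (by rw [h2]; exact ht0)
        rw [ev_sub, ev_vvR hp, ev_algebraMap _ hp]
        rw [h2] at hne
        linarith [start θ v hne])
      t' ⟨le_rfl, hle⟩ θ v (by rw [h1]; exact hne)
    rw [h1, ev_sub, ev_vvR hp, ev_algebraMap _ hp] at this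
    simpa using this
  rcases le_total t t0 with h | h
  · exact core 1 (by norm_num) t (by simp) t0 (by simp) h
  · exact core (-1) (by norm_num) (-t) (by simp) (-t0) (by simp) (by linarith)

/-- bound of the velocity by `log (1 + q²)` and the last two components -/
theorem norm_le_of_log {v : V3} {R Q : ℝ} (h1 : v.2.1 ^ 2 + v.2.2 ^ 2 ≤ R) (h2 : Real.log (1 + v.1 ^ 2) ≤ Q) :
    ‖v‖ ≤ Real.exp Q + |R| + 1 := by
  have h3 : 1 + v.1 ^ 2 ≤ Real.exp Q := by
    rwa [Real.log_le_iff_le_exp (by positivity)] at h2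
  have := abs_nonneg R
  have := le_abs_self R
  have := Real.exp_pos Q
  simp only [Prod.norm_def, Real.norm_eq_abs]
  refine max_le ?_ (max_le ?_ ?_) <;> refine abs_le_of_sq_le_sq ?_ (by positivity)
  · nlinarith
  · nlinarith [sq_nonneg v.2.2]
  · nlinarith [sq_nonneg v.2.1]

theorem exists_supp {t0 : ℝ} (ht0 : t0 ∈ Ioo tp ti) :
    ∃ R, 0 < R ∧ ∀ t ∈ Ico t0 ti, ∀ θ v, ev S.F (t, θ, v) ≠ 0 → ‖v‖ < R := by
  obtain ⟨R, hR0, hR⟩ := S.exists_supp23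
  obtain ⟨R1, hR1⟩ := S.F_supp t0 ht0
  obtain ⟨Λ, h0, hΛ⟩ := S.b_lin_late ht0 R
  set Q := Real.log (1 + |R1| ^ 2) with hQ
  refine ⟨Real.exp (Q + 4 * Λ * (ti - t0)) + |R| + 1 + 1, by positivity, fun t ht θ v hne => ?_⟩
  have hp : ((t, θ, v) : E5) ∈ strip tp ti := mem_strip.2 ⟨ht0.1.trans_le ht.1, ht.2⟩
  have hs : ∀ s ∈ Icc (-t) (-t0), (-1) * s ∈ Ico t0 ti := fun s hs =>
    ⟨by linarith [hs.2], by linarith [hs.1, ht.2]⟩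
  have := propagate_q (-1) (by norm_num) S.c S.b S.F S.eV (s0 := -t) (s1 := -t0) (Λ := Λ) (R := R) (Q := Q)
    (fun s hs' => ⟨ht0.1.trans_le (hs s hs').1, (hs s hs').2⟩) h0 S.F_nonneg
    (fun R => by
      obtain ⟨Λ, h0, hΛ⟩ := S.b_lin_late ht0 R
      exact ⟨Λ, h0, fun s hs' θ v hv => hΛ _ (hs s hs') θ v hv⟩) hR
    (fun s hs' θ v hv => hΛ _ (hs s hs') θ v hv)
    (fun θ v hne => by
      have h1 : ‖v‖ ≤ |R1| := by
        by_contra! hlt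
        refine hne ?_
        simpa using hR1 θ v ((le_abs_self R1).trans_lt hlt)
      simp only [Prod.norm_def, Real.norm_eq_abs, max_le_iff] at h1
      refine Real.log_le_log (by positivity) ?_
      have := sq_le_sq' (by linarith [neg_abs_le v.1, h1.1]) ((le_abs_self v.1).trans h1.1)
      linarith) (-t) ⟨le_rfl, by linarith [ht.1]⟩ θ v (by simpa using hne)
  refine (norm_le_of_log (hR _ hp hne) (this.trans ?_)).trans_lt (lt_add_one _)
  have : -t0 - -t ≤ ti - t0 := by linarith [ht.2]
  have := mul_le_mul_of_nonneg_left this (by positivity : 0 ≤ 4 * Λ)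
  linarith

end Sys

/-- a nonnegative function on velocity space dominated by a slab function has small integral -/
theorem integral_le_of_slab {G : V3 → ℝ} {g : ℝ → ℝ} {R : ℝ} (hR : 0 ≤ R)
    (hg : Integrable g) (hG : ∀ v, G v ≤ g v.1)
    (hG0 : ∀ v, R < |v.2.1| ∨ R < |v.2.2| → G v ≤ 0) (hGn : ∀ v, 0 ≤ G v) :
    ∫ v, G v ≤ 4 * R ^ 2 * ∫ x, g x := by
  let k : ℝ × ℝ → ℝ := (Icc (-R) R ×ˢ Icc (-R) R).indicator fun _ => 1
  have hk : Integrable k := by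
    refine (integrable_indicator_iff (measurableSet_Icc.prod measurableSet_Icc)).2 ?_
    exact (continuous_const.continuousOn).integrableOn_compact (isCompact_Icc.prod isCompact_Icc)
  have hk1 : ∫ z, k z = 4 * R ^ 2 := by
    rw [integral_indicator (measurableSet_Icc.prod measurableSet_Icc), setIntegral_const, smul_eq_mul, mul_one,
      Measure.real, Measure.volume_eq_prod, Measure.prod_prod, Real.volume_Icc, ENNReal.toReal_mul,
      ENNReal.toReal_ofReal (by linarith)]
    ring
  have hInt : Integrable (fun v : V3 => g v.1 * k v.2) := hg.mul_prod hk
  have h1 : ∫ v : V3, g v.1 * k v.2 = (∫ x, g x) * ∫ z, k z := integral_prod_mul g k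
  rw [mul_comm, ← hk1, ← h1]
  refine integral_mono_of_nonneg (Eventually.of_forall hGn) hInt (Eventually.of_forall fun v => ?_)
  by_cases hv : v.2 ∈ Icc (-R) R ×ˢ Icc (-R) R
  · simp only [k, indicator_of_mem hv, mul_one]; exact hG v
  · simp only [k, indicator_of_notMem hv, mul_zero]
    refine hG0 v ?_
    by_contra! h
    exact hv ⟨abs_le.1 h.1, abs_le.1 h.2⟩

namespace Fld

variable [hfact : Fact (0 < tp)] (S : Fld tp ti)

omit hfact in
theorem a_σ : S.a * S.σ = 1 := by
  rw [a, σ, ← expR_add, ← add_smul]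
  refine SF_ext fun p hp => ?_
  rw [ev_expR _ hp, ev_one hp]; norm_num

omit hfact in
theorem a_X (G : SF tp ti) : S.a * S.X G = dd eθ G := by
  rw [X, Derivation.smul_apply, smul_eq_mul, ← mul_assoc, a_σ, one_mul]

omit hfact in
theorem dd_a (e : E5) : dd e S.a = (-1/2 : ℝ) • (S.a * dd e S.L) := by
  rw [a, dd_expR, Derivation.map_smul, mul_smul_comm]

omit hfact in
theorem dd_σ (e : E5) : dd e S.σ = (1/2 : ℝ) • (S.σ * dd e S.L) := by
  rw [σ, dd_expR, Derivation.map_smul, mul_smul_comm]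

omit hfact in
theorem dT_X (G : SF tp ti) : dd eT (S.X G) = S.X (dd eT G) + (1/2 : ℝ) • (S.Lt * S.X G) := by
  rw [X, Derivation.smul_apply, Derivation.smul_apply, smul_eq_mul, smul_eq_mul, Derivation.leibniz, dd_σ,
    dd_comm eT eθ, Lt, smul_eq_mul, smul_eq_mul, mul_smul_comm]
  congr 2; ring

end Fld

namespace Sys

variable [hfact : Fact (0 < tp)] (S : Sys tp ti)

theorem base_Lt : Base S.Lt := S.bL.dd_T
theorem base_ν : Base S.ν := S.bβ.sub (S.bL.smul _)
theorem base_σ : Base S.σ := (S.bL.smul _).exp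
theorem base_a : Base S.a := (S.bL.smul _).exp
theorem base_h : Base S.h := (((S.bU.smul _).exp).mul (base_tI.pow 2)).smul _
theorem base_E2 : Base S.E2 := ((S.bβ.smul _).sub (S.bU.smul _)).exp
theorem base_E4 : Base S.E4 := ((S.bβ.smul _).sub (S.bU.smul _)).exp
theorem base_E0 : Base S.E0 := (S.bβ.smul _).exp
theorem base_κ : Base S.κ := S.bK.sub (S.bA.mul S.bJ)
theorem base_X {G : SF tp ti} (hG : Base G) : Base (S.X G) := S.base_σ.mul hG.dd_θ

theorem mom_int (φ : SF tp ti) {p : E5} (hp : p ∈ strip tp ti) :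
    Integrable (fun v : V3 => ev S.F (p.1, p.2.1, v) * ev φ (p.1, p.2.1, v)) := by
  obtain ⟨R, hR⟩ := S.F_supp p.1 (mem_strip.1 hp)
  have h := ev_integrableOn R (S.F * φ) (mem_strip.1 hp) p.2.1
  simp only [ev_mul] at h
  refine (integrableOn_iff_integrable_of_support_subset fun v hv => ?_).1 h
  by_contra hn
  rw [mem_closedBall_zero_iff, not_le] at hn
  exact hv (by simp [hR _ _ hn])

theorem mom_mono {φ ψ : SF tp ti} {p : E5} (hp : p ∈ strip tp ti)
    (h : ∀ v, ev S.F (p.1, p.2.1, v) ≠ 0 → ev φ (p.1, p.2.1, v) ≤ ev ψ (p.1, p.2.1, v)) :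
    S.mom φ p ≤ S.mom ψ p := by
  refine integral_mono (S.mom_int φ hp) (S.mom_int ψ hp) fun v => ?_
  by_cases h0 : ev S.F (p.1, p.2.1, v) = 0
  · simp [h0]
  · exact mul_le_mul_of_nonneg_left (h v h0) (S.F_nonneg _ (mem_strip.2 (mem_strip.1 hp)))

theorem mom_nonneg {φ : SF tp ti} {p : E5} (hp : p ∈ strip tp ti)
    (h : ∀ v, ev S.F (p.1, p.2.1, v) ≠ 0 → 0 ≤ ev φ (p.1, p.2.1, v)) : 0 ≤ S.mom φ p := by
  have := S.mom_mono (φ := 0) hp (fun v hv => by simpa using h v hv)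
  simpa [Fld.mom] using this

theorem mom_neg (φ : SF tp ti) (p : E5) : S.mom (-φ) p = - S.mom φ p := by
  simp [Fld.mom, integral_neg]

theorem mom_smul (c : ℝ) (φ : SF tp ti) (p : E5) : S.mom (c • φ) p = c * S.mom φ p := by
  simp only [Fld.mom, ev_smul, ← integral_const_mul]
  congr 1; funext v; ring

theorem mom_base_mul {G : SF tp ti} (hG : Base G) (φ : SF tp ti) (p : E5) :
    S.mom (G * φ) p = ev G p * S.mom φ p := by
  simp only [Fld.mom, ev_mul, ← integral_const_mul]
  congr 1; funext v; rw [hG p.1 p.2.1 v p.2.2]; ring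

theorem abs_mom_le {φ ψ : SF tp ti} {p : E5} (hp : p ∈ strip tp ti)
    (h : ∀ v, ev S.F (p.1, p.2.1, v) ≠ 0 → |ev φ (p.1, p.2.1, v)| ≤ ev ψ (p.1, p.2.1, v)) :
    |S.mom φ p| ≤ S.mom ψ p := by
  rw [abs_le]
  constructor
  · rw [← mom_neg]
    exact S.mom_mono hp fun v hv => by rw [ev_neg]; linarith [neg_abs_le (ev φ (p.1, p.2.1, v)), h v hv]
  · exact S.mom_mono hp fun v hv => (le_abs_self _).trans (h v hv)

/-- the moments are ball integrals as soon as the ball contains the support -/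
theorem mom_eq_MR (φ : SF tp ti) {p : E5} (hp : p ∈ strip tp ti) {R : ℝ}
    (hR : ∀ v, ev S.F (p.1, p.2.1, v) ≠ 0 → ‖v‖ ≤ R) : S.mom φ p = ev (MR R (S.F * φ)) p := by
  rw [ev_MR _ _ hp]
  simp only [ev_mul]
  refine (setIntegral_eq_integral_of_forall_compl_eq_zero fun v hv => ?_).symm
  by_contra hn
  exact hv (mem_closedBall_zero_iff.2 (hR v (left_ne_zero_of_mul hn)))

theorem mem' {p : E5} (hp : p ∈ strip tp ti) (v : V3) : ((p.1, p.2.1, v) : E5) ∈ strip tp ti :=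
  mem_strip.2 (mem_strip.1 hp)

/-- `p⁰` as an element -/
def p0 : SF tp ti := S.P * S.rp

theorem p0_pos {p : E5} (hp : p ∈ strip tp ti) : 0 < ev S.p0 p := by
  rw [p0, ev_mul]; exact mul_pos (S.P_pos hp) (S.rp_pos hp)

theorem rp_mul_p0 {p : E5} (hp : p ∈ strip tp ti) : ev S.rp p * ev S.p0 p = 1 := by
  rw [p0, ev_mul]; linear_combination S.ev_P_rp hp

theorem p0_sq {p : E5} (hp : p ∈ strip tp ti) : ev S.p0 p ^ 2 = ev S.P p := by
  rw [p0, ev_mul]; linear_combination ev S.P p * S.ev_P_rp hp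

theorem abs_q_le {p : E5} (hp : p ∈ strip tp ti) : |p.2.2.1| ≤ ev S.p0 p := S.toFld.abs_q_le hp

theorem tI_pos {p : E5} (hp : p ∈ strip tp ti) : 0 < ev (tI : SF tp ti) p := by
  rw [ev_tI hp]; exact inv_pos.2 (hfact.out.trans (mem_strip.1 hp).1)

theorem t_pos {p : E5} (hp : p ∈ strip tp ti) : 0 < p.1 := hfact.out.trans (mem_strip.1 hp).1

theorem h_pos {p : E5} (hp : p ∈ strip tp ti) : 0 < ev S.h p := by
  rw [Fld.h, ev_smul, ev_mul, ev_pow _ _ hp]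
  have := tI_pos hp
  have := expR_pos ((4:ℝ) • S.U) hp
  positivity

theorem ev_m2 {p : E5} (hp : p ∈ strip tp ti) : ev S.m2 p = ev S.E2 p + ev S.E4 p * p.2.2.2.1 ^ 2
    + ev (tI : SF tp ti) p ^ 2 * ev S.E0 p * ev S.w p ^ 2 := by
  simp only [Fld.m2, ev_add, ev_mul, ev_pow _ _ hp, ev_v2R hp]

/-- the time derivative of `ν` -/
def N : SF tp ti := dd eT S.ν

theorem base_N : Base S.N := S.base_ν.dd_T

theorem ev_N {p : E5} (hp : p ∈ strip tp ti) : ev S.N p =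
    p.1 * (ev S.Ut p ^ 2 + ev S.XU p ^ 2 + ev S.h p * (ev S.At p ^ 2 + ev S.XA p ^ 2))
      + 1/4 * (ev (tI : SF tp ti) p * ev S.E4 p * ev S.J p ^ 2)
      + 1/4 * (ev (tI : SF tp ti) p ^ 3 * ev S.E0 p * ev S.κ p ^ 2) + S.mom S.p0 p := by
  rw [N, S.eν p hp]
  simp only [ev_add, ev_mul, ev_smul, ev_pow _ _ hp, ev_tR hp]
  rfl

theorem E4_pos {p : E5} (hp : p ∈ strip tp ti) : 0 < ev S.E4 p := expR_pos _ hp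
theorem E2_pos {p : E5} (hp : p ∈ strip tp ti) : 0 < ev S.E2 p := expR_pos _ hp
theorem E0_pos {p : E5} (hp : p ∈ strip tp ti) : 0 < ev S.E0 p := expR_pos _ hp
theorem a_pos {p : E5} (hp : p ∈ strip tp ti) : 0 < ev S.a p := expR_pos _ hp
theorem mom_p0_nonneg {p : E5} (hp : p ∈ strip tp ti) : 0 ≤ S.mom S.p0 p :=
  S.mom_nonneg hp fun v _ => (S.p0_pos (mem' hp v)).le

theorem N_ge {p : E5} (hp : p ∈ strip tp ti) :
    p.1 * (ev S.Ut p ^ 2 + ev S.XU p ^ 2 + ev S.h p * (ev S.At p ^ 2 + ev S.XA p ^ 2)) + S.mom S.p0 p ≤ ev S.N p := by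
  have := S.E4_pos hp
  have := S.E0_pos hp
  have := tI_pos hp
  rw [S.ev_N hp]
  have h1 : 0 ≤ 1/4 * (ev (tI : SF tp ti) p * ev S.E4 p * ev S.J p ^ 2) := by positivity
  have h2 : 0 ≤ 1/4 * (ev (tI : SF tp ti) p ^ 3 * ev S.E0 p * ev S.κ p ^ 2) := by positivity
  linarith

theorem N_nonneg {p : E5} (hp : p ∈ strip tp ti) : 0 ≤ ev S.N p := by
  refine le_trans ?_ (S.N_ge hp)
  have := t_pos hp
  have := S.h_pos hp
  have := S.mom_p0_nonneg hp
  positivity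

theorem abs_Xβ_le {p : E5} (hp : p ∈ strip tp ti) : |ev (S.X S.β) p| ≤ ev S.N p := by
  refine le_trans ?_ (S.N_ge hp)
  have h1 : |S.mom qR p| ≤ S.mom S.p0 p := S.abs_mom_le hp fun v _ => by
    rw [ev_qR (mem' hp v)]; exact S.abs_q_le (mem' hp v)
  rw [S.eXβ p hp, ev_smul, ev_mul, ev_tR hp, ev_add, ev_mul, ev_mul, ev_mul]
  have t0 := t_pos hp
  have h0 := S.h_pos hp
  have e1 : |2 * (ev S.Ut p * ev S.XU p)| ≤ ev S.Ut p ^ 2 + ev S.XU p ^ 2 := by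
    rw [abs_le]; constructor <;> nlinarith [sq_nonneg (ev S.Ut p + ev S.XU p), sq_nonneg (ev S.Ut p - ev S.XU p)]
  have e2 : |2 * (ev S.At p * ev S.XA p)| ≤ ev S.At p ^ 2 + ev S.XA p ^ 2 := by
    rw [abs_le]; constructor <;> nlinarith [sq_nonneg (ev S.At p + ev S.XA p), sq_nonneg (ev S.At p - ev S.XA p)]
  calc _ = |p.1 * (2 * (ev S.Ut p * ev S.XU p) + ev S.h p * (2 * (ev S.At p * ev S.XA p))) - S.mom qR p| := by ring_nf
    _ ≤ |p.1 * (2 * (ev S.Ut p * ev S.XU p) + ev S.h p * (2 * (ev S.At p * ev S.XA p)))| + |S.mom qR p| := abs_sub _ _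
    _ ≤ _ := by
      refine add_le_add ?_ h1
      rw [abs_mul, abs_of_pos t0]
      refine mul_le_mul_of_nonneg_left ((abs_add_le _ _).trans (add_le_add e1 ?_)) t0.le
      rw [abs_mul, abs_of_pos h0]
      exact mul_le_mul_of_nonneg_left e2 h0.le

theorem Lt_le {p : E5} (hp : p ∈ strip tp ti) : ev S.Lt p ≤ 0 ∧ - ev S.Lt p ≤ 4 * ev S.N p := by
  have h1 := S.E4_pos hp
  have h2 := S.E0_pos hp
  have h3 := tI_pos hp
  have h4 : 0 ≤ S.mom (S.m2 * S.rp) p := S.mom_nonneg hp fun v _ => by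
    rw [ev_mul]; exact (mul_pos (S.m2_pos (mem' hp v)) (S.rp_pos (mem' hp v))).le
  have h5 : S.mom (S.m2 * S.rp) p ≤ S.mom S.p0 p := S.mom_mono hp fun v _ => by
    rw [p0, ev_mul, ev_mul]
    refine mul_le_mul_of_nonneg_right ?_ (S.rp_pos (mem' hp v)).le
    rw [S.ev_P (mem' hp v)]; nlinarith [sq_nonneg v.1]
  have e := S.eL p hp
  simp only [ev_add, ev_mul, ev_pow _ _ hp] at e
  have a1 : 0 ≤ ev (tI : SF tp ti) p * ev S.E4 p * ev S.J p ^ 2 := by positivity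
  have a2 : 0 ≤ ev (tI : SF tp ti) p ^ 3 * ev S.E0 p * ev S.κ p ^ 2 := by positivity
  have t0 := t_pos hp
  have h0 := S.h_pos hp
  have a3 : 0 ≤ p.1 * (ev S.Ut p ^ 2 + ev S.XU p ^ 2 + ev S.h p * (ev S.At p ^ 2 + ev S.XA p ^ 2)) := by positivity
  rw [S.ev_N hp, e]
  constructor <;> linarith

theorem abs_βt_le {p : E5} (hp : p ∈ strip tp ti) : |ev (dd eT S.β) p| ≤ 3 * ev S.N p := by
  have h := S.Lt_le hp
  have : S.N = dd eT S.β - (1/2:ℝ) • S.Lt := by rw [N, Fld.ν, map_sub, Derivation.map_smul]; rfl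
  have e : ev S.N p = ev (dd eT S.β) p - 1/2 * ev S.Lt p := by
    conv_lhs => rw [this]
    simp
  have := S.N_nonneg hp
  rw [abs_le]; constructor <;> linarith

end Sys

theorem Iθ_smul (c : ℝ) (G : SF tp ti) (t : ℝ) : Iθ (c • G) t = c * Iθ G t := by
  unfold Iθ; rw [← integral_const_mul]; simp

theorem Iθ_sub (G H : SF tp ti) {t : ℝ} (ht : t ∈ Ioo tp ti) : Iθ (G - H) t = Iθ G t - Iθ H t := by
  rw [sub_eq_add_neg, Iθ_add _ _ ht, Iθ_neg, sub_eq_add_neg]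

theorem Iθ_nonneg (G : SF tp ti) {t : ℝ} (h : ∀ θ, 0 ≤ ev G (t, θ, 0)) : 0 ≤ Iθ G t :=
  setIntegral_nonneg measurableSet_Icc fun θ _ => h θ

/-- monotonicity of `Iθ` in time from the sign of the derivative up to a divergence -/
theorem Iθ_monotone (G H : SF tp ti)
    (h : ∀ p ∈ strip tp ti, 0 ≤ ev (dd eT G - dd eθ H) p) {s t : ℝ} (hs : s ∈ Ioo tp ti) (ht : t ∈ Ioo tp ti)
    (hst : s ≤ t) : Iθ G s ≤ Iθ G t := by
  have hm : MonotoneOn (Iθ G) (Ioo tp ti) := by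
    refine monotoneOn_of_deriv_nonneg (convex_Ioo _ _)
      (fun t ht => (hasDerivAt_Iθ G ht).continuousAt.continuousWithinAt)
      (fun t ht => (hasDerivAt_Iθ G (interior_subset ht)).differentiableAt.differentiableWithinAt) fun t ht => ?_
    have ht := interior_subset ht
    rw [(hasDerivAt_Iθ G ht).deriv]
    have h1 : 0 ≤ Iθ (dd eT G - dd eθ H) t := Iθ_nonneg _ fun θ => h _ (mem_strip.2 ht)
    rwa [Iθ_sub _ _ ht, Iθ_dθ _ ht, sub_zero] at h1
  exact hm hs ht hst

/-- oscillation bound from an integrable bound of the `θ`-derivative -/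
theorem osc_le (φ g : SF tp ti) {t : ℝ} (ht : t ∈ Ioo tp ti)
    (h : ∀ θ, |ev (dd eθ φ) (t, θ, 0)| ≤ ev g (t, θ, 0)) (x y : ℝ) :
    |ev φ (t, x, 0) - ev φ (t, y, 0)| ≤ Iθ g t := by
  have core : ∀ x ∈ Icc (0:ℝ) 1, ∀ y ∈ Icc (0:ℝ) 1, x ≤ y → |ev φ (t, x, 0) - ev φ (t, y, 0)| ≤ Iθ g t := by
    intro x hx y hy hxy
    rw [abs_sub_comm, ← intervalIntegral.integral_eq_sub_of_hasDerivAt (f := fun θ => ev φ (t, θ, 0))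
      (fun θ _ => hasDerivAt_ev_θ φ ht) ((ev_cont_θ _ ht 0).intervalIntegrable _ _),
      intervalIntegral.integral_of_le hxy, ← integral_Icc_eq_integral_Ioc]
    refine (abs_integral_le_integral_abs).trans ?_
    refine (setIntegral_mono (((ev_cont_θ _ ht 0).abs).continuousOn.integrableOn_compact isCompact_Icc)
      ((ev_cont_θ _ ht 0).continuousOn.integrableOn_compact isCompact_Icc) h).trans ?_
    exact setIntegral_mono_set (Iθ_integrable g ht) (Eventually.of_forall fun θ => (abs_nonneg _).trans (h θ))
      (Icc_subset_Icc hx.1 hy.2).eventuallyLE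
  rw [← ev_fract φ t x, ← ev_fract φ t y]
  have hf : ∀ z : ℝ, Int.fract z ∈ Icc (0:ℝ) 1 := fun z => ⟨Int.fract_nonneg _, (Int.fract_lt_one _).le⟩
  rcases le_total (Int.fract x) (Int.fract y) with hle | hle
  · exact core _ (hf x) _ (hf y) hle
  · rw [abs_sub_comm]; exact core _ (hf y) _ (hf x) hle

/-- frozen in time -/
def frz (s : ℝ) (hs : s ∈ Ioo tp ti) (G : SF tp ti) : SF tp ti :=
  mkR (fun p => ev G (s, p.2)) ((ev_contDiffOn G).comp (by fun_prop) fun p _ => mem_strip.2 hs)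
    (fun t _ θ v => ev_per G s θ v)

theorem ev_frz {s : ℝ} (hs : s ∈ Ioo tp ti) (G : SF tp ti) {p : E5} (hp : p ∈ strip tp ti) :
    ev (frz s hs G) p = ev G (s, p.2) := ev_mkR _ _ _ hp

theorem dT_frz {s : ℝ} (hs : s ∈ Ioo tp ti) (G : SF tp ti) : dd eT (frz s hs G) = 0 := SF_ext fun p hp => by
  obtain ⟨t, θ, v⟩ := p
  have h := hasDerivAt_ev_t (frz s hs G) (θ := θ) (v := v) (mem_strip.1 hp)
  have h2 : (fun s' => ev (frz s hs G) (s', θ, v)) =ᶠ[𝓝 t] fun _ => ev G (s, θ, v) := by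
    filter_upwards [isOpen_Ioo.mem_nhds (mem_strip.1 hp)] with s' hs'
    exact ev_frz hs G (mem_strip.2 hs')
  rw [ev_zero]
  exact h.unique ((hasDerivAt_const t _).congr_of_eventuallyEq h2)

namespace Sys

variable [hfact : Fact (0 < tp)] (S : Sys tp ti)

/-- monotonicity of the density `a` -/
theorem a_mono {s t : ℝ} (hs : s ∈ Ioo tp ti) (ht : t ∈ Ioo tp ti) (hst : s ≤ t) (x : ℝ × V3) :
    ev S.a (s, x) ≤ ev S.a (t, x) := by
  have hm : MonotoneOn (fun s => ev S.a (s, x.1, x.2)) (Ioo tp ti) := by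
    refine monotoneOn_of_deriv_nonneg (convex_Ioo _ _)
      (fun t ht => (hasDerivAt_ev_t S.a ht).continuousAt.continuousWithinAt)
      (fun t ht => (hasDerivAt_ev_t S.a (interior_subset ht)).differentiableAt.differentiableWithinAt) fun t ht => ?_
    have ht := interior_subset ht
    rw [(hasDerivAt_ev_t S.a ht).deriv, S.dd_a, ev_smul, ev_mul]
    have h1 := S.a_pos (mem_strip (p := (t, x.1, x.2)).2 ht)
    have h2 := (S.Lt_le (mem_strip (p := (t, x.1, x.2)).2 ht)).1
    simp only [Fld.Lt] at h2
    nlinarith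
  exact hm hs ht hst

theorem energy_mono {s t : ℝ} (hs : s ∈ Ioo tp ti) (ht : t ∈ Ioo tp ti) (hst : s ≤ t) :
    Iθ (tR ^ 3 * S.a * S.N) s ≤ Iθ (tR ^ 3 * S.a * S.N) t := by
  refine Iθ_monotone _ (tR ^ 3 * S.X S.β) (fun p hp => ?_) hs ht hst
  have t0 := t_pos hp
  have hdt : dd eT (tR ^ 3 : SF tp ti) = (3:ℝ) • tR ^ 2 := by
    rw [Derivation.leibniz_pow, dd_tR]
    simp only [eT, map_one, smul_eq_mul, mul_one]
    rw [← Nat.cast_smul_eq_nsmul ℝ]; norm_num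
  have hdθ : dd eθ (tR ^ 3 : SF tp ti) = 0 := by
    rw [Derivation.leibniz_pow, dd_tR]
    simp [eθ]
  have e1 : dd eT (tR ^ 3 * S.a * S.N) - dd eθ (tR ^ 3 * S.X S.β) =
      tR ^ 2 * S.a * ((3:ℝ) • S.N + tR * (dd eT S.N - (1/2:ℝ) • (S.Lt * S.N) - S.X (S.X S.β))) := by
    have hX : dd eθ (S.X S.β) = S.a * S.X (S.X S.β) := (S.a_X _).symm
    rw [Derivation.leibniz, Derivation.leibniz, Derivation.leibniz, hdt, hdθ, S.dd_a, hX]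
    simp only [smul_eq_mul, Fld.Lt, Algebra.smul_def]
    have : (algebraMap ℝ (SF tp ti)) (-1/2) = - (algebraMap ℝ (SF tp ti)) (1/2) := by
      rw [← map_neg]; norm_num
    rw [this]
    ring
  rw [e1, ev_mul, ev_mul, ev_pow _ _ hp, ev_tR hp]
  have ha := S.a_pos hp
  refine mul_nonneg (by positivity) ?_
  have e2 := S.eνν p hp
  simp only [ev_add, ev_sub, ev_mul, ev_smul, ev_pow _ _ hp, ev_tR hp] at e2 ⊢
  have e2' : ev (dd eT S.N) p = _ := e2
  rw [e2', S.ev_N hp]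
  have hN : ev (dd eT S.ν) p = _ := S.ev_N hp
  have hh := S.h_pos hp
  have h1 := S.E4_pos hp
  have h2 := S.E0_pos hp
  have h3 := tI_pos hp
  have htI : p.1 * ev (tI : SF tp ti) p = 1 := by
    rw [ev_tI hp]; exact mul_inv_cancel₀ t0.ne'
  have hw : S.mom (tI ^ 2 * S.E0 * (S.w ^ 2 * S.rp)) p ≤ S.mom S.p0 p := S.mom_mono hp fun v _ => by
    have hp' := mem' hp v
    simp only [p0, ev_mul, ev_pow _ _ hp']
    rw [← mul_assoc]
    refine mul_le_mul_of_nonneg_right ?_ (S.rp_pos hp').le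
    rw [S.ev_P hp', S.ev_m2 hp']
    have := S.E2_pos hp'
    have := S.E4_pos hp'
    have : 0 ≤ ev S.E4 (p.1, p.2.1, v) * v.2.1 ^ 2 := by positivity
    have := sq_nonneg v.1
    simp only
    linarith
  have hmom : S.mom (tI ^ 2 * S.E0 * (S.w ^ 2 * S.rp)) p
      = ev (tI : SF tp ti) p ^ 2 * ev S.E0 p * S.mom (S.w ^ 2 * S.rp) p := by
    rw [S.mom_base_mul ((base_tI.pow 2).mul S.base_E0), ev_mul, ev_pow _ _ hp]
  rw [hmom] at hw
  have hp0 := S.mom_p0_nonneg hp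
  have hNe : ev (dd eT S.ν) p = ev S.N p := rfl
  rw [hNe, S.ev_N hp]
  set T := ev (tI : SF tp ti) p
  have k1 : 0 ≤ 2 * p.1 * ev S.Ut p ^ 2 + 4 * p.1 * ev S.XU p ^ 2
    + p.1 * ev S.h p * (4 * ev S.At p ^ 2 + 2 * ev S.XA p ^ 2) := by positivity
  have k2 : 0 ≤ 1/2 * (T * ev S.E4 p * ev S.J p ^ 2) := by positivity
  have htE : p.1 * (T ^ 3 * ev S.E0 p * S.mom (S.w ^ 2 * S.rp) p) = T ^ 2 * ev S.E0 p * S.mom (S.w ^ 2 * S.rp) p := by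
    linear_combination (T ^ 2 * ev S.E0 p * S.mom (S.w ^ 2 * S.rp) p) * htI
  have htJ : p.1 * (T ^ 2 * ev S.E4 p * ev S.J p ^ 2) = T * ev S.E4 p * ev S.J p ^ 2 := by
    linear_combination (T * ev S.E4 p * ev S.J p ^ 2) * htI
  have htK : p.1 * (T ^ 4 * ev S.E0 p * ev S.κ p ^ 2) = T ^ 3 * ev S.E0 p * ev S.κ p ^ 2 := by
    linear_combination (T ^ 3 * ev S.E0 p * ev S.κ p ^ 2) * htI
  nlinarith

end Sys

/-- velocity divergences integrate to zero -/
theorem ev_MR_dd_v (e : V3) (G : SF tp ti) {p : E5} (hp : p ∈ strip tp ti) {R : ℝ}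
    (hR : ∀ v, ev G (p.1, p.2.1, v) ≠ 0 → ‖v‖ < R) : ev (MR R (dd (0, 0, e) G)) p = 0 := by
  have hd : ∀ v : V3, HasLineDerivAt ℝ (fun v => ev G (p.1, p.2.1, v)) (ev (dd (0, 0, e) G) (p.1, p.2.1, v)) v e := by
    intro v
    have hc : HasDerivAt (fun s : ℝ => ((p.1, p.2.1, v + s • e) : E5)) (0, 0, e) 0 :=
      (hasDerivAt_const _ _).prodMk ((hasDerivAt_const _ _).prodMk (by
        simpa using ((hasDerivAt_id (0:ℝ)).smul_const e).const_add v))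
    have h1 := hasDerivAt_ev_comp G hc (by simpa [mem_strip] using mem_strip.1 hp)
    simpa [HasLineDerivAt] using h1
  have hz : ∀ v : V3, R < ‖v‖ → ev (dd (0, 0, e) G) (p.1, p.2.1, v) = 0 := by
    intro v hv
    have hev : (fun v : V3 => ev G (p.1, p.2.1, v)) =ᶠ[𝓝 v] fun _ => 0 := by
      filter_upwards [(isOpen_lt continuous_const continuous_norm).mem_nhds hv] with w hw
      by_contra hne
      exact absurd (hR w hne) (not_lt.2 (le_of_lt hw))
    have h2 : HasLineDerivAt ℝ (fun v => ev G (p.1, p.2.1, v)) 0 v e := by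
      have := (hasFDerivAt_const (𝕜 := ℝ) (0:ℝ) v).congr_of_eventuallyEq hev
      simpa using this.hasLineDerivAt e
    exact (hd v).unique h2
  have hInt : ∀ H : SF tp ti, (∀ v : V3, R < ‖v‖ → ev H (p.1, p.2.1, v) = 0) →
      Integrable (fun v : V3 => ev H (p.1, p.2.1, v)) := fun H hH => by
    refine (integrableOn_iff_integrable_of_support_subset fun v hv => ?_).1 (ev_integrableOn R H (mem_strip.1 hp) p.2.1)
    by_contra hn
    rw [mem_closedBall_zero_iff, not_le] at hn
    exact hv (hH v hn)
  have hi1 := hInt G fun v hv => by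
    by_contra hne
    exact absurd (hR v hne) (not_lt.2 hv.le)
  have hi2 := hInt _ hz
  have h1 : ((volume : Measure ℝ).prod (volume : Measure ℝ)).IsAddHaarMeasure := inferInstance
  have h2 : (volume : Measure V3).IsAddHaarMeasure :=
    inferInstanceAs (((volume : Measure ℝ).prod ((volume : Measure ℝ).prod (volume : Measure ℝ))).IsAddHaarMeasure)
  have key := integral_bilinear_hasLineDerivAt_right_eq_neg_left_of_integrable (μ := (volume : Measure V3))
    (f := fun _ => (1:ℝ)) (f' := fun _ => (0:ℝ)) (g := fun v : V3 => ev G (p.1, p.2.1, v))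
    (g' := fun v : V3 => ev (dd (0, 0, e) G) (p.1, p.2.1, v)) (v := e) (B := ContinuousLinearMap.mul ℝ ℝ)
    (by simp) (by simpa using hi2) (by simpa using hi1)
    (fun x _ => by simpa using (hasFDerivAt_const (𝕜 := ℝ) (1:ℝ) x).hasLineDerivAt e) (fun x _ => hd x)
  simp only [ContinuousLinearMap.mul_apply', one_mul, zero_mul, integral_zero, neg_zero] at key
  rw [ev_MR _ _ hp]
  exact (setIntegral_eq_integral_of_forall_compl_eq_zero fun v hv => hz v (by simpa using hv)).trans key

theorem Iθ_pos (G : SF tp ti) {t : ℝ} (ht : t ∈ Ioo tp ti) (h : ∀ θ, 0 ≤ ev G (t, θ, 0))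
    {θ0 : ℝ} (h0 : 0 < ev G (t, θ0, 0)) : 0 < Iθ G t := by
  rw [Iθ, integral_Icc_eq_integral_Ioc, ← intervalIntegral.integral_of_le zero_le_one]
  exact intervalIntegral.integral_pos zero_lt_one (ev_cont_θ _ ht 0).continuousOn (fun θ _ => h θ)
    ⟨Int.fract θ0, ⟨Int.fract_nonneg _, (Int.fract_lt_one _).le⟩, by rwa [ev_fract]⟩

namespace Fld

variable [hfact : Fact (0 < tp)] (S : Fld tp ti)

theorem dd_rp (D : Derivation ℝ (SF tp ti) (SF tp ti)) : D S.rp = (-1/2:ℝ) • (S.rp ^ 3 * D S.P) :=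
  deriv_of_sq_inv D S.P_rp

end Fld

namespace Sys

variable [hfact : Fact (0 < tp)] (S : Sys tp ti)

theorem base_dq {G : SF tp ti} (h : Base G) : dd e1 G = 0 := h.dd_v (1, 0, 0)

theorem dq_v2 : dd e1 (v2R : SF tp ti) = 0 := by rw [dd_v2R]; simp [e1]
theorem dq_v3 : dd e1 (v3R : SF tp ti) = 0 := by rw [dd_v3R]; simp [e1]
theorem dq_q : dd e1 (qR : SF tp ti) = 1 := by rw [dd_qR]; simp [e1]
theorem dθ_q : dd eθ (qR : SF tp ti) = 0 := by rw [dd_qR]; simp [eθ]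
theorem dq_w : dd e1 S.w = 0 := by
  rw [Fld.w, map_sub, Derivation.leibniz, dq_v3, dq_v2, base_dq S.bA]; simp

theorem dq_m2 : dd e1 S.m2 = 0 := by
  simp only [Fld.m2, map_add, Derivation.leibniz, Derivation.leibniz_pow, dq_v2, S.dq_w, base_dq S.base_E2,
    base_dq S.base_E4, base_dq S.base_E0, base_dq base_tI]
  simp

theorem dq_rp : dd e1 S.rp = -(qR * S.rp ^ 3) := by
  rw [S.dd_rp, Fld.P, map_add, S.dq_m2, Derivation.leibniz_pow, dq_q, ← Nat.cast_smul_eq_nsmul ℝ, add_zero,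
    smul_eq_mul, mul_one, pow_one, mul_smul_comm, smul_smul]
  norm_num [mul_comm]

theorem dq_X (G : SF tp ti) : dd e1 (S.X G) = S.X (dd e1 G) := by
  rw [Fld.X_apply, Fld.X_apply, Derivation.leibniz, base_dq S.base_σ, dd_comm e1 eθ]; simp

theorem dq_b1 : dd e1 S.b1 = (1/2 : ℝ) • (S.X S.m2 * (qR * S.rp ^ 3)) := by
  simp only [Fld.b1, map_add, Derivation.map_smul, Derivation.leibniz, Derivation.leibniz_pow, dq_v2, S.dq_w,
    base_dq S.base_E4, base_dq S.base_E0, base_dq base_tI, base_dq S.base_κ, base_dq S.bJ, S.dq_rp, S.dq_X, S.dq_m2]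
  simp only [map_zero, smul_eq_mul, mul_zero, add_zero, smul_zero]
  have : (algebraMap ℝ (SF tp ti)) (-1/2) = - (algebraMap ℝ (SF tp ti)) (1/2) := by
    rw [← map_neg]; norm_num
  rw [Algebra.smul_def, Algebra.smul_def, this]
  ring

theorem dq_b : dd e1 S.b = (1/2 : ℝ) • S.Lt + (1/2 : ℝ) • (S.X S.m2 * (qR * S.rp ^ 3)) := by
  rw [Fld.b, map_add, S.dq_b1, Derivation.map_smul, Derivation.leibniz, dq_q, base_dq S.base_Lt]; simp

theorem number_identity :
    dd eT (S.a * S.F) + dd eθ (qR * S.rp * S.F) + dd e1 (S.a * S.b * S.F) = 0 := by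
  have h1 : dd eT S.F = - (S.c * dd eθ S.F + S.b * dd e1 S.F) := by
    have := S.eV
    rw [Tr_apply] at this
    linear_combination this
  have h2 : S.a * S.σ = 1 := S.a_σ
  have h3 : S.a * S.X S.m2 = dd eθ S.m2 := S.a_X _
  have h4 : dd eθ S.rp = (-1/2:ℝ) • (S.rp ^ 3 * dd eθ S.m2) := by
    rw [S.dd_rp, Fld.P, map_add, Derivation.leibniz_pow, dθ_q]; simp
  have ha := base_dq S.base_a
  have ha' := S.dd_a eT
  simp only [Derivation.leibniz, h1, ha, ha', h4, dθ_q, S.dq_b, smul_eq_mul, Fld.c, Fld.Lt, ← h3,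
    Algebra.smul_def]
  have : (algebraMap ℝ (SF tp ti)) (-1/2) = - (algebraMap ℝ (SF tp ti)) (1/2) := by
    rw [← map_neg]; norm_num
  rw [this]
  linear_combination (- qR * S.rp * dd eθ S.F) * h2

/-- number of particles -/
def num (t : ℝ) : ℝ := ∫ θ in Icc (0:ℝ) 1, ev S.a (t, θ, 0) * S.mom 1 (t, θ, 0)

theorem num_eq {t R : ℝ} (ht : t ∈ Ioo tp ti) (hR : ∀ θ v, ev S.F (t, θ, v) ≠ 0 → ‖v‖ < R) :
    S.num t = Iθ (MR R (S.a * S.F)) t := by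
  unfold num Iθ
  congr 1; funext θ
  rw [MR_mul_base _ S.base_a, ev_mul, S.mom_eq_MR 1 (mem_strip.2 ht) (fun v hv => (hR θ v hv).le), mul_one]

theorem num_const {s t : ℝ} (hs : s ∈ Ioo tp ti) (ht : t ∈ Ioo tp ti) : S.num s = S.num t := by
  obtain ⟨r, hr1, hr2⟩ := exists_between (lt_min hs.1 ht.1)
  have hr : r ∈ Ioo tp ti := ⟨hr1, (hr2.trans_le (min_le_left _ _)).trans hs.2⟩
  obtain ⟨R, -, hR⟩ := S.exists_supp hr
  have hs' : s ∈ Ioo r ti := ⟨hr2.trans_le (min_le_left _ _), hs.2⟩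
  have ht' : t ∈ Ioo r ti := ⟨hr2.trans_le (min_le_right _ _), ht.2⟩
  rw [S.num_eq hs (R := R) (fun θ v hv => hR s ⟨hs'.1.le, hs'.2⟩ θ v hv),
    S.num_eq ht (R := R) (fun θ v hv => hR t ⟨ht'.1.le, ht'.2⟩ θ v hv)]
  have hsub : ∀ x ∈ Ioo r ti, x ∈ Ioo tp ti := fun x hx => ⟨hr.1.trans hx.1, hx.2⟩
  refine isOpen_Ioo.is_const_of_deriv_eq_zero isPreconnected_Ioo
    (fun x hx => (hasDerivAt_Iθ _ (hsub x hx)).differentiableAt.differentiableWithinAt) (fun x hx => ?_) hs' ht'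
  rw [(hasDerivAt_Iθ _ (hsub x hx)).deriv, dd_eT_MR,
    show dd eT (S.a * S.F) = -(dd eθ (qR * S.rp * S.F)) + - dd e1 (S.a * S.b * S.F) by
      linear_combination S.number_identity, MR_add, ← map_neg, ← map_neg, ← dd_eθ_MR, Iθ_add _ _ (hsub x hx),
    Iθ_dθ _ (hsub x hx), zero_add]
  unfold Iθ
  have : ∀ θ : ℝ, ev (MR R (dd e1 (-(S.a * S.b * S.F)))) (x, θ, 0) = 0 := fun θ =>
    ev_MR_dd_v (1, 0, 0) _ (mem_strip.2 (hsub x hx)) fun v hv => hR x ⟨hx.1.le, hx.2⟩ θ v fun h0 => hv (by simp [h0])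
  simp only [this, integral_zero, Pi.zero_apply]

theorem num_pos {t : ℝ} (ht : t ∈ Ioo tp ti) : 0 < S.num t := by
  obtain ⟨p, hp, hne⟩ := S.F_ne
  have hp' := mem_strip.1 hp
  have hm : ∀ (θ : ℝ) (v : V3), ((p.1, θ, v) : E5) ∈ strip tp ti := fun θ v => mem_strip.2 hp'
  rw [S.num_const ht hp']
  obtain ⟨R, hR0, hR⟩ := S.exists_supp hp'
  have hRR := fun θ v hv => hR p.1 ⟨le_rfl, hp'.2⟩ θ v hv
  rw [S.num_eq hp' hRR]
  have e : ∀ θ, ev (MR R (S.a * S.F)) (p.1, θ, 0) = ev S.a (p.1, θ, 0) * S.mom 1 (p.1, θ, 0) := fun θ => by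
    rw [MR_mul_base _ S.base_a, ev_mul, S.mom_eq_MR 1 (hm _ _) (fun v hv => (hRR θ v hv).le), mul_one]
  have h1 : ∀ θ, 0 ≤ S.mom 1 (p.1, θ, 0) := fun θ => S.mom_nonneg (hm _ _) fun v _ => by
    rw [ev_one (hm _ _)]; exact zero_le_one
  refine Iθ_pos _ hp' (θ0 := p.2.1) (fun θ => ?_) ?_
  · rw [e]; exact mul_nonneg (S.a_pos (hm _ _)).le (h1 θ)
  · rw [e]
    refine mul_pos (S.a_pos (hm _ _)) ?_
    have hInt := S.mom_int 1 (p := (p.1, p.2.1, 0)) (hm _ _)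
    unfold Fld.mom
    have hF : ∀ v, ev S.F (p.1, p.2.1, v) * ev 1 (p.1, p.2.1, v) = ev S.F (p.1, p.2.1, v) := fun v => by
      rw [ev_one (hm _ _), mul_one]
    simp only [hF] at hInt ⊢
    rw [integral_pos_iff_support_of_nonneg (fun v => S.F_nonneg _ (hm _ _)) hInt]
    exact ((ev_cont_v S.F hp' _).isOpen_support).measure_pos _ ⟨p.2.2, hne⟩

end Sys

/-- the midpoint of the time interval -/
def tm (tp ti : ℝ) : ℝ := (tp + ti) / 2

/-- the early half of the space-time-velocity domain -/
def early (tp ti : ℝ) : Set E5 := Ioc tp (tm tp ti) ×ˢ univ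

theorem mem_early {p : E5} : p ∈ early tp ti ↔ p.1 ∈ Ioc tp (tm tp ti) := by simp [early]

theorem early_Ioo {t : ℝ} (ht : t ∈ Ioc tp (tm tp ti)) : t ∈ Ioo tp ti := by
  have h1 := ht.1
  have h2 := ht.2
  unfold tm at h2
  exact ⟨h1, by linarith⟩

theorem early_strip {p : E5} (hp : p ∈ early tp ti) : p ∈ strip tp ti :=
  mem_strip.2 (early_Ioo (mem_early.1 hp))

theorem tm_mem (h : tp < ti) : tm tp ti ∈ Ioc tp (tm tp ti) := ⟨by unfold tm; linarith, le_rfl⟩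

/-- the barrier argument, run backwards from the midpoint -/
theorem barrier_early {ι : Type*} [Finite ι] (G : ι → SF tp ti) (y y' : ι → ℝ → ℝ)
    (hy : ∀ i, ∀ t ∈ Ioc tp (tm tp ti), HasDerivAt (y i) (y' i t) t)
    (hsup : ∀ t0 ∈ Ioc tp (tm tp ti), ∃ R, ∀ s ∈ Icc t0 (tm tp ti), ∀ (i : ι) (θ : ℝ) (v : V3), R < ‖v‖ →
      ∃ w, ‖w‖ ≤ R ∧ ev (G i) (s, θ, v) ≤ ev (G i) (s, θ, w))
    (start : ∀ (i : ι) (θ : ℝ) (v : V3), ev (G i) (tm tp ti, θ, v) < y i (tm tp ti))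
    (step : ∀ s ∈ Ioc tp (tm tp ti), ∀ (i : ι) (θ : ℝ) (v : V3),
      (∀ (j : ι) (θ' : ℝ) (v' : V3), ev (G j) (s, θ', v') ≤ y j s) → ev (G i) (s, θ, v) = y i s →
      (∀ e : ℝ × V3, ev (dd (0, e) (G i)) (s, θ, v) = 0) → y' i s < ev (dd eT (G i)) (s, θ, v)) :
    ∀ t ∈ Ioc tp (tm tp ti), ∀ (i : ι) (θ : ℝ) (v : V3), ev (G i) (t, θ, v) < y i t := by
  intro t ht i θ v
  obtain ⟨R, hR⟩ := hsup t ht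
  have hsub : ∀ s ∈ Icc t (tm tp ti), s ∈ Ioc tp (tm tp ti) := fun s hs => ⟨ht.1.trans_le hs.1, hs.2⟩
  have := barrierR (a := t) (b := tm tp ti) (R := R) 1 G y y'
    (fun s hs => by rw [one_mul]; exact early_Ioo (hsub s hs))
    (fun i s hs => hy i s (hsub s hs))
    (fun s hs i θ v hv => by rw [one_mul]; exact hR s hs i θ v hv)
    (by rw [one_mul]; exact start)
    (fun s hs i θ v h1 h2 h3 => by
      rw [one_mul] at h1 h2 h3 ⊢
      rw [one_mul]
      exact step s (hsub s ⟨hs.1, hs.2.le⟩) i θ v h1 h2 h3) t ⟨le_rfl, ht.2⟩ i θ v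
  rwa [one_mul] at this

theorem integrable_ind (c δ : ℝ) : Integrable (fun x : ℝ => indicator (Icc (-δ) δ) (fun _ => c) x) :=
  (integrable_indicator_iff measurableSet_Icc).2 (integrableOn_const (by simp))

namespace Sys

variable [hfact : Fact (0 < tp)] (S : Sys tp ti)

include S in
theorem lt : tp < ti := by
  obtain ⟨p, hp, -⟩ := S.F_ne
  exact (mem_strip.1 hp).1.trans (mem_strip.1 hp).2

include S in
/-- base functions on the early region are controlled by the values at the midpoint -/
theorem bdd_tm {G : SF tp ti} (hG : Base G) : ∃ C, 0 ≤ C ∧ ∀ θ v, |ev G (tm tp ti, θ, v)| ≤ C := by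
  have h := early_Ioo (tm_mem S.lt)
  obtain ⟨C, h0, hC⟩ := hG.bdd (a := tm tp ti) (b := tm tp ti) (by simpa using h)
  exact ⟨C, h0, hC _ (by simp)⟩

theorem a_le : ∃ C, 0 ≤ C ∧ ∀ p ∈ early tp ti, ev S.a p ≤ C := by
  obtain ⟨C, h0, hC⟩ := S.bdd_tm S.base_a
  refine ⟨C, h0, fun p hp => ?_⟩
  have hp := mem_early.1 hp
  exact (S.a_mono (early_Ioo hp) (early_Ioo (tm_mem S.lt)) hp.2 p.2).trans ((le_abs_self _).trans (hC _ _))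

theorem energy_le : ∃ C, 0 < C ∧ ∀ t ∈ Ioc tp (tm tp ti), Iθ (S.a * S.N) t ≤ C := by
  refine ⟨(tp ^ 3)⁻¹ * |Iθ (tR ^ 3 * S.a * S.N) (tm tp ti)| + 1, by
    have := hfact.out; positivity, fun t ht => ?_⟩
  have h1 := S.energy_mono (early_Ioo ht) (early_Ioo (tm_mem S.lt)) ht.2
  have h2 : Iθ (tp ^ 3 • (S.a * S.N)) t ≤ Iθ (tR ^ 3 * S.a * S.N) t := by
    refine Iθ_mono _ _ (early_Ioo ht) fun θ => ?_
    have hp : ((t, θ, 0) : E5) ∈ strip tp ti := mem_strip.2 (early_Ioo ht)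
    rw [ev_smul, mul_assoc, ev_mul (tR ^ 3), ev_pow _ _ hp, ev_tR hp]
    refine mul_le_mul_of_nonneg_right (pow_le_pow_left₀ hfact.out.le ht.1.le 3) ?_
    rw [ev_mul]
    exact mul_nonneg (S.a_pos hp).le (S.N_nonneg hp)
  rw [Iθ_smul] at h2
  have h3 : 0 < tp ^ 3 := by have := hfact.out; positivity
  have h4 : tp ^ 3 * Iθ (S.a * S.N) t ≤ |Iθ (tR ^ 3 * S.a * S.N) (tm tp ti)| :=
    (h2.trans h1).trans (le_abs_self _)
  have h5 : Iθ (S.a * S.N) t ≤ (tp ^ 3)⁻¹ * |Iθ (tR ^ 3 * S.a * S.N) (tm tp ti)| := by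
    rw [inv_mul_eq_div, le_div_iff₀ h3]; linarith
  linarith

/-- the density is bounded -/
theorem F_le : ∃ C, 0 < C ∧ ∀ p ∈ early tp ti, ev S.F p ≤ C := by
  have htm := early_Ioo (tm_mem S.lt)
  obtain ⟨R, hR0, hR⟩ := S.exists_supp htm
  obtain ⟨C0, hC0, hC⟩ := ev_bdd S.F (a := tm tp ti) (b := tm tp ti) (by simpa using htm) R
  have key := barrier_early (ι := Unit) (fun _ => S.F) (fun _ t => C0 + 1 + (tm tp ti - t)) (fun _ _ => -1)
    (fun _ t _ => by simpa using ((hasDerivAt_id t).const_sub (tm tp ti)).const_add (C0 + 1))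
    (fun t0 ht0 => by
      obtain ⟨R, hR0, hR⟩ := S.exists_supp (early_Ioo ht0)
      refine ⟨R, fun s hs _ θ v hv => ⟨0, by simpa using hR0.le, ?_⟩⟩
      have hs' : s ∈ Ico t0 ti := ⟨hs.1, hs.2.trans_lt htm.2⟩
      have : ev S.F (s, θ, v) = 0 := by
        by_contra h; exact absurd (hR s hs' θ v h) (not_lt.2 hv.le)
      rw [this]
      exact S.F_nonneg _ (mem_strip.2 ⟨ht0.1.trans_le hs.1, hs'.2⟩))
    (fun _ θ v => by
      by_cases h : ‖v‖ ≤ R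
      · have := (le_abs_self _).trans (hC (tm tp ti) (by simp) θ v h)
        simp only [sub_self]; linarith
      · have : ev S.F (tm tp ti, θ, v) = 0 := by
          by_contra h'; exact h (hR _ ⟨le_rfl, htm.2⟩ θ v h').le
        rw [this]; simp only [sub_self]; linarith)
    (fun s hs _ θ v _ _ h3 => by
      have h4 := congrArg (fun G => ev G (s, θ, v)) S.eV
      simp only [Tr_apply, ev_add, ev_mul, ev_zero] at h4
      have h5 : ev (dd eθ S.F) (s, θ, v) = 0 := h3 _
      have h6 : ev (dd e1 S.F) (s, θ, v) = 0 := h3 _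
      rw [h5, h6] at h4
      linarith)
  refine ⟨C0 + 1 + (tm tp ti - tp), by have := htm.1; linarith, fun p hp => ?_⟩
  have hp := mem_early.1 hp
  have := key p.1 hp () p.2.1 p.2.2
  have h1 := hp.1
  linarith

theorem mom_one_le : ∃ C, 0 < C ∧ ∀ δ, 0 < δ → ∀ p ∈ early tp ti, S.mom 1 p ≤ C * δ + δ⁻¹ * S.mom S.p0 p := by
  obtain ⟨Fm, hFm, hF⟩ := S.F_le
  obtain ⟨R, hR0, hR⟩ := S.exists_supp23
  refine ⟨8 * (R + 1) ^ 2 * Fm, by positivity, fun δ hδ p hp => ?_⟩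
  have hps := early_strip hp
  have hi1 := S.mom_int 1 hps
  have hi0 := S.mom_int S.p0 hps
  have hpv : ∀ v : V3, ((p.1, p.2.1, v) : E5) ∈ early tp ti := fun v => mem_early.2 (mem_early.1 hp)
  simp only [fun v => ev_one (early_strip (hpv v)), mul_one] at hi1
  set G : V3 → ℝ := fun v => indicator {v : V3 | |v.1| ≤ δ} (fun v => ev S.F (p.1, p.2.1, v)) v with hG
  have hms : MeasurableSet {v : V3 | |v.1| ≤ δ} := (isClosed_le (by fun_prop) continuous_const).measurableSet
  have hGi : Integrable G := hi1.indicator hms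
  have hG0 : ∀ v, 0 ≤ G v := fun v => indicator_nonneg (fun v _ => S.F_nonneg _ (early_strip (hpv v))) v
  have h1 : ∫ v, G v ≤ 4 * (R + 1) ^ 2 * ∫ x : ℝ, indicator (Icc (-δ) δ) (fun _ => Fm) x := by
    refine integral_le_of_slab (by positivity) (integrable_ind Fm δ) (fun v => ?_) (fun v hv => ?_) hG0
    · by_cases h : |v.1| ≤ δ
      · rw [hG]
        simp only
        rw [indicator_of_mem (show v ∈ {v : V3 | |v.1| ≤ δ} from h), indicator_of_mem (show v.1 ∈ Icc (-δ) δ from abs_le.1 h)]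
        exact hF _ (hpv v)
      · rw [hG]
        simp only
        rw [indicator_of_notMem (show v ∉ {v : V3 | |v.1| ≤ δ} from h), indicator_of_notMem (show v.1 ∉ Icc (-δ) δ from fun h' => h (abs_le.2 h'))]
    · have : ev S.F (p.1, p.2.1, v) = 0 := by
        by_contra h
        have h2 := hR _ (early_strip (hpv v)) h
        simp only at h2
        rcases hv with hv | hv
        · have := sq_abs v.2.1; nlinarith [sq_nonneg v.2.2]
        · have := sq_abs v.2.2; nlinarith [sq_nonneg v.2.1]
      rw [hG]
      simp only [indicator_apply, this, ite_self, le_refl]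
  rw [integral_indicator_const _ measurableSet_Icc] at h1
  have hvol : (volume : Measure ℝ).real (Icc (-δ) δ) = 2 * δ := by
    rw [Real.volume_real_Icc_of_le (by linarith)]; ring
  rw [hvol, smul_eq_mul] at h1
  have h2 : S.mom 1 p ≤ ∫ v, (G v + δ⁻¹ * (ev S.F (p.1, p.2.1, v) * ev S.p0 (p.1, p.2.1, v))) := by
    unfold Fld.mom
    refine integral_mono (S.mom_int 1 hps) (hGi.add (hi0.const_mul _)) fun v => ?_
    have hF0 := S.F_nonneg _ (early_strip (hpv v))
    have hp0 := S.p0_pos (early_strip (hpv v))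
    simp only [ev_one (early_strip (hpv v)), mul_one]
    by_cases h : |v.1| ≤ δ
    · have : G v = ev S.F (p.1, p.2.1, v) := indicator_of_mem (show v ∈ {v : V3 | |v.1| ≤ δ} from h) _
      rw [this]
      have : 0 ≤ δ⁻¹ * (ev S.F (p.1, p.2.1, v) * ev S.p0 (p.1, p.2.1, v)) := by positivity
      linarith
    · have h3 := S.abs_q_le (early_strip (hpv v))
      have h4 : δ ≤ ev S.p0 (p.1, p.2.1, v) := (not_le.1 h).le.trans h3
      have h5 : 1 ≤ δ⁻¹ * ev S.p0 (p.1, p.2.1, v) := by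
        rw [inv_mul_eq_div, one_le_div hδ]; exact h4
      have := hG0 v
      nlinarith
  rw [integral_add hGi (hi0.const_mul _), integral_const_mul] at h2
  have h3 : ∫ v, ev S.F (p.1, p.2.1, v) * ev S.p0 (p.1, p.2.1, v) = S.mom S.p0 p := rfl
  rw [h3] at h2
  nlinarith

theorem mom_p0_le_N {p : E5} (hp : p ∈ strip tp ti) : S.mom S.p0 p ≤ ev S.N p := by
  have h := S.N_ge hp
  have := t_pos hp
  have := S.h_pos hp
  have : 0 ≤ p.1 * (ev S.Ut p ^ 2 + ev S.XU p ^ 2 + ev S.h p * (ev S.At p ^ 2 + ev S.XA p ^ 2)) := by positivity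
  linarith

/-- lower bound for the total length -/
theorem length_ge : ∃ c, 0 < c ∧ ∀ t ∈ Ioc tp (tm tp ti), c ≤ Iθ S.a t := by
  obtain ⟨C, hC0, hC⟩ := S.mom_one_le
  obtain ⟨C1, hC10, hC1⟩ := S.energy_le
  have htm := early_Ioo (tm_mem S.lt)
  have hc := S.num_pos htm
  set c0 := S.num (tm tp ti)
  set δ := 2 * C1 / c0 with hδ
  have hδ0 : 0 < δ := by positivity
  refine ⟨c0 / 2 / (C * δ), by positivity, fun t ht => ?_⟩
  obtain ⟨R, hR0, hR⟩ := S.exists_supp (early_Ioo ht)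
  have hRR := fun θ v hv => hR t ⟨le_rfl, (early_Ioo ht).2⟩ θ v hv
  have hps : ∀ (θ : ℝ) (v : V3), ((t, θ, v) : E5) ∈ early tp ti := fun θ v => mem_early.2 ht
  have h1 : c0 = Iθ (MR R (S.a * S.F)) t := by rw [← S.num_eq (early_Ioo ht) hRR]; exact S.num_const htm (early_Ioo ht)
  have h2 : Iθ (MR R (S.a * S.F)) t ≤ Iθ ((C * δ) • S.a + δ⁻¹ • (S.a * S.N)) t := by
    refine Iθ_mono _ _ (early_Ioo ht) fun θ => ?_
    have e : ev (MR R (S.a * S.F)) (t, θ, 0) = ev S.a (t, θ, 0) * S.mom 1 (t, θ, 0) := by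
      rw [MR_mul_base _ S.base_a, ev_mul, S.mom_eq_MR 1 (early_strip (hps _ _)) (fun v hv => (hRR θ v hv).le), mul_one]
    rw [e, ev_add, ev_smul, ev_smul, ev_mul]
    have h3 := hC δ hδ0 _ (hps θ 0)
    have h4 := S.mom_p0_le_N (early_strip (hps θ 0))
    have ha := S.a_pos (early_strip (hps θ 0))
    have hi : 0 < δ⁻¹ := by positivity
    have h5 : S.mom 1 (t, θ, 0) ≤ C * δ + δ⁻¹ * ev S.N (t, θ, 0) := by nlinarith
    calc _ ≤ ev S.a (t, θ, 0) * (C * δ + δ⁻¹ * ev S.N (t, θ, 0)) := mul_le_mul_of_nonneg_left h5 ha.le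
      _ = _ := by ring
  rw [Iθ_add _ _ (early_Ioo ht), Iθ_smul, Iθ_smul, ← h1] at h2
  have h3 := hC1 t ht
  have h4 : δ⁻¹ * Iθ (S.a * S.N) t ≤ c0 / 2 := by
    have : δ⁻¹ * C1 = c0 / 2 := by rw [hδ]; field_simp
    rw [← this]
    exact mul_le_mul_of_nonneg_left h3 (by positivity)
  rw [div_le_iff₀ (by positivity)]
  linarith

/-- functions whose derivatives are controlled by the energy density are bounded -/
theorem avg_bound {φ : SF tp ti} (hφ : Base φ) {C : ℝ} (hC : 0 ≤ C)
    (hT : ∀ p ∈ early tp ti, |ev (dd eT φ) p| ≤ C * (1 + ev S.N p))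
    (hX : ∀ p ∈ early tp ti, |ev (S.X φ) p| ≤ C * (1 + ev S.N p)) : Bd (early tp ti) φ := by
  obtain ⟨Ca, hCa0, hCa⟩ := S.a_le
  obtain ⟨C1, hC10, hC1⟩ := S.energy_le
  obtain ⟨c, hc0, hc⟩ := S.length_ge
  obtain ⟨M, hM0, hM⟩ := S.bdd_tm hφ
  have htm := tm_mem S.lt
  set g : SF tp ti := C • (S.a + S.a * S.N) with hg
  have hmem : ∀ {t : ℝ} (ht : t ∈ Ioc tp (tm tp ti)) (θ : ℝ) (v : V3), ((t, θ, v) : E5) ∈ early tp ti :=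
    fun ht θ v => mem_early.2 ht
  have evg : ∀ p, ev g p = ev S.a p * (C * (1 + ev S.N p)) := fun p => by
    rw [hg, ev_smul, ev_add, ev_mul]; ring
  have hIa : ∀ t ∈ Ioc tp (tm tp ti), Iθ S.a t ≤ Ca := fun t ht => by
    have : Iθ S.a t ≤ Iθ (algebraMap ℝ (SF tp ti) Ca) t := Iθ_mono _ _ (early_Ioo ht) fun θ => by
      rw [ev_algebraMap _ (early_strip (hmem ht θ 0))]
      exact hCa _ (hmem ht θ 0)
    refine this.trans ?_
    unfold Iθ
    simp only [fun θ => ev_algebraMap Ca (early_strip (hmem ht θ 0))]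
    simp
  have hD : ∀ t ∈ Ioc tp (tm tp ti), Iθ g t ≤ C * (Ca + C1) := fun t ht => by
    rw [hg, Iθ_smul, Iθ_add _ _ (early_Ioo ht)]
    exact mul_le_mul_of_nonneg_left (add_le_add (hIa t ht) (hC1 t ht)) hC
  set D := C * (Ca + C1) with hDdef
  have hD0 : 0 ≤ D := by positivity
  have hE : ∀ s ∈ Ioc tp (tm tp ti), |Iθ (S.a * φ) s| ≤ M * Ca + D * (ti - tp) := by
    intro s hs
    set ψ : SF tp ti := frz s (early_Ioo hs) S.a * φ with hψ
    have hder : ∀ t ∈ Icc s (tm tp ti), HasDerivWithinAt (Iθ ψ) (Iθ (dd eT ψ) t) (Icc s (tm tp ti)) t :=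
      fun t ht => (hasDerivAt_Iθ ψ (early_Ioo ⟨hs.1.trans_le ht.1, ht.2⟩)).hasDerivWithinAt
    have hbd : ∀ t ∈ Icc s (tm tp ti), ‖Iθ (dd eT ψ) t‖ ≤ D := by
      intro t ht
      have ht' : t ∈ Ioc tp (tm tp ti) := ⟨hs.1.trans_le ht.1, ht.2⟩
      have hb : ∀ θ, |ev (dd eT ψ) (t, θ, 0)| ≤ ev g (t, θ, 0) := fun θ => by
        have hp := hmem ht' θ 0
        rw [hψ, Derivation.leibniz, dT_frz]
        simp only [smul_eq_mul, mul_zero, add_zero]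
        rw [ev_mul, ev_frz _ _ (early_strip hp), evg, abs_mul]
        have h1 := S.a_mono (early_Ioo hs) (early_Ioo ht') ht.1 (θ, 0)
        have h2 := S.a_pos (early_strip (hmem hs θ 0))
        have h3 := hT _ hp
        simp only at h1 h2 ⊢
        rw [abs_of_pos h2]
        exact mul_le_mul h1 h3 (abs_nonneg _) (h2.le.trans h1)
      rw [Real.norm_eq_abs, abs_le]
      have h1 := Iθ_mono _ _ (early_Ioo ht') fun θ => (abs_le.1 (hb θ)).2
      have h2 : Iθ (-g) t ≤ Iθ (dd eT ψ) t := Iθ_mono _ _ (early_Ioo ht') fun θ => by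
        rw [ev_neg]; exact (abs_le.1 (hb θ)).1
      rw [Iθ_neg] at h2
      have := hD t ht'
      exact ⟨by linarith, by linarith⟩
    have hmv := (convex_Icc s (tm tp ti)).norm_image_sub_le_of_norm_hasDerivWithin_le hder hbd
      (⟨hs.2, le_rfl⟩ : tm tp ti ∈ Icc s (tm tp ti)) (⟨le_rfl, hs.2⟩ : s ∈ Icc s (tm tp ti))
    have h0 : Iθ ψ s = Iθ (S.a * φ) s := by
      unfold Iθ
      congr 1; funext θ
      rw [hψ, ev_mul, ev_mul, ev_frz _ _ (early_strip (hmem hs θ 0))]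
    have h1 : |Iθ ψ (tm tp ti)| ≤ M * Ca := by
      have hb : ∀ θ, |ev ψ (tm tp ti, θ, 0)| ≤ M * Ca := fun θ => by
        rw [hψ, ev_mul, ev_frz _ _ (early_strip (hmem htm θ 0)), abs_mul, mul_comm M]
        simp only
        rw [abs_of_pos (S.a_pos (early_strip (hmem hs θ 0)))]
        exact mul_le_mul (hCa _ (hmem hs θ 0)) (hM θ 0) (abs_nonneg _) hCa0
      have hcst : ∀ r : ℝ, Iθ (algebraMap ℝ (SF tp ti) r) (tm tp ti) = r := fun r => by
        unfold Iθ
        simp only [fun θ => ev_algebraMap r (early_strip (hmem htm θ 0))]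
        simp
      rw [abs_le]
      constructor
      · rw [← hcst (-(M * Ca))]
        refine Iθ_mono _ _ (early_Ioo htm) fun θ => ?_
        rw [ev_algebraMap _ (early_strip (hmem htm θ 0))]
        exact (abs_le.1 (hb θ)).1
      · rw [← hcst (M * Ca)]
        refine Iθ_mono _ _ (early_Ioo htm) fun θ => ?_
        rw [ev_algebraMap _ (early_strip (hmem htm θ 0))]
        exact (abs_le.1 (hb θ)).2
    rw [← h0]
    rw [Real.norm_eq_abs, Real.norm_eq_abs, abs_of_nonpos (by linarith [hs.2] : s - tm tp ti ≤ 0)] at hmv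
    have h2 : D * -(s - tm tp ti) ≤ D * (ti - tp) :=
      mul_le_mul_of_nonneg_left (by have := (early_Ioo htm).2; linarith [hs.1]) hD0
    have h3 : |Iθ ψ s| ≤ |Iθ ψ s - Iθ ψ (tm tp ti)| + |Iθ ψ (tm tp ti)| := by
      simpa using abs_add_le (Iθ ψ s - Iθ ψ (tm tp ti)) (Iθ ψ (tm tp ti))
    linarith
  set Et := M * Ca + D * (ti - tp)
  have hlt := S.lt
  have hEt0 : 0 ≤ Et := by
    have : 0 ≤ D * (ti - tp) := mul_nonneg hD0 (by linarith)
    positivity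
  refine ⟨(Et + D * Ca) / c, by positivity, fun p hp => ?_⟩
  have ht := mem_early.1 hp
  set t := p.1
  have hosc : ∀ x, |ev φ p - ev φ (t, x, 0)| ≤ D := fun x => by
    have h1 := osc_le φ g (early_Ioo ht) (fun θ => by
      have hp' := hmem ht θ 0
      rw [← S.a_X, ev_mul, abs_mul, evg, abs_of_pos (S.a_pos (early_strip hp'))]
      exact mul_le_mul_of_nonneg_left (hX _ hp') (S.a_pos (early_strip hp')).le) p.2.1 x
    have h2 : ev φ p = ev φ (t, p.2.1, 0) := hφ t p.2.1 p.2.2 0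
    rw [h2]
    exact h1.trans (hD t ht)
  have hu : ev φ p * Iθ S.a t ≤ Iθ (S.a * φ) t + D * Iθ S.a t := by
    rw [← Iθ_smul, ← Iθ_smul, ← Iθ_add _ _ (early_Ioo ht)]
    refine Iθ_mono _ _ (early_Ioo ht) fun θ => ?_
    rw [ev_smul, ev_add, ev_mul, ev_smul]
    have := S.a_pos (early_strip (hmem ht θ 0))
    nlinarith [(abs_le.1 (hosc θ)).2]
  have hl : Iθ (S.a * φ) t ≤ ev φ p * Iθ S.a t + D * Iθ S.a t := by
    rw [← Iθ_smul, ← Iθ_smul, ← Iθ_add _ _ (early_Ioo ht)]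
    refine Iθ_mono _ _ (early_Ioo ht) fun θ => ?_
    rw [ev_mul, ev_add, ev_smul, ev_smul]
    have := S.a_pos (early_strip (hmem ht θ 0))
    nlinarith [(abs_le.1 (hosc θ)).1]
  have h1 := abs_le.1 (hE t ht)
  have h2 := hIa t ht
  have h3 := hc t ht
  have h4 : D * Iθ S.a t ≤ D * Ca := mul_le_mul_of_nonneg_left h2 hD0
  rw [le_div_iff₀ hc0]
  have h5 : |ev φ p| * Iθ S.a t ≤ Et + D * Ca := by
    rw [← abs_of_pos (hc0.trans_le h3), ← abs_mul, abs_le]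
    constructor <;> linarith
  exact (mul_le_mul_of_nonneg_left h3 (abs_nonneg _)).trans h5

theorem bd_U : Bd (early tp ti) S.U := by
  have h0 := hfact.out
  have key : ∀ p ∈ early tp ti, ∀ x : ℝ, x ^ 2 * p.1 ≤ ev S.N p → |x| ≤ (1 + tp⁻¹) * (1 + ev S.N p) := by
    intro p hp x hx
    have ht := (mem_early.1 hp).1
    have hN := S.N_nonneg (early_strip hp)
    have h1 : x ^ 2 ≤ tp⁻¹ * ev S.N p := by
      rw [inv_mul_eq_div, le_div_iff₀ h0]
      nlinarith [sq_nonneg x]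
    have h2 : |x| ≤ 1 + x ^ 2 := by nlinarith [sq_abs x, sq_nonneg (|x| - 1)]
    have : 0 < tp⁻¹ := by positivity
    nlinarith
  have hb : ∀ p ∈ early tp ti, p.1 * (ev S.Ut p ^ 2 + ev S.XU p ^ 2) ≤ ev S.N p := fun p hp => by
    have hps := early_strip hp
    have h1 := S.N_ge hps
    have := S.mom_p0_nonneg hps
    have := t_pos hps
    have := S.h_pos hps
    have : 0 ≤ p.1 * (ev S.h p * (ev S.At p ^ 2 + ev S.XA p ^ 2)) := by positivity
    linarith
  refine S.avg_bound S.bU (C := 1 + tp⁻¹) (by positivity) (fun p hp => key p hp _ ?_) (fun p hp => key p hp _ ?_)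
  · have := hb p hp
    have := t_pos (early_strip hp)
    change ev S.Ut p ^ 2 * p.1 ≤ _
    nlinarith [sq_nonneg (ev S.XU p)]
  · have := hb p hp
    have := t_pos (early_strip hp)
    change ev S.XU p ^ 2 * p.1 ≤ _
    nlinarith [sq_nonneg (ev S.Ut p)]

theorem bd_β : Bd (early tp ti) S.β := by
  refine S.avg_bound S.bβ (C := 3) (by norm_num) (fun p hp => ?_) (fun p hp => ?_)
  · have := S.abs_βt_le (early_strip hp); linarith
  · have := S.abs_Xβ_le (early_strip hp); have := S.N_nonneg (early_strip hp); linarith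

/-- `1/p⁰` is bounded -/
theorem rp_le_const : ∃ C, 0 ≤ C ∧ ∀ p ∈ early tp ti, ev S.rp p ≤ C := by
  obtain ⟨C, h0, hC⟩ := (S.bd_U.sub S.bd_β).expR
  exact ⟨C, h0, fun p hp => (S.rp_le (early_strip hp)).trans ((le_abs_self _).trans (hC p hp))⟩

theorem mom_one_le_N : ∃ C, 0 ≤ C ∧ ∀ p ∈ early tp ti, S.mom 1 p ≤ C * ev S.N p := by
  obtain ⟨C, h0, hC⟩ := S.rp_le_const
  refine ⟨C, h0, fun p hp => ?_⟩
  have hps := early_strip hp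
  have h1 : S.mom 1 p ≤ S.mom (C • S.p0) p := S.mom_mono hps fun v _ => by
    have hpv : ((p.1, p.2.1, v) : E5) ∈ early tp ti := mem_early.2 (mem_early.1 hp)
    rw [ev_one (early_strip hpv), ev_smul, ← S.rp_mul_p0 (early_strip hpv)]
    exact mul_le_mul_of_nonneg_right (hC _ hpv) (S.p0_pos (early_strip hpv)).le
  rw [S.mom_smul] at h1
  exact h1.trans (mul_le_mul_of_nonneg_left (S.mom_p0_le_N hps) h0)

theorem q_rp_le {p : E5} (hp : p ∈ strip tp ti) : |p.2.2.1| * ev S.rp p ≤ 1 := by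
  rw [← S.rp_mul_p0 hp, mul_comm]
  exact mul_le_mul_of_nonneg_left (S.abs_q_le hp) (S.rp_pos hp).le

theorem v23_le : ∃ R, 0 ≤ R ∧ ∀ p ∈ strip tp ti, ev S.F p ≠ 0 → |p.2.2.2.1| ≤ R ∧ |p.2.2.2.2| ≤ R := by
  obtain ⟨R, h0, hR⟩ := S.exists_supp23
  refine ⟨R + 1, by positivity, fun p hp h => ?_⟩
  have := hR p hp h
  constructor
  · refine abs_le_of_sq_le_sq (by nlinarith [sq_nonneg p.2.2.2.2]) (by positivity)
  · refine abs_le_of_sq_le_sq (by nlinarith [sq_nonneg p.2.2.2.1]) (by positivity)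

theorem bd_JK : Bd (early tp ti) S.J ∧ Bd (early tp ti) S.K := by
  obtain ⟨R, hR0, hR⟩ := S.v23_le
  obtain ⟨C, hC0, hC⟩ := S.mom_one_le_N
  have key : ∀ φ : SF tp ti, (∀ p ∈ strip tp ti, ev S.F p ≠ 0 → |ev φ p| ≤ R) → ∀ p ∈ early tp ti,
      |S.mom φ p| ≤ R * (C * ev S.N p) := fun φ hφ p hp => by
    have hps := early_strip hp
    have h1 : |S.mom φ p| ≤ S.mom (R • (1 : SF tp ti)) p := S.abs_mom_le hps fun v hv => by
      rw [ev_smul, ev_one (mem' hps v), mul_one]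
      exact hφ _ (mem' hps v) hv
    rw [S.mom_smul] at h1
    exact h1.trans (mul_le_mul_of_nonneg_left (hC p hp) hR0)
  have hq : ∀ {φ : SF tp ti} {x : ℝ} {p : E5}, p ∈ strip tp ti → ev φ p = x → |x| ≤ R →
      |ev (qR * φ * S.rp) p| ≤ R := fun {φ x p} hp hx hxR => by
    rw [ev_mul, ev_mul, ev_qR hp, hx, abs_mul, abs_mul, abs_of_pos (S.rp_pos hp)]
    calc |p.2.2.1| * |x| * ev S.rp p = (|p.2.2.1| * ev S.rp p) * |x| := by ring
      _ ≤ 1 * |x| := mul_le_mul_of_nonneg_right (S.q_rp_le hp) (abs_nonneg _)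
      _ ≤ R := by linarith
  have fin : ∀ φ : SF tp ti, (∀ p ∈ strip tp ti, ev S.F p ≠ 0 → |ev φ p| ≤ R) → ∀ p ∈ early tp ti, ∀ x : ℝ,
      |x| = 2 * |S.mom φ p| → |x| ≤ (2 * R * C) * (1 + ev S.N p) := fun φ hφ p hp x hx => by
    rw [hx]
    have := key φ hφ p hp
    have : 0 ≤ 2 * R * C := by positivity
    nlinarith
  constructor
  · refine S.avg_bound S.bJ (C := 2 * R * C) (by positivity)
      (fun p hp => fin (qR * v2R * S.rp) (fun p hp h => hq hp (ev_v2R hp) (hR p hp h).1) p hp _ ?_)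
      (fun p hp => fin v2R (fun p hp h => by rw [ev_v2R hp]; exact (hR p hp h).1) p hp _ ?_)
    · rw [S.eJt p (early_strip hp), abs_mul]; norm_num
    · rw [S.eXJ p (early_strip hp), abs_mul]; norm_num
  · refine S.avg_bound S.bK (C := 2 * R * C) (by positivity)
      (fun p hp => fin (qR * v3R * S.rp) (fun p hp h => hq hp (ev_v3R hp) (hR p hp h).2) p hp _ ?_)
      (fun p hp => fin v3R (fun p hp h => by rw [ev_v3R hp]; exact (hR p hp h).2) p hp _ ?_)
    · rw [S.eKt p (early_strip hp), abs_mul]; norm_num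
    · rw [S.eXK p (early_strip hp), abs_mul]; norm_num

theorem h_ge : ∃ c, 0 < c ∧ ∀ p ∈ early tp ti, c ≤ p.1 * ev S.h p := by
  obtain ⟨C, h0, hC⟩ := S.bd_U
  have htp := hfact.out
  have hti : 0 < ti := htp.trans S.lt
  refine ⟨Real.exp (-4 * C) / (4 * ti), by positivity, fun p hp => ?_⟩
  have hps := early_strip hp
  have ht := mem_strip.1 hps
  have ht0 := t_pos hps
  rw [Fld.h, ev_smul, ev_mul, ev_expR _ hps, ev_pow _ _ hps, ev_tI hps, ev_smul]
  have h1 : Real.exp (-4 * C) ≤ Real.exp (4 * ev S.U p) := by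
    have := (abs_le.1 (hC p hp)).1
    exact Real.exp_le_exp.2 (by linarith)
  have h2 : p.1 * (1/4 * (Real.exp (4 * ev S.U p) * p.1⁻¹ ^ 2)) = Real.exp (4 * ev S.U p) / (4 * p.1) := by
    field_simp
  rw [h2]
  exact div_le_div₀ (Real.exp_pos _).le h1 (by positivity) (by linarith [ht.2])

theorem bd_A : Bd (early tp ti) S.A := by
  obtain ⟨c, h0, hc⟩ := S.h_ge
  have key : ∀ p ∈ early tp ti, ∀ x : ℝ, c * x ^ 2 ≤ ev S.N p → |x| ≤ (1 + c⁻¹) * (1 + ev S.N p) := by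
    intro p hp x hx
    have hN := S.N_nonneg (early_strip hp)
    have h1 : x ^ 2 ≤ c⁻¹ * ev S.N p := by
      rw [inv_mul_eq_div, le_div_iff₀ h0]
      linarith
    have h2 : |x| ≤ 1 + x ^ 2 := by nlinarith [sq_abs x, sq_nonneg (|x| - 1)]
    have : 0 < c⁻¹ := by positivity
    nlinarith
  have hb : ∀ p ∈ early tp ti, c * (ev S.At p ^ 2 + ev S.XA p ^ 2) ≤ ev S.N p := fun p hp => by
    have hps := early_strip hp
    have h1 := S.N_ge hps
    have := S.mom_p0_nonneg hps
    have := t_pos hps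
    have := S.h_pos hps
    have : 0 ≤ p.1 * (ev S.Ut p ^ 2 + ev S.XU p ^ 2) := by positivity
    have := mul_le_mul_of_nonneg_right (hc p hp) (by positivity : 0 ≤ ev S.At p ^ 2 + ev S.XA p ^ 2)
    linarith
  refine S.avg_bound S.bA (C := 1 + c⁻¹) (by positivity) (fun p hp => key p hp _ ?_) (fun p hp => key p hp _ ?_)
  · have := hb p hp
    change c * ev S.At p ^ 2 ≤ _
    nlinarith [sq_nonneg (ev S.XA p)]
  · have := hb p hp
    change c * ev S.XA p ^ 2 ≤ _
    nlinarith [sq_nonneg (ev S.At p)]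

end Sys

theorem integral_inv_sqrt_le {Y : ℝ} (h1 : 1 ≤ Y) (hY : 1 ≤ Real.log Y) :
    Integrable (indicator (Icc (-Y) Y) fun x : ℝ => (√(1 + x ^ 2))⁻¹) ∧
      ∫ x, indicator (Icc (-Y) Y) (fun x : ℝ => (√(1 + x ^ 2))⁻¹) x ≤ 6 * Real.log Y := by
  have hc : Continuous fun x : ℝ => (√(1 + x ^ 2))⁻¹ :=
    (by fun_prop : Continuous fun x : ℝ => √(1 + x ^ 2)).inv₀ fun x => (Real.sqrt_pos.2 (by positivity)).ne'
  refine ⟨(integrable_indicator_iff measurableSet_Icc).2 hc.integrableOn_Icc, ?_⟩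
  rw [integral_indicator measurableSet_Icc, integral_Icc_eq_integral_Ioc,
    ← intervalIntegral.integral_of_le (by linarith),
    intervalIntegral.integral_eq_sub_of_hasDerivAt (fun x _ => Real.hasDerivAt_arsinh x) (hc.intervalIntegrable _ _),
    Real.arsinh_neg, Real.arsinh]
  have h2 : √(1 + Y ^ 2) ≤ 2 * Y := Real.sqrt_le_iff.2 ⟨by linarith, by nlinarith⟩
  have h3 : Real.log (Y + √(1 + Y ^ 2)) ≤ Real.log (3 * Y) :=
    Real.log_le_log (by positivity) (by linarith)
  rw [Real.log_mul (by norm_num) (by linarith)] at h3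
  have h4 := Real.log_le_sub_one_of_pos (show (0:ℝ) < 3 by norm_num)
  linarith

namespace Fld

variable [hfact : Fact (0 < tp)] (S : Fld tp ti)

/-- null derivatives of the wave unknowns -/
def Uε (ε : ℝ) : SF tp ti := S.Ut + ε • S.XU
def Aε (ε : ℝ) : SF tp ti := S.At + ε • S.XA
def g (ε : ℝ) : SF tp ti := S.Uε ε ^ 2 + S.h * S.Aε ε ^ 2

theorem D_h (D : Derivation ℝ (SF tp ti) (SF tp ti)) (hD : D (expR ((4:ℝ) • S.U)) = expR ((4:ℝ) • S.U) * D ((4:ℝ) • S.U)) :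
    D S.h = S.h * ((4 : ℝ) • D S.U) + (1/2 : ℝ) • (expR ((4 : ℝ) • S.U) * tI * D tI) := by
  rw [h, Derivation.map_smul, Derivation.leibniz, sq, Derivation.leibniz, hD, Derivation.map_smul]
  have h2 : (algebraMap ℝ (SF tp ti)) (1/2) = 2 * (algebraMap ℝ (SF tp ti)) (1/4) := by
    rw [show (2 : SF tp ti) = algebraMap ℝ (SF tp ti) 2 from (map_ofNat _ 2).symm, ← map_mul]; norm_num
  simp only [smul_eq_mul, Algebra.smul_def, map_ofNat, h2]
  ring

theorem dT_h : dd eT S.h = S.h * ((4 : ℝ) • S.Ut - (2 : ℝ) • tI) := by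
  have h2 : (algebraMap ℝ (SF tp ti)) (1/2) = 2 * (algebraMap ℝ (SF tp ti)) (1/4) := by
    rw [show (2 : SF tp ti) = algebraMap ℝ (SF tp ti) 2 from (map_ofNat _ 2).symm, ← map_mul]; norm_num
  have e : (eT : E5).1 = 1 := rfl
  rw [S.D_h _ (dd_expR _ _), dd_tI, Ut, h, e]
  simp only [Algebra.smul_def, map_ofNat, map_one, h2]
  ring

theorem X_h : S.X S.h = S.h * ((4 : ℝ) • S.XU) := by
  have e : (eθ : E5).1 = 0 := rfl
  have ht : S.X (tI : SF tp ti) = 0 := by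
    rw [X_apply, dd_tI, e]; simp
  rw [S.D_h _ (by rw [X_apply, dd_expR, X_apply]; ring), ht, XU]
  simp

theorem Tr_P : Tr S.c S.b S.P = dd eT S.m2 + S.b * dd e1 S.m2 + S.Lt * qR ^ 2
    + (2 : ℝ) • (qR * (tI ^ 3 * S.E0 * S.κ * S.w + tI * S.E4 * S.J * v2R)) := by
  have h1 : dd e1 (qR : SF tp ti) = 1 := by rw [dd_qR]; simp [e1]
  have h2 : dd eT (qR : SF tp ti) = 0 := by rw [dd_qR]; simp [eT]
  have h3 : dd eθ (qR : SF tp ti) = 0 := by rw [dd_qR]; simp [eθ]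
  rw [Tr_apply, P, map_add, map_add, map_add, sq qR]
  simp only [Derivation.leibniz, h1, h2, h3, smul_eq_mul]
  rw [b, b1, X_apply, c]
  have : (algebraMap ℝ (SF tp ti)) (-1/2) = - (algebraMap ℝ (SF tp ti)) (1/2) := by
    rw [← map_neg]; norm_num
  have h2 : (algebraMap ℝ (SF tp ti)) (1/2) * 2 = 1 := by
    rw [show (2 : SF tp ti) = algebraMap ℝ (SF tp ti) 2 from (map_ofNat _ 2).symm, ← map_mul]; norm_num
  simp only [Algebra.smul_def, this, map_ofNat]
  linear_combination (S.Lt * qR ^ 2 - qR * S.σ * dd eθ S.m2 * S.rp) * h2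

end Fld

namespace Sys

variable [hfact : Fact (0 < tp)] (S : Sys tp ti)

/-- matter and twist source in the equation for `U` -/
def SU (p : E5) : ℝ := 1/2 * ev (tI ^ 2 * S.E4 * S.J ^ 2) p + (1/2) * ev (tI * S.E2) p
        * S.mom ((1 + (2 : ℝ) • (expR ((-2 : ℝ) • S.U) * v2R ^ 2)) * S.rp) p
/-- matter and twist source in the equation for `A` -/
def SA (p : E5) : ℝ := ev (tI ^ 2 * S.E4 * S.J * S.κ) p
      + 2 * ev (tI * S.E4) p * S.mom (v2R * S.w * S.rp) p

theorem base_Ut : Base S.Ut := S.bU.dd_T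
theorem base_At : Base S.At := S.bA.dd_T
theorem base_XU : Base S.XU := S.base_X S.bU
theorem base_XA : Base S.XA := S.base_X S.bA
theorem base_g (ε : ℝ) : Base (S.g ε) :=
  ((S.base_Ut.add (S.base_XU.smul _)).pow 2).add (S.base_h.mul ((S.base_At.add (S.base_XA.smul _)).pow 2))

theorem dT_Uε {ε : ℝ} (hε : ε * ε = 1) {p : E5} (hp : p ∈ strip tp ti) :
    ev (dd eT (S.Uε ε)) p - ε * ev (S.X (S.Uε ε)) p = 1/2 * (ev S.Lt p * ev (S.Uε ε) p)
      - ev (tI : SF tp ti) p * ev S.Ut p + 2 * ev S.h p * (ev (S.Aε ε) p * ev (S.Aε (-ε)) p) + S.SU p := by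
  have e1 : ev (dd eT S.XU) p = ev (S.X S.Ut) p + 1/2 * (ev S.Lt p * ev S.XU p) := by
    rw [Fld.XU, S.dT_X]; simp only [ev_add, ev_smul, ev_mul, Fld.Ut]
  have e2 := S.eU p hp
  simp only [ev_add, ev_sub, ev_smul, ev_mul, ev_pow _ _ hp] at e2
  simp only [Fld.Uε, Fld.Aε, map_add, Derivation.map_smul, ev_add, ev_smul, SU, ev_mul, ev_pow _ _ hp, e1, e2]
  linear_combination (-ev (S.X S.XU) p + 2 * ev S.h p * ev S.XA p ^ 2) * hε

theorem dT_Aε {ε : ℝ} (hε : ε * ε = 1) {p : E5} (hp : p ∈ strip tp ti) :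
    ev (dd eT (S.Aε ε)) p - ε * ev (S.X (S.Aε ε)) p = 1/2 * (ev S.Lt p * ev (S.Aε ε) p)
      + ev (tI : SF tp ti) p * ev S.At p
      - 2 * (ev (S.Aε ε) p * ev (S.Uε (-ε)) p + ev (S.Aε (-ε)) p * ev (S.Uε ε) p) + S.SA p := by
  have e1 : ev (dd eT S.XA) p = ev (S.X S.At) p + 1/2 * (ev S.Lt p * ev S.XA p) := by
    rw [Fld.XA, S.dT_X]; simp only [ev_add, ev_smul, ev_mul, Fld.At]
  have e2 := S.eA p hp
  simp only [ev_add, ev_sub, ev_smul, ev_mul, ev_pow _ _ hp] at e2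
  simp only [Fld.Uε, Fld.Aε, map_add, Derivation.map_smul, ev_add, ev_smul, SA, ev_mul, ev_pow _ _ hp, e1, e2]
  linear_combination (-ev (S.X S.XA) p - 4 * ev S.XA p * ev S.XU p) * hε

theorem dT_g {ε : ℝ} (hε : ε * ε = 1) {p : E5} (hp : p ∈ strip tp ti) :
    ev (dd eT (S.g ε)) p - ε * ev (S.X (S.g ε)) p = ev S.Lt p * ev (S.g ε) p
      - 2 * (ev (tI : SF tp ti) p * (ev (S.Uε ε) p * ev S.Ut p)) + 2 * ev (S.Uε ε) p * S.SU p
      - 2 * (ev S.h p * ev (tI : SF tp ti) p * ev (S.Aε ε) p ^ 2)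
      + 2 * (ev S.h p * ev (tI : SF tp ti) p * (ev (S.Aε ε) p * ev S.At p))
      + 2 * ev S.h p * ev (S.Aε ε) p * S.SA p := by
  have e1 := S.dT_Uε hε hp
  have e2 := S.dT_Aε hε hp
  have e3 : ev (dd eT S.h) p = ev S.h p * (4 * ev S.Ut p - 2 * ev (tI : SF tp ti) p) := by
    rw [S.dT_h]; simp only [ev_mul, ev_sub, ev_smul]
  have e4 : ev (S.X S.h) p = ev S.h p * (4 * ev S.XU p) := by
    rw [S.X_h]; simp only [ev_mul, ev_smul]
  have e5 : ev (S.Uε (-ε)) p = ev S.Ut p - ε * ev S.XU p := by simp only [Fld.Uε, ev_add, ev_smul]; ring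
  have d : ∀ D : Derivation ℝ (SF tp ti) (SF tp ti), ev (D (S.g ε)) p = 2 * ev (S.Uε ε) p * ev (D (S.Uε ε)) p
      + ev (D S.h) p * ev (S.Aε ε) p ^ 2 + 2 * ev S.h p * ev (S.Aε ε) p * ev (D (S.Aε ε)) p := fun D => by
    rw [Fld.g, sq, sq]
    simp only [map_add, Derivation.leibniz, smul_eq_mul, ev_add, ev_mul]; ring
  rw [d, d, e3, e4, Fld.g, ev_add, ev_mul, ev_pow _ _ hp, ev_pow _ _ hp]
  rw [e5] at e2
  linear_combination 2 * ev (S.Uε ε) p * e1 + 2 * ev S.h p * ev (S.Aε ε) p * e2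

end Sys

namespace Sys

variable [hfact : Fact (0 < tp)] (S : Sys tp ti)

/-- the early part of the set where the density is nonzero -/
def supp : Set E5 := {p | p ∈ early tp ti ∧ ev S.F p ≠ 0}

theorem supp_sub : S.supp ⊆ early tp ti := fun p hp => hp.1

theorem bd_E2 : Bd (early tp ti) S.E2 := ((S.bd_β.smul _).sub (S.bd_U.smul _)).expR
theorem bd_E4 : Bd (early tp ti) S.E4 := ((S.bd_β.smul _).sub (S.bd_U.smul _)).expR
theorem bd_E0 : Bd (early tp ti) S.E0 := (S.bd_β.smul _).expR
theorem bd_κ : Bd (early tp ti) S.κ := S.bd_JK.2.sub (S.bd_A.mul S.bd_JK.1)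
theorem bd_h : Bd (early tp ti) S.h := ((S.bd_U.smul _).expR.mul (Bd.tI.pow 2)).smul _
theorem bd_v2 : Bd S.supp (v2R : SF tp ti) := by
  obtain ⟨R, h0, hR⟩ := S.v23_le
  refine ⟨R, h0, fun p hp => ?_⟩
  have h := early_strip hp.1
  rw [ev_v2R h]; exact (hR p h hp.2).1
theorem bd_v3 : Bd S.supp (v3R : SF tp ti) := by
  obtain ⟨R, h0, hR⟩ := S.v23_le
  refine ⟨R, h0, fun p hp => ?_⟩
  have h := early_strip hp.1
  rw [ev_v3R h]; exact (hR p h hp.2).2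
theorem bd_w : Bd S.supp S.w := S.bd_v3.sub ((S.bd_A.mono S.supp_sub).mul S.bd_v2)
theorem bd_m2_supp : Bd S.supp S.m2 :=
  ((S.bd_E2.mono S.supp_sub).add ((S.bd_E4.mono S.supp_sub).mul (S.bd_v2.pow 2))).add
    (((Bd.tI.pow 2).mul (S.bd_E0.mono S.supp_sub)).mul (S.bd_w.pow 2))

theorem h_ge' : ∃ c, 0 < c ∧ ∀ p ∈ early tp ti, c ≤ ev S.h p := by
  obtain ⟨c, h0, hc⟩ := S.h_ge
  have hti : 0 < ti := hfact.out.trans S.lt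
  refine ⟨c / ti, by positivity, fun p hp => ?_⟩
  rw [div_le_iff₀ hti]
  have h1 := hc p hp
  have h2 := (mem_strip.1 (early_strip hp)).2
  have h3 := S.h_pos (early_strip hp)
  nlinarith

theorem P_ge : ∃ c, 0 < c ∧ ∀ p ∈ early tp ti, c * (1 + p.2.2.1 ^ 2) ≤ ev S.P p := by
  obtain ⟨C, h0, hC⟩ := ((S.bd_U.smul 2).sub (S.bd_β.smul 2)).expR
  refine ⟨min 1 (C + 1)⁻¹, by positivity, fun p hp => ?_⟩
  have hps := early_strip hp
  have h1 : (C + 1)⁻¹ ≤ ev S.E2 p := by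
    have h2 : ev S.E2 p * ev (expR ((2:ℝ) • S.U - (2:ℝ) • S.β)) p = 1 := by
      rw [Fld.E2, ev_expR _ hps, ev_expR _ hps, ← Real.exp_add]
      simp
    have h3 := (le_abs_self _).trans (hC p hp)
    rw [inv_le_iff_one_le_mul₀ (by positivity)]
    have := S.E2_pos hps
    nlinarith
  have h2 := S.m2_ge hps
  rw [S.ev_P hps]
  have h3 := min_le_left 1 (C + 1)⁻¹
  have h4 := min_le_right 1 (C + 1)⁻¹
  nlinarith [sq_nonneg p.2.2.1]

/-- bounds for moments by the logarithm of the maximal momentum -/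
theorem mom_log : ∃ C, 0 ≤ C ∧ ∀ p ∈ early tp ti, ∀ Y : ℝ, 1 ≤ Y → 1 ≤ Real.log Y →
    (∀ v : V3, ev (S.F * S.P ^ 2) (p.1, p.2.1, v) ≤ Y ^ 2) →
    S.mom S.rp p ≤ C * Real.log Y ∧ S.mom S.p0 p ≤ C * (Y * Real.log Y) := by
  obtain ⟨c, hc0, hc⟩ := S.P_ge
  obtain ⟨Fm, hFm, hF⟩ := S.F_le
  obtain ⟨R, hR0, hR⟩ := S.v23_le
  set M := Fm + 1 with hM
  have hM1 : 1 ≤ M := by linarith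
  obtain ⟨k, hk0, hk⟩ : ∃ k : ℝ, 1 ≤ k ∧ 1 ≤ c * k ^ 2 := by
    refine ⟨1 + c⁻¹, by linarith [inv_pos.2 hc0], ?_⟩
    have : c * c⁻¹ = 1 := mul_inv_cancel₀ hc0.ne'
    have := inv_pos.2 hc0
    nlinarith
  refine ⟨4 * R ^ 2 * (6 * (M * k) + k ^ 5 * Real.pi), by positivity, fun p hp Y hY1 hY hFP => ?_⟩
  have hps := early_strip hp
  obtain ⟨hInt, hle⟩ := integral_inv_sqrt_le hY1 hY
  set φ : ℝ → ℝ := indicator (Icc (-Y) Y) fun x : ℝ => (√(1 + x ^ 2))⁻¹ with hφ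
  have hφ0 : ∀ x, 0 ≤ φ x := fun x => indicator_nonneg (fun x _ => by positivity) x
  have hi2 := integrable_inv_one_add_sq
  -- pointwise bounds
  have pt : ∀ v : V3, ev S.F (p.1, p.2.1, v) * ev S.rp (p.1, p.2.1, v) ≤ M * k * φ v.1 + k ^ 5 * (1 + v.1 ^ 2)⁻¹ ∧
      ev S.F (p.1, p.2.1, v) * ev S.p0 (p.1, p.2.1, v) ≤ Y * (M * k * φ v.1 + k ^ 5 * (1 + v.1 ^ 2)⁻¹) := by
    intro v
    have hv : ((p.1, p.2.1, v) : E5) ∈ early tp ti := mem_early.2 (mem_early.1 hp)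
    have hvs := early_strip hv
    have f0 := S.F_nonneg _ hvs
    have f1 := hF _ hv
    have P1 := hc _ hv
    have r0 := S.rp_pos hvs
    have q0 := S.p0_pos hvs
    have rq := S.rp_mul_p0 hvs
    have qq := S.p0_sq hvs
    have hfp := hFP v
    rw [ev_mul, ev_pow _ _ hvs] at hfp
    simp only at P1
    set D := √(1 + v.1 ^ 2) with hD
    have hD0 : 0 < D := Real.sqrt_pos.2 (by positivity)
    have hD2 : D ^ 2 = 1 + v.1 ^ 2 := Real.sq_sqrt (by positivity)
    have hD1 : 1 ≤ D := by nlinarith [sq_nonneg v.1]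
    generalize ev S.F (p.1, p.2.1, v) = f at *
    generalize ev S.rp (p.1, p.2.1, v) = r at *
    generalize ev S.p0 (p.1, p.2.1, v) = z at *
    rw [← hD2] at P1 ⊢
    rw [← qq] at hfp P1
    -- D ≤ k z
    have h1 : D ≤ k * z := by
      refine (le_abs_self _).trans (abs_le_of_sq_le_sq ?_ (by positivity))
      have e1 : k ^ 2 * (c * D ^ 2) ≤ k ^ 2 * z ^ 2 := mul_le_mul_of_nonneg_left P1 (by positivity)
      have e2 : 1 * D ^ 2 ≤ (c * k ^ 2) * D ^ 2 := mul_le_mul_of_nonneg_right hk (by positivity)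
      rw [mul_pow]; linarith
    have h2 : r ≤ k * D⁻¹ := by
      rw [← div_eq_mul_inv, le_div_iff₀ hD0]
      calc r * D ≤ r * (k * z) := mul_le_mul_of_nonneg_left h1 r0.le
        _ = k * (r * z) := by ring
        _ = k := by rw [rq, mul_one]
    have hDi : 0 < D⁻¹ := by positivity
    have hDi1 : D⁻¹ ≤ 1 := inv_le_one_of_one_le₀ hD1
    have hk5 : k ≤ k ^ 5 ∧ k ^ 3 ≤ k ^ 5 := ⟨by simpa using pow_le_pow_right₀ hk0 (show 1 ≤ 5 by norm_num), pow_le_pow_right₀ hk0 (by norm_num)⟩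
    have hY0 : 0 < Y := by linarith
    by_cases hx : v.1 ∈ Icc (-Y) Y
    · have e : φ v.1 = D⁻¹ := indicator_of_mem hx _
      rw [e]
      have a1 : f * r ≤ M * (k * D⁻¹) := mul_le_mul (by linarith) h2 r0.le (by positivity)
      have a2 : f * z ^ 2 ≤ M * Y := by
        refine (le_abs_self _).trans (abs_le_of_sq_le_sq ?_ (by positivity))
        have b1 : f * (f * (z ^ 2) ^ 2) ≤ M * Y ^ 2 := mul_le_mul (by linarith) hfp (by positivity) (by positivity)
        have b2 : M * Y ^ 2 ≤ M * (M * Y ^ 2) := mul_le_mul_of_nonneg_left (by nlinarith [sq_nonneg Y]) (by positivity)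
        calc (f * z ^ 2) ^ 2 = f * (f * (z ^ 2) ^ 2) := by ring
          _ ≤ _ := b1.trans b2
          _ = _ := by ring
      have a3 : f * z ≤ M * Y * (k * D⁻¹) := by
        calc f * z = (f * z ^ 2) * r := by linear_combination (-f * z) * rq
          _ ≤ _ := mul_le_mul a2 h2 r0.le (by positivity)
      have a4 : 0 ≤ k ^ 5 * (D ^ 2)⁻¹ := by positivity
      constructor
      · linarith
      · nlinarith
    · have e : φ v.1 = 0 := indicator_of_notMem hx _
      rw [e, mul_zero, zero_add]
      have hYD : Y ≤ D := by
        refine (le_abs_self _).trans (abs_le_of_sq_le_sq ?_ hD0.le)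
        rw [hD2]
        have : Y ≤ |v.1| := by
          by_contra! h
          exact hx (abs_le.1 h.le)
        have := sq_abs v.1
        nlinarith
      have hYD' : Y * D⁻¹ ≤ 1 := by rw [← div_eq_mul_inv, div_le_one hD0]; exact hYD
      have r5 : r ^ 5 ≤ (k * D⁻¹) ^ 5 := pow_le_pow_left₀ r0.le h2 5
      have r3 : r ^ 3 ≤ (k * D⁻¹) ^ 3 := pow_le_pow_left₀ r0.le h2 3
      rw [← inv_pow]
      have hb : (Y * D⁻¹) ^ 2 ≤ 1 := pow_le_one₀ (by positivity) hYD'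
      constructor
      · calc f * r = (f * (z ^ 2) ^ 2) * r ^ 5 := by
              have : r ^ 4 * z ^ 4 = 1 := by rw [← mul_pow, rq, one_pow]
              linear_combination (-f * r) * this
          _ ≤ Y ^ 2 * (k * D⁻¹) ^ 5 := mul_le_mul hfp r5 (by positivity) (by positivity)
          _ = k ^ 5 * D⁻¹ ^ 2 * ((Y * D⁻¹) ^ 2 * D⁻¹) := by ring
          _ ≤ k ^ 5 * D⁻¹ ^ 2 * (1 * 1) := by
              refine mul_le_mul_of_nonneg_left (mul_le_mul hb hDi1 hDi.le zero_le_one) (by positivity)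
          _ = _ := by ring
      · calc f * z = (f * (z ^ 2) ^ 2) * r ^ 3 := by
              have : r ^ 3 * z ^ 3 = 1 := by rw [← mul_pow, rq, one_pow]
              linear_combination (-f * z) * this
          _ ≤ Y ^ 2 * (k * D⁻¹) ^ 3 := mul_le_mul hfp r3 (by positivity) (by positivity)
          _ = Y * (k ^ 3 * D⁻¹ ^ 2) * (Y * D⁻¹) := by ring
          _ ≤ Y * (k ^ 5 * D⁻¹ ^ 2) * 1 := by
              refine mul_le_mul (mul_le_mul_of_nonneg_left (mul_le_mul_of_nonneg_right hk5.2 (by positivity)) hY0.le)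
                hYD' (by positivity) (by positivity)
          _ = _ := by ring
  have hI : Integrable fun x : ℝ => M * k * φ x + k ^ 5 * (1 + x ^ 2)⁻¹ := (hInt.const_mul _).add (hi2.const_mul _)
  have hIv : ∫ x : ℝ, (M * k * φ x + k ^ 5 * (1 + x ^ 2)⁻¹) ≤ (6 * (M * k) + k ^ 5 * Real.pi) * Real.log Y := by
    rw [integral_add (hInt.const_mul _) (hi2.const_mul _), integral_const_mul, integral_const_mul,
      integral_univ_inv_one_add_sq]
    have : 0 < M * k := by positivity
    have : 0 < k ^ 5 * Real.pi := by positivity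
    nlinarith
  have hz : ∀ v : V3, R < |v.2.1| ∨ R < |v.2.2| → ev S.F (p.1, p.2.1, v) = 0 := fun v hv => by
    by_contra h
    have := hR _ (mem' hps v) h
    simp only at this
    rcases hv with hv | hv
    · linarith [this.1]
    · linarith [this.2]
  constructor
  · refine (integral_le_of_slab hR0 hI (fun v => (pt v).1) (fun v hv => by rw [hz v hv, zero_mul])
      (fun v => mul_nonneg (S.F_nonneg _ (mem' hps v)) (S.rp_pos (mem' hps v)).le)).trans ?_
    have : 0 ≤ 4 * R ^ 2 := by positivity
    calc _ ≤ 4 * R ^ 2 * _ := mul_le_mul_of_nonneg_left hIv this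
      _ = _ := by ring
  · refine (integral_le_of_slab hR0 (hI.const_mul Y) (fun v => (pt v).2) (fun v hv => by rw [hz v hv, zero_mul])
      (fun v => mul_nonneg (S.F_nonneg _ (mem' hps v)) (S.p0_pos (mem' hps v)).le)).trans ?_
    rw [integral_const_mul]
    have : 0 ≤ 4 * R ^ 2 := by positivity
    calc _ ≤ 4 * R ^ 2 * (Y * _) := mul_le_mul_of_nonneg_left (mul_le_mul_of_nonneg_left hIv (by linarith)) this
      _ = _ := by ring

/-- moments with bounded weights -/
theorem mom_bd {φ ψ : SF tp ti} (hφ : Bd S.supp φ) (hψ : ∀ p ∈ early tp ti, 0 ≤ ev ψ p) :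
    ∃ C, 0 ≤ C ∧ ∀ p ∈ early tp ti, |S.mom (φ * ψ) p| ≤ C * S.mom ψ p := by
  obtain ⟨C, h0, hC⟩ := hφ
  refine ⟨C, h0, fun p hp => ?_⟩
  have hv : ∀ v, ((p.1, p.2.1, v) : E5) ∈ early tp ti := fun v => mem_early.2 (mem_early.1 hp)
  rw [← S.mom_smul]
  refine S.abs_mom_le (early_strip hp) fun v hF => ?_
  rw [ev_mul, abs_mul, abs_of_nonneg (hψ _ (hv v)), ev_smul]
  exact mul_le_mul_of_nonneg_right (hC _ ⟨hv v, hF⟩) (hψ _ (hv v))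

theorem rp_nonneg' : ∀ p ∈ early tp ti, 0 ≤ ev S.rp p := fun p hp => (S.rp_pos (early_strip hp)).le

theorem mom_rp_nonneg {p : E5} (hp : p ∈ early tp ti) : 0 ≤ S.mom S.rp p :=
  S.mom_nonneg (early_strip hp) fun v _ => (S.rp_pos (mem' (early_strip hp) v)).le

/-- the sources are controlled by the lowest moment -/
theorem sources_le : ∃ C, 0 ≤ C ∧ ∀ p ∈ early tp ti, |S.SU p| ≤ C * (1 + S.mom S.rp p) ∧
    |S.SA p| ≤ C * (1 + S.mom S.rp p) ∧ |ev S.Lt p| ≤ C * (1 + S.mom S.rp p) := by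
  have comb : ∀ (G H φ : SF tp ti) (x y : ℝ), Bd (early tp ti) G → Bd (early tp ti) H → Bd S.supp φ →
      ∃ C, 0 ≤ C ∧ ∀ p ∈ early tp ti, |x * ev G p + y * ev H p * S.mom (φ * S.rp) p| ≤ C * (1 + S.mom S.rp p) := by
    intro G H φ x y ⟨C1, h1, hC1⟩ ⟨C2, h2, hC2⟩ hφ
    obtain ⟨C3, h3, hC3⟩ := S.mom_bd hφ S.rp_nonneg'
    refine ⟨|x| * C1 + |y| * C2 * C3, by positivity, fun p hp => (abs_add_le _ _).trans ?_⟩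
    have e1 := hC1 p hp
    have e2 := hC2 p hp
    have e3 := hC3 p hp
    have e0 := S.mom_rp_nonneg hp
    rw [abs_mul, abs_mul, abs_mul]
    have a1 : |x| * |ev G p| ≤ |x| * C1 := mul_le_mul_of_nonneg_left e1 (abs_nonneg _)
    have a2 : |y| * |ev H p| ≤ |y| * C2 := mul_le_mul_of_nonneg_left e2 (abs_nonneg _)
    have a3 : |y| * |ev H p| * |S.mom (φ * S.rp) p| ≤ |y| * C2 * (C3 * S.mom S.rp p) :=
      mul_le_mul a2 e3 (abs_nonneg _) (by positivity)
    have a4 : 0 ≤ |x| * C1 * S.mom S.rp p := by positivity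
    have a5 : 0 ≤ |y| * C2 * C3 := by positivity
    nlinarith
  have hs := S.supp_sub
  obtain ⟨C1, h1, hC1⟩ := comb (tI ^ 2 * S.E4 * S.J ^ 2) (tI * S.E2) (1 + (2 : ℝ) • (expR ((-2 : ℝ) • S.U) * v2R ^ 2))
    (1/2) (1/2) (((Bd.tI.pow 2).mul S.bd_E4).mul (S.bd_JK.1.pow 2)) (Bd.tI.mul S.bd_E2)
    (Bd.one.add ((((S.bd_U.mono hs).smul _).expR.mul (S.bd_v2.pow 2)).smul _))
  obtain ⟨C2, h2, hC2⟩ := comb (tI ^ 2 * S.E4 * S.J * S.κ) (tI * S.E4) (v2R * S.w)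
    1 2 ((((Bd.tI.pow 2).mul S.bd_E4).mul S.bd_JK.1).mul S.bd_κ) (Bd.tI.mul S.bd_E4) (S.bd_v2.mul S.bd_w)
  obtain ⟨C3, h3, hC3⟩ := comb (tI * S.E4 * S.J ^ 2 + tI ^ 3 * S.E0 * S.κ ^ 2) 1 S.m2
    (-1) (-2) (((Bd.tI.mul S.bd_E4).mul (S.bd_JK.1.pow 2)).add (((Bd.tI.pow 3).mul S.bd_E0).mul (S.bd_κ.pow 2)))
    Bd.one S.bd_m2_supp
  refine ⟨C1 + C2 + C3, by positivity, fun p hp => ?_⟩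
  have e1 := hC1 p hp
  have e2 := hC2 p hp
  have e3 := hC3 p hp
  have e0 := S.mom_rp_nonneg hp
  have hps := early_strip hp
  have hL : ev S.Lt p = -1 * ev (tI * S.E4 * S.J ^ 2 + tI ^ 3 * S.E0 * S.κ ^ 2) p + -2 * ev (1 : SF tp ti) p * S.mom (S.m2 * S.rp) p := by
    rw [S.eL p hps, ev_one hps]; ring
  have hA : S.SA p = 1 * ev (tI ^ 2 * S.E4 * S.J * S.κ) p + 2 * ev (tI * S.E4) p * S.mom (v2R * S.w * S.rp) p := by
    rw [SA, one_mul]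
  rw [← hL] at e3
  rw [← hA] at e2
  have e1' : |S.SU p| ≤ C1 * (1 + S.mom S.rp p) := e1
  refine ⟨e1'.trans ?_, e2.trans ?_, e3.trans ?_⟩ <;> refine mul_le_mul_of_nonneg_right ?_ (by linarith) <;> linarith

end Sys

theorem step_g_aux {L G T u u' h x x' s s' Y l C3 Ct Ch : ℝ} (hL : |L| ≤ C3 * l) (hs : |s| ≤ C3 * l)
    (hs' : |s'| ≤ C3 * l) (hT : 0 ≤ T) (hTt : T ≤ Ct) (hh : 0 ≤ h) (hhh : h ≤ Ch) (hu : u ^ 2 ≤ Y) (hu' : u' ^ 2 ≤ Y)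
    (hx : h * x ^ 2 ≤ Y) (hx' : h * x' ^ 2 ≤ Y) (hG : 0 ≤ G) (hGY : G ≤ Y) (hY : 1 ≤ Y) (hl : 1 ≤ l) (hC : 0 ≤ C3) :
    -((C3 * (4 + Ch) + 6 * Ct) * (Y * l)) ≤ L * G - 2 * (T * (u * u')) + 2 * u * s - 2 * (h * T * x ^ 2)
      + 2 * (h * T * (x * x')) + 2 * h * x * s' := by
  have hYl : Y ≤ Y * l := by nlinarith
  have hCl : 0 ≤ C3 * l := by positivity
  have a1 : -(C3 * l * Y) ≤ L * G := by
    have : |L * G| ≤ C3 * l * Y := by rw [abs_mul, abs_of_nonneg hG]; exact mul_le_mul hL hGY hG hCl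
    exact (abs_le.1 this).1
  have a2 : -(Ct * (2 * Y)) ≤ - 2 * (T * (u * u')) := by
    have e1 : 2 * (u * u') ≤ 2 * Y := by nlinarith [sq_nonneg (u - u')]
    have : T * (2 * (u * u')) ≤ T * (2 * Y) := mul_le_mul_of_nonneg_left e1 hT
    have : T * (2 * Y) ≤ Ct * (2 * Y) := mul_le_mul_of_nonneg_right hTt (by linarith)
    linarith
  have a3 : -(C3 * l * (2 * Y)) ≤ 2 * u * s := by
    have e1 : |2 * u| ≤ 2 * Y := by rw [abs_le]; constructor <;> nlinarith [sq_nonneg (u - 1), sq_nonneg (u + 1)]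
    have : |2 * u * s| ≤ 2 * Y * (C3 * l) := by rw [abs_mul]; exact mul_le_mul e1 hs (abs_nonneg _) (by linarith)
    linarith [(abs_le.1 this).1]
  have a4 : T * (h * x ^ 2) ≤ Ct * Y := mul_le_mul hTt hx (by positivity) (hT.trans hTt)
  have a5 : -(Ct * (2 * Y)) ≤ 2 * (h * T * (x * x')) := by
    have e1 : -(2 * Y) ≤ 2 * (h * (x * x')) := by nlinarith [mul_nonneg hh (sq_nonneg (x + x'))]
    have : T * -(2 * Y) ≤ T * (2 * (h * (x * x'))) := mul_le_mul_of_nonneg_left e1 hT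
    have : T * (2 * Y) ≤ Ct * (2 * Y) := mul_le_mul_of_nonneg_right hTt (by linarith)
    linarith
  have a6 : -((Ch + Y) * (C3 * l)) ≤ 2 * h * x * s' := by
    have e1 : |2 * h * x| ≤ Ch + Y := by
      rw [abs_le]; constructor <;> nlinarith [mul_nonneg hh (sq_nonneg (x - 1)), mul_nonneg hh (sq_nonneg (x + 1))]
    have : |2 * h * x * s'| ≤ (Ch + Y) * (C3 * l) := by
      rw [abs_mul]; exact mul_le_mul e1 hs' (abs_nonneg _) (by linarith)
    linarith [(abs_le.1 this).1]
  have b1 : Ch * (C3 * l) ≤ Ch * (C3 * l) * Y := le_mul_of_one_le_right (mul_nonneg (hh.trans hhh) hCl) hY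
  have b2 : Ct * Y ≤ Ct * (Y * l) := mul_le_mul_of_nonneg_left hYl (hT.trans hTt)
  nlinarith

theorem step_P_aux {f P m L q k Y l M C3 C5 Cf : ℝ} (hf : 0 ≤ f) (hP : 0 ≤ P) (hq : q ^ 2 ≤ P) (hfP : f * P ^ 2 = Y ^ 2)
    (hfP1 : f * P ≤ M * Y) (hm : |m| ≤ C5 * (Y * l)) (hL : |L| ≤ C3 * l) (hk : |k| ≤ Cf) (hY : 1 ≤ Y) (hl : 1 ≤ l)
    (hM : 0 ≤ M) (hC3 : 0 ≤ C3) :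
    -(2 * (M * C5 + C3 + Cf * (M + 1)) * (Y ^ 2 * l)) ≤ 2 * (f * P) * (m + L * q ^ 2 + 2 * (q * k)) := by
  have hfP0 : 0 ≤ f * P := mul_nonneg hf hP
  have a1 : |f * P * m| ≤ M * Y * (C5 * (Y * l)) := by
    rw [abs_mul, abs_of_nonneg hfP0]; exact mul_le_mul hfP1 hm (abs_nonneg _) (by positivity)
  have e1 : f * P * q ^ 2 ≤ Y ^ 2 := by rw [← hfP, sq P, ← mul_assoc]; exact mul_le_mul_of_nonneg_left hq hfP0
  have a2 : |f * P * q ^ 2 * L| ≤ Y ^ 2 * (C3 * l) := by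
    rw [abs_mul, abs_of_nonneg (by positivity)]; exact mul_le_mul e1 hL (abs_nonneg _) (by positivity)
  have e2 : |f * P * (2 * q)| ≤ M * Y + Y ^ 2 := by
    rw [abs_mul, abs_of_nonneg hfP0]
    have : |2 * q| ≤ 1 + q ^ 2 := by rw [abs_le]; constructor <;> nlinarith [sq_nonneg (q - 1), sq_nonneg (q + 1)]
    have := mul_le_mul_of_nonneg_left this hfP0
    linarith
  have a3 : |f * P * (2 * q) * k| ≤ (M * Y + Y ^ 2) * Cf := by
    rw [abs_mul]; exact mul_le_mul e2 hk (abs_nonneg _) (by positivity)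
  have b1 := (abs_le.1 a1).1
  have b2 := (abs_le.1 a2).1
  have b3 := (abs_le.1 a3).1
  have hCf := (abs_nonneg _).trans hk
  have c1 : Y ^ 2 ≤ Y ^ 2 * l := by nlinarith [sq_nonneg Y]
  have c2 : (M * Y + Y ^ 2) * Cf ≤ (M + 1) * (Y ^ 2 * l) * Cf := by
    refine mul_le_mul_of_nonneg_right ?_ hCf
    have : M * Y ≤ M * Y ^ 2 := mul_le_mul_of_nonneg_left (by nlinarith) hM
    nlinarith
  nlinarith

namespace Sys

variable [hfact : Fact (0 < tp)] (S : Sys tp ti)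

theorem dd_m2 (e : E5) (h2 : e.2.2.2.1 = 0) (h3 : e.2.2.2.2 = 0) : dd e S.m2 =
    dd e S.β * ((2 : ℝ) • S.m2) - dd e S.U * ((2:ℝ) • S.E2 + (4:ℝ) • (S.E4 * v2R ^ 2))
      - dd e S.A * ((2:ℝ) • (tI ^ 2 * S.E0 * S.w * v2R)) + dd e tI * ((2:ℝ) • (tI * S.E0 * S.w ^ 2)) := by
  have a2 : dd e (v2R : SF tp ti) = 0 := by rw [dd_v2R, h2]; simp
  have a3 : dd e (v3R : SF tp ti) = 0 := by rw [dd_v3R, h3]; simp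
  have e2 : dd e S.E2 = S.E2 * ((2:ℝ) • dd e S.β - (2:ℝ) • dd e S.U) := by
    rw [Fld.E2, dd_expR, map_sub, Derivation.map_smul, Derivation.map_smul]
  have e4 : dd e S.E4 = S.E4 * ((2:ℝ) • dd e S.β - (4:ℝ) • dd e S.U) := by
    rw [Fld.E4, dd_expR, map_sub, Derivation.map_smul, Derivation.map_smul]
  have e0 : dd e S.E0 = S.E0 * ((2:ℝ) • dd e S.β) := by
    rw [Fld.E0, dd_expR, Derivation.map_smul]
  have ew : dd e S.w = - (v2R * dd e S.A) := by
    rw [Fld.w, map_sub, Derivation.leibniz, a2, a3]; simp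
  rw [Fld.m2, map_add, map_add, sq, sq, sq]
  simp only [Derivation.leibniz, a2, e2, e4, e0, ew, smul_eq_mul, Algebra.smul_def, map_ofNat]
  ring

theorem g_ge {p : E5} (hp : p ∈ strip tp ti) (ε : ℝ) : ev (S.Uε ε) p ^ 2 ≤ ev (S.g ε) p ∧
    ev S.h p * ev (S.Aε ε) p ^ 2 ≤ ev (S.g ε) p ∧ 0 ≤ ev (S.g ε) p := by
  have := S.h_pos hp
  rw [Fld.g, ev_add, ev_mul, ev_pow _ _ hp, ev_pow _ _ hp]
  have : 0 ≤ ev S.h p * ev (S.Aε ε) p ^ 2 := by positivity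
  refine ⟨by linarith, by nlinarith, by positivity⟩

theorem g_add {p : E5} (hp : p ∈ strip tp ti) : ev (S.g 1) p + ev (S.g (-1)) p =
    2 * (ev S.Ut p ^ 2 + ev S.XU p ^ 2 + ev S.h p * (ev S.At p ^ 2 + ev S.XA p ^ 2)) := by
  simp only [Fld.g, Fld.Uε, Fld.Aε, ev_add, ev_mul, ev_pow _ _ hp, ev_smul]; ring

theorem N_le_g : ∃ C, 0 ≤ C ∧ ∀ p ∈ early tp ti, ev S.N p ≤ C * (1 + ev (S.g 1) p + ev (S.g (-1)) p) + S.mom S.p0 p := by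
  obtain ⟨C, h0, hC⟩ := ((Bd.tI.mul S.bd_E4).mul (S.bd_JK.1.pow 2)).add (((Bd.tI.pow 3).mul S.bd_E0).mul (S.bd_κ.pow 2))
  have hti : 0 < ti := hfact.out.trans S.lt
  refine ⟨C + ti, by positivity, fun p hp => ?_⟩
  have hps := early_strip hp
  have h1 := (le_abs_self _).trans (hC p hp)
  have g1 := (S.g_ge hps 1).2.2
  have g2 := (S.g_ge hps (-1)).2.2
  have h2 := (mem_strip.1 hps).2
  rw [S.ev_N hps]
  simp only [ev_add, ev_mul, ev_pow _ _ hps] at h1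
  have h3 := S.g_add hps
  set x := ev S.Ut p ^ 2 + ev S.XU p ^ 2 + ev S.h p * (ev S.At p ^ 2 + ev S.XA p ^ 2)
  have h4 : p.1 * x ≤ ti * x := mul_le_mul_of_nonneg_right h2.le (by linarith)
  have h5 : 0 ≤ C * (ev (S.g 1) p + ev (S.g (-1)) p) := by positivity
  have h6 : 0 ≤ ti * (ev (S.g 1) p + ev (S.g (-1)) p) := by positivity
  have h7 : ti * x = ti * (ev (S.g 1) p + ev (S.g (-1)) p) / 2 := by rw [h3]; ring
  nlinarith

theorem FP_start : ∃ C, ∀ θ v, ev (S.F * S.P ^ 2) (tm tp ti, θ, v) ≤ C := by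
  have htm := early_Ioo (tm_mem S.lt)
  obtain ⟨R, hR0, hR⟩ := S.exists_supp htm
  obtain ⟨C0, hC0, hC⟩ := ev_bdd (S.F * S.P ^ 2) (a := tm tp ti) (b := tm tp ti) (by simpa using htm) R
  refine ⟨C0, fun θ v => ?_⟩
  by_cases h : ‖v‖ ≤ R
  · exact (le_abs_self _).trans (hC (tm tp ti) (by simp) θ v h)
  · have : ev S.F (tm tp ti, θ, v) = 0 := by
      by_contra h'; exact h (hR _ ⟨le_rfl, htm.2⟩ θ v h').le
    rw [ev_mul, this, zero_mul]; exact hC0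

theorem dT_m2_le : ∃ C, 0 ≤ C ∧ ∀ p ∈ S.supp, |ev (dd eT S.m2) p| ≤
    C * (1 + |ev S.Ut p| + |ev (dd eT S.β) p| + |ev S.At p|) := by
  have hs := S.supp_sub
  obtain ⟨C1, h1, hC1⟩ := S.bd_m2_supp.smul 2
  obtain ⟨C2, h2, hC2⟩ := ((S.bd_E2.mono hs).smul 2).add (((S.bd_E4.mono hs).mul (S.bd_v2.pow 2)).smul 4)
  obtain ⟨C3, h3, hC3⟩ := ((((Bd.tI.pow 2).mul (S.bd_E0.mono hs)).mul S.bd_w).mul S.bd_v2).smul 2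
  obtain ⟨C4, h4, hC4⟩ := (((Bd.tI.pow 2).smul 1).neg).mul (((Bd.tI.mul (S.bd_E0.mono hs)).mul (S.bd_w.pow 2)).smul 2)
  refine ⟨C1 + C2 + C3 + C4, by positivity, fun p hp => ?_⟩
  rw [S.dd_m2 eT rfl rfl, dd_tI]
  have e : (eT : E5).1 = 1 := rfl
  rw [e, ev_add, ev_sub, ev_sub, ev_mul (dd eT S.β), ev_mul (dd eT S.U), ev_mul (dd eT S.A)]
  have b1 : |ev (dd eT S.β) p * ev ((2:ℝ) • S.m2) p| ≤ |ev (dd eT S.β) p| * C1 := by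
    rw [abs_mul]; exact mul_le_mul_of_nonneg_left (hC1 p hp) (abs_nonneg _)
  have b2 : |ev (dd eT S.U) p * ev ((2:ℝ) • S.E2 + (4:ℝ) • (S.E4 * v2R ^ 2)) p| ≤ |ev S.Ut p| * C2 := by
    rw [abs_mul]; exact mul_le_mul_of_nonneg_left (hC2 p hp) (abs_nonneg _)
  have b3 : |ev (dd eT S.A) p * ev ((2:ℝ) • (tI ^ 2 * S.E0 * S.w * v2R)) p| ≤ |ev S.At p| * C3 := by
    rw [abs_mul]; exact mul_le_mul_of_nonneg_left (hC3 p hp) (abs_nonneg _)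
  have b4 := hC4 p hp
  have b := (abs_add_le _ _).trans (add_le_add ((abs_sub _ _).trans (add_le_add ((abs_sub _ _).trans (add_le_add b1 b2)) b3)) b4)
  refine b.trans ?_
  have u1 := abs_nonneg (ev (dd eT S.β) p)
  have u2 := abs_nonneg (ev S.Ut p)
  have u3 := abs_nonneg (ev S.At p)
  nlinarith [mul_nonneg h1 u2, mul_nonneg h1 u3, mul_nonneg h2 u1, mul_nonneg h2 u3, mul_nonneg h3 u1, mul_nonneg h3 u2,
    mul_nonneg h4 u1, mul_nonneg h4 u2, mul_nonneg h4 u3]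

end Sys

namespace Sys

variable [hfact : Fact (0 < tp)] (S : Sys tp ti)

theorem Ut_sq_le {p : E5} (hp : p ∈ strip tp ti) {Y : ℝ} (h1 : ev (S.g 1) p ≤ Y) (h2 : ev (S.g (-1)) p ≤ Y) :
    ev S.Ut p ^ 2 ≤ Y ∧ ev S.h p * ev S.At p ^ 2 ≤ Y := by
  have h := S.g_add hp
  have h0 := S.h_pos hp
  have : 0 ≤ ev S.h p * ev S.At p ^ 2 := by positivity
  have : 0 ≤ ev S.h p * ev S.XA p ^ 2 := by positivity
  constructor <;> nlinarith [sq_nonneg (ev S.XU p), sq_nonneg (ev S.Ut p)]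

theorem step_g : ∃ C, 0 ≤ C ∧ ∀ p ∈ early tp ti, ∀ Y : ℝ, 1 ≤ Y → 1 ≤ Real.log Y →
    (∀ v : V3, ev (S.F * S.P ^ 2) (p.1, p.2.1, v) ≤ Y ^ 2) → ev (S.g 1) p ≤ Y → ev (S.g (-1)) p ≤ Y →
    ∀ ε : ℝ, ε = 1 ∨ ε = -1 → (∀ e : ℝ × V3, ev (dd (0, e) (S.g ε)) p = 0) →
      -(C * (Y * Real.log Y)) ≤ ev (dd eT (S.g ε)) p := by
  obtain ⟨C1, h1, hC1⟩ := S.mom_log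
  obtain ⟨C2, h2, hC2⟩ := S.sources_le
  obtain ⟨Ct, hCt, hCt'⟩ := Bd.tI (W := early tp ti) (tp := tp) (ti := ti)
  obtain ⟨Ch, hCh, hCh'⟩ := S.bd_h
  refine ⟨C2 * (1 + C1) * (4 + Ch) + 6 * Ct, by positivity, fun p hp Y hY hl hFP g1 g2 ε hε hcrit => ?_⟩
  have hps := early_strip hp
  obtain ⟨m1, -⟩ := hC1 p hp Y hY hl hFP
  obtain ⟨s1, s2, s3⟩ := hC2 p hp
  have hm : C2 * (1 + S.mom S.rp p) ≤ C2 * (1 + C1) * Real.log Y := by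
    rw [mul_assoc]; exact mul_le_mul_of_nonneg_left (by nlinarith) h2
  have hεε : ε * ε = 1 := by rcases hε with h | h <;> rw [h] <;> norm_num
  have hgε : ev (S.g ε) p ≤ Y := by rcases hε with h | h <;> rw [h] <;> assumption
  have hX : ev (S.X (S.g ε)) p = 0 := by
    rw [Fld.X_apply, ev_mul, show (eθ : E5) = (0, ((1:ℝ), (0:V3))) from rfl, hcrit, mul_zero]
  have e := S.dT_g hεε hps
  rw [hX, mul_zero, sub_zero] at e
  rw [e]
  obtain ⟨b1, b2, b3⟩ := S.g_ge hps ε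
  obtain ⟨c1, c2⟩ := S.Ut_sq_le hps g1 g2
  exact step_g_aux (s3.trans hm) (s1.trans hm) (s2.trans hm) (tI_pos hps).le ((le_abs_self _).trans (hCt' p hp))
    (S.h_pos hps).le ((le_abs_self _).trans (hCh' p hp)) (b1.trans hgε) c1 (b2.trans hgε) c2 b3 hgε hY hl (by positivity)

theorem step_P : ∃ C, 0 ≤ C ∧ ∀ p ∈ early tp ti, ∀ Y : ℝ, 1 ≤ Y → 1 ≤ Real.log Y →
    (∀ v : V3, ev (S.F * S.P ^ 2) (p.1, p.2.1, v) ≤ Y ^ 2) → ev (S.g 1) p ≤ Y → ev (S.g (-1)) p ≤ Y →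
    ev (S.F * S.P ^ 2) p = Y ^ 2 → (∀ e : ℝ × V3, ev (dd (0, e) (S.F * S.P ^ 2)) p = 0) →
      -(2 * C * (Y ^ 2 * Real.log Y)) ≤ ev (dd eT (S.F * S.P ^ 2)) p := by
  obtain ⟨C1, h1, hC1⟩ := S.mom_log
  obtain ⟨C2, h2, hC2⟩ := S.sources_le
  obtain ⟨CN, hCN, hCN'⟩ := S.N_le_g
  obtain ⟨Cm, hCm, hCm'⟩ := S.dT_m2_le
  obtain ⟨Fm, hFm, hF⟩ := S.F_le
  obtain ⟨c, hc, hc'⟩ := S.h_ge'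
  have hs := S.supp_sub
  obtain ⟨Cf, hCf, hCf'⟩ := ((((Bd.tI.pow 3).mul (S.bd_E0.mono hs)).mul (S.bd_κ.mono hs)).mul S.bd_w).add
    (((Bd.tI.mul (S.bd_E4.mono hs)).mul (S.bd_JK.1.mono hs)).mul S.bd_v2)
  set C5 := Cm * (2 + 3 * (3 * CN + C1) + (1 + c⁻¹)) with hC5
  refine ⟨(Fm + 1) * C5 + C2 * (1 + C1) + Cf * ((Fm + 1) + 1), by positivity,
    fun p hp Y hY hl hFP g1 g2 heq hcrit => ?_⟩
  have hps := early_strip hp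
  obtain ⟨m1, m2⟩ := hC1 p hp Y hY hl hFP
  obtain ⟨-, -, s3⟩ := hC2 p hp
  have hm : C2 * (1 + S.mom S.rp p) ≤ C2 * (1 + C1) * Real.log Y := by
    rw [mul_assoc]; exact mul_le_mul_of_nonneg_left (by nlinarith) h2
  have hY0 : 0 < Y := by linarith
  have hYl : Y ≤ Y * Real.log Y := by nlinarith
  have hFne : ev S.F p ≠ 0 := fun h => by
    rw [ev_mul, h, zero_mul] at heq; have : 0 < Y ^ 2 := by positivity
    linarith
  have hsup : p ∈ S.supp := ⟨hp, hFne⟩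
  have f0 := S.F_nonneg p hps
  have P0 := S.P_pos hps
  have hq : p.2.2.1 ^ 2 ≤ ev S.P p := by rw [S.ev_P hps]; linarith [S.m2_pos hps]
  have heq' : ev S.F p * ev S.P p ^ 2 = Y ^ 2 := by rw [← heq, ev_mul, ev_pow _ _ hps]
  have hfP1 : ev S.F p * ev S.P p ≤ (Fm + 1) * Y := by
    refine (le_abs_self _).trans (abs_le_of_sq_le_sq ?_ (by positivity))
    have : (ev S.F p * ev S.P p) ^ 2 = ev S.F p * Y ^ 2 := by rw [← heq']; ring
    rw [this, mul_pow]
    exact mul_le_mul_of_nonneg_right (by nlinarith [hF p hp]) (by positivity)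
  -- derivative of the mass term
  have hm2 : |ev (dd eT S.m2) p| ≤ C5 * (Y * Real.log Y) := by
    refine (hCm' p hsup).trans ?_
    rw [hC5, mul_assoc]
    refine mul_le_mul_of_nonneg_left ?_ hCm
    obtain ⟨c1, c2⟩ := S.Ut_sq_le hps g1 g2
    have u1 : |ev S.Ut p| ≤ Y := abs_le_of_sq_le_sq (by nlinarith) hY0.le
    have u2 : |ev (dd eT S.β) p| ≤ 3 * (3 * CN + C1) * (Y * Real.log Y) := by
      refine (S.abs_βt_le hps).trans ?_
      rw [mul_assoc]
      refine mul_le_mul_of_nonneg_left ((hCN' p hp).trans ?_) (by norm_num)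
      have : CN * (1 + ev (S.g 1) p + ev (S.g (-1)) p) ≤ CN * (3 * (Y * Real.log Y)) :=
        mul_le_mul_of_nonneg_left (by linarith) hCN
      linarith
    have u3 : |ev S.At p| ≤ (1 + c⁻¹) * (Y * Real.log Y) := by
      have h0 := hc' p hp
      have e1 : c * ev S.At p ^ 2 ≤ Y := (mul_le_mul_of_nonneg_right h0 (sq_nonneg _)).trans c2
      have e2 : ev S.At p ^ 2 ≤ c⁻¹ * Y := by rw [inv_mul_eq_div, le_div_iff₀ hc]; linarith
      have e3 : |ev S.At p| ≤ 1 + ev S.At p ^ 2 := by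
        rw [abs_le]; constructor <;> nlinarith [sq_nonneg (ev S.At p - 1), sq_nonneg (ev S.At p + 1)]
      have e4 : c⁻¹ * Y ≤ c⁻¹ * (Y * Real.log Y) := mul_le_mul_of_nonneg_left hYl (by positivity)
      linarith
    linarith
  have hTr : ev (Tr S.c S.b (S.F * S.P ^ 2)) p = 2 * (ev S.F p * ev S.P p) *
      (ev (dd eT S.m2) p + ev S.Lt p * p.2.2.1 ^ 2 + 2 * (p.2.2.1 *
        ev (tI ^ 3 * S.E0 * S.κ * S.w + tI * S.E4 * S.J * v2R) p)) := by
    rw [Derivation.leibniz, S.eV, smul_zero, add_zero, sq, Derivation.leibniz, S.Tr_P, S.dq_m2]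
    simp only [smul_eq_mul, ev_mul, ev_add, ev_smul, ev_qR hps, ev_pow _ _ hps, ev_zero]
    ring
  have hT2 : ev (dd eT (S.F * S.P ^ 2)) p = ev (Tr S.c S.b (S.F * S.P ^ 2)) p := by
    rw [Tr_apply, ev_add, ev_add, ev_mul, ev_mul, show (eθ : E5) = (0, ((1:ℝ), (0:V3))) from rfl,
      show (e1 : E5) = (0, ((0:ℝ), ((1, 0, 0):V3))) from rfl, hcrit, hcrit]
    ring
  rw [hT2, hTr]
  exact step_P_aux f0 P0.le hq heq' hfP1 hm2 (s3.trans hm) (hCf' p hsup) hY hl (by positivity) (by positivity)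

/-- the null energies and the momenta are bounded -/
theorem first_order : ∃ Y, 1 ≤ Y ∧ 1 ≤ Real.log Y ∧ ∀ p ∈ early tp ti, ev (S.g 1) p ≤ Y ∧ ev (S.g (-1)) p ≤ Y ∧
    ∀ v : V3, ev (S.F * S.P ^ 2) (p.1, p.2.1, v) ≤ Y ^ 2 := by
  obtain ⟨C1, h1, hC1⟩ := S.step_g
  obtain ⟨C2, h2, hC2⟩ := S.step_P
  obtain ⟨B1, hB1, hB1'⟩ := S.bdd_tm (S.base_g 1)
  obtain ⟨B2, hB2, hB2'⟩ := S.bdd_tm (S.base_g (-1))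
  obtain ⟨B3, hB3'⟩ := S.FP_start
  set B3' := |B3|
  have hB3 : 0 ≤ B3' := abs_nonneg _
  set lam := C1 + C2 + 1 with hlam
  set μ := B1 + B2 + B3' with hμ
  set l : ℝ → ℝ := fun t => Real.exp (lam * (tm tp ti - t) + μ) with hl
  set Y : ℝ → ℝ := fun t => Real.exp (l t) with hY
  have hlog : ∀ t, Real.log (Y t) = l t := fun t => Real.log_exp _
  have hl' : ∀ t, HasDerivAt l (-lam * l t) t := fun t => by
    have := ((((hasDerivAt_id t).const_sub (tm tp ti)).const_mul lam).add_const μ).exp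
    simp only [id] at this
    convert this using 1
    simp only [hl]; ring
  have hY' : ∀ t, HasDerivAt Y (-lam * (Y t * l t)) t := fun t => by
    have := (hl' t).exp
    convert this using 1
    simp only [hY]; ring
  have hl1 : ∀ t ∈ Ioc tp (tm tp ti), 1 ≤ l t := fun t ht => Real.one_le_exp (by
    have := ht.2
    have : 0 ≤ lam * (tm tp ti - t) := mul_nonneg (by positivity) (by linarith)
    linarith)
  have hY1 : ∀ t ∈ Ioc tp (tm tp ti), 1 ≤ Y t := fun t ht => Real.one_le_exp (by linarith [hl1 t ht])
  let G : Option Bool → SF tp ti := fun i => match i with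
    | none => S.F * S.P ^ 2
    | some true => S.g 1
    | some false => S.g (-1)
  let y : Option Bool → ℝ → ℝ := fun i t => match i with
    | none => Y t ^ 2
    | some _ => Y t
  let y' : Option Bool → ℝ → ℝ := fun i t => match i with
    | none => -(2 * lam * (Y t ^ 2 * l t))
    | some _ => -lam * (Y t * l t)
  have key := barrier_early G y y' ?_ ?_ ?_ ?_
  · have htp : 0 ≤ lam * (tm tp ti - tp) := by
      have := (tm_mem S.lt).1
      exact mul_nonneg (by positivity) (by linarith)
    refine ⟨Y tp, Real.one_le_exp (Real.exp_pos _).le, ?_, fun p hp => ?_⟩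
    · rw [hlog]; exact Real.one_le_exp (by positivity)
    · have hp' := mem_early.1 hp
      have hle : Y p.1 ≤ Y tp := Real.exp_le_exp.2 (Real.exp_le_exp.2 (by
        have : lam * (tm tp ti - p.1) ≤ lam * (tm tp ti - tp) :=
          mul_le_mul_of_nonneg_left (by linarith [hp'.1]) (by positivity)
        linarith))
      refine ⟨(key p.1 hp' (some true) p.2.1 p.2.2).le.trans hle, (key p.1 hp' (some false) p.2.1 p.2.2).le.trans hle,
        fun v => (key p.1 hp' none p.2.1 v).le.trans ?_⟩
      exact pow_le_pow_left₀ (Real.exp_pos _).le hle 2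
  · rintro (_ | _) t ht
    · have h := ((hY' t).pow 2).congr_deriv (f' := _) (g' := -(2 * lam * (Y t ^ 2 * l t))) (by push_cast; ring)
      exact h
    · exact hY' t
  · intro t0 ht0
    obtain ⟨R, hR0, hR⟩ := S.exists_supp (early_Ioo ht0)
    refine ⟨R, fun s hs i θ v hv => ?_⟩
    have htm := early_Ioo (tm_mem S.lt)
    have hs' : s ∈ Ico t0 ti := ⟨hs.1, hs.2.trans_lt htm.2⟩
    have hss : s ∈ Ioo tp ti := ⟨ht0.1.trans_le hs.1, hs'.2⟩
    refine ⟨0, by simpa using hR0.le, ?_⟩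
    rcases i with _ | _ | _
    · have : ev S.F (s, θ, v) = 0 := by
        by_contra h; exact absurd (hR s hs' θ v h) (not_lt.2 hv.le)
      simp only [G, ev_mul, this, zero_mul]
      have hp : ((s, θ, 0) : E5) ∈ strip tp ti := mem_strip.2 hss
      rw [ev_pow _ _ hp]
      exact mul_nonneg (S.F_nonneg _ hp) (sq_nonneg _)
    · exact (S.base_g _ _ _ _ _).le
    · exact (S.base_g _ _ _ _ _).le
  · have hlm : μ < l (tm tp ti) := by
      simp only [hl, sub_self, mul_zero, zero_add]
      linarith [Real.add_one_le_exp μ]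
    have hYm : μ < Y (tm tp ti) := by
      have := Real.add_one_le_exp (l (tm tp ti))
      simp only [hY]; linarith
    have hY1m := hY1 _ (tm_mem S.lt)
    rintro (_ | _ | _) θ v
    · have := (hB3' θ v).trans (le_abs_self _)
      refine this.trans_lt ?_
      simp only [y]
      show B3' < _
      nlinarith
    · have := (le_abs_self _).trans (hB2' θ v)
      refine this.trans_lt ?_
      simp only [y]
      linarith
    · have := (le_abs_self _).trans (hB1' θ v)
      refine this.trans_lt ?_
      simp only [y]
      linarith
  · intro s hs i θ v hall heq hcrit
    have hp : ((s, θ, v) : E5) ∈ early tp ti := mem_early.2 hs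
    have k1 : 1 ≤ Real.log (Y s) := by rw [hlog]; exact hl1 s hs
    have hFP : ∀ v' : V3, ev (S.F * S.P ^ 2) (s, θ, v') ≤ Y s ^ 2 := fun v' => hall none θ v'
    have hg1 : ev (S.g 1) (s, θ, v) ≤ Y s := hall (some true) θ v
    have hg2 : ev (S.g (-1)) (s, θ, v) ≤ Y s := hall (some false) θ v
    have pos : 0 < Y s * l s := mul_pos (Real.exp_pos _) (Real.exp_pos _)
    have pos2 : 0 < Y s ^ 2 * l s := mul_pos (pow_pos (Real.exp_pos _) 2) (Real.exp_pos _)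
    have a1 : C1 * (Y s * l s) < lam * (Y s * l s) := mul_lt_mul_of_pos_right (by rw [hlam]; linarith) pos
    have a2 : C2 * (Y s ^ 2 * l s) < lam * (Y s ^ 2 * l s) := mul_lt_mul_of_pos_right (by rw [hlam]; linarith) pos2
    rcases i with _ | _ | _
    · have := hC2 _ hp (Y s) (hY1 s hs) k1 hFP hg1 hg2 heq hcrit
      rw [hlog] at this
      refine lt_of_lt_of_le ?_ this
      simp only [y']; linarith
    · have := hC1 _ hp (Y s) (hY1 s hs) k1 hFP hg1 hg2 (-1) (Or.inr rfl) hcrit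
      rw [hlog] at this
      refine lt_of_lt_of_le ?_ this
      simp only [y']; linarith
    · have := hC1 _ hp (Y s) (hY1 s hs) k1 hFP hg1 hg2 1 (Or.inl rfl) hcrit
      rw [hlog] at this
      refine lt_of_lt_of_le ?_ this
      simp only [y']; linarith

end Sys

namespace Sys

variable [hfact : Fact (0 < tp)] (S : Sys tp ti)

theorem first_order_bd : (Bd (early tp ti) S.Ut ∧ Bd (early tp ti) S.XU) ∧ (Bd (early tp ti) S.At ∧ Bd (early tp ti) S.XA)
    ∧ Bd (early tp ti) S.Lt ∧ Bd (early tp ti) S.N := by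
  obtain ⟨Y, hY, hl, h⟩ := S.first_order
  obtain ⟨c, hc, hc'⟩ := S.h_ge'
  obtain ⟨Cm, hCm, hCm'⟩ := S.mom_log
  obtain ⟨CN, hCN, hCN'⟩ := S.N_le_g
  obtain ⟨Cs, hCs, hCs'⟩ := S.sources_le
  have key : ∀ p ∈ early tp ti, (ev S.Ut p ^ 2 ≤ Y ∧ ev S.XU p ^ 2 ≤ Y) ∧
      (c * ev S.At p ^ 2 ≤ Y ∧ c * ev S.XA p ^ 2 ≤ Y) := fun p hp => by
    have h1 := S.g_add (early_strip hp)
    have h2 := hc' p hp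
    obtain ⟨g1, g2, -⟩ := h p hp
    have h3 := mul_le_mul_of_nonneg_right h2 (sq_nonneg (ev S.At p))
    have h4 := mul_le_mul_of_nonneg_right h2 (sq_nonneg (ev S.XA p))
    have h5 : 0 ≤ c * ev S.At p ^ 2 := by positivity
    have h6 : 0 ≤ c * ev S.XA p ^ 2 := by positivity
    refine ⟨⟨?_, ?_⟩, ?_, ?_⟩ <;> nlinarith [sq_nonneg (ev S.Ut p), sq_nonneg (ev S.XU p)]
  have of1 : ∀ G : SF tp ti, (∀ p ∈ early tp ti, ev G p ^ 2 ≤ Y) → Bd (early tp ti) G := fun G hG =>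
    ⟨Y, by linarith, fun p hp => abs_le_of_sq_le_sq (by nlinarith [hG p hp]) (by linarith)⟩
  have of2 : ∀ G : SF tp ti, (∀ p ∈ early tp ti, c * ev G p ^ 2 ≤ Y) → Bd (early tp ti) G := fun G hG =>
    ⟨1 + c⁻¹ * Y, by positivity, fun p hp => by
      have h1 := hG p hp
      have h2 : ev G p ^ 2 ≤ c⁻¹ * Y := by rw [inv_mul_eq_div, le_div_iff₀ hc]; linarith
      rw [abs_le]; constructor <;> nlinarith [sq_nonneg (ev G p - 1), sq_nonneg (ev G p + 1)]⟩
  refine ⟨⟨of1 _ fun p hp => (key p hp).1.1, of1 _ fun p hp => (key p hp).1.2⟩,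
    ⟨of2 _ fun p hp => (key p hp).2.1, of2 _ fun p hp => (key p hp).2.2⟩,
    ⟨Cs * (1 + Cm * Real.log Y), by positivity, fun p hp => (hCs' p hp).2.2.trans ?_⟩,
    ⟨CN * (1 + Y + Y) + Cm * (Y * Real.log Y), by positivity, fun p hp => ?_⟩⟩
  · have := (hCm' p hp Y hY hl (h p hp).2.2).1
    exact mul_le_mul_of_nonneg_left (by linarith) hCs
  · rw [abs_of_nonneg (S.N_nonneg (early_strip hp))]
    have h1 := (hCm' p hp Y hY hl (h p hp).2.2).2
    have h2 := hCN' p hp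
    obtain ⟨g1, g2, -⟩ := h p hp
    have : CN * (1 + ev (S.g 1) p + ev (S.g (-1)) p) ≤ CN * (1 + Y + Y) :=
      mul_le_mul_of_nonneg_left (by linarith) hCN
    linarith

theorem bd_Lt : Bd (early tp ti) S.Lt := S.first_order_bd.2.2.1
theorem bd_N : Bd (early tp ti) S.N := S.first_order_bd.2.2.2
theorem bd_Xβ : Bd (early tp ti) (S.X S.β) := S.bd_N.of_le fun p hp =>
  (S.abs_Xβ_le (early_strip hp)).trans (le_abs_self _)
include S in
theorem bd_of_dT {G : SF tp ti} (hG : Base G) (h : Bd (early tp ti) (dd eT G)) : Bd (early tp ti) G := by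
  obtain ⟨C, h0, hC⟩ := h
  obtain ⟨D, k0, hD⟩ := S.bdd_tm hG
  refine ⟨D + C * (tm tp ti - tp), add_nonneg k0 (mul_nonneg h0 (by have := (tm_mem S.lt).1; linarith)), fun p hp => ?_⟩
  obtain ⟨t, θ, v⟩ := p
  have ht := mem_early.1 hp
  have hsub : Icc t (tm tp ti) ⊆ Ioc tp (tm tp ti) := fun s hs => ⟨ht.1.trans_le hs.1, hs.2⟩
  have := (convex_Icc t (tm tp ti)).norm_image_sub_le_of_norm_hasDerivWithin_le
    (f := fun s => ev G (s, θ, v)) (f' := fun s => ev (dd eT G) (s, θ, v)) (C := C)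
    (fun s hs => (hasDerivAt_ev_t G (early_Ioo (hsub hs))).hasDerivWithinAt)
    (fun s hs => hC (s, θ, v) (mem_early.2 (hsub hs))) (left_mem_Icc.2 ht.2) (right_mem_Icc.2 ht.2)
  simp only [Real.norm_eq_abs] at this
  have h1 := hD θ v
  have h2 : C * |tm tp ti - t| ≤ C * (tm tp ti - tp) :=
    mul_le_mul_of_nonneg_left (by rw [abs_of_nonneg (by linarith [ht.2])]; linarith [ht.1]) h0
  have h3 := abs_sub_abs_le_abs_sub (ev G (t, θ, v)) (ev G (tm tp ti, θ, v))
  rw [abs_sub_comm] at h3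
  linarith

theorem bd_L : Bd (early tp ti) S.L := S.bd_of_dT S.bL S.bd_Lt
theorem X_m2 : S.X S.m2 = S.X S.β * ((2 : ℝ) • S.m2) - S.XU * ((2:ℝ) • S.E2 + (4:ℝ) • (S.E4 * v2R ^ 2))
    - S.XA * ((2:ℝ) • (tI ^ 2 * S.E0 * S.w * v2R)) := by
  simp only [Fld.XU, Fld.XA, Fld.X_apply, S.dd_m2 eθ rfl rfl, dd_tI]
  simp only [eθ, zero_smul, neg_zero, zero_mul, add_zero]
  ring

/-- bounded pieces on sets where the last two velocities are bounded -/
theorem bd_slab {W : Set E5} (hW : W ⊆ early tp ti) (h2 : Bd W (v2R : SF tp ti)) (h3 : Bd W (v3R : SF tp ti)) :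
    Bd W S.w ∧ Bd W S.m2 ∧ Bd W (S.X S.m2) ∧ Bd W S.rp ∧ Bd W S.b1 := by
  have hw : Bd W S.w := h3.sub ((S.bd_A.mono hW).mul h2)
  have hm : Bd W S.m2 := ((S.bd_E2.mono hW).add ((S.bd_E4.mono hW).mul (h2.pow 2))).add
    (((Bd.tI.pow 2).mul (S.bd_E0.mono hW)).mul (hw.pow 2))
  have hX : Bd W (S.X S.m2) := by
    rw [X_m2]
    exact (((S.bd_Xβ.mono hW).mul (hm.smul 2)).sub ((S.first_order_bd.1.2.mono hW).mul
      (((S.bd_E2.mono hW).smul 2).add (((S.bd_E4.mono hW).mul (h2.pow 2)).smul 4)))).sub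
      ((S.first_order_bd.2.1.2.mono hW).mul ((((Bd.tI.pow 2).mul (S.bd_E0.mono hW)).mul hw).mul h2 |>.smul 2))
  have hrp : Bd W S.rp := S.toFld.bd_rp (hW.trans fun p hp => early_strip hp) (S.bd_U.mono hW) (S.bd_β.mono hW)
  exact ⟨hw, hm, hX, hrp, (((hX.mul hrp).smul _).add
    ((((Bd.tI.pow 3).mul (S.bd_E0.mono hW)).mul (S.bd_κ.mono hW)).mul hw)).add
    (((Bd.tI.mul (S.bd_E4.mono hW)).mul (S.bd_JK.1.mono hW)).mul h2)⟩

theorem b_lin_early (R : ℝ) : ∃ Λ, 0 ≤ Λ ∧ ∀ t ∈ Ioc tp (tm tp ti), ∀ θ (v : V3), v.2.1 ^ 2 + v.2.2 ^ 2 ≤ R →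
    |ev S.b (t, θ, v)| ≤ Λ * (1 + |v.1|) := by
  set W : Set E5 := {p | p ∈ early tp ti ∧ p.2.2.2.1 ^ 2 + p.2.2.2.2 ^ 2 ≤ R} with hWdef
  have hW : W ⊆ early tp ti := fun p hp => hp.1
  have hsq : ∀ x y : ℝ, x ^ 2 + y ^ 2 ≤ R → |x| ≤ |R| + 1 ∧ |y| ≤ |R| + 1 := fun x y h => by
    have := le_abs_self R
    have := abs_nonneg R
    constructor <;> refine abs_le_of_sq_le_sq ?_ (by positivity) <;> nlinarith [sq_nonneg x, sq_nonneg y]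
  have h2 : Bd W (v2R : SF tp ti) := ⟨|R| + 1, by positivity, fun p hp => by
    rw [ev_v2R (early_strip hp.1)]; exact (hsq _ _ hp.2).1⟩
  have h3 : Bd W (v3R : SF tp ti) := ⟨|R| + 1, by positivity, fun p hp => by
    rw [ev_v3R (early_strip hp.1)]; exact (hsq _ _ hp.2).2⟩
  obtain ⟨C, C0, hC⟩ := (S.bd_slab hW h2 h3).2.2.2.2
  obtain ⟨D, D0, hD⟩ := S.bd_Lt
  refine ⟨C + D, by positivity, fun t ht θ v hv => ?_⟩
  have hpe : ((t, θ, v) : E5) ∈ early tp ti := mem_early.2 ht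
  have hp := early_strip hpe
  have a1 := hC (t, θ, v) ⟨hpe, hv⟩
  have a2 := hD (t, θ, v) hpe
  rw [Fld.b, ev_add, ev_smul, ev_mul, ev_qR hp]
  refine (abs_add_le _ _).trans ?_
  rw [abs_mul, abs_mul, abs_of_pos (by norm_num : (0:ℝ) < 1/2)]
  have q0 := abs_nonneg v.1
  have : |ev S.Lt (t, θ, v)| * |v.1| ≤ D * |v.1| := mul_le_mul_of_nonneg_right a2 q0
  show 1 / 2 * (|ev S.Lt (t, θ, v)| * |v.1|) + |ev S.b1 (t, θ, v)| ≤ _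
  nlinarith [mul_nonneg C0 q0, mul_nonneg D0 q0]

/-- the velocity support is bounded uniformly in time -/
theorem supp_bdd : ∃ B, 0 < B ∧ ∀ p ∈ strip tp ti, ev S.F p ≠ 0 → ‖p.2.2‖ < B := by
  have htm := early_Ioo (tm_mem S.lt)
  obtain ⟨R1, hR1, hR1'⟩ := S.exists_supp htm
  obtain ⟨R, hR0, hR⟩ := S.exists_supp23
  obtain ⟨Λ, h0, hΛ⟩ := S.b_lin_early R
  set Q := Real.log (1 + R1 ^ 2) with hQ
  have hexp := Real.exp_pos (Q + 4 * Λ * (tm tp ti - tp))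
  refine ⟨R1 + (Real.exp (Q + 4 * Λ * (tm tp ti - tp)) + |R| + 1 + 1), by positivity, fun p hp hne => ?_⟩
  obtain ⟨t, θ, v⟩ := p
  have ht := mem_strip.1 hp
  rcases le_total (tm tp ti) t with hle | hle
  · exact (hR1' t ⟨hle, ht.2⟩ θ v hne).trans (by have := abs_nonneg R; linarith)
  have hs : ∀ s ∈ Icc t (tm tp ti), 1 * s ∈ Ioc tp (tm tp ti) := fun s hs => by
    rw [one_mul]; exact ⟨ht.1.trans_le hs.1, hs.2⟩
  have := propagate_q 1 (by norm_num) S.c S.b S.F S.eV (s0 := t) (s1 := tm tp ti) (Λ := Λ) (R := R) (Q := Q)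
    (fun s hs' => early_Ioo (hs s hs')) h0 S.F_nonneg
    (fun R => by
      obtain ⟨Λ, h0, hΛ⟩ := S.b_lin_early R
      exact ⟨Λ, h0, fun s hs' θ v hv => hΛ _ (hs s hs') θ v hv⟩) hR
    (fun s hs' θ v hv => hΛ _ (hs s hs') θ v hv)
    (fun θ v hne => by
      have h1 := (hR1' _ ⟨le_rfl, htm.2⟩ θ v (by simpa using hne)).le
      simp only [Prod.norm_def, Real.norm_eq_abs, max_le_iff] at h1
      refine Real.log_le_log (by positivity) ?_
      have := sq_le_sq' (by linarith [neg_abs_le v.1, h1.1]) ((le_abs_self v.1).trans h1.1)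
      linarith) t (left_mem_Icc.2 hle) θ v (by simpa using hne)
  have h2 : Q + 4 * Λ * (tm tp ti - t) ≤ Q + 4 * Λ * (tm tp ti - tp) := by
    have : tm tp ti - t ≤ tm tp ti - tp := by linarith [ht.1]
    have := mul_le_mul_of_nonneg_left this (by positivity : 0 ≤ 4 * Λ)
    linarith
  refine (norm_le_of_log (hR _ hp hne) (this.trans h2)).trans_lt ?_
  linarith

end Sys

/-- all words of length `< n` in the derivations `D` are bounded on `W`, those of length `n` are `O(N)` -/
def PB {ι : Type} (W : Set E5) (D : ι → Derivation ℝ (SF tp ti) (SF tp ti)) (N : ℝ → ℝ) : ℕ → SF tp ti → Prop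
  | 0, G => ∃ C, 0 ≤ C ∧ ∀ p ∈ W, |ev G p| ≤ C * N p.1
  | n + 1, G => Bd W G ∧ ∀ i, PB W D N n (D i G)

namespace PB

variable {ι : Type} {W : Set E5} {D : ι → Derivation ℝ (SF tp ti) (SF tp ti)} {N : ℝ → ℝ} {n : ℕ} {G H : SF tp ti}

theorem zero_one_iff : PB W D 1 0 G ↔ Bd W G := by simp [PB, Bd]

theorem of_bd (hN : ∀ p ∈ W, 1 ≤ N p.1) (h : Bd W G) : PB W D N 0 G := by
  obtain ⟨C, h0, hC⟩ := h
  exact ⟨C, h0, fun p hp => (hC p hp).trans (le_mul_of_one_le_right h0 (hN p hp))⟩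

theorem down (hN : ∀ p ∈ W, 1 ≤ N p.1) (h : PB W D N (n + 1) G) : PB W D N n G := by
  induction n generalizing G with
  | zero => exact of_bd hN h.1
  | succ n ih => exact ⟨h.1, fun i => ih (h.2 i)⟩

theorem of_one (hN : ∀ p ∈ W, 1 ≤ N p.1) (h : PB W D 1 n G) : PB W D N n G := by
  induction n generalizing G with
  | zero => exact of_bd hN (zero_one_iff.1 h)
  | succ n ih => exact ⟨h.1, fun i => ih (h.2 i)⟩

theorem bd (h : PB W D 1 n G) : Bd W G := by
  cases n with
  | zero => exact zero_one_iff.1 h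
  | succ n => exact h.1

theorem zero (hN : ∀ p ∈ W, 1 ≤ N p.1) : PB W D N n (0 : SF tp ti) := by
  induction n with
  | zero => exact of_bd hN Bd.zero
  | succ n ih => exact ⟨Bd.zero, fun i => by rw [map_zero]; exact ih⟩

theorem smul (c : ℝ) (h : PB W D N n G) : PB W D N n (c • G) := by
  induction n generalizing G with
  | zero =>
    obtain ⟨C, h0, hC⟩ := h
    refine ⟨|c| * C, by positivity, fun p hp => ?_⟩
    rw [ev_smul, abs_mul, mul_assoc]
    exact mul_le_mul_of_nonneg_left (hC p hp) (abs_nonneg _)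
  | succ n ih => exact ⟨h.1.smul c, fun i => by rw [Derivation.map_smul]; exact ih (h.2 i)⟩

theorem neg (h : PB W D N n G) : PB W D N n (-G) := by
  simpa using h.smul (-1)

theorem add (h : PB W D N n G) (k : PB W D N n H) : PB W D N n (G + H) := by
  induction n generalizing G H with
  | zero =>
    obtain ⟨C, h0, hC⟩ := h
    obtain ⟨C', h0', hC'⟩ := k
    refine ⟨C + C', by positivity, fun p hp => ?_⟩
    rw [ev_add, add_mul]
    exact (abs_add_le _ _).trans (add_le_add (hC p hp) (hC' p hp))
  | succ n ih => exact ⟨h.1.add k.1, fun i => by rw [map_add]; exact ih (h.2 i) (k.2 i)⟩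

theorem sub (h : PB W D N n G) (k : PB W D N n H) : PB W D N n (G - H) := by
  rw [sub_eq_add_neg]; exact h.add k.neg

/-- products; one factor bounded suffices, also at top order -/
theorem mul (hN : ∀ p ∈ W, 1 ≤ N p.1) (h : PB W D N n G) (k : PB W D N n H) (hb : Bd W G) :
    PB W D N n (G * H) := by
  induction n generalizing G H with
  | zero =>
    obtain ⟨C, h0, hC⟩ := hb
    obtain ⟨C', h0', hC'⟩ := k
    refine ⟨C * C', by positivity, fun p hp => ?_⟩
    rw [ev_mul, abs_mul, mul_assoc]
    exact mul_le_mul (hC p hp) (hC' p hp) (abs_nonneg _) h0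
  | succ n ih =>
    refine ⟨h.1.mul k.1, fun i => ?_⟩
    rw [Derivation.leibniz]
    exact (ih (h.down hN) (k.2 i) hb).add (ih (k.down hN) (h.2 i) k.1)

theorem const (hN : ∀ p ∈ W, 1 ≤ N p.1) (c : ℝ) : PB W D N n (algebraMap ℝ (SF tp ti) c) := by
  cases n with
  | zero => exact of_bd hN (Bd.algebraMap c)
  | succ n => exact ⟨Bd.algebraMap c, fun i => by rw [Derivation.map_algebraMap]; exact zero hN⟩

theorem one (hN : ∀ p ∈ W, 1 ≤ N p.1) : PB W D N n (1 : SF tp ti) := by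
  simpa using const (n := n) (D := D) hN 1

theorem pow (hN : ∀ p ∈ W, 1 ≤ N p.1) (h : PB W D N n G) (hb : Bd W G) (k : ℕ) : PB W D N n (G ^ k) := by
  induction k with
  | zero => rw [pow_zero]; exact one hN
  | succ k ih => rw [pow_succ', ]; exact h.mul hN ih hb

theorem expR (hN : ∀ p ∈ W, 1 ≤ N p.1) (hD : ∀ i G, D i (expR G) = _root_.expR G * D i G)
    (h : PB W D N n G) (hb : Bd W G) : PB W D N n (_root_.expR G) := by
  induction n with
  | zero => exact of_bd hN hb.expR
  | succ n ih =>
    exact ⟨hb.expR, fun i => by rw [hD]; exact (ih (h.down hN)).mul hN (h.2 i) hb.expR⟩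

theorem sq_inv (hN : ∀ p ∈ W, 1 ≤ N p.1) {r : SF tp ti} (hr : G * r ^ 2 = 1) (h : PB W D N n G) (hb : Bd W r) :
    PB W D N n r := by
  induction n with
  | zero => exact of_bd hN hb
  | succ n ih =>
    refine ⟨hb, fun i => ?_⟩
    rw [deriv_of_sq_inv (D i) hr]
    exact (((ih (h.down hN)).pow hN hb 3).mul hN (h.2 i) (hb.pow 3)).smul _

theorem const_of (hN : ∀ p ∈ W, 1 ≤ N p.1) (hb : Bd W G) (h : ∀ i, D i G = 0) : PB W D N n G := by
  cases n with
  | zero => exact of_bd hN hb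
  | succ n => exact ⟨hb, fun i => by rw [h]; exact zero hN⟩

theorem linear_of (hN : ∀ p ∈ W, 1 ≤ N p.1) (hb : Bd W G) (h : ∀ i, ∃ c : ℝ, D i G = algebraMap ℝ _ c) :
    PB W D N n G := by
  cases n with
  | zero => exact of_bd hN hb
  | succ n => exact ⟨hb, fun i => by obtain ⟨c, hc⟩ := h i; rw [hc]; exact const hN c⟩

end PB

/-- iterated derivation along a word -/
def Dw {ι : Type} (D : ι → Derivation ℝ (SF tp ti) (SF tp ti)) : List ι → SF tp ti → SF tp ti
  | [], G => G
  | i :: w, G => D i (Dw D w G)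

theorem Dw_append {ι : Type} (D : ι → Derivation ℝ (SF tp ti) (SF tp ti)) (w : List ι) (i : ι) (G : SF tp ti) :
    Dw D (w ++ [i]) G = Dw D w (D i G) := by
  induction w with
  | nil => rfl
  | cons j w ih => simp only [List.cons_append, Dw, ih]

theorem PB.of_words {ι : Type} {W : Set E5} {D : ι → Derivation ℝ (SF tp ti) (SF tp ti)} {N : ℝ → ℝ}
    {n : ℕ} {G : SF tp ti} (h : PB W D 1 n G)
    (k : ∀ w : List ι, w.length = n + 1 → PB W D N 0 (Dw D w G)) : PB W D N (n + 1) G := by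
  induction n generalizing G with
  | zero => exact ⟨h.bd, fun i => k [i] rfl⟩
  | succ n ih =>
    refine ⟨h.bd, fun i => ih (h.2 i) fun w hw => ?_⟩
    rw [← Dw_append]
    exact k _ (by simp [hw])

namespace Sys
variable [hfact : Fact (0 < tp)] (S : Sys tp ti)

/-- velocity bound of the support of the density -/
def B : ℝ := S.supp_bdd.choose
theorem B_pos : 0 < S.B := S.supp_bdd.choose_spec.1
theorem B_supp {p : E5} (hp : p ∈ strip tp ti) (h : ev S.F p ≠ 0) : ‖p.2.2‖ < S.B := S.supp_bdd.choose_spec.2 p hp h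

/-- early times and velocities up to the bound -/
def dom : Set E5 := {p | p ∈ early tp ti ∧ ‖p.2.2‖ ≤ S.B}
theorem dom_sub : S.dom ⊆ early tp ti := fun _ h => h.1
theorem dom_strip {p : E5} (hp : p ∈ S.dom) : p ∈ strip tp ti := early_strip hp.1

/-- momentum integral, as a smooth function -/
def M (φ : SF tp ti) : SF tp ti := MR S.B (S.F * φ)

theorem mom_eq (φ : SF tp ti) {p : E5} (hp : p ∈ strip tp ti) : S.mom φ p = ev (S.M φ) p :=
  S.mom_eq_MR φ hp fun v hv => (S.B_supp (mem' hp v) hv).le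

theorem Bd_early_of_dom {G : SF tp ti} (hG : Base G) (h : Bd S.dom G) : Bd (early tp ti) G := by
  obtain ⟨C, h0, hC⟩ := h
  refine ⟨C, h0, fun p hp => ?_⟩
  obtain ⟨t, θ, v⟩ := p
  rw [hG t θ v 0]
  exact hC (t, θ, 0) ⟨hp, by simpa using S.B_pos.le⟩

theorem PB_MR_zero {N : ℝ → ℝ} {ι : Type} {D : ι → Derivation ℝ (SF tp ti) (SF tp ti)} {G : SF tp ti}
    (h : PB S.dom D N 0 G) : PB S.dom D N 0 (MR S.B G) := by
  obtain ⟨C, h0, hC⟩ := h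
  refine ⟨C * volume.real (closedBall (0 : V3) S.B), mul_nonneg h0 measureReal_nonneg, fun p hp => ?_⟩
  rw [ev_MR _ _ (S.dom_strip hp)]
  have : ∀ v ∈ closedBall (0 : V3) S.B, ‖ev G (p.1, p.2.1, v)‖ ≤ C * N p.1 := fun v hv =>
    hC (p.1, p.2.1, v) ⟨hp.1, by simpa using hv⟩
  have := norm_setIntegral_le_of_norm_le_const (μ := volume) (by exact measure_closedBall_lt_top) this
  rw [Real.norm_eq_abs] at this
  linarith

theorem PB_MR {N : ℝ → ℝ} {ι : Type} {D : ι → Derivation ℝ (SF tp ti) (SF tp ti)} {n : ℕ}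
    (hN : ∀ p ∈ S.dom, 1 ≤ N p.1) (hD : ∀ i G, D i (MR S.B G) = 0 ∨ D i (MR S.B G) = MR S.B (D i G))
    {G : SF tp ti} (h : PB S.dom D N n G) : PB S.dom D N n (MR S.B G) := by
  induction n generalizing G with
  | zero => exact S.PB_MR_zero h
  | succ n ih =>
    refine ⟨PB.zero_one_iff.1 (S.PB_MR_zero (D := D) (PB.zero_one_iff.2 h.1)), fun i => ?_⟩
    rcases hD i G with h' | h' <;> rw [h']
    · exact PB.zero hN
    · exact ih (h.2 i)

/-- vanishing for large velocities -/
def Van (G : SF tp ti) : Prop := ∀ p ∈ strip tp ti, S.B < ‖p.2.2‖ → ev G p = 0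

theorem van_F : S.Van S.F := fun p hp h => by
  by_contra h'
  exact absurd (S.B_supp hp h') (not_lt.2 h.le)

variable {S} in
theorem Van.dd {G : SF tp ti} (h : S.Van G) (e : E5) : S.Van (dd e G) := fun p hp hv => by
  rw [ev_dd _ _ hp]
  have : ev G =ᶠ[𝓝 p] fun _ => 0 := by
    have h1 : {p : E5 | S.B < ‖p.2.2‖} ∈ 𝓝 p := (isOpen_lt continuous_const (by fun_prop)).mem_nhds hv
    filter_upwards [isOpen_strip.mem_nhds hp, h1] with q hq hq' using h q hq hq'
  rw [this.fderiv_eq]; simp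

variable {S} in
theorem Van.mul {G : SF tp ti} (h : S.Van G) (H : SF tp ti) : S.Van (H * G) := fun p hp hv => by
  rw [ev_mul, h p hp hv, mul_zero]
variable {S} in
theorem Van.add {G H : SF tp ti} (h : S.Van G) (k : S.Van H) : S.Van (G + H) := fun p hp hv => by
  rw [ev_add, h p hp hv, k p hp hv, add_zero]
variable {S} in
theorem Van.X {G : SF tp ti} (h : S.Van G) : S.Van (S.X G) := (h.dd eθ).mul _

/-- independent of velocity, or vanishing for large velocities -/
def Loc (G : SF tp ti) : Prop := Base G ∨ S.Van G

variable {S} in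
theorem Loc.dom_of {G : SF tp ti} (h : S.Loc G) {C : ℝ} (h0 : 0 ≤ C) {t : ℝ} (ht : t ∈ Ioo tp ti)
    (hC : ∀ θ v, ‖v‖ ≤ S.B → |ev G (t, θ, v)| ≤ C) (θ : ℝ) (v : V3) : |ev G (t, θ, v)| ≤ C := by
  by_cases hv : ‖v‖ ≤ S.B
  · exact hC _ _ hv
  · rcases h with h | h
    · rw [h t θ v 0]; exact hC θ 0 (by simpa using S.B_pos.le)
    · rw [h (t, θ, v) (mem_strip.2 ht) (not_le.1 hv), abs_zero]; exact h0

/-- one plus the maximum of a family at time `t` -/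
def Nsup {ι : Type} (G : ι → SF tp ti) (t : ℝ) : ℝ :=
  1 + sSup {x | ∃ i θ, ∃ v : V3, ‖v‖ ≤ S.B ∧ x = |ev (G i) (t, θ, v)|}

theorem one_le_Nsup {ι : Type} (G : ι → SF tp ti) (t : ℝ) : 1 ≤ S.Nsup G t := by
  have : 0 ≤ sSup {x | ∃ i θ, ∃ v : V3, ‖v‖ ≤ S.B ∧ x = |ev (G i) (t, θ, v)|} :=
    Real.sSup_nonneg (by rintro x ⟨i, θ, v, -, rfl⟩; exact abs_nonneg _)
  unfold Nsup; linarith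

theorem Nsup_le {ι : Type} (G : ι → SF tp ti) {t Y : ℝ} (hY : 0 ≤ Y)
    (h : ∀ i θ v, |ev (G i) (t, θ, v)| ≤ Y) : S.Nsup G t ≤ 1 + Y := by
  have : sSup {x | ∃ i θ, ∃ v : V3, ‖v‖ ≤ S.B ∧ x = |ev (G i) (t, θ, v)|} ≤ Y :=
    Real.sSup_le (by rintro x ⟨i, θ, v, -, rfl⟩; exact h _ _ _) hY
  unfold Nsup; linarith

theorem le_Nsup {ι : Type} [Finite ι] (G : ι → SF tp ti) {p : E5} (hp : p ∈ S.dom) (i : ι) :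
    |ev (G i) p| ≤ S.Nsup G p.1 := by
  have hs : Icc p.1 p.1 ⊆ Ioo tp ti := fun s hs => by rw [Icc_self] at hs; rw [hs]; exact mem_strip.1 (S.dom_strip hp)
  choose C h0 hC using fun i => ev_bdd (G i) hs S.B
  obtain ⟨D, hD⟩ := (Set.finite_range C).bddAbove
  have := le_csSup (s := {x | ∃ i θ, ∃ v : V3, ‖v‖ ≤ S.B ∧ x = |ev (G i) (p.1, θ, v)|})
    ⟨D, by rintro x ⟨i, θ, v, hv, rfl⟩; exact (hC i p.1 (by simp) θ v hv).trans (hD ⟨i, rfl⟩)⟩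
    ⟨i, p.2.1, p.2.2, hp.2, rfl⟩
  unfold Nsup
  linarith

theorem gronwall {ι : Type} [Finite ι] (G : ι → SF tp ti) (hG : ∀ i, S.Loc (G i)) (c b : ι → SF tp ti)
    (h : ∀ i, ∃ C, 0 ≤ C ∧ ∀ p ∈ S.dom, |ev (Tr (c i) (b i) (G i)) p| ≤ C * S.Nsup G p.1) (i : ι) :
    Bd (early tp ti) (G i) := by
  choose C h0 hC using h
  obtain ⟨Λ, hΛ⟩ := (Set.finite_range C).bddAbove
  have hΛ0 : 0 ≤ Λ := (h0 i).trans (hΛ ⟨i, rfl⟩)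
  have htm := early_Ioo (tm_mem S.lt)
  have hs : Icc (tm tp ti) (tm tp ti) ⊆ Ioo tp ti := fun s hs => by rw [Icc_self] at hs; rwa [hs]
  choose C1 k0 hC1 using fun i => ev_bdd (G i) hs S.B
  obtain ⟨Γ, hΓ⟩ := (Set.finite_range C1).bddAbove
  have hΓ0 : 0 ≤ Γ := (k0 i).trans (hΓ ⟨i, rfl⟩)
  set Y : ℝ → ℝ := fun t => (Γ + 1) * Real.exp ((2 * Λ + 1) * (tm tp ti - t)) with hY
  have hY1 : ∀ t ∈ Ioc tp (tm tp ti), 1 ≤ Y t := fun t ht => by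
    have := Real.one_le_exp (x := (2 * Λ + 1) * (tm tp ti - t)) (mul_nonneg (by linarith) (by linarith [ht.2]))
    simp only [hY]; nlinarith
  have hd : ∀ t, HasDerivAt Y (-((2 * Λ + 1) * Y t)) t := fun t => by
    have := ((((hasDerivAt_id t).const_sub (tm tp ti)).const_mul (2 * Λ + 1)).exp).const_mul (Γ + 1)
    exact this.congr_deriv (by simp only [hY, id]; ring)
  have key := barrier_early (ι := ι × Bool) (fun j => if j.2 then G j.1 else -(G j.1)) (fun _ => Y)
    (fun _ t => -((2 * Λ + 1) * Y t)) (fun _ t _ => hd t)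
    (fun t0 ht0 => by
      refine ⟨S.B + 1, fun s hs j θ v hv => ?_⟩
      have hs' := early_Ioo (tp := tp) (ti := ti) ⟨ht0.1.trans_le hs.1, hs.2⟩
      have hB := S.B_pos
      have hn : ‖((S.B + 1, 0, 0) : V3)‖ = S.B + 1 := by
        simp [Prod.norm_def, abs_of_pos (show (0:ℝ) < S.B + 1 by linarith)]; linarith
      refine ⟨(S.B + 1, 0, 0), hn.le, le_of_eq ?_⟩
      have : ev (G j.1) (s, θ, v) = ev (G j.1) (s, θ, ((S.B + 1, 0, 0) : V3)) := by
        rcases hG j.1 with h' | h'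
        · exact h' _ _ _ _
        · rw [h' (s, θ, v) (mem_strip.2 hs') (show S.B < ‖v‖ by linarith),
            h' (s, θ, _) (mem_strip.2 hs') (show S.B < ‖((S.B + 1, 0, 0) : V3)‖ by rw [hn]; linarith)]
      by_cases hj : j.2
      · simp only [hj, if_true, this]
      · simp only [hj, if_false, ev_neg, this, Bool.false_eq_true])
    (fun j θ v => by
      have h1 := (hG j.1).dom_of hΓ0 htm (fun θ v hv => (hC1 j.1 _ (by simp) θ v hv).trans (hΓ ⟨_, rfl⟩)) θ v
      have h2 : Y (tm tp ti) = Γ + 1 := by simp [hY]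
      rw [h2]
      by_cases hj : j.2
      · simp only [hj, if_true]; linarith [le_abs_self (ev (G j.1) (tm tp ti, θ, v))]
      · simp only [hj, ev_neg, Bool.false_eq_true, if_false]
        linarith [neg_abs_le (ev (G j.1) (tm tp ti, θ, v))])
    (fun s hs j θ v h1 h2 h3 => by
      have hs' := early_Ioo hs
      have hYs := hY1 s hs
      have hall : ∀ i θ v, |ev (G i) (s, θ, v)| ≤ Y s := fun i θ v => by
        have a1 := h1 (i, true) θ v
        have a2 := h1 (i, false) θ v
        simp only [if_true, Bool.false_eq_true, if_false, ev_neg] at a1 a2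
        exact abs_le.2 ⟨by linarith, a1⟩
      have hN := S.Nsup_le G (by linarith) hall
      have hne : |ev (G j.1) (s, θ, v)| = Y s := by
        by_cases hj : j.2
        · simp only [hj, if_true] at h2; rw [h2]; exact abs_of_nonneg (by linarith)
        · simp only [hj, ev_neg, Bool.false_eq_true, if_false] at h2
          rw [← abs_neg, h2]; exact abs_of_nonneg (by linarith)
      have hz : ∀ e : ℝ × V3, ev (dd (0, e) (G j.1)) (s, θ, v) = 0 := fun e => by
        have := h3 e
        by_cases hj : j.2
        · simpa only [hj, if_true] using this
        · simp only [hj, Bool.false_eq_true, if_false, map_neg, ev_neg] at this; linarith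
      obtain ⟨v', hv', e1', e2', e3'⟩ : ∃ v' : V3, ‖v'‖ ≤ S.B ∧ ev (dd eT (G j.1)) (s, θ, v) = ev (dd eT (G j.1)) (s, θ, v')
          ∧ ev (dd eθ (G j.1)) (s, θ, v') = 0 ∧ ev (dd e1 (G j.1)) (s, θ, v') = 0 := by
        rcases hG j.1 with h' | h'
        · refine ⟨0, by simpa using S.B_pos.le, h'.dd_T _ _ _ _, ?_, ?_⟩
          · rw [h'.dd_θ s θ 0 v]; exact hz _
          · rw [base_dq h', ev_zero]
        · refine ⟨v, ?_, rfl, hz _, hz _⟩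
          by_contra hv
          rw [h' _ (mem_strip.2 hs') (not_le.1 hv), abs_zero] at hne
          linarith
      have h4 := hC j.1 (s, θ, v') ⟨mem_early.2 hs, hv'⟩
      rw [Tr_apply, ev_add, ev_add, ev_mul, ev_mul, e2', e3', mul_zero, mul_zero, add_zero, add_zero, ← e1'] at h4
      have h5 : C j.1 * S.Nsup G s ≤ Λ * (2 * Y s) := mul_le_mul (hΛ ⟨_, rfl⟩) (by linarith)
        (by linarith [S.one_le_Nsup G s]) hΛ0
      have h6 := abs_le.1 (h4.trans h5)
      by_cases hj : j.2
      · simp only [hj, if_true]; linarith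
      · simp only [hj, Bool.false_eq_true, if_false, map_neg, ev_neg]; linarith)
  have hE := Real.exp_pos ((2 * Λ + 1) * (tm tp ti - tp))
  refine ⟨(Γ + 1) * Real.exp ((2 * Λ + 1) * (tm tp ti - tp)), by positivity, fun p hp => ?_⟩
  obtain ⟨t, θ, v⟩ := p
  have ht := mem_early.1 hp
  have hYt : Y t ≤ (Γ + 1) * Real.exp ((2 * Λ + 1) * (tm tp ti - tp)) := by
    refine mul_le_mul_of_nonneg_left (Real.exp_le_exp.2 (mul_le_mul_of_nonneg_left ?_ (by linarith))) (by linarith)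
    linarith [ht.1]
  have a1 := key t ht (i, true) θ v
  have a2 := key t ht (i, false) θ v
  simp only [if_true, Bool.false_eq_true, if_false, ev_neg] at a1 a2
  exact abs_le.2 ⟨by linarith, by linarith⟩

end Sys

namespace Sys
variable [hfact : Fact (0 < tp)] (S : Sys tp ti)

theorem bdd_F : Bd S.dom S.F := by
  obtain ⟨C, h0, hC⟩ := S.F_le
  refine ⟨C, h0.le, fun p hp => ?_⟩
  rw [abs_of_nonneg (S.F_nonneg p (S.dom_strip hp))]
  exact hC p hp.1

theorem bdd_q : Bd S.dom (qR : SF tp ti) := ⟨S.B, S.B_pos.le, fun p hp => by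
  rw [ev_qR (S.dom_strip hp)]; exact (norm_fst_le p.2.2).trans hp.2⟩
theorem bdd_v2 : Bd S.dom (v2R : SF tp ti) := ⟨S.B, S.B_pos.le, fun p hp => by
  rw [ev_v2R (S.dom_strip hp)]; exact ((norm_fst_le p.2.2.2).trans (norm_snd_le p.2.2)).trans hp.2⟩
theorem bdd_v3 : Bd S.dom (v3R : SF tp ti) := ⟨S.B, S.B_pos.le, fun p hp => by
  rw [ev_v3R (S.dom_strip hp)]; exact ((norm_snd_le p.2.2.2).trans (norm_snd_le p.2.2)).trans hp.2⟩
theorem bdd_t : Bd S.dom (tR : SF tp ti) := Bd.tR.mono fun _ h => S.dom_strip h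
theorem bdd_tI : Bd S.dom (tI : SF tp ti) := Bd.tI.mono fun _ h => S.dom_strip h

theorem bdd_slab : Bd S.dom S.w ∧ Bd S.dom S.m2 ∧ Bd S.dom (S.X S.m2) ∧ Bd S.dom S.rp ∧ Bd S.dom S.b1 :=
  S.bd_slab S.dom_sub S.bdd_v2 S.bdd_v3

theorem eq_Lt : S.Lt = -(tI * S.E4 * S.J ^ 2 + tI ^ 3 * S.E0 * S.κ ^ 2) - (2 : ℝ) • S.M (S.m2 * S.rp) :=
  SF_ext fun p hp => by rw [S.eL p hp, S.mom_eq _ hp]; simp only [ev_sub, ev_neg, ev_smul]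

theorem eq_Xβ : S.X S.β = (2 : ℝ) • (tR * (S.Ut * S.XU + S.h * S.At * S.XA)) - S.M qR :=
  SF_ext fun p hp => by rw [S.eXβ p hp, S.mom_eq _ hp]; simp only [ev_sub]

theorem eq_Jt : dd eT S.J = (-2 : ℝ) • S.M (qR * v2R * S.rp) :=
  SF_ext fun p hp => by rw [S.eJt p hp, S.mom_eq _ hp]; simp only [ev_smul]
theorem eq_XJ : S.X S.J = (2 : ℝ) • S.M v2R :=
  SF_ext fun p hp => by rw [S.eXJ p hp, S.mom_eq _ hp]; simp only [ev_smul]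
theorem eq_Kt : dd eT S.K = (-2 : ℝ) • S.M (qR * v3R * S.rp) :=
  SF_ext fun p hp => by rw [S.eKt p hp, S.mom_eq _ hp]; simp only [ev_smul]
theorem eq_XK : S.X S.K = (2 : ℝ) • S.M v3R :=
  SF_ext fun p hp => by rw [S.eXK p hp, S.mom_eq _ hp]; simp only [ev_smul]

theorem eq_N : S.N = tR * (S.Ut ^ 2 + S.XU ^ 2 + S.h * (S.At ^ 2 + S.XA ^ 2))
      + (1/4 : ℝ) • (tI * S.E4 * S.J ^ 2) + (1/4 : ℝ) • (tI ^ 3 * S.E0 * S.κ ^ 2) + S.M (S.P * S.rp) :=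
  SF_ext fun p hp => by rw [N, S.eν p hp, S.mom_eq _ hp]; simp only [ev_add]

theorem eq_βt : dd eT S.β = S.N + (1/2 : ℝ) • S.Lt := by
  rw [N, Fld.ν, map_sub, Derivation.map_smul, Fld.Lt]; abel

/-- lower order part of the wave equation for `U` -/
def RU : SF tp ti := -(tI * S.Ut) + (1/2 : ℝ) • (S.Lt * S.Ut) + (2 : ℝ) • (S.h * (S.At ^ 2 - S.XA ^ 2))
  + (1/2 : ℝ) • (tI ^ 2 * S.E4 * S.J ^ 2)
  + (1/2 : ℝ) • (tI * S.E2 * S.M ((1 + (2 : ℝ) • (expR ((-2 : ℝ) • S.U) * v2R ^ 2)) * S.rp))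
/-- lower order part of the wave equation for `A` -/
def RA : SF tp ti := tI * S.At + (1/2 : ℝ) • (S.Lt * S.At) - (4 : ℝ) • (S.At * S.Ut - S.XA * S.XU)
  + tI ^ 2 * S.E4 * S.J * S.κ + (2 : ℝ) • (tI * S.E4 * S.M (v2R * S.w * S.rp))
/-- lower order part of the wave equation for `ν` -/
def Rν : SF tp ti := (1/2 : ℝ) • (S.Lt * S.N) - S.Ut ^ 2 + S.XU ^ 2
  + S.h * (S.At ^ 2 - S.XA ^ 2) - (1/4 : ℝ) • (tI ^ 2 * S.E4 * S.J ^ 2)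
  - (3/4 : ℝ) • (tI ^ 4 * S.E0 * S.κ ^ 2) - tI ^ 3 * S.E0 * S.M (S.w ^ 2 * S.rp)

theorem eq_Ut : dd eT S.Ut = S.X S.XU + S.RU := SF_ext fun p hp => by
  rw [S.eU p hp, S.mom_eq _ hp, RU]; simp only [ev_sub, ev_add, ev_smul, ev_mul, ev_neg]; ring
theorem eq_At : dd eT S.At = S.X S.XA + S.RA := SF_ext fun p hp => by
  rw [S.eA p hp, S.mom_eq _ hp, RA]; simp only [ev_sub, ev_add, ev_smul, ev_mul]; ring
theorem eq_Nt : dd eT S.N = S.X (S.X S.β) + S.Rν := SF_ext fun p hp => by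
  rw [N, S.eνν p hp, S.mom_eq _ hp, Rν, N]; simp only [ev_sub, ev_add, ev_smul, ev_mul]; ring

/-- derivation families compatible with the operations used -/
structure Good {ι : Type} (D : ι → Derivation ℝ (SF tp ti) (SF tp ti)) : Prop where
  exp : ∀ i G, D i (expR G) = expR G * D i G
  mr : ∀ i G, D i (MR S.B G) = 0 ∨ D i (MR S.B G) = MR S.B (D i G)
  lin : ∀ G ∈ ({tR, qR, v2R, v3R} : Set (SF tp ti)), ∀ i, ∃ c : ℝ, D i G = algebraMap ℝ _ c
  inv : ∀ i, ∃ c : ℝ, D i tI = c • tI ^ 2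

/-- the basic fields at level `n` -/
structure Lvl {ι : Type} (D : ι → Derivation ℝ (SF tp ti) (SF tp ti)) (N : ℝ → ℝ) (n : ℕ) : Prop where
  good : S.Good D
  hN : ∀ p ∈ S.dom, 1 ≤ N p.1
  U : PB S.dom D N n S.U
  A : PB S.dom D N n S.A
  β : PB S.dom D N n S.β
  J : PB S.dom D N n S.J
  K : PB S.dom D N n S.K

variable {ι : Type} {D : ι → Derivation ℝ (SF tp ti) (SF tp ti)} {N : ℝ → ℝ} {n : ℕ} {S}

theorem Good.t (g : S.Good D) (hN : ∀ p ∈ S.dom, 1 ≤ N p.1) : PB S.dom D N n tR :=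
  PB.linear_of hN S.bdd_t (g.lin _ (by simp))
theorem Good.q (g : S.Good D) (hN : ∀ p ∈ S.dom, 1 ≤ N p.1) : PB S.dom D N n qR :=
  PB.linear_of hN S.bdd_q (g.lin _ (by simp))
theorem Good.v2 (g : S.Good D) (hN : ∀ p ∈ S.dom, 1 ≤ N p.1) : PB S.dom D N n v2R :=
  PB.linear_of hN S.bdd_v2 (g.lin _ (by simp))
theorem Good.v3 (g : S.Good D) (hN : ∀ p ∈ S.dom, 1 ≤ N p.1) : PB S.dom D N n v3R :=
  PB.linear_of hN S.bdd_v3 (g.lin _ (by simp))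
theorem Good.tI (g : S.Good D) (hN : ∀ p ∈ S.dom, 1 ≤ N p.1) : PB S.dom D N n tI := by
  induction n with
  | zero => exact PB.of_bd hN S.bdd_tI
  | succ n ih =>
    refine ⟨S.bdd_tI, fun i => ?_⟩
    obtain ⟨c, hc⟩ := g.inv i
    rw [hc]
    exact (ih.pow hN S.bdd_tI 2).smul c

variable (S) in
theorem bdd_Ut : Bd S.dom S.Ut := S.first_order_bd.1.1.mono S.dom_sub
variable (S) in
theorem bdd_XU : Bd S.dom S.XU := S.first_order_bd.1.2.mono S.dom_sub
variable (S) in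
theorem bdd_At : Bd S.dom S.At := S.first_order_bd.2.1.1.mono S.dom_sub
variable (S) in
theorem bdd_XA : Bd S.dom S.XA := S.first_order_bd.2.1.2.mono S.dom_sub
variable (S) in
theorem bdd_Lt : Bd S.dom S.Lt := S.bd_Lt.mono S.dom_sub
variable (S) in
theorem bdd_h : Bd S.dom S.h := S.bd_h.mono S.dom_sub
variable (S) in
theorem bdd_N : Bd S.dom S.N := S.bd_N.mono S.dom_sub

namespace Lvl

variable (l : S.Lvl D N n)
include l

theorem E2 : PB S.dom D N n S.E2 := ((l.β.smul _).sub (l.U.smul _)).expR l.hN l.good.exp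
  (((S.bd_β.smul _).sub (S.bd_U.smul _)).mono S.dom_sub)
theorem E4 : PB S.dom D N n S.E4 := ((l.β.smul _).sub (l.U.smul _)).expR l.hN l.good.exp
  (((S.bd_β.smul _).sub (S.bd_U.smul _)).mono S.dom_sub)
theorem E0 : PB S.dom D N n S.E0 := (l.β.smul _).expR l.hN l.good.exp ((S.bd_β.smul _).mono S.dom_sub)
theorem h : PB S.dom D N n S.h := (((l.U.smul _).expR l.hN l.good.exp ((S.bd_U.smul _).mono S.dom_sub)).mul l.hN
  ((l.good.tI l.hN).pow l.hN S.bdd_tI 2) ((S.bd_U.smul _).mono S.dom_sub).expR).smul _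
theorem κ : PB S.dom D N n S.κ := l.K.sub (l.A.mul l.hN l.J (S.bd_A.mono S.dom_sub))
theorem w : PB S.dom D N n S.w := (l.good.v3 l.hN).sub (l.A.mul l.hN (l.good.v2 l.hN) (S.bd_A.mono S.dom_sub))
theorem m2 : PB S.dom D N n S.m2 :=
  (l.E2.add (l.E4.mul l.hN ((l.good.v2 l.hN).pow l.hN S.bdd_v2 2) (S.bd_E4.mono S.dom_sub))).add
    ((((l.good.tI l.hN).pow l.hN S.bdd_tI 2).mul l.hN l.E0 (S.bdd_tI.pow 2)).mul l.hN
      (l.w.pow l.hN S.bdd_slab.1 2) ((S.bdd_tI.pow 2).mul (S.bd_E0.mono S.dom_sub)))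
theorem P : PB S.dom D N n S.P := ((l.good.q l.hN).pow l.hN S.bdd_q 2).add l.m2
theorem rp : PB S.dom D N n S.rp := l.P.sq_inv l.hN S.P_rp S.bdd_slab.2.2.2.1
theorem lam : PB S.dom D N n (qR * S.rp) := (l.good.q l.hN).mul l.hN l.rp S.bdd_q

theorem M {φ : SF tp ti} (hF : PB S.dom D N n S.F) (h : PB S.dom D N n φ) : PB S.dom D N n (S.M φ) :=
  S.PB_MR l.hN l.good.mr (hF.mul l.hN h S.bdd_F)

theorem tE4J : PB S.dom D N n (S.E4 * S.J ^ 2) :=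
  l.E4.mul l.hN (l.J.pow l.hN (S.bd_JK.1.mono S.dom_sub) 2) (S.bd_E4.mono S.dom_sub)
theorem tE0κ : PB S.dom D N n (S.E0 * S.κ ^ 2) :=
  l.E0.mul l.hN (l.κ.pow l.hN (S.bd_κ.mono S.dom_sub) 2) (S.bd_E0.mono S.dom_sub)
theorem tpow (k : ℕ) {G : SF tp ti} (h : PB S.dom D N n G) : PB S.dom D N n (tI ^ k * G) :=
  ((l.good.tI l.hN).pow l.hN S.bdd_tI k).mul l.hN h (S.bdd_tI.pow k)
theorem tmul {G : SF tp ti} (h : PB S.dom D N n G) : PB S.dom D N n (tI * G) :=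
  (l.good.tI l.hN).mul l.hN h S.bdd_tI

theorem Lt (hF : PB S.dom D N n S.F) : PB S.dom D N n S.Lt := by
  rw [S.eq_Lt, mul_assoc, mul_assoc]
  exact ((l.tmul l.tE4J).add (l.tpow 3 l.tE0κ)).neg.sub ((l.M hF (l.m2.mul l.hN l.rp S.bdd_slab.2.1)).smul _)

theorem Xm2_of (hβ : PB S.dom D N n (S.X S.β)) (hU : PB S.dom D N n S.XU) (hA : PB S.dom D N n S.XA) :
    PB S.dom D N n (S.X S.m2) := by
  rw [S.X_m2]
  have hm := l.m2.smul 2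
  have hmb := S.bdd_slab.2.1.smul 2
  rw [mul_comm (S.X S.β)]
  refine PB.sub (PB.sub (hm.mul l.hN hβ hmb) (hU.mul l.hN ?_ S.bdd_XU)) (hA.mul l.hN ?_ S.bdd_XA)
  · exact (l.E2.smul _).add ((l.E4.mul l.hN ((l.good.v2 l.hN).pow l.hN S.bdd_v2 2) (S.bd_E4.mono S.dom_sub)).smul _)
  · rw [mul_assoc, mul_assoc]
    exact (l.tpow 2 (l.E0.mul l.hN (l.w.mul l.hN (l.good.v2 l.hN) S.bdd_slab.1) (S.bd_E0.mono S.dom_sub))).smul _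

theorem b_rest : PB S.dom D N n (tI ^ 3 * S.E0 * S.κ * S.w + tI * S.E4 * S.J * v2R) := by
  rw [mul_assoc (tI ^ 3), mul_assoc (tI ^ 3), mul_assoc S.E0, mul_assoc tI, mul_assoc tI, mul_assoc S.E4]
  exact (l.tpow 3 (l.E0.mul l.hN (l.κ.mul l.hN l.w (S.bd_κ.mono S.dom_sub)) (S.bd_E0.mono S.dom_sub))).add
      (l.tmul (l.E4.mul l.hN (l.J.mul l.hN (l.good.v2 l.hN) (S.bd_JK.1.mono S.dom_sub)) (S.bd_E4.mono S.dom_sub)))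

theorem b_of (hL : PB S.dom D N n S.Lt) (hβ : PB S.dom D N n (S.X S.β)) (hU : PB S.dom D N n S.XU)
    (hA : PB S.dom D N n S.XA) : PB S.dom D N n S.b := by
  unfold Fld.b Fld.b1
  rw [add_assoc (_ • _) (tI ^ 3 * S.E0 * S.κ * S.w)]
  exact ((hL.mul l.hN (l.good.q l.hN) S.bdd_Lt).smul _).add
    ((((l.Xm2_of hβ hU hA).mul l.hN l.rp S.bdd_slab.2.2.1).smul _).add l.b_rest)

end Lvl

/-- the first derivatives of `U` and `A` at level `n` -/
structure Lvl1 (S : Sys tp ti) {ι : Type} (D : ι → Derivation ℝ (SF tp ti) (SF tp ti)) (N : ℝ → ℝ) (n : ℕ) : Prop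
    extends S.Lvl D N n where
  F : PB S.dom D N n S.F
  Ut : PB S.dom D N n S.Ut
  XU : PB S.dom D N n S.XU
  At : PB S.dom D N n S.At
  XA : PB S.dom D N n S.XA

namespace Lvl1

variable (l : S.Lvl1 D N n)
include l

theorem Lt : PB S.dom D N n S.Lt := l.toLvl.Lt l.F

theorem Xβ : PB S.dom D N n (S.X S.β) := by
  rw [S.eq_Xβ]
  exact (((l.good.t l.hN).mul l.hN ((l.Ut.mul l.hN l.XU S.bdd_Ut).add
    ((l.h.mul l.hN l.At S.bdd_h).mul l.hN l.XA (S.bdd_h.mul S.bdd_At))) S.bdd_t).smul _).sub (l.M l.F (l.good.q l.hN))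

theorem N_ : PB S.dom D N n S.N := by
  rw [S.eq_N, mul_assoc tI, mul_assoc (tI ^ 3)]
  refine PB.add (PB.add (PB.add ?_ ((l.tmul l.tE4J).smul _)) ((l.tpow 3 l.tE0κ).smul _)) (l.M l.F ?_)
  · exact (l.good.t l.hN).mul l.hN (((l.Ut.pow l.hN S.bdd_Ut 2).add (l.XU.pow l.hN S.bdd_XU 2)).add
      (l.h.mul l.hN ((l.At.pow l.hN S.bdd_At 2).add (l.XA.pow l.hN S.bdd_XA 2)) S.bdd_h)) S.bdd_t
  · rw [mul_comm]; exact l.rp.mul l.hN l.P S.bdd_slab.2.2.2.1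

theorem hdiff : PB S.dom D N n (S.h * (S.At ^ 2 - S.XA ^ 2)) :=
  l.h.mul l.hN ((l.At.pow l.hN S.bdd_At 2).sub (l.XA.pow l.hN S.bdd_XA 2)) S.bdd_h

theorem RU : PB S.dom D N n S.RU := by
  unfold Sys.RU
  rw [mul_assoc (tI ^ 2), mul_assoc tI S.E2]
  refine PB.add (PB.add (PB.add (PB.add (l.tmul l.Ut).neg ((l.Lt.mul l.hN l.Ut S.bdd_Lt).smul _)) (l.hdiff.smul _))
    ((l.tpow 2 l.tE4J).smul _)) ((l.tmul (l.E2.mul l.hN (l.M l.F ?_) (S.bd_E2.mono S.dom_sub))).smul _)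
  have hb : Bd S.dom (expR ((-2 : ℝ) • S.U)) := ((S.bd_U.smul _).mono S.dom_sub).expR
  rw [mul_comm]
  exact l.rp.mul l.hN ((PB.one l.hN).add ((((l.U.smul _).expR l.hN l.good.exp ((S.bd_U.smul _).mono S.dom_sub)).mul l.hN
    ((l.good.v2 l.hN).pow l.hN S.bdd_v2 2) hb).smul _)) S.bdd_slab.2.2.2.1

theorem RA : PB S.dom D N n S.RA := by
  unfold Sys.RA
  rw [mul_assoc (tI ^ 2), mul_assoc (tI ^ 2), mul_assoc S.E4, mul_assoc tI S.E4]
  refine PB.add (PB.add (PB.sub (PB.add (l.tmul l.At) ((l.Lt.mul l.hN l.At S.bdd_Lt).smul _))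
    (((l.At.mul l.hN l.Ut S.bdd_At).sub (l.XA.mul l.hN l.XU S.bdd_XA)).smul _))
    (l.tpow 2 (l.E4.mul l.hN (l.J.mul l.hN l.κ (S.bd_JK.1.mono S.dom_sub)) (S.bd_E4.mono S.dom_sub))))
    ((l.tmul (l.E4.mul l.hN (l.M l.F ?_) (S.bd_E4.mono S.dom_sub))).smul _)
  exact ((l.good.v2 l.hN).mul l.hN l.w S.bdd_v2).mul l.hN l.rp (S.bdd_v2.mul S.bdd_slab.1)

theorem Rν : PB S.dom D N n S.Rν := by
  unfold Sys.Rν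
  rw [mul_assoc (tI ^ 2), mul_assoc (tI ^ 4), mul_assoc (tI ^ 3)]
  refine PB.sub (PB.sub (PB.sub (PB.add (PB.add (PB.sub ((l.Lt.mul l.hN l.N_ S.bdd_Lt).smul _)
    (l.Ut.pow l.hN S.bdd_Ut 2)) (l.XU.pow l.hN S.bdd_XU 2)) l.hdiff) ((l.tpow 2 l.tE4J).smul _))
    ((l.tpow 4 l.tE0κ).smul _)) (l.tpow 3 (l.E0.mul l.hN (l.M l.F ?_) (S.bd_E0.mono S.dom_sub)))
  exact (l.w.pow l.hN S.bdd_slab.1 2).mul l.hN l.rp (S.bdd_slab.1.pow 2)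

theorem b : PB S.dom D N n S.b := l.b_of l.Lt l.Xβ l.XU l.XA

end Lvl1

end Sys

namespace Sys
variable [hfact : Fact (0 < tp)] (S : Sys tp ti)

theorem X_expR (G : SF tp ti) : S.X (expR G) = expR G * S.X G := by
  rw [Fld.X_apply, dd_expR, Fld.X_apply]; ring

theorem dv_MR (e : V3) (R : ℝ) (G : SF tp ti) : dd (0, 0, e) (MR R G) = 0 := (base_MR R G).dd_v e

theorem X_MR (R : ℝ) (G : SF tp ti) : S.X (MR R G) = MR R (S.X G) := by
  rw [Fld.X_apply, Fld.X_apply, dd_eθ_MR, MR_mul_base R S.base_σ]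

theorem dv_X (e : V3) (G : SF tp ti) : dd (0, 0, e) (S.X G) = S.X (dd (0, 0, e) G) := by
  rw [Fld.X_apply, Fld.X_apply, Derivation.leibniz, S.base_σ.dd_v, dd_comm _ eθ]; simp

/-- the standard velocity directions -/
def ve : Fin 3 → V3 := ![(1, 0, 0), (0, 1, 0), (0, 0, 1)]

/-- velocity derivatives -/
def Dv (i : Fin 3) : Derivation ℝ (SF tp ti) (SF tp ti) := dd (0, 0, ve i)

/-- spatial and velocity derivatives -/
def D : Option (Fin 3) → Derivation ℝ (SF tp ti) (SF tp ti)
  | none => S.X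
  | some i => Dv i

/-- the time derivative, as a family -/
def DT (_ : Unit) : Derivation ℝ (SF tp ti) (SF tp ti) := dd eT

theorem lin_dd (e : E5) {G : SF tp ti} (hG : G ∈ ({tR, qR, v2R, v3R} : Set (SF tp ti))) :
    ∃ c : ℝ, dd e G = algebraMap ℝ _ c := by
  rcases hG with rfl | rfl | rfl | rfl
  · exact ⟨_, dd_tR e⟩
  · exact ⟨_, dd_qR e⟩
  · exact ⟨_, dd_v2R e⟩
  · exact ⟨_, dd_v3R e⟩

theorem good_D : S.Good S.D where
  exp i G := by
    cases i with
    | none => exact S.X_expR G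
    | some i => exact dd_expR _ _
  mr i G := by
    cases i with
    | none => exact Or.inr (S.X_MR _ G)
    | some i => exact Or.inl (dv_MR _ _ G)
  lin G hG i := by
    cases i with
    | none =>
      refine ⟨0, ?_⟩
      rw [map_zero]
      show S.X G = 0
      rw [Fld.X_apply]
      have : dd eθ G = 0 := by
        rcases hG with rfl | rfl | rfl | rfl
        · rw [dd_tR]; simp [eθ]
        · rw [dd_qR]; simp [eθ]
        · rw [dd_v2R]; simp [eθ]
        · rw [dd_v3R]; simp [eθ]
      rw [this, mul_zero]
    | some i => exact lin_dd _ hG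
  inv i := by
    cases i with
    | none =>
      refine ⟨0, ?_⟩
      show S.X tI = _
      rw [Fld.X_apply, dd_tI]; simp [eθ]
    | some i =>
      refine ⟨0, ?_⟩
      show dd _ tI = _
      rw [dd_tI]; simp

theorem good_Dv : S.Good (Dv (tp := tp) (ti := ti)) where
  exp i G := S.good_D.exp (some i) G
  mr i G := S.good_D.mr (some i) G
  lin G hG i := S.good_D.lin G hG (some i)
  inv i := S.good_D.inv (some i)

theorem good_DT : S.Good (DT (tp := tp) (ti := ti)) where
  exp i G := dd_expR _ _
  mr i G := Or.inr (dd_eT_MR _ G)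
  lin G hG i := lin_dd _ hG
  inv i := ⟨-1, by show dd eT tI = _; rw [dd_tI]; simp [eT]⟩

theorem one_le_one : ∀ p ∈ S.dom, (1 : ℝ) ≤ (1 : ℝ → ℝ) p.1 := fun _ _ => le_rfl

theorem base_PB_Dv {G : SF tp ti} (hG : Base G) (h : Bd S.dom G) (n : ℕ) : PB S.dom Dv 1 n G :=
  PB.const_of S.one_le_one h fun i => hG.dd_v _

theorem lvl_Dv (n : ℕ) : S.Lvl Dv 1 n where
  good := S.good_Dv
  hN := S.one_le_one
  U := S.base_PB_Dv S.bU (S.bd_U.mono S.dom_sub) n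
  A := S.base_PB_Dv S.bA (S.bd_A.mono S.dom_sub) n
  β := S.base_PB_Dv S.bβ (S.bd_β.mono S.dom_sub) n
  J := S.base_PB_Dv S.bJ (S.bd_JK.1.mono S.dom_sub) n
  K := S.base_PB_Dv S.bK (S.bd_JK.2.mono S.dom_sub) n

theorem base_PB_succ {G : SF tp ti} {N : ℝ → ℝ} {n : ℕ} (hN : ∀ p ∈ S.dom, 1 ≤ N p.1) (hG : Base G) (h : Bd S.dom G)
    (hX : PB S.dom S.D N n (S.X G)) : PB S.dom S.D N (n + 1) G := ⟨h, fun i => by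
  cases i with
  | none => exact hX
  | some i =>
    show PB S.dom S.D N n (dd _ G)
    rw [hG.dd_v]; exact PB.zero hN⟩

theorem lvl_zero {ι : Type} {D : ι → Derivation ℝ (SF tp ti) (SF tp ti)} (hD : S.Good D) : S.Lvl D 1 0 where
  good := hD
  hN := S.one_le_one
  U := PB.zero_one_iff.2 (S.bd_U.mono S.dom_sub)
  A := PB.zero_one_iff.2 (S.bd_A.mono S.dom_sub)
  β := PB.zero_one_iff.2 (S.bd_β.mono S.dom_sub)
  J := PB.zero_one_iff.2 (S.bd_JK.1.mono S.dom_sub)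
  K := PB.zero_one_iff.2 (S.bd_JK.2.mono S.dom_sub)

theorem lvl1_zero {ι : Type} {D : ι → Derivation ℝ (SF tp ti) (SF tp ti)} (hD : S.Good D) : S.Lvl1 D 1 0 where
  toLvl := S.lvl_zero hD
  F := PB.zero_one_iff.2 S.bdd_F
  Ut := PB.zero_one_iff.2 S.bdd_Ut
  XU := PB.zero_one_iff.2 S.bdd_XU
  At := PB.zero_one_iff.2 S.bdd_At
  XA := PB.zero_one_iff.2 S.bdd_XA

variable {S} in
/-- one more derivative of the basic fields -/
theorem Lvl1.succ {N : ℝ → ℝ} {n : ℕ} (l : S.Lvl1 S.D N n) : S.Lvl S.D N (n + 1) where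
  good := l.good
  hN := l.hN
  U := S.base_PB_succ l.hN S.bU (S.bd_U.mono S.dom_sub) l.XU
  A := S.base_PB_succ l.hN S.bA (S.bd_A.mono S.dom_sub) l.XA
  β := S.base_PB_succ l.hN S.bβ (S.bd_β.mono S.dom_sub) l.Xβ
  J := S.base_PB_succ l.hN S.bJ (S.bd_JK.1.mono S.dom_sub) (by
    rw [S.eq_XJ]; exact (l.M l.F (l.good.v2 l.hN)).smul _)
  K := S.base_PB_succ l.hN S.bK (S.bd_JK.2.mono S.dom_sub) (by
    rw [S.eq_XK]; exact (l.M l.F (l.good.v3 l.hN)).smul _)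

theorem lvl_one : S.Lvl S.D 1 1 := (S.lvl1_zero S.good_D).succ

theorem lvl_DT : S.Lvl DT 1 1 := by
  have l := S.lvl1_zero S.good_DT
  have hb := l.M l.F (((l.good.q l.hN).mul l.hN (l.good.v2 l.hN) S.bdd_q).mul l.hN l.rp (S.bdd_q.mul S.bdd_v2))
  have hc := l.M l.F (((l.good.q l.hN).mul l.hN (l.good.v3 l.hN) S.bdd_q).mul l.hN l.rp (S.bdd_q.mul S.bdd_v3))
  refine ⟨l.good, l.hN, ⟨S.bd_U.mono S.dom_sub, fun _ => l.Ut⟩, ⟨S.bd_A.mono S.dom_sub, fun _ => l.At⟩,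
    ⟨S.bd_β.mono S.dom_sub, fun _ => ?_⟩, ⟨S.bd_JK.1.mono S.dom_sub, fun _ => ?_⟩, ⟨S.bd_JK.2.mono S.dom_sub, fun _ => ?_⟩⟩
  · show PB S.dom DT 1 0 (dd eT S.β)
    rw [S.eq_βt]; exact l.N_.add (l.Lt.smul _)
  · show PB S.dom DT 1 0 (dd eT S.J)
    rw [S.eq_Jt]; exact hb.smul _
  · show PB S.dom DT 1 0 (dd eT S.K)
    rw [S.eq_Kt]; exact hc.smul _

theorem Tr_X (l b G : SF tp ti) : Tr (l * S.σ) b G = dd eT G + l * S.X G + b * dd e1 G := by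
  rw [Tr_apply, Fld.X_apply]; ring

theorem Tr_comm_X (l b G : SF tp ti) : Tr (l * S.σ) b (S.X G) = S.X (Tr (l * S.σ) b G)
    + (1/2 : ℝ) • (S.Lt * S.X G) - S.X l * S.X G - S.X b * dd e1 G := by
  rw [Tr_X, Tr_X, map_add, map_add, Derivation.leibniz, Derivation.leibniz, S.dT_X, S.dq_X]
  simp only [smul_eq_mul]; ring

theorem Tr_comm_v (e : V3) (l b G : SF tp ti) : Tr (l * S.σ) b (dd (0, 0, e) G) = dd (0, 0, e) (Tr (l * S.σ) b G)
    - dd (0, 0, e) l * S.X G - dd (0, 0, e) b * dd e1 G := by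
  rw [Tr_X, Tr_X, map_add, map_add, Derivation.leibniz, Derivation.leibniz, S.dv_X, dd_comm eT, dd_comm e1]
  simp only [smul_eq_mul]; ring

end Sys

namespace Sys
variable [hfact : Fact (0 < tp)] (S : Sys tp ti)

/-- `1/m` -/
def rm : SF tp ti := rsq S.m2 fun _ hp => S.m2_pos hp
theorem m2_rm : S.m2 * S.rm ^ 2 = 1 := rsq_sq _ _

theorem bdd_rm : Bd S.dom S.rm := by
  have hE : Bd S.dom (expR (S.U - S.β)) := ((S.bd_U.sub S.bd_β).mono S.dom_sub).expR
  refine hE.of_le fun p hp => ?_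
  have hp' := S.dom_strip hp
  have h2 : ev S.m2 p * ev S.rm p ^ 2 = 1 := by
    rw [← ev_pow _ _ hp', ← ev_mul, S.m2_rm, ev_one hp']
  have h3 : ev S.E2 p * ev (expR (S.U - S.β)) p ^ 2 = 1 := by
    rw [← ev_pow _ _ hp', ← ev_mul, Fld.E2, sq, ← expR_add, ← expR_add]
    have : (2:ℝ) • S.β - (2:ℝ) • S.U + (S.U - S.β + (S.U - S.β)) = 0 := by
      simp only [two_smul]; abel
    rw [this, ev_expR _ hp']; simp
  have h4 := S.m2_ge hp'
  have h5 := expR_pos S.E2 hp'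
  have hE2 : 0 < ev S.E2 p := expR_pos _ hp'
  rw [← sq_le_sq]
  by_contra! h
  have : ev S.E2 p * ev (expR (S.U - S.β)) p ^ 2 < ev S.m2 p * ev S.rm p ^ 2 :=
    (mul_lt_mul_of_pos_left h hE2).trans_le (mul_le_mul_of_nonneg_right h4 (sq_nonneg _))
  linarith

/-- coefficient of `XU` in `X m²` -/
def cU : SF tp ti := (2:ℝ) • S.E2 + (4:ℝ) • (S.E4 * v2R ^ 2)
/-- coefficient of `XA` in `X m²` -/
def cA : SF tp ti := (2:ℝ) • (tI ^ 2 * S.E0 * S.w * v2R)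
/-- the multipliers in the modified derivative -/
def gU : SF tp ti := (1/2:ℝ) • (S.P * S.rp * S.rm ^ 2 * S.cU)
def gA : SF tp ti := (1/2:ℝ) • (S.P * S.rp * S.rm ^ 2 * S.cA)
/-- characteristic speed -/
def lam : SF tp ti := qR * S.rp
def ZU : SF tp ti := S.Ut - S.lam * S.XU
def ZA : SF tp ti := S.At - S.lam * S.XA
def Zβ : SF tp ti := S.N - S.lam * S.X S.β
/-- correction absorbing the top order part of `X b` -/
def gC : SF tp ti := -(S.P * S.rp * S.Zβ) + S.gU * S.ZU + S.gA * S.ZA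

theorem bdd_Xβ : Bd S.dom (S.X S.β) := S.bd_Xβ.mono S.dom_sub
theorem bdd_lam : Bd S.dom S.lam := S.bdd_q.mul S.bdd_slab.2.2.2.1
theorem bdd_b : Bd S.dom S.b := ((S.bdd_Lt.mul S.bdd_q).smul _).add S.bdd_slab.2.2.2.2

section
variable {S} {ι : Type} {D : ι → Derivation ℝ (SF tp ti) (SF tp ti)} {N : ℝ → ℝ} {n : ℕ}

theorem Lvl.cU (l : S.Lvl D N n) : PB S.dom D N n S.cU :=
  (l.E2.smul _).add ((l.E4.mul l.hN ((l.good.v2 l.hN).pow l.hN S.bdd_v2 2) (S.bd_E4.mono S.dom_sub)).smul _)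
theorem Lvl.cA (l : S.Lvl D N n) : PB S.dom D N n S.cA := by
  unfold Sys.cA
  rw [mul_assoc, mul_assoc]
  exact (l.tpow 2 (l.E0.mul l.hN (l.w.mul l.hN (l.good.v2 l.hN) S.bdd_slab.1) (S.bd_E0.mono S.dom_sub))).smul _
theorem Lvl.p0 (l : S.Lvl D N n) : PB S.dom D N n (S.P * S.rp) := by
  rw [mul_comm]; exact l.rp.mul l.hN l.P S.bdd_slab.2.2.2.1
theorem Lvl.rm (l : S.Lvl D N n) : PB S.dom D N n S.rm := l.m2.sq_inv l.hN S.m2_rm S.bdd_rm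
variable (S) in
theorem bdd_p0 : Bd S.dom (S.P * S.rp) := (S.lvl_zero S.good_D).p0.bd
theorem Lvl.p0rm (l : S.Lvl D N n) : PB S.dom D N n (S.P * S.rp * S.rm ^ 2) :=
  l.p0.mul l.hN (l.rm.pow l.hN S.bdd_rm 2) S.bdd_p0
theorem Lvl.gU (l : S.Lvl D N n) : PB S.dom D N n S.gU :=
  (l.p0rm.mul l.hN l.cU (S.bdd_p0.mul (S.bdd_rm.pow 2))).smul _
theorem Lvl.gA (l : S.Lvl D N n) : PB S.dom D N n S.gA :=
  (l.p0rm.mul l.hN l.cA (S.bdd_p0.mul (S.bdd_rm.pow 2))).smul _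
end

theorem Tr_bdd {l b G : SF tp ti} (hl : Bd S.dom l) (hb : Bd S.dom b) (h1 : PB S.dom DT 1 1 G)
    (h2 : PB S.dom S.D 1 1 G) : Bd S.dom (Tr (l * S.σ) b G) := by
  rw [Tr_X]
  have a1 : Bd S.dom (dd eT G) := (h1.2 ()).bd
  have a2 : Bd S.dom (S.X G) := (h2.2 none).bd
  have a3 : Bd S.dom (dd e1 G) := (h2.2 (some 0)).bd
  exact (a1.add (hl.mul a2)).add (hb.mul a3)

theorem c_eq : S.c = S.lam * S.σ := rfl

theorem Tr_ZU : Tr S.c S.b S.ZU = S.m2 * S.rp ^ 2 * S.X S.XU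
    + (S.RU - Tr S.c S.b S.lam * S.XU - S.lam * ((1/2:ℝ) • (S.Lt * S.XU))) := by
  have hP : (qR ^ 2 + S.m2) * S.rp ^ 2 = 1 := S.P_rp
  rw [ZU, map_sub, Derivation.leibniz, c_eq, S.Tr_X _ _ S.Ut, S.eq_Ut, S.Tr_X _ _ S.XU, base_dq S.base_Ut, base_dq S.base_XU]
  have h3 : dd eT S.XU = S.X S.Ut + (1/2:ℝ) • (S.Lt * S.XU) := S.dT_X S.U
  rw [h3]
  simp only [smul_eq_mul, lam]
  linear_combination (-S.X S.XU) * hP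

theorem Tr_ZA : Tr S.c S.b S.ZA = S.m2 * S.rp ^ 2 * S.X S.XA
    + (S.RA - Tr S.c S.b S.lam * S.XA - S.lam * ((1/2:ℝ) • (S.Lt * S.XA))) := by
  have hP : (qR ^ 2 + S.m2) * S.rp ^ 2 = 1 := S.P_rp
  rw [ZA, map_sub, Derivation.leibniz, c_eq, S.Tr_X _ _ S.At, S.eq_At, S.Tr_X _ _ S.XA, base_dq S.base_At, base_dq S.base_XA]
  have h3 : dd eT S.XA = S.X S.At + (1/2:ℝ) • (S.Lt * S.XA) := S.dT_X S.A
  rw [h3]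
  simp only [smul_eq_mul, lam]
  linear_combination (-S.X S.XA) * hP

theorem Tr_Zβ : Tr S.c S.b S.Zβ = S.m2 * S.rp ^ 2 * S.X (S.X S.β) - S.lam * ((1/2:ℝ) • S.X S.Lt)
    + (S.Rν - Tr S.c S.b S.lam * S.X S.β - S.lam * ((1/2:ℝ) • (S.Lt * S.X S.β))) := by
  have hP : (qR ^ 2 + S.m2) * S.rp ^ 2 = 1 := S.P_rp
  have hXβ : Base (S.X S.β) := S.base_X S.bβ
  rw [Zβ, map_sub, Derivation.leibniz, c_eq, S.Tr_X _ _ S.N, S.eq_Nt, S.Tr_X _ _ (S.X S.β), base_dq S.base_N,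
    base_dq hXβ, S.dT_X, S.eq_βt, map_add, Derivation.map_smul]
  simp only [smul_eq_mul, lam]
  linear_combination (-S.X (S.X S.β)) * hP

/-- lower order part of `X b` -/
def Eb : SF tp ti := -((1/2:ℝ) • (S.X S.rp * S.X S.m2))
  - (1/2:ℝ) • (S.rp * ((2:ℝ) • (S.X S.m2 * S.X S.β) - S.X S.cU * S.XU - S.X S.cA * S.XA))
  + S.X (tI ^ 3 * S.E0 * S.κ * S.w + tI * S.E4 * S.J * v2R)

theorem X_q : S.X qR = 0 := by
  rw [Fld.X_apply, dd_qR]; simp [eθ]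

theorem X_b : S.X S.b = (1/2:ℝ) • (qR * S.X S.Lt) - S.rp * S.m2 * S.X (S.X S.β)
    + (1/2:ℝ) • (S.rp * S.cU * S.X S.XU) + (1/2:ℝ) • (S.rp * S.cA * S.X S.XA) + S.Eb := by
  have h1 : S.X (S.X S.m2) = (2:ℝ) • (S.m2 * S.X (S.X S.β)) + (2:ℝ) • (S.X S.m2 * S.X S.β)
      - S.cU * S.X S.XU - S.X S.cU * S.XU - S.cA * S.X S.XA - S.X S.cA * S.XA := by
    rw [S.X_m2, map_sub, map_sub, Derivation.leibniz, Derivation.leibniz, Derivation.leibniz, Derivation.map_smul,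
      S.X_m2]
    simp only [smul_eq_mul, Algebra.smul_def, cU, cA]; ring
  have hb : S.b = (1/2:ℝ) • (S.Lt * qR) + ((-1/2 : ℝ) • (S.X S.m2 * S.rp)
      + (tI ^ 3 * S.E0 * S.κ * S.w + tI * S.E4 * S.J * v2R)) := by
    rw [Fld.b, Fld.b1]; ring
  rw [hb, map_add, map_add, Derivation.map_smul, Derivation.map_smul, Derivation.leibniz, Derivation.leibniz, h1, X_q, Eb]
  have e1 : algebraMap ℝ (SF tp ti) (-1/2) = -algebraMap ℝ (SF tp ti) (1/2) := by rw [← map_neg]; norm_num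
  have h2 : algebraMap ℝ (SF tp ti) (1/2) * 2 = 1 := by
    rw [← map_ofNat (algebraMap ℝ (SF tp ti)) 2, ← map_mul]; norm_num
  simp only [smul_eq_mul, Algebra.smul_def, e1, map_ofNat]
  linear_combination (-(S.rp * S.m2 * S.X (S.X S.β))) * h2

theorem Tr_gC : Tr S.c S.b S.gC - S.X S.b =
    -(Tr S.c S.b (S.P * S.rp) * S.Zβ) + Tr S.c S.b S.gU * S.ZU + Tr S.c S.b S.gA * S.ZA
    - S.P * S.rp * (S.Rν - Tr S.c S.b S.lam * S.X S.β - S.lam * ((1/2:ℝ) • (S.Lt * S.X S.β)))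
    + S.gU * (S.RU - Tr S.c S.b S.lam * S.XU - S.lam * ((1/2:ℝ) • (S.Lt * S.XU)))
    + S.gA * (S.RA - Tr S.c S.b S.lam * S.XA - S.lam * ((1/2:ℝ) • (S.Lt * S.XA))) - S.Eb := by
  have h1 : S.P * S.rp ^ 2 = 1 := S.P_rp
  have h2 : S.m2 * S.rm ^ 2 = 1 := S.m2_rm
  rw [gC, map_add, map_add, map_neg, Derivation.leibniz, Derivation.leibniz _ S.gU, Derivation.leibniz _ S.gA, Tr_ZU, Tr_ZA,
    Tr_Zβ, X_b]
  simp only [smul_eq_mul, lam]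
  generalize Tr S.c S.b (S.P * S.rp) = x1
  generalize Tr S.c S.b S.gU = x2
  generalize Tr S.c S.b S.gA = x3
  generalize Tr S.c S.b (qR * S.rp) = x4
  simp only [gU, gA, Algebra.smul_def]
  linear_combination (-(S.m2 * S.rp * S.X (S.X S.β)) + qR * algebraMap ℝ (SF tp ti) (1/2) * S.X S.Lt
    + algebraMap ℝ (SF tp ti) (1/2) * S.rp * (S.cU * S.X S.XU + S.cA * S.X S.XA) * (S.m2 * S.rm ^ 2)) * h1
    + algebraMap ℝ (SF tp ti) (1/2) * S.rp * (S.cU * S.X S.XU + S.cA * S.X S.XA) * h2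
end Sys

namespace Sys
variable [hfact : Fact (0 < tp)] (S : Sys tp ti)

theorem bdd_X_of {G : SF tp ti} (h : PB S.dom S.D 1 1 G) : Bd S.dom (S.X G) := (h.2 none).bd

theorem bdd_Eb : Bd S.dom S.Eb := by
  have l := S.lvl_one
  exact (((S.bdd_X_of l.rp).mul S.bdd_slab.2.2.1).smul _).neg |>.sub
    ((S.bdd_slab.2.2.2.1.mul ((((S.bdd_slab.2.2.1.mul S.bdd_Xβ).smul _).sub ((S.bdd_X_of l.cU).mul S.bdd_XU)).sub
      ((S.bdd_X_of l.cA).mul S.bdd_XA))).smul _) |>.add (S.bdd_X_of l.b_rest)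

theorem bdd_gC : Bd S.dom S.gC := by
  have l := S.lvl_zero S.good_D
  exact ((S.bdd_p0.mul (S.bdd_N.sub (S.bdd_lam.mul S.bdd_Xβ))).neg.add
    (l.gU.bd.mul (S.bdd_Ut.sub (S.bdd_lam.mul S.bdd_XU)))).add
    (l.gA.bd.mul (S.bdd_At.sub (S.bdd_lam.mul S.bdd_XA)))

theorem bdd_Tr_gC : Bd S.dom (Tr S.c S.b S.gC - S.X S.b) := by
  rw [Tr_gC]
  have l := S.lvl_one
  have d := S.lvl_DT
  have l0 := S.lvl_zero S.good_D
  have l1 := S.lvl1_zero S.good_D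
  have T : ∀ {G : SF tp ti}, PB S.dom DT 1 1 G → PB S.dom S.D 1 1 G → Bd S.dom (Tr S.c S.b G) :=
    fun h h' => S.Tr_bdd S.bdd_lam S.bdd_b h h'
  have Tl : Bd S.dom (Tr S.c S.b S.lam) := T d.lam l.lam
  have zU : Bd S.dom S.ZU := S.bdd_Ut.sub (S.bdd_lam.mul S.bdd_XU)
  have zA : Bd S.dom S.ZA := S.bdd_At.sub (S.bdd_lam.mul S.bdd_XA)
  have zβ : Bd S.dom S.Zβ := S.bdd_N.sub (S.bdd_lam.mul S.bdd_Xβ)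
  have r1 : ∀ {R X : SF tp ti}, Bd S.dom R → Bd S.dom X →
      Bd S.dom (R - Tr S.c S.b S.lam * X - S.lam * ((1/2:ℝ) • (S.Lt * X))) := fun hR hX =>
    (hR.sub (Tl.mul hX)).sub (S.bdd_lam.mul ((S.bdd_Lt.mul hX).smul _))
  exact (((((((T d.p0 l.p0).mul zβ).neg.add ((T d.gU l.gU).mul zU)).add ((T d.gA l.gA).mul zA)).sub
    (S.bdd_p0.mul (r1 l1.Rν.bd S.bdd_Xβ))).add (l0.gU.bd.mul (r1 l1.RU.bd S.bdd_XU))).add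
    (l0.gA.bd.mul (r1 l1.RA.bd S.bdd_XA))).sub S.bdd_Eb

theorem PB_Dv_b (n : ℕ) : PB S.dom Dv 1 n S.b :=
  (S.lvl_Dv n).b_of (S.base_PB_Dv S.bL.dd_T S.bdd_Lt n) (S.base_PB_Dv (S.base_X S.bβ) S.bdd_Xβ n)
    (S.base_PB_Dv S.base_XU S.bdd_XU n) (S.base_PB_Dv S.base_XA S.bdd_XA n)

theorem bdd_dv_b (i : Fin 3) : Bd S.dom (Dv i S.b) := ((S.PB_Dv_b 1).2 i).bd
theorem bdd_dv_lam (i : Fin 3) : Bd S.dom (Dv i S.lam) := ((S.lvl_Dv 1).lam.2 i).bd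

/-- the modified first derivatives of `F` -/
def ψ : Option (Fin 3) → SF tp ti
  | none => S.X S.F + S.gC * dd e1 S.F
  | some i => Dv i S.F

theorem van_ψ : ∀ i, S.Van (S.ψ i)
  | none => S.van_F.X.add ((S.van_F.dd e1).mul _)
  | some i => S.van_F.dd _

theorem Tr_XF : Tr S.c S.b (S.X S.F) = (1/2 : ℝ) • (S.Lt * S.X S.F) - S.X S.lam * S.X S.F - S.X S.b * dd e1 S.F := by
  rw [c_eq, S.Tr_comm_X, ← c_eq, S.eV, map_zero, zero_add]

theorem Tr_dF (i : Fin 3) : Tr S.c S.b (Dv i S.F) = -(Dv i S.lam * S.X S.F) - Dv i S.b * dd e1 S.F := by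
  have := S.Tr_comm_v (ve i) S.lam S.b S.F
  rw [← c_eq, S.eV, map_zero, zero_sub] at this
  exact this

theorem XF_eq : S.X S.F = S.ψ none - S.gC * S.ψ (some 0) := by
  show _ = S.X S.F + S.gC * dd e1 S.F - S.gC * dd e1 S.F
  ring

/-- bounded combinations of a finite family -/
theorem lin_Nsup {ι : Type} [Finite ι] {G : ι → SF tp ti} {H : SF tp ti} {C : ι → SF tp ti}
    (hC : ∀ i, Bd S.dom (C i)) (s : Finset ι) (h : H = ∑ i ∈ s, C i * G i) :
    ∃ c, 0 ≤ c ∧ ∀ p ∈ S.dom, |ev H p| ≤ c * S.Nsup G p.1 := by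
  choose c h0 hc using hC
  refine ⟨∑ i ∈ s, c i, Finset.sum_nonneg fun i _ => h0 i, fun p hp => ?_⟩
  rw [h, ev_sum, Finset.sum_mul]
  refine (Finset.abs_sum_le_sum_abs _ _).trans (Finset.sum_le_sum fun i _ => ?_)
  rw [ev_mul, abs_mul]
  exact mul_le_mul (hc i p hp) (S.le_Nsup G hp i) (abs_nonneg _) (h0 i)

theorem bd_ψ (i : Option (Fin 3)) : Bd (early tp ti) (S.ψ i) := by
  refine S.gronwall S.ψ (fun i => Or.inr (S.van_ψ i)) (fun _ => S.c) (fun _ => S.b) (fun i => ?_) i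
  have hXl := S.bdd_X_of S.lvl_one.lam
  have h0 : ∀ a b : SF tp ti, Bd S.dom a → Bd S.dom b →
      ∀ j : Option (Fin 3), Bd S.dom (match j with | none => a | some 0 => b | some _ => 0) := by
    rintro a b ha hb (_ | j)
    · exact ha
    · fin_cases j
      · exact hb
      · exact Bd.zero
      · exact Bd.zero
  have key : ∀ H a b : SF tp ti, Bd S.dom a → Bd S.dom b → H = a * S.ψ none + b * S.ψ (some 0) →
      ∃ C, 0 ≤ C ∧ ∀ p ∈ S.dom, |ev H p| ≤ C * S.Nsup S.ψ p.1 := fun H a b ha hb h =>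
    S.lin_Nsup (h0 a b ha hb) {none, some 0} (by rw [h, Finset.sum_pair (by simp)]; rfl)
  cases i with
  | some i =>
    refine key _ (-Dv i S.lam) (Dv i S.lam * S.gC - Dv i S.b) (S.bdd_dv_lam i).neg
      (((S.bdd_dv_lam i).mul S.bdd_gC).sub (S.bdd_dv_b i)) ?_
    show Tr S.c S.b (Dv i S.F) = _
    rw [S.Tr_dF, S.XF_eq]
    show _ - _ * S.ψ (some 0) = _
    ring
  | none =>
    have hl : Bd S.dom ((1/2:ℝ) • S.Lt - S.X S.lam - S.gC * Dv 0 S.lam) :=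
      ((S.bdd_Lt.smul _).sub hXl).sub (S.bdd_gC.mul (S.bdd_dv_lam 0))
    refine key _ _ (-(((1/2:ℝ) • S.Lt - S.X S.lam - S.gC * Dv 0 S.lam) * S.gC) + (Tr S.c S.b S.gC - S.X S.b)
      - S.gC * Dv 0 S.b) hl (((hl.mul S.bdd_gC).neg.add S.bdd_Tr_gC).sub (S.bdd_gC.mul (S.bdd_dv_b 0))) ?_
    have h1 := S.Tr_dF 0
    have h2 := S.Tr_XF
    have h3 := S.XF_eq
    show Tr S.c S.b (S.X S.F + S.gC * Dv 0 S.F) = _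
    rw [map_add, Derivation.leibniz, h1, h2]
    show _ - _ - _ * S.ψ (some 0) + (_ • (_ - _ * S.ψ (some 0)) + S.ψ (some 0) • _) = _
    rw [h3]
    simp only [smul_eq_mul, Algebra.smul_def]
    ring

theorem PB_F_one : PB S.dom S.D 1 1 S.F := by
  refine ⟨S.bdd_F, fun i => PB.zero_one_iff.2 ?_⟩
  cases i with
  | none =>
    show Bd S.dom (S.X S.F)
    rw [S.XF_eq]
    exact ((S.bd_ψ none).mono S.dom_sub).sub (S.bdd_gC.mul ((S.bd_ψ (some 0)).mono S.dom_sub))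
  | some i => exact (S.bd_ψ (some i)).mono S.dom_sub

/-- the transport operator applied to a derivative -/
theorem Tr_D {N : ℝ → ℝ} {n : ℕ} (hN : ∀ p ∈ S.dom, 1 ≤ N p.1) {l b : SF tp ti}
    (hl : PB S.dom S.D N (n + 1) l) (hb : PB S.dom S.D N (n + 1) b) (hL : PB S.dom S.D N n S.Lt)
    (hl1 : ∀ i, Bd S.dom (S.D i l)) (hb1 : ∀ i, Bd S.dom (S.D i b)) {G : SF tp ti}
    (hG : PB S.dom S.D N (n + 1) G) (hT : PB S.dom S.D N (n + 1) (Tr (l * S.σ) b G)) (i : Option (Fin 3)) :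
    PB S.dom S.D N n (Tr (l * S.σ) b (S.D i G)) := by
  have hX : PB S.dom S.D N n (S.X G) := hG.2 none
  have hq : PB S.dom S.D N n (dd e1 G) := hG.2 (some 0)
  cases i with
  | none =>
    show PB S.dom S.D N n (Tr (l * S.σ) b (S.X G))
    rw [S.Tr_comm_X]
    exact (((hT.2 none).add ((hL.mul hN hX S.bdd_Lt).smul _)).sub ((hl.2 none).mul hN hX (hl1 none))).sub
      ((hb.2 none).mul hN hq (hb1 none))
  | some i =>
    have h : Tr (l * S.σ) b (S.D (some i) G) = S.D (some i) (Tr (l * S.σ) b G)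
      - S.D (some i) l * S.X G - S.D (some i) b * dd e1 G := S.Tr_comm_v (ve i) l b G
    rw [h]
    exact ((hT.2 (some i)).sub ((hl.2 (some i)).mul hN hX (hl1 (some i)))).sub
      ((hb.2 (some i)).mul hN hq (hb1 (some i)))

/-- words of derivatives of solutions of transport equations -/
theorem word_bound {N : ℝ → ℝ} {n : ℕ} (hN : ∀ p ∈ S.dom, 1 ≤ N p.1) {l b : SF tp ti}
    (hl : PB S.dom S.D N n l) (hb : PB S.dom S.D N n b) (hL : PB S.dom S.D N n S.Lt)
    (hl1 : ∀ i, Bd S.dom (S.D i l)) (hb1 : ∀ i, Bd S.dom (S.D i b)) {G : SF tp ti}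
    (hG : PB S.dom S.D N n G) (hT : PB S.dom S.D N n (Tr (l * S.σ) b G)) :
    ∀ w : List (Option (Fin 3)), w.length = n → PB S.dom S.D N 0 (Tr (l * S.σ) b (Dw S.D w G)) := by
  induction n generalizing G with
  | zero =>
    intro w hw
    rw [List.length_eq_zero_iff.1 hw]; exact hT
  | succ n ih =>
    intro w hw
    rcases List.eq_nil_or_concat w with rfl | ⟨w', i, rfl⟩
    · simp at hw
    rw [List.concat_eq_append, Dw_append]
    exact ih (hl.down hN) (hb.down hN) (hL.down hN) (hG.2 i)
      (S.Tr_D hN hl hb (hL.down hN) hl1 hb1 hG hT i) w' (by simpa using hw)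

/-- one more derivative for a family of solutions of transport equations -/
theorem stepGen {κ : Type} [Finite κ] (G l b : κ → SF tp ti) (k : ℕ) (hG : ∀ i, S.Loc (G i))
    (h : ∀ i, PB S.dom S.D 1 k (G i))
    (H : ∀ N : ℝ → ℝ, (∀ p ∈ S.dom, 1 ≤ N p.1) → (∀ i, PB S.dom S.D N (k + 1) (G i)) →
      PB S.dom S.D N (k + 1) S.Lt ∧ ∀ i, PB S.dom S.D N (k + 1) (Tr (l i * S.σ) (b i) (G i)) ∧
        PB S.dom S.D N (k + 1) (l i) ∧ PB S.dom S.D N (k + 1) (b i) ∧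
        (∀ j, Bd S.dom (S.D j (l i))) ∧ ∀ j, Bd S.dom (S.D j (b i))) (i : κ) :
    PB S.dom S.D 1 (k + 1) (G i) := by
  set Gw : κ × List.Vector (Option (Fin 3)) (k + 1) → SF tp ti := fun x => Dw S.D x.2.1 (G x.1) with hGw
  have hLoc : ∀ (w : List (Option (Fin 3))) i, S.Loc (Dw S.D w (G i)) := by
    intro w i
    induction w with
    | nil => exact hG i
    | cons j w ih =>
      rcases ih with ih | ih
      · cases j with
        | none => exact Or.inl (S.base_X ih)
        | some j =>
          left
          show Base (dd _ _)
          rw [ih.dd_v]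
          intro t θ v w; simp
      · cases j with
        | none => exact Or.inr ih.X
        | some j => exact Or.inr (ih.dd _)
  have hN : ∀ p ∈ S.dom, 1 ≤ S.Nsup Gw p.1 := fun p _ => S.one_le_Nsup Gw p.1
  have : Finite (List.Vector (Option (Fin 3)) (k + 1)) := inferInstance
  have hk : ∀ i, PB S.dom S.D (S.Nsup Gw) (k + 1) (G i) := fun i => (h i).of_words fun w hw =>
    ⟨1, zero_le_one, fun p hp => by rw [one_mul]; exact S.le_Nsup Gw hp (i, ⟨w, hw⟩)⟩
  obtain ⟨hL, hH⟩ := H _ hN hk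
  have key := S.gronwall Gw (fun x => hLoc _ _) (fun x => l x.1 * S.σ) (fun x => b x.1) (fun x => by
    obtain ⟨h1, h2, h3, h4, h5⟩ := hH x.1
    exact S.word_bound hN h2 h3 hL h4 h5 (hk x.1) h1 x.2.1 x.2.2)
  exact (h i).of_words fun w hw => PB.zero_one_iff.2 ((key (i, ⟨w, hw⟩)).mono S.dom_sub)

end Sys

namespace Sys
variable [hfact : Fact (0 < tp)] (S : Sys tp ti)

/-- the sign of a null direction -/
def sg (s : Bool) : ℝ := if s then 1 else -1

theorem sg_true : sg true = 1 := rfl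
theorem sg_false : sg false = -1 := by simp [sg]

theorem sg_sq (s : Bool) : sg s * sg s = 1 := by cases s <;> norm_num [sg]

/-- null derivatives of `U` and `A` -/
def nul : Bool × Bool → SF tp ti
  | (true, s) => S.Ut + sg s • S.XU
  | (false, s) => S.At + sg s • S.XA

theorem base_nul : ∀ x, Base (S.nul x)
  | (true, s) => S.base_Ut.add (S.base_XU.smul _)
  | (false, s) => S.base_At.add (S.base_XA.smul _)

theorem bdd_nul : ∀ x, Bd S.dom (S.nul x)
  | (true, s) => S.bdd_Ut.add (S.bdd_XU.smul _)
  | (false, s) => S.bdd_At.add (S.bdd_XA.smul _)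

theorem Tr_nul_U (s : Bool) : Tr (algebraMap ℝ _ (-sg s) * S.σ) 0 (S.nul (true, s)) =
    S.RU + sg s • ((1/2:ℝ) • (S.Lt * S.XU)) := by
  have h3 : dd eT S.XU = S.X S.Ut + (1/2:ℝ) • (S.Lt * S.XU) := S.dT_X S.U
  have h4 : algebraMap ℝ (SF tp ti) (sg s) * algebraMap ℝ (SF tp ti) (sg s) = 1 := by
    rw [← map_mul, sg_sq, map_one]
  rw [Tr_X, nul, map_add, map_add, Derivation.map_smul, Derivation.map_smul, S.eq_Ut, h3]
  simp only [Algebra.smul_def, map_neg, zero_mul]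
  linear_combination (-S.X S.XU) * h4

theorem Tr_nul_A (s : Bool) : Tr (algebraMap ℝ _ (-sg s) * S.σ) 0 (S.nul (false, s)) =
    S.RA + sg s • ((1/2:ℝ) • (S.Lt * S.XA)) := by
  have h3 : dd eT S.XA = S.X S.At + (1/2:ℝ) • (S.Lt * S.XA) := S.dT_X S.A
  have h4 : algebraMap ℝ (SF tp ti) (sg s) * algebraMap ℝ (SF tp ti) (sg s) = 1 := by
    rw [← map_mul, sg_sq, map_one]
  rw [Tr_X, nul, map_add, map_add, Derivation.map_smul, Derivation.map_smul, S.eq_At, h3]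
  simp only [Algebra.smul_def, map_neg, zero_mul]
  linear_combination (-S.X S.XA) * h4

variable {S} {N : ℝ → ℝ} {n k : ℕ}

theorem Lvl.of_one (hN : ∀ p ∈ S.dom, 1 ≤ N p.1) (l : S.Lvl S.D 1 n) : S.Lvl S.D N n where
  good := l.good
  hN := hN
  U := l.U.of_one hN
  A := l.A.of_one hN
  β := l.β.of_one hN
  J := l.J.of_one hN
  K := l.K.of_one hN

theorem Lvl.lvl1 (l : S.Lvl S.D N n) (hF : PB S.dom S.D N n S.F) (h : ∀ x, PB S.dom S.D N n (S.nul x)) :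
    S.Lvl1 S.D N n where
  toLvl := l
  F := hF
  Ut := by
    have : S.Ut = (1/2:ℝ) • (S.nul (true, true) + S.nul (true, false)) := by simp only [nul, sg_true, sg_false]; module
    rw [this]; exact ((h _).add (h _)).smul _
  XU := by
    have : S.XU = (1/2:ℝ) • (S.nul (true, true) - S.nul (true, false)) := by simp only [nul, sg_true, sg_false]; module
    rw [this]; exact ((h _).sub (h _)).smul _
  At := by
    have : S.At = (1/2:ℝ) • (S.nul (false, true) + S.nul (false, false)) := by simp only [nul, sg_true, sg_false]; module
    rw [this]; exact ((h _).add (h _)).smul _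
  XA := by
    have : S.XA = (1/2:ℝ) • (S.nul (false, true) - S.nul (false, false)) := by simp only [nul, sg_true, sg_false]; module
    rw [this]; exact ((h _).sub (h _)).smul _

theorem Lvl1.nul (l : S.Lvl1 S.D N n) : ∀ x, PB S.dom S.D N n (S.nul x)
  | (true, s) => l.Ut.add (l.XU.smul _)
  | (false, s) => l.At.add (l.XA.smul _)

theorem Lvl1.Tr_nul (l : S.Lvl1 S.D N n) : ∀ x : Bool × Bool,
    PB S.dom S.D N n (Tr (algebraMap ℝ _ (-sg x.2) * S.σ) 0 (S.nul x))
  | (true, s) => by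
    rw [S.Tr_nul_U]; exact l.RU.add (((l.Lt.mul l.hN l.XU S.bdd_Lt).smul _).smul _)
  | (false, s) => by
    rw [S.Tr_nul_A]; exact l.RA.add (((l.Lt.mul l.hN l.XA S.bdd_Lt).smul _).smul _)

variable (S)

theorem bdd_D_const (c : ℝ) (j : Option (Fin 3)) : Bd S.dom (S.D j (algebraMap ℝ _ c)) := by
  rw [Derivation.map_algebraMap]; exact Bd.zero
theorem bdd_D_zero (j : Option (Fin 3)) : Bd S.dom (S.D j 0) := by
  rw [map_zero]; exact Bd.zero

theorem lvl1_one : S.Lvl1 S.D 1 1 := by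
  refine S.lvl_one.lvl1 S.PB_F_one fun x => ?_
  refine S.stepGen S.nul (fun x => algebraMap ℝ _ (-sg x.2)) (fun _ => 0) 0 (fun x => Or.inl (S.base_nul x))
    (fun x => PB.zero_one_iff.2 (S.bdd_nul x)) (fun N hN h => ?_) x
  have l := (S.lvl_one.of_one hN).lvl1 (S.PB_F_one.of_one hN) h
  exact ⟨l.Lt, fun x => ⟨l.Tr_nul x, PB.const hN _, PB.zero hN, S.bdd_D_const _, S.bdd_D_zero⟩⟩

theorem lvl1_succ (l : S.Lvl1 S.D 1 (k + 1)) : S.Lvl1 S.D 1 (k + 2) := by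
  have l1 := S.lvl1_one
  have key := S.stepGen (κ := Option (Bool × Bool)) (fun x => x.elim S.F S.nul)
    (fun x => x.elim S.lam fun x => algebraMap ℝ _ (-sg x.2)) (fun x => x.elim S.b fun _ => 0) (k + 1)
    (fun x => by
      cases x with
      | none => exact Or.inr S.van_F
      | some x => exact Or.inl (S.base_nul x))
    (fun x => by
      cases x with
      | none => exact l.F
      | some x => exact l.nul x)
    (fun N hN h => by
      have m := (l.succ.of_one hN).lvl1 (h none) fun x => h (some x)
      refine ⟨m.Lt, fun x => ?_⟩
      cases x with
      | none =>
        refine ⟨?_, m.lam, m.b, fun j => (l1.lam.2 j).bd, fun j => (l1.b.2 j).bd⟩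
        show PB _ _ _ _ (Tr S.c S.b S.F)
        rw [S.eV]; exact PB.zero hN
      | some x => exact ⟨m.Tr_nul x, PB.const hN _, PB.zero hN, S.bdd_D_const _, S.bdd_D_zero⟩)
  exact l.succ.lvl1 (key none) fun x => key (some x)

theorem lvl1 (n : ℕ) : S.Lvl1 S.D 1 n := by
  cases n with
  | zero => exact S.lvl1_zero S.good_D
  | succ n =>
    induction n with
    | zero => exact S.lvl1_one
    | succ n ih => exact S.lvl1_succ ih

theorem PB_L (n : ℕ) : PB S.dom S.D 1 n S.L := by
  induction n with
  | zero => exact PB.zero_one_iff.2 (S.bd_L.mono S.dom_sub)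
  | succ n ih =>
    refine S.stepGen (κ := Unit) (fun _ => S.L) (fun _ => 0) (fun _ => 0) n (fun _ => Or.inl S.bL) (fun _ => ih)
      (fun N hN _ => ?_) ()
    have h := (S.lvl1 (n + 1)).Lt.of_one hN
    refine ⟨h, fun _ => ⟨?_, PB.zero hN, PB.zero hN, S.bdd_D_zero, S.bdd_D_zero⟩⟩
    rw [Tr_X, zero_mul, zero_mul, add_zero, add_zero]; exact h

end Sys

namespace Sys
variable [hfact : Fact (0 < tp)] (S : Sys tp ti)

/-- functions built from the fields by the operations occurring in the equations -/
inductive Mem : SF tp ti → Prop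
  | U : Mem S.U
  | A : Mem S.A
  | L : Mem S.L
  | β : Mem S.β
  | J : Mem S.J
  | K : Mem S.K
  | F : Mem S.F
  | Ut : Mem S.Ut
  | At : Mem S.At
  | tI : Mem tI
  | t : Mem tR
  | q : Mem qR
  | v2 : Mem v2R
  | v3 : Mem v3R
  | const (c : ℝ) : Mem (algebraMap ℝ _ c)
  | add {G H : SF tp ti} : Mem G → Mem H → Mem (G + H)
  | mul {G H : SF tp ti} : Mem G → Mem H → Mem (G * H)
  | exp {G : SF tp ti} : Mem G → Mem (expR G)
  | inv {G r : SF tp ti} : Mem G → G * r ^ 2 = 1 → Bd S.dom r → Mem r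
  | D {G : SF tp ti} (i : Option (Fin 3)) : Mem G → Mem (S.D i G)
  | mr {G : SF tp ti} : Mem G → Mem (MR S.B G)

variable {S}

theorem Mem.reg {G : SF tp ti} (h : S.Mem G) (n : ℕ) : PB S.dom S.D 1 n G := by
  have hN := S.one_le_one
  induction h generalizing n with
  | U => exact (S.lvl1 n).U
  | A => exact (S.lvl1 n).A
  | L => exact S.PB_L n
  | β => exact (S.lvl1 n).β
  | J => exact (S.lvl1 n).J
  | K => exact (S.lvl1 n).K
  | F => exact (S.lvl1 n).F
  | Ut => exact (S.lvl1 n).Ut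
  | At => exact (S.lvl1 n).At
  | tI => exact S.good_D.tI hN
  | t => exact S.good_D.t hN
  | q => exact S.good_D.q hN
  | v2 => exact S.good_D.v2 hN
  | v3 => exact S.good_D.v3 hN
  | const c => exact PB.const hN c
  | add _ _ h k => exact (h n).add (k n)
  | mul _ _ h k => exact (h n).mul hN (k n) (h 0).bd
  | exp _ h => exact (h n).expR hN S.good_D.exp (h 0).bd
  | inv _ hr hb h => exact (h n).sq_inv hN hr hb
  | D i _ h => exact (h (n + 1)).2 i
  | mr _ h => exact S.PB_MR hN S.good_D.mr (h n)

namespace Mem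

theorem smul {G : SF tp ti} (c : ℝ) (h : S.Mem G) : S.Mem (c • G) := by
  rw [Algebra.smul_def]; exact (const c).mul h
theorem neg {G : SF tp ti} (h : S.Mem G) : S.Mem (-G) := by
  rw [← neg_one_smul ℝ G]; exact h.smul _
theorem sub {G H : SF tp ti} (h : S.Mem G) (k : S.Mem H) : S.Mem (G - H) := by
  rw [sub_eq_add_neg]; exact h.add k.neg
theorem one : S.Mem (1 : SF tp ti) := by rw [← map_one (algebraMap ℝ (SF tp ti))]; exact const 1
theorem zero : S.Mem (0 : SF tp ti) := by rw [← map_zero (algebraMap ℝ (SF tp ti))]; exact const 0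
theorem pow {G : SF tp ti} (h : S.Mem G) (n : ℕ) : S.Mem (G ^ n) := by
  induction n with
  | zero => rw [pow_zero]; exact one
  | succ n ih => rw [pow_succ]; exact ih.mul h
theorem X {G : SF tp ti} (h : S.Mem G) : S.Mem (S.X G) := h.D none
theorem dv {G : SF tp ti} (h : S.Mem G) (i : Fin 3) : S.Mem (dd (0, 0, ve i) G) := h.D (some i)
theorem XU : S.Mem S.XU := U.X
theorem XA : S.Mem S.XA := A.X
theorem E2 : S.Mem S.E2 := ((β.smul _).sub (U.smul _)).exp
theorem E4 : S.Mem S.E4 := ((β.smul _).sub (U.smul _)).exp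
theorem E0 : S.Mem S.E0 := (β.smul _).exp
theorem σ : S.Mem S.σ := (L.smul _).exp
theorem a : S.Mem S.a := (L.smul _).exp
theorem h : S.Mem S.h := (((U.smul _).exp).mul (tI.pow _)).smul _
theorem κ : S.Mem S.κ := K.sub (A.mul J)
theorem w : S.Mem S.w := v3.sub (A.mul v2)
theorem m2 : S.Mem S.m2 := (E2.add (E4.mul (v2.pow 2))).add (((tI.pow 2).mul E0).mul (w.pow 2))
theorem P : S.Mem S.P := (q.pow 2).add m2
theorem rp : S.Mem S.rp := P.inv S.P_rp S.bdd_slab.2.2.2.1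
theorem M {φ : SF tp ti} (h : S.Mem φ) : S.Mem (S.M φ) := (F.mul h).mr
theorem Lt : S.Mem S.Lt := by
  rw [S.eq_Lt]
  exact (((tI.mul E4).mul (J.pow 2)).add (((tI.pow 3).mul E0).mul (κ.pow 2))).neg.sub ((m2.mul rp).M.smul _)
theorem N : S.Mem S.N := by
  rw [S.eq_N]
  exact (((t.mul (((Ut.pow 2).add (XU.pow 2)).add (h.mul ((At.pow 2).add (XA.pow 2))))).add
    (((tI.mul E4).mul (J.pow 2)).smul _)).add ((((tI.pow 3).mul E0).mul (κ.pow 2)).smul _)).add (P.mul rp).M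
theorem b : S.Mem S.b := ((Lt.mul q).smul _).add (((((m2.X).mul rp).smul _).add
    ((((tI.pow 3).mul E0).mul κ).mul w)).add (((tI.mul E4).mul J).mul v2))
theorem RU : S.Mem S.RU := (((((tI.mul Ut).neg.add ((Lt.mul Ut).smul _)).add
  ((h.mul ((At.pow 2).sub (XA.pow 2))).smul _)).add ((((tI.pow 2).mul E4).mul (J.pow 2)).smul _)).add
  (((tI.mul E2).mul (((one.add ((((U.smul _).exp).mul (v2.pow 2)).smul _)).mul rp).M)).smul _))
theorem RA : S.Mem S.RA := ((((tI.mul At).add ((Lt.mul At).smul _)).sub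
  (((At.mul Ut).sub (XA.mul XU)).smul _)).add ((((tI.pow 2).mul E4).mul J).mul κ)).add
  (((tI.mul E4).mul ((v2.mul w).mul rp).M).smul _)

theorem dT {G : SF tp ti} (m : S.Mem G) : S.Mem (dd eT G) := by
  have lin : ∀ {G : SF tp ti}, G ∈ ({tR, qR, v2R, v3R} : Set (SF tp ti)) → S.Mem (dd eT G) := fun hG => by
    obtain ⟨c, hc⟩ := lin_dd eT hG
    rw [hc]; exact const c
  induction m with
  | U => exact Ut
  | A => exact At
  | L => exact Lt
  | β => rw [S.eq_βt]; exact N.add (Lt.smul _)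
  | J => rw [S.eq_Jt]; exact ((q.mul v2).mul rp).M.smul _
  | K => rw [S.eq_Kt]; exact ((q.mul v3).mul rp).M.smul _
  | F =>
    have : dd eT S.F = -(S.lam * S.X S.F) - S.b * dd e1 S.F := by
      have := S.eV
      rw [c_eq, Tr_X] at this
      linear_combination this
    rw [this]
    exact ((q.mul rp).mul F.X).neg.sub (b.mul (F.dv 0))
  | Ut => rw [S.eq_Ut]; exact XU.X.add RU
  | At => rw [S.eq_At]; exact XA.X.add RA
  | tI => rw [dd_tI]; exact ((tI.pow 2).smul _).neg
  | t => exact lin (by simp)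
  | q => exact lin (by simp)
  | v2 => exact lin (by simp)
  | v3 => exact lin (by simp)
  | const c => rw [Derivation.map_algebraMap]; exact zero
  | add _ _ h k => rw [map_add]; exact h.add k
  | mul h k h' k' => rw [Derivation.leibniz]; exact (h.mul k').add (k.mul h')
  | exp h h' => rw [dd_expR]; exact h.exp.mul h'
  | inv h hr hb h' =>
    rw [deriv_of_sq_inv _ hr]
    exact (((h.inv hr hb).pow 3).mul h').smul _
  | D i h h' =>
    cases i with
    | none =>
      show S.Mem (dd eT (S.X _))
      rw [S.dT_X]; exact h'.X.add ((Lt.mul h.X).smul _)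
    | some i =>
      show S.Mem (dd eT (dd _ _))
      rw [dd_comm]; exact h'.dv i
  | mr h h' => rw [dd_eT_MR]; exact h'.mr

theorem dθ {G : SF tp ti} (m : S.Mem G) : S.Mem (dd eθ G) := by
  rw [← S.a_X]; exact a.mul m.X

theorem bd {G : SF tp ti} (m : S.Mem G) : Bd S.dom G := (m.reg 0).bd

end Mem

end Sys

section Iter
variable {E : Type*} [NormedAddCommGroup E] [NormedSpace ℝ E]

/-- a class of functions closed under partial derivatives, all bounded, has bounded iterated derivatives -/
theorem iter_bdd {ι : Type*} [Fintype ι] (e : ι → E) (π : ι → E →L[ℝ] ℝ) (hπ : ∀ x, x = ∑ i, π i x • e i)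
    {W W' : Set E} (hW : IsOpen W) (hW' : W' ⊆ W) (C : Set (E → ℝ)) (h1 : ∀ g ∈ C, ContDiffOn ℝ (⊤ : ℕ∞) g W)
    (h2 : ∀ g ∈ C, ∃ c, ∀ p ∈ W', |g p| ≤ c)
    (h3 : ∀ g ∈ C, ∀ i, ∃ g' ∈ C, ∀ p ∈ W, fderiv ℝ g p (e i) = g' p) (k : ℕ) :
    ∀ g ∈ C, ∃ c, ∀ p ∈ W', ‖iteratedFDeriv ℝ k g p‖ ≤ c := by
  induction k with
  | zero =>
    intro g hg
    obtain ⟨c, hc⟩ := h2 g hg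
    exact ⟨c, fun p hp => by rw [norm_iteratedFDeriv_zero]; exact hc p hp⟩
  | succ k ih =>
    intro g hg
    choose g' hg' hd using h3 g hg
    choose c hc using fun i => ih (g' i) (hg' i)
    refine ⟨∑ i, ‖ContinuousLinearMap.smulRight (1 : ℝ →L[ℝ] ℝ) (π i)‖ * c i, fun p hp => ?_⟩
    rw [← norm_iteratedFDeriv_fderiv]
    have hp' := hW' hp
    have he : fderiv ℝ g =ᶠ[𝓝 p] ∑ i, (ContinuousLinearMap.smulRight (1 : ℝ →L[ℝ] ℝ) (π i)) ∘ g' i := by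
      filter_upwards [hW.mem_nhds hp'] with q hq
      ext x
      simp only [Finset.sum_apply, Function.comp, ContinuousLinearMap.smulRight_apply, one_apply_eq_self,
        _root_.sum_apply, _root_.smul_apply, smul_eq_mul]
      conv_lhs => rw [hπ x, map_sum]
      refine Finset.sum_congr rfl fun i _ => ?_
      rw [map_smul, hd i q hq, smul_eq_mul, mul_comm]
    have hs : ∀ i, ContDiffAt ℝ k (g' i) p := fun i =>
      ((h1 _ (hg' i)).contDiffAt (hW.mem_nhds hp')).of_le (by exact_mod_cast le_top)
    rw [(he.iteratedFDeriv ℝ k).eq_of_nhds, iteratedFDeriv_sum_apply fun i _ =>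
      (ContinuousLinearMap.contDiff _).contDiffAt.comp p (hs i)]
    refine (norm_sum_le _ _).trans (Finset.sum_le_sum fun i _ => ?_)
    refine (ContinuousLinearMap.norm_iteratedFDeriv_comp_left _ (hs i) le_rfl).trans ?_
    exact mul_le_mul_of_nonneg_left (hc i p hp) (norm_nonneg _)

theorem iteratedFDeriv_zero_of_eventually {F : Type*} [NormedAddCommGroup F] [NormedSpace ℝ F] {g : E → F} {p : E}
    (h : g =ᶠ[𝓝 p] 0) (k : ℕ) : iteratedFDeriv ℝ k g p = 0 := by
  rw [(h.iteratedFDeriv ℝ k).eq_of_nhds]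
  simp

/-- boundedness by compactness, up to symmetries and away from the support -/
theorem iter_bdd_compact {s K W' : Set E} (hs : UniqueDiffOn ℝ s) {g : E → ℝ} (hg : ContDiffOn ℝ (⊤ : ℕ∞) g s)
    (hK : IsCompact K) (hKs : K ⊆ s)
    (h : ∀ p ∈ W', (∃ τ, (∀ x, g (x + τ) = g x) ∧ p + τ ∈ K ∧ p + τ ∈ interior s) ∨ g =ᶠ[𝓝 p] 0) (k : ℕ) :
    ∃ c, ∀ p ∈ W', ‖iteratedFDeriv ℝ k g p‖ ≤ c := by
  have hc : ContinuousOn (iteratedFDerivWithin ℝ k g s) K :=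
    (hg.continuousOn_iteratedFDerivWithin (by exact_mod_cast le_top) hs).mono hKs
  obtain ⟨c, hc⟩ := hK.exists_bound_of_continuousOn hc
  refine ⟨max c 0, fun p hp => ?_⟩
  rcases h p hp with ⟨τ, h1, h2, h3⟩ | h0
  · have : iteratedFDeriv ℝ k g p = iteratedFDeriv ℝ k g (p + τ) := by
      rw [← iteratedFDeriv_comp_add_right k τ p]
      congr 1
      funext x; exact (h1 x).symm
    rw [this]
    refine le_trans ?_ (le_max_left _ _)
    have := hc _ h2
    rwa [← iteratedFDerivWithin_univ, iteratedFDerivWithin_congr_set (t := s)]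
    exact (mem_interior_iff_mem_nhds.1 h3 |> fun hm => by
      filter_upwards [hm] with x hx
      exact propext ⟨fun _ => hx, fun _ => trivial⟩)
  · rw [iteratedFDeriv_zero_of_eventually h0, norm_zero]; exact le_max_right _ _

/-- interior bounds extend to the boundary -/
theorem iter_within_of_interior {s : Set E} (hs : UniqueDiffOn ℝ s) (hsi : s ⊆ closure (interior s)) {g : E → ℝ}
    (hg : ContDiffOn ℝ (⊤ : ℕ∞) g s) {k : ℕ} {c : ℝ} (h : ∀ p ∈ interior s, ‖iteratedFDeriv ℝ k g p‖ ≤ c) :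
    ∀ p ∈ s, ‖iteratedFDerivWithin ℝ k g s p‖ ≤ c := by
  have hc := hg.continuousOn_iteratedFDerivWithin (m := k) (by exact_mod_cast le_top) hs
  intro p hp
  have hp' : (𝓝[interior s] p).NeBot := mem_closure_iff_nhdsWithin_neBot.1 (hsi hp)
  have ht := ((hc p hp).mono interior_subset).norm
  refine le_of_tendsto ht.tendsto ?_
  filter_upwards [self_mem_nhdsWithin] with q hq
  have := h q hq
  rwa [← iteratedFDerivWithin_univ, iteratedFDerivWithin_congr_set (t := s)] at this
  filter_upwards [mem_interior_iff_mem_nhds.1 hq] with x hx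
  exact propext ⟨fun _ => hx, fun _ => trivial⟩

end Iter

namespace Sys
variable [hfact : Fact (0 < tp)] (S : Sys tp ti)

theorem fderiv_eq_of_curve {E : Type*} [NormedAddCommGroup E] [NormedSpace ℝ E] {g : E → ℝ} {p e : E} {d : ℝ}
    (hg : DifferentiableAt ℝ g p) (h : HasDerivAt (fun s : ℝ => g (p + s • e)) d 0) : fderiv ℝ g p e = d := by
  have h1 : HasDerivAt (fun s : ℝ => p + s • e) e 0 := by
    simpa using ((hasDerivAt_id (0:ℝ)).smul_const e).const_add p
  have h2 : HasFDerivAt g (fderiv ℝ g p) (p + (0:ℝ) • e) := by simpa using hg.hasFDerivAt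
  exact (h2.comp_hasDerivAt (0:ℝ) h1).unique h

/-- restriction to zero velocity -/
def rest (G : SF tp ti) (x : ℝ × ℝ) : ℝ := ev G (x.1, x.2, 0)

theorem rest_contDiffOn (G : SF tp ti) : ContDiffOn ℝ (⊤ : ℕ∞) (rest G) (Ioo tp ti ×ˢ univ) :=
  (ev_contDiffOn G).comp (f := fun x : ℝ × ℝ => ((x.1, x.2, 0) : E5)) (by fun_prop)
    fun x hx => mem_strip.2 hx.1

theorem isOpen_base : IsOpen (Ioo tp ti ×ˢ (univ : Set ℝ)) := isOpen_Ioo.prod isOpen_univ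

theorem rest_iter {G : SF tp ti} (hm : S.Mem G) (hb : Base G) (k : ℕ) :
    ∃ c, ∀ x ∈ Ioc tp (tm tp ti) ×ˢ (univ : Set ℝ), ‖iteratedFDeriv ℝ k (rest G) x‖ ≤ c := by
  have hsub : Ioc tp (tm tp ti) ×ˢ (univ : Set ℝ) ⊆ Ioo tp ti ×ˢ univ := fun x hx =>
    ⟨early_Ioo hx.1, hx.2⟩
  refine iter_bdd (e := fun i : Bool => bif i then ((1, 0) : ℝ × ℝ) else (0, 1))
    (π := fun i => bif i then ContinuousLinearMap.fst ℝ ℝ ℝ else ContinuousLinearMap.snd ℝ ℝ ℝ)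
    (fun x => by ext <;> simp) isOpen_base hsub {g | ∃ G : SF tp ti, S.Mem G ∧ Base G ∧ g = rest G} ?_ ?_ ?_ k
    _ ⟨G, hm, hb, rfl⟩
  · rintro _ ⟨G, -, -, rfl⟩
    exact rest_contDiffOn G
  · rintro _ ⟨G, hm, hb, rfl⟩
    obtain ⟨c, -, hc⟩ := S.Bd_early_of_dom hb hm.bd
    exact ⟨c, fun x hx => hc _ ⟨hx.1, trivial⟩⟩
  · rintro _ ⟨G, hm, hb, rfl⟩ i
    have hd : ∀ x ∈ Ioo tp ti ×ˢ (univ : Set ℝ), DifferentiableAt ℝ (rest G) x := fun x hx =>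
      ((rest_contDiffOn G).contDiffAt (isOpen_base.mem_nhds hx)).differentiableAt (by simp)
    cases i with
    | true =>
      refine ⟨_, ⟨dd eT G, hm.dT, hb.dd_T, rfl⟩, fun x hx => fderiv_eq_of_curve (hd x hx) ?_⟩
      have := hasDerivAt_ev_comp G (c := fun s : ℝ => ((x.1, x.2, 0) + s • eT : E5)) (e := eT) (s := 0)
        (by simpa using ((hasDerivAt_id (0:ℝ)).smul_const eT).const_add ((x.1, x.2, 0) : E5))
        (by simpa [mem_strip] using hx.1)
      refine (this.congr_of_eventuallyEq (.of_forall fun s => ?_)).congr_deriv ?_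
      · simp [rest, eT]; rfl
      · simp [rest]
    | false =>
      refine ⟨_, ⟨dd eθ G, hm.dθ, hb.dd_θ, rfl⟩, fun x hx => fderiv_eq_of_curve (hd x hx) ?_⟩
      have := hasDerivAt_ev_comp G (c := fun s : ℝ => ((x.1, x.2, 0) + s • eθ : E5)) (e := eθ) (s := 0)
        (by simpa using ((hasDerivAt_id (0:ℝ)).smul_const eθ).const_add ((x.1, x.2, 0) : E5))
        (by simpa [mem_strip] using hx.1)
      refine (this.congr_of_eventuallyEq (.of_forall fun s => ?_)).congr_deriv ?_
      · simp [rest, eθ]; rfl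
      · simp [rest]

/-- rescaling of the first velocity component -/
def scale (σ : SF tp ti) (p : E5) : E5 := (p.1, p.2.1, ev σ p * p.2.2.1, p.2.2.2)

theorem scale_strip {σ : SF tp ti} {p : E5} (hp : p ∈ strip tp ti) : scale σ p ∈ strip tp ti :=
  mem_strip.2 (mem_strip.1 hp)

theorem scale_contDiffOn (σ : SF tp ti) : ContDiffOn ℝ (⊤ : ℕ∞) (scale σ) (strip tp ti) := by
  have h1 : ContDiffOn ℝ (⊤ : ℕ∞) (fun p : E5 => p.2.2.1) (strip tp ti) := by fun_prop
  have h2 : ContDiffOn ℝ (⊤ : ℕ∞) (fun p : E5 => p.1) (strip tp ti) := by fun_prop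
  have h3 : ContDiffOn ℝ (⊤ : ℕ∞) (fun p : E5 => p.2.1) (strip tp ti) := by fun_prop
  have h4 : ContDiffOn ℝ (⊤ : ℕ∞) (fun p : E5 => p.2.2.2) (strip tp ti) := by fun_prop
  exact h2.prodMk (h3.prodMk (((ev_contDiffOn σ).mul h1).prodMk h4))

theorem pull_contDiffOn (σ G : SF tp ti) :
    ContDiffOn ℝ (⊤ : ℕ∞) (fun p => ev G (scale σ p)) (strip tp ti) :=
  (ev_contDiffOn G).comp (scale_contDiffOn σ) fun _ hp => scale_strip hp

theorem fderiv_scale (e : E5) (σ G : SF tp ti) {p : E5} (hp : p ∈ strip tp ti) :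
    fderiv ℝ (fun p => ev G (scale σ p)) p e = ev (dd e G) (scale σ p)
      + (ev (dd e σ) p * p.2.2.1 + (ev σ p - 1) * e.2.2.1) * ev (dd e1 G) (scale σ p) := by
  refine fderiv_eq_of_curve (((pull_contDiffOn σ G).contDiffAt (isOpen_strip.mem_nhds hp)).differentiableAt
    (by simp)) ?_
  have hΨ := scale_strip (σ := σ) hp
  have hl : HasDerivAt (fun s : ℝ => p + s • e) e 0 := by
    simpa using ((hasDerivAt_id (0:ℝ)).smul_const e).const_add p
  have hσ := hasDerivAt_ev_comp σ (c := fun s : ℝ => p + s • e) hl (by simpa using hp)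
  have hl1 : HasDerivAt (fun s : ℝ => (p + s • e).1) e.1 0 := hl.fst
  have hl2 : HasDerivAt (fun s : ℝ => (p + s • e).2.1) e.2.1 0 := hl.snd.fst
  have hl3 : HasDerivAt (fun s : ℝ => (p + s • e).2.2.1) e.2.2.1 0 := hl.snd.snd.fst
  have hl4 : HasDerivAt (fun s : ℝ => (p + s • e).2.2.2) e.2.2.2 0 := hl.snd.snd.snd
  have hc := hl1.prodMk (hl2.prodMk ((hσ.mul hl3).prodMk hl4))
  refine (hasDerivAt_ev_comp G hc ?_).congr_deriv ?_
  · simpa [mem_strip] using mem_strip.1 hp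
  simp only [Pi.mul_apply, zero_smul, add_zero]
  change ev (dd _ G) (scale σ p) = _
  rw [ev_dd _ _ hΨ, ev_dd _ _ hΨ, ev_dd e1 _ hΨ,
    ← smul_eq_mul (b := fderiv ℝ (ev G) (scale σ p) e1), ← map_smul, ← map_add]
  congr 1
  ext <;> simp [e1]
  ring

/-- the passage to rescaled velocities -/
def Ψ (p : E5) : E5 := scale S.σ p

theorem Ψ_strip {p : E5} (hp : p ∈ strip tp ti) : S.Ψ p ∈ strip tp ti := scale_strip hp

/-- directional derivative conjugated by the rescaling -/
def dΨ (e : E5) (G : SF tp ti) : SF tp ti :=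
  dd e G + (S.a * dd e S.σ * qR + e.2.2.1 • (S.σ - 1)) * dd e1 G

theorem fderiv_pull (e : E5) (he : Base (dd e S.σ)) (G : SF tp ti) {p : E5} (hp : p ∈ strip tp ti) :
    fderiv ℝ (fun p => ev G (S.Ψ p)) p e = ev (S.dΨ e G) (S.Ψ p) := by
  have hΨ := S.Ψ_strip hp
  have e1' : ev S.σ (S.Ψ p) = ev S.σ p := S.base_σ _ _ _ _
  have e2 : ev (dd e S.σ) (S.Ψ p) = ev (dd e S.σ) p := he _ _ _ _
  have e3 : ev S.a (S.Ψ p) * ev S.σ p = 1 := by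
    have := congrArg (fun G => ev G (S.Ψ p)) S.a_σ
    simpa [e1', ev_one hΨ] using this
  rw [dΨ, ev_add, ev_mul, ev_add, ev_mul, ev_mul, ev_qR hΨ, ev_smul, ev_sub, ev_one hΨ, e1', e2]
  refine (fderiv_scale e S.σ G hp).trans ?_
  change _ = _ + (_ * (ev S.σ p * p.2.2.1) + _) * _
  change ev _ (S.Ψ p) + _ * ev _ (S.Ψ p) = _
  linear_combination (-(ev (dd e S.σ) p * p.2.2.1 * ev (dd e1 G) (S.Ψ p))) * e3

theorem Mem.dΨ {e : E5} {G : SF tp ti} (hm : S.Mem G) (h1 : S.Mem (dd e G)) (h2 : S.Mem (dd e S.σ)) :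
    S.Mem (S.dΨ e G) :=
  h1.add (((((Mem.a).mul h2).mul Mem.q).add ((Mem.σ.sub Mem.one).smul _)).mul (hm.dv 0))

/-- the standard basis of time, space and velocity -/
def basE : Option (Option (Fin 3)) → E5
  | none => eT
  | some none => eθ
  | some (some i) => (0, 0, ve i)

/-- the standard coordinates -/
def basπ : Option (Option (Fin 3)) → E5 →L[ℝ] ℝ
  | none => ContinuousLinearMap.fst ℝ ℝ _
  | some none => (ContinuousLinearMap.fst ℝ ℝ _).comp (ContinuousLinearMap.snd ℝ ℝ _)
  | some (some i) => (![ContinuousLinearMap.fst ℝ ℝ _, (ContinuousLinearMap.fst ℝ ℝ _).comp (ContinuousLinearMap.snd ℝ ℝ _),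
    (ContinuousLinearMap.snd ℝ ℝ _).comp (ContinuousLinearMap.snd ℝ ℝ _)] i : V3 →L[ℝ] ℝ).comp
      ((ContinuousLinearMap.snd ℝ ℝ _).comp (ContinuousLinearMap.snd ℝ ℝ _))

theorem bas_sum (x : E5) : x = ∑ i, basπ i x • basE i := by
  simp only [Fintype.sum_option, Fin.sum_univ_three, basπ, basE, ve]
  ext <;> simp [eT, eθ]

theorem base_bas (i) : Base (dd (basE i) S.σ) := by
  match i with
  | none => exact S.base_σ.dd_T
  | some none => exact S.base_σ.dd_θ
  | some (some i) => rw [basE, S.base_σ.dd_v]; exact fun _ _ _ _ => by simp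

theorem Mem.bas {G : SF tp ti} (hm : S.Mem G) (i) : S.Mem (dd (basE i) G) := by
  match i with
  | none => exact hm.dT
  | some none => exact hm.dθ
  | some (some i) => exact hm.dv i

theorem pull_iter (k : ℕ) : ∃ c, ∀ p ∈ early tp ti, ‖iteratedFDeriv ℝ k (fun p => ev S.F (S.Ψ p)) p‖ ≤ c := by
  obtain ⟨c, hc⟩ := iter_bdd basE basπ bas_sum isOpen_strip (W' := {p ∈ early tp ti | ‖(S.Ψ p).2.2‖ ≤ S.B})
    (fun p hp => early_strip hp.1) {g | ∃ G : SF tp ti, S.Mem G ∧ g = fun p => ev G (S.Ψ p)}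
    (by rintro _ ⟨G, -, rfl⟩; exact pull_contDiffOn S.σ G)
    (by
      rintro _ ⟨G, hm, rfl⟩
      obtain ⟨c, -, hc⟩ := hm.bd
      exact ⟨c, fun p hp => hc _ ⟨hp.1, hp.2⟩⟩)
    (by
      rintro _ ⟨G, hm, rfl⟩ i
      exact ⟨_, ⟨_, Mem.dΨ S hm (Mem.bas S hm i) (Mem.bas S .σ i), rfl⟩, fun p hp =>
        S.fderiv_pull _ (S.base_bas i) G hp⟩) k _ ⟨S.F, .F, rfl⟩
  refine ⟨max c 0, fun p hp => ?_⟩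
  by_cases h : ‖(S.Ψ p).2.2‖ ≤ S.B
  · exact (hc p ⟨hp, h⟩).trans (le_max_left _ _)
  · have hs := early_strip hp
    have hΨ := ((scale_contDiffOn S.σ).continuousOn.continuousAt (isOpen_strip.mem_nhds hs))
    have hn : ∀ᶠ q in 𝓝 p, S.B < ‖(S.Ψ q).2.2‖ := (hΨ.snd.snd.norm).eventually (lt_mem_nhds (not_le.1 h))
    rw [iteratedFDeriv_zero_of_eventually (p := p), norm_zero]
    · exact le_max_right _ _
    · filter_upwards [hn, isOpen_strip.mem_nhds hs] with q hq hq'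
      by_contra h0
      exact absurd (S.B_supp (S.Ψ_strip hq') h0) (not_lt.2 hq.le)

end Sys

/-- smooth and periodic on the closed slab -/
structure RegOn (tp ti : ℝ) (g : ℝ → ℝ → ℝ) : Prop where
  sm : ContDiffOn ℝ (⊤ : ℕ∞) (fun p : ℝ × ℝ => g p.1 p.2) (Ioc tp ti ×ˢ (univ : Set ℝ))
  per : ∀ t θ, g t (θ + 1) = g t θ

/-- the element of the algebra given by a function of time and space -/
def liftR (g : ℝ → ℝ → ℝ) (hg : RegOn tp ti g) : SF tp ti :=
  mkR (fun p => g p.1 p.2.1)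
    (hg.sm.comp (f := fun p : E5 => (p.1, p.2.1)) (by fun_prop)
      fun p hp => ⟨Ioo_subset_Ioc_self (mem_strip.1 hp), trivial⟩)
    fun t _ θ _ => hg.per t θ

/-- the element is given by the function on the open slab -/
def Fits (G : SF tp ti) (g : ℝ → ℝ → ℝ) : Prop := ∀ t ∈ Ioo tp ti, ∀ θ v, ev G (t, θ, v) = g t θ

theorem fits_liftR (g : ℝ → ℝ → ℝ) (hg : RegOn tp ti g) : Fits (liftR g hg) g := fun t ht θ v =>
  ev_mkR _ _ _ (mem_strip.2 ht)

theorem Fits.base {G : SF tp ti} {g : ℝ → ℝ → ℝ} (h : Fits G g) : Base G := base_of_strip fun t ht θ v w => by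
  rw [h t ht, h t ht]

theorem Fits.dT {G : SF tp ti} {g : ℝ → ℝ → ℝ} (h : Fits G g) : Fits (dd eT G) (pt g) := fun t ht θ v => by
  have h1 := hasDerivAt_ev_t G (θ := θ) (v := v) ht
  have h2 : (fun s => ev G (s, θ, v)) =ᶠ[𝓝 t] fun s => g s θ := by
    filter_upwards [isOpen_Ioo.mem_nhds ht] with s hs using h s hs θ v
  exact (h2.hasDerivAt_iff.1 h1).deriv.symm

theorem Fits.dθ {G : SF tp ti} {g : ℝ → ℝ → ℝ} (h : Fits G g) : Fits (dd eθ G) (pθ g) := fun t ht θ v => by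
  have h1 := hasDerivAt_ev_θ G (θ := θ) (v := v) ht
  have h2 : (fun s => ev G (t, s, v)) = fun s => g t s := funext fun s => h t ht s v
  rw [h2] at h1
  exact h1.deriv.symm

theorem Fits.rest [Fact (0 < tp)] {G : SF tp ti} {g : ℝ → ℝ → ℝ} (h : Fits G g) {x : ℝ × ℝ} (hx : x ∈ Ioo tp ti ×ˢ (univ : Set ℝ)) :
    Sys.rest G =ᶠ[𝓝 x] fun q => g q.1 q.2 := by
  filter_upwards [Sys.isOpen_base.mem_nhds hx] with q hq using h _ hq.1 _ _

theorem uniqueDiffOn_slab {E : Type*} [NormedAddCommGroup E] [NormedSpace ℝ E] :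
    UniqueDiffOn ℝ (Ioc tp ti ×ˢ (univ : Set E)) := (uniqueDiffOn_Ioc tp ti).prod uniqueDiffOn_univ

theorem interior_slab {E : Type*} [NormedAddCommGroup E] [NormedSpace ℝ E] :
    interior (Ioc tp ti ×ˢ (univ : Set E)) = Ioo tp ti ×ˢ univ := by
  rw [interior_prod_eq, interior_Ioc, interior_univ]

theorem slab_sub_closure {E : Type*} [NormedAddCommGroup E] [NormedSpace ℝ E] (h : tp < ti) :
    Ioc tp ti ×ˢ (univ : Set E) ⊆ closure (interior (Ioc tp ti ×ˢ (univ : Set E))) := by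
  rw [interior_slab, closure_prod_eq, closure_Ioo h.ne, closure_univ]
  exact prod_mono Ioc_subset_Icc_self le_rfl

theorem per_int {g : ℝ → ℝ} (h : ∀ x, g (x + 1) = g x) (x : ℝ) (n : ℤ) : g (x + n) = g x := by
  have : Function.Periodic g 1 := h
  simpa using this.int_mul n x

theorem late_iter {g : ℝ → ℝ → ℝ} (hg : RegOn tp ti g) {t1 : ℝ} (ht1 : t1 ∈ Ioo tp ti) (k : ℕ) :
    ∃ c, ∀ p ∈ Ico t1 ti ×ˢ (univ : Set ℝ), ‖iteratedFDeriv ℝ k (fun q : ℝ × ℝ => g q.1 q.2) p‖ ≤ c := by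
  refine iter_bdd_compact uniqueDiffOn_slab hg.sm (K := Icc t1 ti ×ˢ Icc (0:ℝ) 1)
    (isCompact_Icc.prod isCompact_Icc) (fun p hp => ⟨⟨ht1.1.trans_le hp.1.1, hp.1.2⟩, trivial⟩) ?_ k
  rintro ⟨t, θ⟩ ⟨ht, -⟩
  refine .inl ⟨(0, ((-⌊θ⌋ : ℤ) : ℝ)), fun x => ?_, ⟨?_, ?_⟩, ?_⟩
  · simpa using per_int (hg.per x.1) x.2 (-⌊θ⌋)
  · simpa using ⟨ht.1, ht.2.le⟩
  · have h1 := Int.floor_le θ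
    have h2 := Int.lt_floor_add_one θ
    simp only [Prod.mk_add_mk, Int.cast_neg, mem_Icc]
    constructor <;> linarith
  · rw [interior_slab]
    exact ⟨by simpa using ⟨ht1.1.trans_le ht.1, ht.2⟩, trivial⟩

theorem late_bd {G : SF tp ti} {g : ℝ → ℝ → ℝ} (hg : RegOn tp ti g) (h : Fits G g) {t1 : ℝ} (ht1 : t1 ∈ Ioo tp ti) :
    Bd (Ico t1 ti ×ˢ univ) G ∧ Bd (Ico t1 ti ×ˢ univ) (dd eT G) ∧ Bd (Ico t1 ti ×ˢ univ) (dd eθ G) := by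
  obtain ⟨c0, h0⟩ := late_iter hg ht1 0
  obtain ⟨c1, h1⟩ := late_iter hg ht1 1
  have hd : ∀ t ∈ Ico t1 ti, ∀ θ, ∀ e : ℝ × ℝ, ‖e‖ ≤ 1 → |fderiv ℝ (fun q : ℝ × ℝ => g q.1 q.2) (t, θ) e| ≤ c1 := by
    intro t ht θ e he
    have := h1 (t, θ) ⟨ht, trivial⟩
    rw [norm_iteratedFDeriv_one] at this
    refine (ContinuousLinearMap.le_opNorm (fderiv ℝ (fun q : ℝ × ℝ => g q.1 q.2) (t, θ)) e).trans ?_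
    nlinarith [norm_nonneg (fderiv ℝ (fun q : ℝ × ℝ => g q.1 q.2) (t, θ)), norm_nonneg e]
  have hD : ∀ t ∈ Ico t1 ti, ∀ θ, HasFDerivAt (fun q : ℝ × ℝ => g q.1 q.2)
      (fderiv ℝ (fun q : ℝ × ℝ => g q.1 q.2) (t, θ)) (t, θ) := fun t ht θ => by
    refine ((hg.sm.contDiffAt ?_).differentiableAt (by simp)).hasFDerivAt
    rw [← mem_interior_iff_mem_nhds, interior_slab]
    exact ⟨⟨ht1.1.trans_le ht.1, ht.2⟩, trivial⟩
  have hI : ∀ t ∈ Ico t1 ti, t ∈ Ioo tp ti := fun t ht => ⟨ht1.1.trans_le ht.1, ht.2⟩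
  refine ⟨⟨max c0 0, le_max_right _ _, ?_⟩, ⟨max c1 0, le_max_right _ _, ?_⟩, ⟨max c1 0, le_max_right _ _, ?_⟩⟩
  · rintro ⟨t, θ, v⟩ ⟨ht, -⟩
    have := h0 (t, θ) ⟨ht, trivial⟩
    rw [norm_iteratedFDeriv_zero] at this
    rw [h t (hI t ht)]
    exact this.trans (le_max_left _ _)
  · rintro ⟨t, θ, v⟩ ⟨ht, -⟩
    rw [h.dT t (hI t ht)]
    have := (hD t ht θ).comp_hasDerivAt t ((hasDerivAt_id t).prodMk (hasDerivAt_const t θ))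
    rw [pt, show deriv (fun s => g s θ) t = _ from this.deriv]
    exact (hd t ht θ _ (by simp [Prod.norm_def])).trans (le_max_left _ _)
  · rintro ⟨t, θ, v⟩ ⟨ht, -⟩
    rw [h.dθ t (hI t ht)]
    have := (hD t ht θ).comp_hasDerivAt θ ((hasDerivAt_const θ t).prodMk (hasDerivAt_id θ))
    rw [pθ, show deriv (fun s => g t s) θ = _ from this.deriv]
    exact (hd t ht θ _ (by simp [Prod.norm_def])).trans (le_max_left _ _)

/-- rescaling the first velocity component in an integral -/
theorem integral_rescale (g : V3 → ℝ) {a : ℝ} (ha : 0 < a) : ∫ v, g v = a * ∫ v : V3, g (a * v.1, v.2) := by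
  have hm : Measure.map (Prod.map (fun x : ℝ => a * x) (id : ℝ × ℝ → ℝ × ℝ)) (volume : Measure V3)
      = ENNReal.ofReal a⁻¹ • volume := by
    change Measure.map _ ((volume : Measure ℝ).prod (volume : Measure (ℝ × ℝ))) = _
    rw [← Measure.map_prod_map _ _ (measurable_const_mul a) measurable_id, Measure.map_id,
      Real.map_volume_mul_left ha.ne', Measure.prod_smul_left, abs_of_pos (inv_pos.2 ha)]
    rfl
  have he : MeasurableEmbedding (Prod.map (fun x : ℝ => a * x) (id : ℝ × ℝ → ℝ × ℝ)) :=
    (measurableEmbedding_mulLeft₀ ha.ne').prodMap .id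
  have := he.integral_map (μ := (volume : Measure V3)) g
  rw [hm, integral_smul_measure, ENNReal.toReal_ofReal (inv_pos.2 ha).le, smul_eq_mul] at this
  change _ = a * ∫ v : V3, g (Prod.map (fun x : ℝ => a * x) id v)
  rw [← this, mul_inv_cancel_left₀ ha.ne']

/-- the Einstein–Vlasov system in the original variables -/
structure Plain (tp ti : ℝ) (U A ν α J K : ℝ → ℝ → ℝ) (f : ℝ → ℝ → V3 → ℝ) : Prop where
  hti : tp < ti
  rU : RegOn tp ti U
  rA : RegOn tp ti A
  rν : RegOn tp ti ν
  rα : RegOn tp ti α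
  rJ : RegOn tp ti J
  rK : RegOn tp ti K
  hfsm : ContDiffOn ℝ (⊤ : ℕ∞) (fun p : ℝ × ℝ × V3 => f p.1 p.2.1 p.2.2) (Ioc tp ti ×ˢ (univ : Set (ℝ × V3)))
  hfper : ∀ t θ v, f t (θ + 1) v = f t θ v
  hαpos : ∀ t ∈ Ioc tp ti, ∀ θ : ℝ, 0 < α t θ
  hfnn : ∀ t ∈ Ioc tp ti, ∀ (θ : ℝ) (v : V3), 0 ≤ f t θ v
  hfsupp : ∀ t ∈ Ioc tp ti, ∃ R : ℝ, ∀ (θ : ℝ) (v : V3), R < ‖v‖ → f t θ v = 0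
  hvlasov :
      ∀ t ∈ Ioc tp ti, ∀ (θ : ℝ) (v : V3),
      ptf f t θ v
        = pv1 (v0 α ν U A t θ) v * pθf f t θ v
          - (deriv (fun x => v0 α ν U A t x v) θ
              + Real.sqrt (α t θ) * Real.exp (2 * ν t θ) / t ^ 3 * (K t θ - A t θ * J t θ) * (v.2.2 - A t θ * v.2.1)
              + Real.sqrt (α t θ) * Real.exp (2 * ν t θ - 4 * U t θ) / t * J t θ * v.2.1)
            * pv1 (f t θ) v
  hnut :
      ∀ t ∈ Ioc tp ti, ∀ θ : ℝ,
      (pt ν t θ)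
        = t * ((pt U t θ) ^ 2 + α t θ * (pθ U t θ) ^ 2
              + Real.exp (4 * U t θ) / (4 * t ^ 2) * ((pt A t θ) ^ 2 + α t θ * (pθ A t θ) ^ 2))
          + α t θ * Real.exp (2 * ν t θ - 4 * U t θ) / (4 * t) * J t θ ^ 2
          + α t θ * Real.exp (2 * ν t θ) / (4 * t ^ 3) * (K t θ - A t θ * J t θ) ^ 2
          + Real.sqrt (α t θ) * ∫ v : V3, f t θ v * |v0 α ν U A t θ v|
  hnuth :
      ∀ t ∈ Ioc tp ti, ∀ θ : ℝ,
      (pθ ν t θ)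
        = 2 * t * ((pt U t θ) * (pθ U t θ) + Real.exp (4 * U t θ) / (4 * t ^ 2) * (pt A t θ) * (pθ A t θ))
          - (pθ α t θ) / (2 * α t θ)
          - Real.sqrt (α t θ) * ∫ v : V3, f t θ v * v.1
  halt :
      ∀ t ∈ Ioc tp ti, ∀ θ : ℝ,
      (pt α t θ) / α t θ
        = - (α t θ * Real.exp (2 * ν t θ - 4 * U t θ) * J t θ ^ 2 / t)
          - α t θ * Real.exp (2 * ν t θ) * (K t θ - A t θ * J t θ) ^ 2 / t ^ 3
          - 2 * (α t θ * Real.sqrt (α t θ)) * Real.exp (2 * ν t θ)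
            * ∫ v : V3, f t θ v
                * (Real.exp (-2 * U t θ) + Real.exp (-4 * U t θ) * v.2.1 ^ 2
                    + (t ^ 2)⁻¹ * (v.2.2 - A t θ * v.2.1) ^ 2)
                / |v0 α ν U A t θ v|
  hjt :
      ∀ t ∈ Ioc tp ti, ∀ θ : ℝ,
      (pt J t θ) = -2 * α t θ * ∫ v : V3, f t θ v * v.1 * v.2.1 / |v0 α ν U A t θ v|
  hjth :
      ∀ t ∈ Ioc tp ti, ∀ θ : ℝ,
      (pθ J t θ) = 2 * ∫ v : V3, f t θ v * v.2.1
  hkt :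
      ∀ t ∈ Ioc tp ti, ∀ θ : ℝ,
      (pt K t θ) = -2 * α t θ * ∫ v : V3, f t θ v * v.1 * v.2.2 / |v0 α ν U A t θ v|
  hkth :
      ∀ t ∈ Ioc tp ti, ∀ θ : ℝ,
      (pθ K t θ) = 2 * ∫ v : V3, f t θ v * v.2.2
  hutt :
      ∀ t ∈ Ioc tp ti, ∀ θ : ℝ,
      (pt (pt U) t θ)
        = α t θ * (pθ (pθ U) t θ) - (pt U t θ) / t
          + (pt α t θ) * (pt U t θ) / (2 * α t θ) + (pθ α t θ) * (pθ U t θ) / 2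
          + Real.exp (4 * U t θ) / (2 * t ^ 2) * ((pt A t θ) ^ 2 - α t θ * (pθ A t θ) ^ 2)
          + α t θ * Real.exp (2 * ν t θ - 4 * U t θ) / (2 * t ^ 2) * J t θ ^ 2
          + (α t θ * Real.sqrt (α t θ)) * Real.exp (2 * ν t θ - 2 * U t θ) / (2 * t)
            * ∫ v : V3, f t θ v * (1 + 2 * Real.exp (-2 * U t θ) * v.2.1 ^ 2) / |v0 α ν U A t θ v|
  hatt :
      ∀ t ∈ Ioc tp ti, ∀ θ : ℝ,
      (pt (pt A) t θ)
        = α t θ * (pθ (pθ A) t θ) + (pt A t θ) / t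
          + (pt α t θ) * (pt A t θ) / (2 * α t θ) + (pθ α t θ) * (pθ A t θ) / 2
          - 4 * ((pt A t θ) * (pt U t θ) - α t θ * (pθ A t θ) * (pθ U t θ))
          + α t θ * Real.exp (2 * ν t θ - 4 * U t θ) / t ^ 2 * J t θ * (K t θ - A t θ * J t θ)
          + 2 * (α t θ * Real.sqrt (α t θ)) * Real.exp (2 * ν t θ - 4 * U t θ) / t
            * ∫ v : V3, f t θ v * v.2.1 * (v.2.2 - A t θ * v.2.1) / |v0 α ν U A t θ v|
  hnutt :
      ∀ t ∈ Ioc tp ti, ∀ θ : ℝ,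
      (pt (pt ν) t θ)
        = α t θ * (pθ (pθ ν) t θ)
          + (pt α t θ) * (pt ν t θ) / (2 * α t θ) + (pθ α t θ) * (pθ ν t θ) / 2
          + (pθ (pθ α) t θ) / 2 - (pθ α t θ) ^ 2 / (4 * α t θ)
          - (pt U t θ) ^ 2 + α t θ * (pθ U t θ) ^ 2
          + Real.exp (4 * U t θ) / (4 * t ^ 2) * ((pt A t θ) ^ 2 - α t θ * (pθ A t θ) ^ 2)
          - α t θ * Real.exp (2 * ν t θ - 4 * U t θ) * J t θ ^ 2 / (4 * t ^ 2)
          - 3 * α t θ * Real.exp (2 * ν t θ) * (K t θ - A t θ * J t θ) ^ 2 / (4 * t ^ 4)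
          - (α t θ * Real.sqrt (α t θ)) * Real.exp (2 * ν t θ) / t ^ 3
            * ∫ v : V3, f t θ v * (v.2.2 - A t θ * v.2.1) ^ 2 / |v0 α ν U A t θ v|
  hC2 : 0 < ∫ θ in (0:ℝ)..1, ∫ v : V3, f ti θ v

namespace Plain
variable [hfact : Fact (0 < tp)] {U A ν α J K : ℝ → ℝ → ℝ} {f : ℝ → ℝ → V3 → ℝ}
  (H : Plain tp ti U A ν α J K f)

include H in
theorem rL : RegOn tp ti (fun t θ => Real.log (α t θ)) where
  sm := H.rα.sm.log fun p hp => (H.hαpos _ hp.1 _).ne'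
  per t θ := by simp only [H.rα.per]

include H in
theorem rβ : RegOn tp ti (fun t θ => ν t θ + (1/2) * Real.log (α t θ)) where
  sm := H.rν.sm.add (contDiffOn_const.mul H.rL.sm)
  per t θ := by simp only [H.rα.per, H.rν.per]

/-- the density in the original variables -/
def fR : SF tp ti := mkR (fun p => f p.1 p.2.1 p.2.2)
  (H.hfsm.mono (prod_mono Ioo_subset_Ioc_self le_rfl)) fun t _ θ v => H.hfper t θ v

theorem ev_fR {t : ℝ} (ht : t ∈ Ioo tp ti) (θ : ℝ) (v : V3) : ev H.fR (t, θ, v) = f t θ v :=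
  ev_mkR _ _ _ (mem_strip.2 ht)

/-- `1/√α` -/
def aR : SF tp ti := expR ((-1/2 : ℝ) • liftR _ H.rL)

/-- the unknowns in rescaled velocities -/
def fld : Fld tp ti where
  U := liftR U H.rU
  A := liftR A H.rA
  L := liftR _ H.rL
  β := liftR _ H.rβ
  J := liftR J H.rJ
  K := liftR K H.rK
  F := mkR (fun p => ev H.fR (Sys.scale H.aR p)) (Sys.pull_contDiffOn _ _) fun t ht θ v => by
    simp only [Sys.scale, ev_per]

theorem fU : Fits H.fld.U U := fits_liftR _ H.rU
theorem fA : Fits H.fld.A A := fits_liftR _ H.rA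
theorem fL : Fits H.fld.L (fun t θ => Real.log (α t θ)) := fits_liftR _ H.rL
theorem fβ : Fits H.fld.β (fun t θ => ν t θ + (1/2) * Real.log (α t θ)) := fits_liftR _ H.rβ
theorem fJ : Fits H.fld.J J := fits_liftR _ H.rJ
theorem fK : Fits H.fld.K K := fits_liftR _ H.rK
theorem fν : Fits H.fld.ν ν := fun t ht θ v => by
  rw [Fld.ν, ev_sub, ev_smul, H.fβ t ht, H.fL t ht]; ring
theorem fα : Fits (expR H.fld.L) α := fun t ht θ v => by
  rw [ev_expR _ (mem_strip.2 ht), H.fL t ht, Real.exp_log (H.hαpos t (Ioo_subset_Ioc_self ht) θ)]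

/-- square root of `α` -/
theorem fσ : Fits H.fld.σ (fun t θ => Real.sqrt (α t θ)) := fun t ht θ v => by
  rw [Fld.σ, ev_expR _ (mem_strip.2 ht), ev_smul, H.fL t ht]
  beta_reduce
  rw [Real.sqrt_eq_rpow, Real.rpow_def_of_pos (H.hαpos t (Ioo_subset_Ioc_self ht) θ), mul_comm]

theorem bL : Base H.fld.L := H.fL.base
theorem ba : Base H.fld.a := (H.bL.smul _).exp
theorem bσ : Base H.fld.σ := (H.bL.smul _).exp

theorem ev_F {p : E5} (hp : p ∈ strip tp ti) : ev H.fld.F p = ev H.fR (Sys.scale H.fld.a p) := ev_mkR _ _ _ hp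

theorem ev_dd_F (e : E5) {p : E5} (hp : p ∈ strip tp ti) : ev (dd e H.fld.F) p =
    ev (dd e H.fR) (Sys.scale H.fld.a p) + (ev (dd e H.fld.a) p * p.2.2.1 + (ev H.fld.a p - 1) * e.2.2.1)
      * ev (dd e1 H.fR) (Sys.scale H.fld.a p) := by
  rw [← Sys.fderiv_scale e H.fld.a H.fR hp, ev_dd _ _ hp]
  exact congrArg (fun l : E5 →L[ℝ] ℝ => l e) (Filter.EventuallyEq.fderiv_eq (by
    filter_upwards [isOpen_strip.mem_nhds hp] with q hq using H.ev_F hq))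

theorem σ_sq : H.fld.σ ^ 2 = expR H.fld.L := SF_ext fun p hp => by
  rw [ev_pow _ _ hp, Fld.σ, ev_expR _ hp, ev_expR _ hp, ev_smul, ← Real.exp_nat_mul]
  congr 1; push_cast; ring

theorem a_mul_σ : H.fld.a * H.fld.σ = 1 := SF_ext fun p hp => by
  rw [ev_mul, Fld.a, Fld.σ, ev_expR _ hp, ev_expR _ hp, ← Real.exp_add, ev_one hp, ev_smul, ev_smul]
  norm_num

theorem E4_eq : H.fld.E4 = expR H.fld.L * expR ((2 : ℝ) • H.fld.ν - (4 : ℝ) • H.fld.U) := by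
  rw [← expR_add, Fld.E4, Fld.ν]; congr 1; module
theorem E2_eq : H.fld.E2 = expR H.fld.L * expR ((2 : ℝ) • H.fld.ν - (2 : ℝ) • H.fld.U) := by
  rw [← expR_add, Fld.E2, Fld.ν]; congr 1; module
theorem E0_eq : H.fld.E0 = expR H.fld.L * expR ((2 : ℝ) • H.fld.ν) := by
  rw [← expR_add, Fld.E0, Fld.ν]; congr 1; module

/-- square of the energy in the original variables -/
def Q : SF tp ti := expR H.fld.L * qR ^ 2 + H.fld.m2

theorem Q_pos {p : E5} (hp : p ∈ strip tp ti) : 0 < ev H.Q p := by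
  rw [Q, ev_add, ev_mul, ev_pow _ _ hp]
  have h1 := expR_pos H.fld.L hp
  have h2 := H.fld.m2_pos hp
  positivity

theorem Q_eq {t : ℝ} (ht : t ∈ Ioo tp ti) (θ : ℝ) (v : V3) : ev H.Q (t, θ, v) =
    α t θ * Real.exp (2 * ν t θ - 2 * U t θ) + α t θ * v.1 ^ 2
    + α t θ * Real.exp (2 * ν t θ - 4 * U t θ) * v.2.1 ^ 2
    + α t θ * (t ^ 2)⁻¹ * Real.exp (2 * ν t θ) * (v.2.2 - A t θ * v.2.1) ^ 2 := by
  have hp : (t, θ, v) ∈ strip tp ti := mem_strip.2 ht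
  simp only [Q, Fld.m2, Fld.w, ev_add, ev_mul, ev_sub, ev_pow _ _ hp, ev_qR hp, ev_v2R hp, ev_v3R hp, ev_tI hp,
    E4_eq, E2_eq, E0_eq, H.fα t ht, H.fA t ht, ev_expR _ hp, ev_smul, H.fν t ht, H.fU t ht]
  rw [← H.fα t ht θ v, ev_expR _ hp]
  ring

/-- reciprocal of the energy -/
def r : SF tp ti := rsq H.Q fun _ hp => H.Q_pos hp

theorem v0_eq {t : ℝ} (ht : t ∈ Ioo tp ti) (θ : ℝ) (v : V3) : v0 α ν U A t θ v = - ev (H.Q * H.r) (t, θ, v) := by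
  have hp : (t, θ, v) ∈ strip tp ti := mem_strip.2 ht
  have h := H.Q_pos hp
  rw [v0, ← H.Q_eq ht, ev_mul, r, ev_rsq _ _ hp, ← div_eq_mul_inv, Real.div_sqrt]

theorem Q_scale {p : E5} (hp : p ∈ strip tp ti) : ev H.Q (Sys.scale H.fld.a p) = ev H.fld.P p := by
  have hs := Sys.scale_strip (σ := H.fld.a) hp
  obtain ⟨t, θ, v⟩ := p
  have ht := mem_strip.1 hp
  have h1 : ev H.fld.a (t, θ, v) * ev H.fld.σ (t, θ, v) = 1 := by rw [← ev_mul, a_mul_σ, ev_one hp]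
  have h2 : ev H.fld.σ (t, θ, v) ^ 2 = ev (expR H.fld.L) (t, θ, v) := by rw [← ev_pow _ _ hp, σ_sq]
  have h3 : ev (expR H.fld.L) (Sys.scale H.fld.a (t, θ, v)) = ev (expR H.fld.L) (t, θ, v) := H.bL.exp _ _ _ _
  have h4 : ev H.fld.m2 (Sys.scale H.fld.a (t, θ, v)) = ev H.fld.m2 (t, θ, v) := by
    have b2 : Base H.fld.E2 := ((H.fβ.base.smul _).sub (H.fU.base.smul _)).exp
    have b4 : Base H.fld.E4 := ((H.fβ.base.smul _).sub (H.fU.base.smul _)).exp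
    have b0 : Base H.fld.E0 := (H.fβ.base.smul _).exp
    simp only [Fld.m2, Fld.w, ev_add, ev_mul, ev_sub, ev_pow _ _ hp, ev_pow _ _ hs, ev_v2R hp, ev_v3R hp,
      ev_tI hp, ev_v2R hs, ev_v3R hs, ev_tI hs]
    rw [show ev H.fld.E2 (Sys.scale H.fld.a (t, θ, v)) = ev H.fld.E2 (t, θ, v) from b2 _ _ _ _,
      show ev H.fld.E4 (Sys.scale H.fld.a (t, θ, v)) = ev H.fld.E4 (t, θ, v) from b4 _ _ _ _,
      show ev H.fld.E0 (Sys.scale H.fld.a (t, θ, v)) = ev H.fld.E0 (t, θ, v) from b0 _ _ _ _,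
      show ev H.fld.A (Sys.scale H.fld.a (t, θ, v)) = ev H.fld.A (t, θ, v) from H.fA.base _ _ _ _]
    rfl
  rw [Q, Fld.P, ev_add, ev_add, h4, ev_mul, ev_pow _ _ hs, ev_pow _ _ hp, h3, ← h2, ev_qR hp, ev_qR hs]
  change ev H.fld.σ (t, θ, v) ^ 2 * (ev H.fld.a (t, θ, v) * v.1) ^ 2 + _ = v.1 ^ 2 + _
  linear_combination (v.1 ^ 2 * (ev H.fld.a (t, θ, v) * ev H.fld.σ (t, θ, v) + 1)) * h1

theorem r_scale {p : E5} (hp : p ∈ strip tp ti) : ev H.r (Sys.scale H.fld.a p) = ev H.fld.rp p := by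
  rw [r, ev_rsq _ _ (Sys.scale_strip hp), Q_scale _ hp, Fld.rp, ev_rsq _ _ hp]

/-- the energy at the rescaled velocity -/
theorem abs_v0 {t : ℝ} (ht : t ∈ Ioo tp ti) (θ : ℝ) (v : V3) :
    |v0 α ν U A t θ (ev H.fld.a (t, θ, v) * v.1, v.2)| = ev (H.fld.P * H.fld.rp) (t, θ, v) := by
  have hp : (t, θ, v) ∈ strip tp ti := mem_strip.2 ht
  rw [H.v0_eq ht, abs_neg, ev_mul, ev_mul]
  change |ev H.Q (Sys.scale H.fld.a (t, θ, v)) * ev H.r (Sys.scale H.fld.a (t, θ, v))| = _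
  rw [H.Q_scale hp, H.r_scale hp, abs_of_nonneg]
  have := H.fld.P_pos hp
  rw [Fld.rp, ev_rsq _ _ hp]
  positivity

theorem inv_abs_v0 {t : ℝ} (ht : t ∈ Ioo tp ti) (θ : ℝ) (v : V3) :
    |v0 α ν U A t θ (ev H.fld.a (t, θ, v) * v.1, v.2)|⁻¹ = ev H.fld.rp (t, θ, v) := by
  have hp : (t, θ, v) ∈ strip tp ti := mem_strip.2 ht
  rw [H.abs_v0 ht]
  have h : ev (H.fld.P * H.fld.rp ^ 2) (t, θ, v) = 1 := by rw [H.fld.P_rp, ev_one hp]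
  rw [ev_mul, ev_pow _ _ hp] at h
  rw [ev_mul]
  exact inv_eq_of_mul_eq_one_right (by linear_combination h)

end Plain

namespace Plain
variable [hfact : Fact (0 < tp)] {U A ν α J K : ℝ → ℝ → ℝ} {f : ℝ → ℝ → V3 → ℝ}
  (H : Plain tp ti U A ν α J K f)

theorem ev_dT_fR {t : ℝ} (ht : t ∈ Ioo tp ti) (θ : ℝ) (v : V3) : ev (dd eT H.fR) (t, θ, v) = ptf f t θ v :=
  (((hasDerivAt_ev_t H.fR ht).congr_of_eventuallyEq (by
    filter_upwards [isOpen_Ioo.mem_nhds ht] with s hs using (H.ev_fR hs θ v).symm)).deriv).symm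

theorem ev_dθ_fR {t : ℝ} (ht : t ∈ Ioo tp ti) (θ : ℝ) (v : V3) : ev (dd eθ H.fR) (t, θ, v) = pθf f t θ v :=
  (((hasDerivAt_ev_θ H.fR ht).congr_of_eventuallyEq
    (.of_forall fun s => (H.ev_fR ht s v).symm)).deriv).symm

theorem ev_d1_fR {t : ℝ} (ht : t ∈ Ioo tp ti) (θ : ℝ) (v : V3) : ev (dd e1 H.fR) (t, θ, v) = pv1 (f t θ) v :=
  (((hasDerivAt_ev_1 H.fR ht).congr_of_eventuallyEq
    (.of_forall fun s => (H.ev_fR ht θ (s, v.2.1, v.2.2)).symm)).deriv).symm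

theorem Q_r : H.Q * H.r ^ 2 = 1 := rsq_sq _ _

theorem dd_Q_r (e : E5) : dd e (H.Q * H.r) = (1/2 : ℝ) • (H.r * dd e H.Q) := by
  have h := H.Q_r
  have hhalf : (algebraMap ℝ (SF tp ti) (1/2)) * 2 = 1 := by
    rw [← map_ofNat (algebraMap ℝ (SF tp ti)) 2, ← map_mul]; norm_num
  rw [Derivation.leibniz, deriv_of_sq_inv (dd e) h]
  simp only [smul_eq_mul, Algebra.smul_def]
  rw [show ((-1/2 : ℝ)) = -(1/2) by norm_num, map_neg]
  linear_combination (- algebraMap ℝ (SF tp ti) (1/2) * H.r * dd e H.Q) * h - H.r * dd e H.Q * hhalf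

theorem pv1_v0 {t : ℝ} (ht : t ∈ Ioo tp ti) (θ : ℝ) (v : V3) :
    pv1 (v0 α ν U A t θ) v = - ev (dd e1 (H.Q * H.r)) (t, θ, v) :=
  (((hasDerivAt_ev_1 (H.Q * H.r) ht).neg.congr_of_eventuallyEq
    (.of_forall fun s => H.v0_eq ht θ (s, v.2.1, v.2.2))).deriv)

theorem dθ_v0 {t : ℝ} (ht : t ∈ Ioo tp ti) (θ : ℝ) (v : V3) :
    deriv (fun x => v0 α ν U A t x v) θ = - ev (dd eθ (H.Q * H.r)) (t, θ, v) :=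
  (((hasDerivAt_ev_θ (H.Q * H.r) ht).neg.congr_of_eventuallyEq
    (.of_forall fun s => H.v0_eq ht s v)).deriv)

theorem d1_m2 : dd e1 H.fld.m2 = 0 := by
  have b2 : Base H.fld.E2 := ((H.fβ.base.smul _).sub (H.fU.base.smul _)).exp
  have b4 : Base H.fld.E4 := ((H.fβ.base.smul _).sub (H.fU.base.smul _)).exp
  have b0 : Base H.fld.E0 := (H.fβ.base.smul _).exp
  have bA := H.fA.base
  have z : dd e1 (tI : SF tp ti) = 0 := by rw [dd_tI]; simp [e1]
  unfold Fld.m2 Fld.w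
  simp only [sq, map_add, map_sub, Derivation.leibniz, Sys.dq_v2, Sys.dq_v3, z, Sys.base_dq b2, Sys.base_dq b4,
    Sys.base_dq b0, Sys.base_dq bA, smul_zero, add_zero, sub_zero]

theorem dd_Q (e : E5) : dd e H.Q = expR H.fld.L * dd e H.fld.L * qR ^ 2
    + (2 * e.2.2.1) • (expR H.fld.L * qR) + dd e H.fld.m2 := by
  rw [Q, map_add, Derivation.leibniz, sq, Derivation.leibniz, dd_expR, dd_qR]
  simp only [smul_eq_mul, Algebra.smul_def, map_mul, map_ofNat]
  ring

theorem fE0 : Fits H.fld.E0 (fun t θ => α t θ * Real.exp (2 * ν t θ)) := fun t ht θ v => by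
  rw [E0_eq, ev_mul, H.fα t ht, ev_expR _ (mem_strip.2 ht), ev_smul, H.fν t ht]

theorem fE4 : Fits H.fld.E4 (fun t θ => α t θ * Real.exp (2 * ν t θ - 4 * U t θ)) := fun t ht θ v => by
  rw [E4_eq, ev_mul, H.fα t ht, ev_expR _ (mem_strip.2 ht), ev_sub, ev_smul, ev_smul, H.fν t ht, H.fU t ht]

theorem fE2 : Fits H.fld.E2 (fun t θ => α t θ * Real.exp (2 * ν t θ - 2 * U t θ)) := fun t ht θ v => by
  rw [E2_eq, ev_mul, H.fα t ht, ev_expR _ (mem_strip.2 ht), ev_sub, ev_smul, ev_smul, H.fν t ht, H.fU t ht]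

theorem ev_σ_sq {t : ℝ} (ht : t ∈ Ioo tp ti) (θ : ℝ) (v : V3) : ev H.fld.σ (t, θ, v) ^ 2 = α t θ := by
  rw [← ev_pow _ _ (mem_strip.2 ht), σ_sq, H.fα t ht]

theorem ev_a_σ {p : E5} (hp : p ∈ strip tp ti) : ev H.fld.a p * ev H.fld.σ p = 1 := by
  rw [← ev_mul, a_mul_σ, ev_one hp]

theorem m2_q {t : ℝ} (ht : t ∈ Ioo tp ti) (θ x y : ℝ) (w : ℝ × ℝ) :
    ev H.fld.m2 (t, θ, x, w) = ev H.fld.m2 (t, θ, y, w) := by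
  have hp : (t, θ, (x, w)) ∈ strip tp ti := mem_strip.2 ht
  have hs : (t, θ, (y, w)) ∈ strip tp ti := mem_strip.2 ht
  simp only [Fld.m2, Fld.w, ev_add, ev_mul, ev_sub, ev_pow _ _ hp, ev_pow _ _ hs, ev_v2R hp, ev_v3R hp,
    ev_tI hp, ev_v2R hs, ev_v3R hs, ev_tI hs, H.fE2 t ht, H.fE4 t ht, H.fE0 t ht, H.fA t ht]

theorem dθ_m2_q {t : ℝ} (ht : t ∈ Ioo tp ti) (θ x y : ℝ) (w : ℝ × ℝ) :
    ev (dd eθ H.fld.m2) (t, θ, x, w) = ev (dd eθ H.fld.m2) (t, θ, y, w) :=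
  ((hasDerivAt_ev_θ H.fld.m2 ht).congr_of_eventuallyEq (.of_forall fun s => H.m2_q ht s y x w)).unique
    (hasDerivAt_ev_θ H.fld.m2 ht)

theorem dd_a (e : E5) : dd e H.fld.a = (-1/2 : ℝ) • (H.fld.a * dd e H.fld.L) := by
  rw [Fld.a, dd_expR, Derivation.map_smul, mul_smul_comm]

theorem vlasov : Tr H.fld.c H.fld.b H.fld.F = 0 := SF_ext fun p hp => by
  have hs := Sys.scale_strip (σ := H.fld.a) hp
  obtain ⟨t, θ, q, w⟩ := p
  have ht : t ∈ Ioo tp ti := mem_strip.1 hp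
  have hV := H.hvlasov t (Ioo_subset_Ioc_self ht) θ (ev H.fld.a (t, θ, q, w) * q, w)
  have hd1L : dd e1 H.fld.L = 0 := Sys.base_dq H.bL
  have hr : ev H.r (t, θ, ev H.fld.a (t, θ, q, w) * q, w) = ev H.fld.rp (t, θ, q, w) := H.r_scale hp
  have hEL : ev (expR H.fld.L) (t, θ, ev H.fld.a (t, θ, q, w) * q, w) = ev H.fld.σ (t, θ, q, w) ^ 2 := by
    rw [H.fα t ht, H.ev_σ_sq ht]
  have hLθ : ev (dd eθ H.fld.L) (t, θ, ev H.fld.a (t, θ, q, w) * q, w) = ev (dd eθ H.fld.L) (t, θ, q, w) :=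
    H.bL.dd_θ _ _ _ _
  have hF := fun e => H.ev_dd_F e hp
  have hscale : Sys.scale H.fld.a (t, θ, q, w) = (t, θ, ev H.fld.a (t, θ, q, w) * q, w) := rfl
  rw [hscale] at hs hF
  rw [← H.ev_dT_fR ht, ← H.ev_dθ_fR ht, ← H.ev_d1_fR ht, H.pv1_v0 ht, H.dθ_v0 ht, dd_Q_r, dd_Q_r, dd_Q, dd_Q,
    d1_m2, hd1L] at hV
  simp only [ev_smul, ev_mul, ev_add, ev_zero, ev_pow _ _ hs, hr, hEL, hLθ, ev_qR hs, H.dθ_m2_q ht θ _ q w] at hV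
  rw [← show ev H.fld.σ (t, θ, q, w) = Real.sqrt (α t θ) from H.fσ t ht θ (q, w)] at hV
  rw [Tr_apply, ev_zero]
  simp only [ev_add, ev_mul, hF, dd_a, hd1L, ev_zero, ev_smul, Fld.c, Fld.b, Fld.b1, Fld.Lt, Fld.κ, Fld.w, ev_sub, Fld.X_apply,
    ev_qR hp, ev_pow _ _ hp, ev_tI hp, ev_v2R hp, ev_v3R hp, H.fE0 t ht, H.fE4 t ht, H.fA t ht, H.fJ t ht, H.fK t ht]
  have haσ := H.ev_a_σ hp
  have hσ2 := H.ev_σ_sq ht θ (q, w)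
  rw [show eθ.2.2.1 = 0 from rfl, show e1.2.2.1 = 1 from rfl] at hV ⊢
  rw [show eT.2.2.1 = 0 from rfl]
  rw [← hσ2]
  generalize ev H.fld.σ (t, θ, q, w) = σ at hV haσ ⊢
  generalize ev H.fld.a (t, θ, q, w) = a at hV haσ ⊢
  generalize ev H.fld.rp (t, θ, q, w) = rp at hV ⊢
  linear_combination hV + (- q * rp * σ * ev (dd eθ H.fR) (t, θ, a * q, w)
    + ev (dd e1 H.fR) (t, θ, a * q, w) * (1 / 2 * q ^ 2 * rp * ev (dd eθ H.fld.L) (t, θ, q, w) * σ * a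
      - 1 / 2 * rp * ev (dd eθ H.fld.m2) (t, θ, q, w)
      + σ * (Real.exp (2 * ν t θ) / t ^ 3 * (K t θ - A t θ * J t θ) * (w.2 - A t θ * w.1)
        + Real.exp (2 * ν t θ - 4 * U t θ) / t * J t θ * w.1))) * haσ

end Plain

namespace Plain
variable [hfact : Fact (0 < tp)] {U A ν α J K : ℝ → ℝ → ℝ} {f : ℝ → ℝ → V3 → ℝ}
  (H : Plain tp ti U A ν α J K f)

theorem ev_F_eq {t : ℝ} (ht : t ∈ Ioo tp ti) (θ : ℝ) (v : V3) :
    ev H.fld.F (t, θ, v) = f t θ (ev H.fld.a (t, θ, v) * v.1, v.2) := by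
  rw [H.ev_F (mem_strip.2 ht)]; exact H.ev_fR ht _ _

/-- change of variables in a velocity average -/
theorem mul_integral {t : ℝ} (ht : t ∈ Ioo tp ti) (θ : ℝ) (u : V3) (φ : SF tp ti) (g : V3 → ℝ) (c k : ℝ)
    (h : ∀ v, c * ev H.fld.a (t, θ, v) * g (ev H.fld.a (t, θ, v) * v.1, v.2) =
      k * (f t θ (ev H.fld.a (t, θ, v) * v.1, v.2) * ev φ (t, θ, v))) :
    c * ∫ v, g v = k * H.fld.mom φ (t, θ, u) := by
  have ha : 0 < ev H.fld.a (t, θ, u) := expR_pos _ (mem_strip.2 ht)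
  rw [integral_rescale g ha, Fld.mom, ← mul_assoc, ← integral_const_mul, ← integral_const_mul]
  congr 1
  funext v
  rw [show ev H.fld.a (t, θ, u) = ev H.fld.a (t, θ, v) from H.ba _ _ _ _, h v]
  exact congrArg (fun x => k * (x * _)) (H.ev_F_eq ht θ v).symm

theorem ev_σ {t : ℝ} (ht : t ∈ Ioo tp ti) (θ : ℝ) (v : V3) : Real.sqrt (α t θ) = ev H.fld.σ (t, θ, v) :=
  (H.fσ t ht θ v).symm

theorem pt_α {t : ℝ} (ht : t ∈ Ioo tp ti) (θ : ℝ) (v : V3) :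
    pt α t θ = α t θ * ev (dd eT H.fld.L) (t, θ, v) := by
  rw [← H.fα.dT t ht θ v, dd_expR, ev_mul, H.fα t ht]

theorem pθ_α {t : ℝ} (ht : t ∈ Ioo tp ti) (θ : ℝ) (v : V3) :
    pθ α t θ = α t θ * ev (dd eθ H.fld.L) (t, θ, v) := by
  rw [← H.fα.dθ t ht θ v, dd_expR, ev_mul, H.fα t ht]

theorem pθ_pθ_α {t : ℝ} (ht : t ∈ Ioo tp ti) (θ : ℝ) (v : V3) : pθ (pθ α) t θ =
    α t θ * (ev (dd eθ (dd eθ H.fld.L)) (t, θ, v) + ev (dd eθ H.fld.L) (t, θ, v) ^ 2) := by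
  rw [← H.fα.dθ.dθ t ht θ v, dd_expR, Derivation.leibniz, dd_expR]
  simp only [ev_add, ev_mul, smul_eq_mul, H.fα t ht]
  ring

theorem ev_X (G : SF tp ti) (p : E5) : ev (H.fld.X G) p = ev H.fld.σ p * ev (dd eθ G) p := by
  rw [Fld.X_apply, ev_mul]

theorem ev_X_X (G : SF tp ti) {t : ℝ} (ht : t ∈ Ioo tp ti) (θ : ℝ) (v : V3) : ev (H.fld.X (H.fld.X G)) (t, θ, v) =
    α t θ * (ev (dd eθ (dd eθ G)) (t, θ, v) + 1/2 * ev (dd eθ H.fld.L) (t, θ, v) * ev (dd eθ G) (t, θ, v)) := by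
  rw [← H.ev_σ_sq ht θ v, Fld.X_apply, Fld.X_apply, Derivation.leibniz,
    show dd eθ H.fld.σ = (1/2 : ℝ) • (H.fld.σ * dd eθ H.fld.L) by
      rw [Fld.σ, dd_expR, Derivation.map_smul, mul_smul_comm]]
  simp only [ev_add, ev_mul, ev_smul, smul_eq_mul]
  ring

theorem ev_h {t : ℝ} (ht : t ∈ Ioo tp ti) (θ : ℝ) (v : V3) :
    ev H.fld.h (t, θ, v) = Real.exp (4 * U t θ) / (4 * t ^ 2) := by
  have hp : (t, θ, v) ∈ strip tp ti := mem_strip.2 ht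
  rw [Fld.h, ev_smul, ev_mul, ev_expR _ hp, ev_smul, ev_pow _ _ hp, ev_tI hp, H.fU t ht]
  ring

theorem t_ne {t : ℝ} (ht : t ∈ Ioo tp ti) : t ≠ 0 := (hfact.out.trans ht.1).ne'

theorem eq_ν {p : E5} (hp : p ∈ strip tp ti) : ev (dd eT H.fld.ν) p =
    ev (tR * (H.fld.Ut ^ 2 + H.fld.XU ^ 2 + H.fld.h * (H.fld.At ^ 2 + H.fld.XA ^ 2))
      + (1/4 : ℝ) • (tI * H.fld.E4 * H.fld.J ^ 2) + (1/4 : ℝ) • (tI ^ 3 * H.fld.E0 * H.fld.κ ^ 2)) p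
      + H.fld.mom (H.fld.P * H.fld.rp) p := by
  obtain ⟨t, θ, v⟩ := p
  have ht : t ∈ Ioo tp ti := mem_strip.1 hp
  have hm := H.mul_integral ht θ v (H.fld.P * H.fld.rp) (fun v => f t θ v * |v0 α ν U A t θ v|)
    (Real.sqrt (α t θ)) 1 fun w => by
      have haσ := H.ev_a_σ (mem_strip.2 ht : (t, θ, w) ∈ strip tp ti)
      rw [H.abs_v0 ht, H.ev_σ ht θ w]
      linear_combination f t θ (ev H.fld.a (t, θ, w) * w.1, w.2) * ev (H.fld.P * H.fld.rp) (t, θ, w) * haσ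
  rw [H.fν.dT t ht, H.hnut t (Ioo_subset_Ioc_self ht), hm]
  simp only [Fld.Ut, Fld.At, Fld.XU, Fld.XA, Fld.κ, ev_add, ev_sub, ev_mul, ev_smul, ev_pow _ _ hp, ev_tR hp,
    ev_tI hp, ev_X, ev_h H ht, H.fE4 t ht, H.fE0 t ht, H.fU.dT t ht, H.fU.dθ t ht, H.fA.dT t ht, H.fA.dθ t ht,
    H.fA t ht, H.fJ t ht, H.fK t ht, mul_pow, H.ev_σ_sq ht]
  have := t_ne ht
  field_simp

theorem dθ_β : dd eθ H.fld.β = dd eθ H.fld.ν + (1/2 : ℝ) • dd eθ H.fld.L := by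
  rw [Fld.ν, map_sub, Derivation.map_smul, sub_add_cancel]

theorem eq_Xβ {p : E5} (hp : p ∈ strip tp ti) : ev (H.fld.X H.fld.β) p =
    ev ((2 : ℝ) • (tR * (H.fld.Ut * H.fld.XU + H.fld.h * H.fld.At * H.fld.XA))) p - H.fld.mom qR p := by
  obtain ⟨t, θ, v⟩ := p
  have ht : t ∈ Ioo tp ti := mem_strip.1 hp
  have hα := (H.hαpos t (Ioo_subset_Ioc_self ht) θ).ne'
  have hm := H.mul_integral ht θ v qR (fun v => f t θ v * v.1) (α t θ) 1 fun w => by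
      have haσ := H.ev_a_σ (mem_strip.2 ht : (t, θ, w) ∈ strip tp ti)
      rw [← H.ev_σ_sq ht θ w, ev_qR (mem_strip.2 ht)]
      linear_combination f t θ (ev H.fld.a (t, θ, w) * w.1, w.2) * w.1 *
        (1 + ev H.fld.a (t, θ, w) * ev H.fld.σ (t, θ, w)) * haσ
  have hσ := H.ev_σ_sq ht θ v
  rw [ev_X, dθ_β, ev_add, ev_smul, H.fν.dθ t ht, H.hnuth t (Ioo_subset_Ioc_self ht), H.ev_σ ht θ v, H.pθ_α ht θ v]
  simp only [Fld.Ut, Fld.At, Fld.XU, Fld.XA, ev_add, ev_mul, ev_smul, ev_tR hp,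
    ev_X, ev_h H ht, H.fU.dT t ht, H.fU.dθ t ht, H.fA.dT t ht, H.fA.dθ t ht]
  have h1 : α t θ * ev (dd eθ H.fld.L) (t, θ, v) / (2 * α t θ) = ev (dd eθ H.fld.L) (t, θ, v) / 2 := by field_simp
  rw [h1]
  linear_combination (-1 : ℝ) * hm - (∫ v, f t θ v * v.1) * hσ

theorem eq_L {p : E5} (hp : p ∈ strip tp ti) : ev H.fld.Lt p =
    - ev (tI * H.fld.E4 * H.fld.J ^ 2 + tI ^ 3 * H.fld.E0 * H.fld.κ ^ 2) p - 2 * H.fld.mom (H.fld.m2 * H.fld.rp) p := by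
  obtain ⟨t, θ, v⟩ := p
  have ht : t ∈ Ioo tp ti := mem_strip.1 hp
  have hα := (H.hαpos t (Ioo_subset_Ioc_self ht) θ).ne'
  have hm := H.mul_integral ht θ v (H.fld.m2 * H.fld.rp) (fun v => f t θ v
                * (Real.exp (-2 * U t θ) + Real.exp (-4 * U t θ) * v.2.1 ^ 2
                    + (t ^ 2)⁻¹ * (v.2.2 - A t θ * v.2.1) ^ 2)
                / |v0 α ν U A t θ v|)
    (2 * (α t θ * Real.sqrt (α t θ)) * Real.exp (2 * ν t θ)) 2 fun w => by
      have hp : (t, θ, w) ∈ strip tp ti := mem_strip.2 ht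
      have haσ := H.ev_a_σ hp
      rw [div_eq_mul_inv, H.inv_abs_v0 ht, H.ev_σ ht θ w]
      simp only [Fld.m2, Fld.w, ev_add, ev_mul, ev_sub, ev_pow _ _ hp, ev_v2R hp, ev_v3R hp,
        ev_tI hp, H.fE2 t ht, H.fE4 t ht, H.fE0 t ht, H.fA t ht, sub_eq_add_neg _ (2 * U t θ), sub_eq_add_neg _ (4 * U t θ),
        Real.exp_add, ← neg_mul]
      linear_combination 2 * α t θ * Real.exp (2 * ν t θ) * f t θ (ev H.fld.a (t, θ, w) * w.1, w.2) *
        (Real.exp (-2 * U t θ) + Real.exp (-4 * U t θ) * w.2.1 ^ 2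
                    + (t ^ 2)⁻¹ * (w.2.2 - A t θ * w.2.1) ^ 2) * ev H.fld.rp (t, θ, w) * haσ
  have h := H.halt t (Ioo_subset_Ioc_self ht) θ
  rw [H.pt_α ht θ v, mul_div_cancel_left₀ _ hα, hm] at h
  rw [Fld.Lt, h]
  simp only [Fld.κ, ev_add, ev_sub, ev_mul, ev_pow _ _ hp, ev_tI hp, H.fE4 t ht, H.fE0 t ht,
    H.fA t ht, H.fJ t ht, H.fK t ht]
  ring

theorem eq_Jt {p : E5} (hp : p ∈ strip tp ti) : ev (dd eT H.fld.J) p = -2 * H.fld.mom (qR * v2R * H.fld.rp) p := by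
  obtain ⟨t, θ, v⟩ := p
  have ht : t ∈ Ioo tp ti := mem_strip.1 hp
  rw [H.fJ.dT t ht, H.hjt t (Ioo_subset_Ioc_self ht)]
  refine H.mul_integral ht θ v _ _ _ _ fun w => ?_
  have hp : (t, θ, w) ∈ strip tp ti := mem_strip.2 ht
  rw [div_eq_mul_inv, H.inv_abs_v0 ht, ← H.ev_σ_sq ht θ w, ev_mul, ev_mul, ev_qR hp, ev_v2R hp]
  linear_combination -2 * f t θ (ev H.fld.a (t, θ, w) * w.1, w.2) * w.1 * w.2.1 * ev H.fld.rp (t, θ, w) *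
        (1 + ev H.fld.a (t, θ, w) * ev H.fld.σ (t, θ, w)) * H.ev_a_σ hp

theorem eq_Kt {p : E5} (hp : p ∈ strip tp ti) : ev (dd eT H.fld.K) p = -2 * H.fld.mom (qR * v3R * H.fld.rp) p := by
  obtain ⟨t, θ, v⟩ := p
  have ht : t ∈ Ioo tp ti := mem_strip.1 hp
  rw [H.fK.dT t ht, H.hkt t (Ioo_subset_Ioc_self ht)]
  refine H.mul_integral ht θ v _ _ _ _ fun w => ?_
  have hp : (t, θ, w) ∈ strip tp ti := mem_strip.2 ht
  rw [div_eq_mul_inv, H.inv_abs_v0 ht, ← H.ev_σ_sq ht θ w, ev_mul, ev_mul, ev_qR hp, ev_v3R hp]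
  linear_combination -2 * f t θ (ev H.fld.a (t, θ, w) * w.1, w.2) * w.1 * w.2.2 * ev H.fld.rp (t, θ, w) *
        (1 + ev H.fld.a (t, θ, w) * ev H.fld.σ (t, θ, w)) * H.ev_a_σ hp

theorem eq_XJ {p : E5} (hp : p ∈ strip tp ti) : ev (H.fld.X H.fld.J) p = 2 * H.fld.mom v2R p := by
  obtain ⟨t, θ, v⟩ := p
  have ht : t ∈ Ioo tp ti := mem_strip.1 hp
  rw [ev_X, H.fJ.dθ t ht, H.hjth t (Ioo_subset_Ioc_self ht), ← H.ev_σ ht θ v, ← mul_assoc]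
  refine H.mul_integral ht θ v _ _ _ _ fun w => ?_
  have hp : (t, θ, w) ∈ strip tp ti := mem_strip.2 ht
  rw [ev_v2R hp, H.ev_σ ht θ w]
  linear_combination 2 * f t θ (ev H.fld.a (t, θ, w) * w.1, w.2) * w.2.1 * H.ev_a_σ hp

theorem eq_XK {p : E5} (hp : p ∈ strip tp ti) : ev (H.fld.X H.fld.K) p = 2 * H.fld.mom v3R p := by
  obtain ⟨t, θ, v⟩ := p
  have ht : t ∈ Ioo tp ti := mem_strip.1 hp
  rw [ev_X, H.fK.dθ t ht, H.hkth t (Ioo_subset_Ioc_self ht), ← H.ev_σ ht θ v, ← mul_assoc]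
  refine H.mul_integral ht θ v _ _ _ _ fun w => ?_
  have hp : (t, θ, w) ∈ strip tp ti := mem_strip.2 ht
  rw [ev_v3R hp, H.ev_σ ht θ w]
  linear_combination 2 * f t θ (ev H.fld.a (t, θ, w) * w.1, w.2) * w.2.2 * H.ev_a_σ hp

end Plain

namespace Plain
variable [hfact : Fact (0 < tp)] {U A ν α J K : ℝ → ℝ → ℝ} {f : ℝ → ℝ → V3 → ℝ}
  (H : Plain tp ti U A ν α J K f)

theorem eq_U {p : E5} (hp : p ∈ strip tp ti) : ev (dd eT H.fld.Ut) p =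
    ev (H.fld.X H.fld.XU - tI * H.fld.Ut + (1/2 : ℝ) • (H.fld.Lt * H.fld.Ut)
      + (2 : ℝ) • (H.fld.h * (H.fld.At ^ 2 - H.fld.XA ^ 2)) + (1/2 : ℝ) • (tI ^ 2 * H.fld.E4 * H.fld.J ^ 2)) p
      + (1/2) * ev (tI * H.fld.E2) p
        * H.fld.mom ((1 + (2 : ℝ) • (expR ((-2 : ℝ) • H.fld.U) * v2R ^ 2)) * H.fld.rp) p := by
  obtain ⟨t, θ, v⟩ := p
  have ht : t ∈ Ioo tp ti := mem_strip.1 hp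
  have hα := (H.hαpos t (Ioo_subset_Ioc_self ht) θ).ne'
  have hm := H.mul_integral ht θ v ((1 + (2 : ℝ) • (expR ((-2 : ℝ) • H.fld.U) * v2R ^ 2)) * H.fld.rp)
    (fun v => f t θ v * (1 + 2 * Real.exp (-2 * U t θ) * v.2.1 ^ 2) / |v0 α ν U A t θ v|)
    ((α t θ * Real.sqrt (α t θ)) * Real.exp (2 * ν t θ - 2 * U t θ) / (2 * t))
    ((1/2) * ev (tI * H.fld.E2) (t, θ, v)) fun w => by
      have hq : (t, θ, w) ∈ strip tp ti := mem_strip.2 ht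
      have haσ := H.ev_a_σ hq
      rw [div_eq_mul_inv (_ * _) |_|, H.inv_abs_v0 ht, H.ev_σ ht θ w]
      simp only [ev_add, ev_mul, ev_smul, ev_one hq, ev_pow _ _ hq, ev_v2R hq, ev_tI hp, ev_expR _ hq,
        H.fE2 t ht, H.fU t ht]
      linear_combination α t θ * Real.exp (2 * ν t θ - 2 * U t θ) / (2 * t) *
        f t θ (ev H.fld.a (t, θ, w) * w.1, w.2) *
        (1 + 2 * Real.exp (-2 * U t θ) * w.2.1 ^ 2) * ev H.fld.rp (t, θ, w) * haσ
  have hL : pt α t θ * pt U t θ / (2 * α t θ) = 1/2 * ev (dd eT H.fld.L) (t, θ, v) * pt U t θ := by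
    rw [H.pt_α ht θ v]; field_simp
  rw [Fld.Ut, H.fU.dT.dT t ht, H.hutt t (Ioo_subset_Ioc_self ht), hm, hL, H.pθ_α ht θ v]
  simp only [Fld.At, Fld.XU, Fld.XA, Fld.Lt, ev_add, ev_sub, ev_mul, ev_smul, ev_pow _ _ hp, ev_tI hp,
    H.ev_X_X _ ht, ev_X, ev_h H ht, H.fE4 t ht, H.fU.dT t ht, H.fU.dθ t ht, H.fU.dθ.dθ t ht, H.fA.dT t ht,
    H.fA.dθ t ht, H.fJ t ht, mul_pow, H.ev_σ_sq ht]
  ring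

theorem eq_A {p : E5} (hp : p ∈ strip tp ti) : ev (dd eT H.fld.At) p =
    ev (H.fld.X H.fld.XA + tI * H.fld.At + (1/2 : ℝ) • (H.fld.Lt * H.fld.At)
      - (4 : ℝ) • (H.fld.At * H.fld.Ut - H.fld.XA * H.fld.XU) + tI ^ 2 * H.fld.E4 * H.fld.J * H.fld.κ) p
      + 2 * ev (tI * H.fld.E4) p * H.fld.mom (v2R * H.fld.w * H.fld.rp) p := by
  obtain ⟨t, θ, v⟩ := p
  have ht : t ∈ Ioo tp ti := mem_strip.1 hp
  have hα := (H.hαpos t (Ioo_subset_Ioc_self ht) θ).ne'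
  have hm := H.mul_integral ht θ v (v2R * H.fld.w * H.fld.rp)
    (fun v => f t θ v * v.2.1 * (v.2.2 - A t θ * v.2.1) / |v0 α ν U A t θ v|)
    (2 * (α t θ * Real.sqrt (α t θ)) * Real.exp (2 * ν t θ - 4 * U t θ) / t)
    (2 * ev (tI * H.fld.E4) (t, θ, v)) fun w => by
      have hq : (t, θ, w) ∈ strip tp ti := mem_strip.2 ht
      have haσ := H.ev_a_σ hq
      rw [div_eq_mul_inv (_ * _) |_|, H.inv_abs_v0 ht, H.ev_σ ht θ w]
      simp only [Fld.w, ev_sub, ev_mul, ev_v2R hq, ev_v3R hq, ev_tI hp, H.fE4 t ht, H.fA t ht]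
      linear_combination 2 * α t θ * Real.exp (2 * ν t θ - 4 * U t θ) / t *
        f t θ (ev H.fld.a (t, θ, w) * w.1, w.2) *
        w.2.1 * (w.2.2 - A t θ * w.2.1) * ev H.fld.rp (t, θ, w) * haσ
  have hL : pt α t θ * pt A t θ / (2 * α t θ) = 1/2 * ev (dd eT H.fld.L) (t, θ, v) * pt A t θ := by
    rw [H.pt_α ht θ v]; field_simp
  have hσ := H.ev_σ_sq ht θ v
  rw [Fld.At, H.fA.dT.dT t ht, H.hatt t (Ioo_subset_Ioc_self ht), hm, hL, H.pθ_α ht θ v]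
  simp only [Fld.Ut, Fld.XU, Fld.XA, Fld.Lt, Fld.κ, ev_add, ev_sub, ev_mul, ev_smul, ev_pow _ _ hp, ev_tI hp,
    H.ev_X_X _ ht, ev_X, H.fE4 t ht, H.fU.dT t ht, H.fU.dθ t ht, H.fA.dθ.dθ t ht, H.fA.dT t ht,
    H.fA.dθ t ht, H.fA t ht, H.fJ t ht, H.fK t ht]
  linear_combination (-4 * pθ A t θ * pθ U t θ) * hσ

theorem eq_νν {p : E5} (hp : p ∈ strip tp ti) : ev (dd eT (dd eT H.fld.ν)) p =
    ev (H.fld.X (H.fld.X H.fld.β) + (1/2 : ℝ) • (H.fld.Lt * dd eT H.fld.ν) - H.fld.Ut ^ 2 + H.fld.XU ^ 2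
      + H.fld.h * (H.fld.At ^ 2 - H.fld.XA ^ 2) - (1/4 : ℝ) • (tI ^ 2 * H.fld.E4 * H.fld.J ^ 2)
      - (3/4 : ℝ) • (tI ^ 4 * H.fld.E0 * H.fld.κ ^ 2)) p
      - ev (tI ^ 3 * H.fld.E0) p * H.fld.mom (H.fld.w ^ 2 * H.fld.rp) p := by
  obtain ⟨t, θ, v⟩ := p
  have ht : t ∈ Ioo tp ti := mem_strip.1 hp
  have hα := (H.hαpos t (Ioo_subset_Ioc_self ht) θ).ne'
  have hm := H.mul_integral ht θ v (H.fld.w ^ 2 * H.fld.rp)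
    (fun v => f t θ v * (v.2.2 - A t θ * v.2.1) ^ 2 / |v0 α ν U A t θ v|)
    ((α t θ * Real.sqrt (α t θ)) * Real.exp (2 * ν t θ) / t ^ 3)
    (ev (tI ^ 3 * H.fld.E0) (t, θ, v)) fun w => by
      have hq : (t, θ, w) ∈ strip tp ti := mem_strip.2 ht
      have haσ := H.ev_a_σ hq
      rw [div_eq_mul_inv (_ * _) |_|, H.inv_abs_v0 ht, H.ev_σ ht θ w]
      simp only [Fld.w, ev_sub, ev_mul, ev_pow _ _ hp, ev_pow _ _ hq, ev_v2R hq, ev_v3R hq, ev_tI hp,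
        H.fE0 t ht, H.fA t ht]
      linear_combination α t θ * Real.exp (2 * ν t θ) / t ^ 3 *
        f t θ (ev H.fld.a (t, θ, w) * w.1, w.2) *
        (w.2.2 - A t θ * w.2.1) ^ 2 * ev H.fld.rp (t, θ, w) * haσ
  have hL : pt α t θ * pt ν t θ / (2 * α t θ) = 1/2 * ev (dd eT H.fld.L) (t, θ, v) * pt ν t θ := by
    rw [H.pt_α ht θ v]; field_simp
  have hL2 : pθ α t θ ^ 2 / (4 * α t θ) = 1/4 * α t θ * ev (dd eθ H.fld.L) (t, θ, v) ^ 2 := by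
    rw [H.pθ_α ht θ v]; field_simp
  rw [H.fν.dT.dT t ht, H.hnutt t (Ioo_subset_Ioc_self ht), hm, hL, hL2, H.pθ_α ht θ v, H.pθ_pθ_α ht θ v]
  simp only [Fld.Ut, Fld.At, Fld.XU, Fld.XA, Fld.Lt, Fld.κ, ev_add, ev_sub, ev_mul, ev_smul, ev_pow _ _ hp, ev_tI hp,
    H.ev_X_X _ ht, dθ_β, map_add, Derivation.map_smul, ev_X, ev_h H ht, H.fE4 t ht, H.fE0 t ht, H.fU.dT t ht,
    H.fU.dθ t ht, H.fν.dT t ht, H.fν.dθ t ht, H.fν.dθ.dθ t ht, H.fA.dT t ht,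
    H.fA.dθ t ht, H.fA t ht, H.fJ t ht, H.fK t ht, mul_pow, H.ev_σ_sq ht]
  ring

end Plain

namespace Plain
variable [hfact : Fact (0 < tp)] {U A ν α J K : ℝ → ℝ → ℝ} {f : ℝ → ℝ → V3 → ℝ}
  (H : Plain tp ti U A ν α J K f)

theorem f_eq {t : ℝ} (ht : t ∈ Ioo tp ti) (θ : ℝ) (v : V3) :
    f t θ v = ev H.fld.F (Sys.scale H.fld.σ (t, θ, v)) := by
  have h := H.ev_F_eq ht θ (ev H.fld.σ (t, θ, v) * v.1, v.2)
  have ha : ev H.fld.a (t, θ, ev H.fld.σ (t, θ, v) * v.1, v.2) = ev H.fld.a (t, θ, v) := H.ba _ _ _ _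
  rw [ha] at h
  rw [show Sys.scale H.fld.σ (t, θ, v) = (t, θ, ev H.fld.σ (t, θ, v) * v.1, v.2) from rfl, h]
  change f t θ v = f t θ (ev H.fld.a (t, θ, v) * (ev H.fld.σ (t, θ, v) * v.1), v.2)
  rw [← mul_assoc, H.ev_a_σ (mem_strip.2 ht), one_mul]

theorem norm_le_of_scaled {τ ρ x C R : ℝ} {w : ℝ × ℝ} (h : τ * ρ = 1) (hτ : |τ| ≤ C) (hR : ‖((ρ * x, w) : V3)‖ ≤ R) :
    ‖((x, w) : V3)‖ ≤ max C 1 * R := by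
  have h0 : 0 ≤ R := (norm_nonneg _).trans hR
  obtain ⟨h1, h2⟩ := max_le_iff.1 hR
  refine max_le ?_ (h2.trans (le_mul_of_one_le_left h0 (le_max_right _ _)))
  change |ρ * x| ≤ R at h1
  change |x| ≤ _
  calc |x| = |τ| * |ρ * x| := by rw [← abs_mul, ← mul_assoc, h, one_mul]
    _ ≤ max C 1 * R := mul_le_mul (hτ.trans (le_max_left _ _)) h1 (abs_nonneg _) (by positivity)

theorem ne_zero : ∃ p ∈ strip tp ti, ev H.fld.F p ≠ 0 := by
  by_contra! h0
  have h1 : ∀ t ∈ Ioo tp ti, ∀ θ v, f t θ v = 0 := fun t ht θ v => by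
    rw [H.f_eq ht, h0 _ (Sys.scale_strip (mem_strip.2 ht))]
  have h2 : ∀ θ v, f ti θ v = 0 := fun θ v => by
    have hc : ContinuousWithinAt (fun s => f s θ v) (Ioo tp ti) ti :=
      ((H.hfsm.continuousOn.comp (f := fun s : ℝ => (s, θ, v)) (s := Ioc tp ti) (by fun_prop)
        fun s hs => ⟨hs, trivial⟩) ti ⟨H.hti, le_rfl⟩).mono Ioo_subset_Ioc_self
    have hne : (𝓝[Ioo tp ti] ti).NeBot := mem_closure_iff_nhdsWithin_neBot.1 (by
      rw [closure_Ioo H.hti.ne]; exact right_mem_Icc.2 H.hti.le)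
    refine tendsto_nhds_unique hc.tendsto (tendsto_const_nhds.congr' ?_)
    filter_upwards [self_mem_nhdsWithin] with s hs using (h1 s hs θ v).symm
  have := H.hC2
  simp [h2] at this

/-- the system in rescaled velocities -/
def sys : Sys tp ti where
  toFld := H.fld
  bU := H.fU.base
  bA := H.fA.base
  bL := H.fL.base
  bβ := H.fβ.base
  bJ := H.fJ.base
  bK := H.fK.base
  F_nonneg := by
    rintro ⟨t, θ, v⟩ hp
    rw [H.ev_F_eq (mem_strip.1 hp)]
    exact H.hfnn _ (Ioo_subset_Ioc_self (mem_strip.1 hp)) _ _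
  F_supp t ht := by
    obtain ⟨R, hR⟩ := H.hfsupp t (Ioo_subset_Ioc_self ht)
    obtain ⟨C, -, hC⟩ := H.bσ.bdd (a := t) (b := t) (by simpa using ht)
    refine ⟨max C 1 * R, fun θ v hv => ?_⟩
    rw [H.ev_F_eq ht]
    by_contra h0
    have h1 := not_lt.1 fun h => h0 (hR _ _ h)
    exact absurd (norm_le_of_scaled (by rw [mul_comm]; exact H.ev_a_σ (mem_strip.2 ht))
      (hC t ⟨le_rfl, le_rfl⟩ θ v) h1) (not_le.2 hv)
  F_ne := H.ne_zero
  late t1 ht1 G hG := by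
    rcases hG with rfl | rfl | rfl | rfl | rfl | rfl
    · exact late_bd H.rU H.fU ht1
    · exact late_bd H.rA H.fA ht1
    · exact late_bd H.rL H.fL ht1
    · exact late_bd H.rβ H.fβ ht1
    · exact late_bd H.rJ H.fJ ht1
    · exact late_bd H.rK H.fK ht1
  eV := H.vlasov
  eν _ := H.eq_ν
  eXβ _ := H.eq_Xβ
  eL _ := H.eq_L
  eJt _ := H.eq_Jt
  eXJ _ := H.eq_XJ
  eKt _ := H.eq_Kt
  eXK _ := H.eq_XK
  eU _ := H.eq_U
  eA _ := H.eq_A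
  eνν _ := H.eq_νν

include H in
theorem tm_Ioo : tm tp ti ∈ Ioo tp ti := early_Ioo (tm_mem H.hti)

include H in
theorem metric_iter {G : SF tp ti} {g : ℝ → ℝ → ℝ} (hg : RegOn tp ti g) (h : Fits G g) (hm : H.sys.Mem G) (k : ℕ) :
    ∃ c, ∀ p ∈ Ioc tp ti ×ˢ (univ : Set ℝ),
      ‖iteratedFDerivWithin ℝ k (fun q : ℝ × ℝ => g q.1 q.2) (Ioc tp ti ×ˢ univ) p‖ ≤ c := by
  obtain ⟨c1, h1⟩ := H.sys.rest_iter hm h.base k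
  obtain ⟨c2, h2⟩ := late_iter hg H.tm_Ioo k
  refine ⟨max c1 c2, iter_within_of_interior uniqueDiffOn_slab (slab_sub_closure H.hti) hg.sm fun p hp => ?_⟩
  rw [interior_slab] at hp
  rcases le_or_gt p.1 (tm tp ti) with ht | ht
  · rw [← ((h.rest hp).iteratedFDeriv ℝ k).eq_of_nhds]
    exact (h1 p ⟨⟨hp.1.1, ht⟩, trivial⟩).trans (le_max_left _ _)
  · exact (h2 p ⟨⟨ht.le, hp.1.2⟩, trivial⟩).trans (le_max_right _ _)

include H in
theorem late_iter_f (k : ℕ) : ∃ c, ∀ p ∈ Ico (tm tp ti) ti ×ˢ (univ : Set (ℝ × V3)),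
    ‖iteratedFDeriv ℝ k (fun q : ℝ × ℝ × V3 => f q.1 q.2.1 q.2.2) p‖ ≤ c := by
  have htm := H.tm_Ioo
  obtain ⟨t1, ht1⟩ := exists_between htm.1
  have ht1' : t1 ∈ Ioo tp ti := ⟨ht1.1, ht1.2.trans htm.2⟩
  obtain ⟨C, -, hC⟩ := (((late_bd H.rL H.fL ht1').1.smul (-1/2)).expR : Bd _ H.fld.a)
  set R := max C 1 * H.sys.B with hRdef
  refine iter_bdd_compact uniqueDiffOn_slab H.hfsm (K := Icc (tm tp ti) ti ×ˢ Icc (0:ℝ) 1 ×ˢ closedBall (0 : V3) R)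
    (isCompact_Icc.prod (isCompact_Icc.prod (isCompact_closedBall _ _)))
    (fun p hp => ⟨⟨htm.1.trans_le hp.1.1, hp.1.2⟩, trivial⟩) ?_ k
  rintro ⟨t, θ, v⟩ ⟨ht, -⟩
  rcases le_or_gt ‖v‖ R with hv | hv
  · refine .inl ⟨(0, ((-⌊θ⌋ : ℤ) : ℝ), 0), fun x => ?_, ⟨?_, ?_, ?_⟩, ?_⟩
    · simpa using per_int (g := fun y => f x.1 y x.2.2) (fun y => H.hfper _ _ _) x.2.1 (-⌊θ⌋)
    · simpa using ⟨ht.1, ht.2.le⟩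
    · have h1 := Int.floor_le θ
      have h2 := Int.lt_floor_add_one θ
      simp only [Prod.mk_add_mk, Int.cast_neg, mem_Icc]
      constructor <;> linarith
    · simpa using hv
    · rw [interior_slab]
      exact ⟨by simpa using ⟨htm.1.trans_le ht.1, ht.2⟩, trivial⟩
  · right
    have hv' : ∀ᶠ q : ℝ × ℝ × V3 in 𝓝 (t, θ, v), R < ‖q.2.2‖ :=
      (continuous_snd.snd.norm.continuousAt (x := (t, θ, v))).eventually (lt_mem_nhds hv)
    have ht' : ∀ᶠ q : ℝ × ℝ × V3 in 𝓝 (t, θ, v), q.1 ∈ Ioo t1 ti :=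
      (continuous_fst.continuousAt (x := (t, θ, v))).eventually (isOpen_Ioo.mem_nhds ⟨ht1.2.trans_le ht.1, ht.2⟩)
    filter_upwards [hv', ht'] with q hq hqt
    obtain ⟨s, θ', w⟩ := q
    have hs : s ∈ Ioo tp ti := ⟨ht1.1.trans hqt.1, hqt.2⟩
    by_contra h0
    change f s θ' w ≠ 0 at h0
    rw [H.f_eq hs] at h0
    have h3 := (H.sys.B_supp (Sys.scale_strip (mem_strip.2 hs)) h0).le
    exact absurd (norm_le_of_scaled (H.ev_a_σ (mem_strip.2 hs)) (hC (s, θ', w) ⟨⟨hqt.1.le, hqt.2⟩, trivial⟩) h3)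
      (not_le.2 hq)

include H in
theorem f_iter (k : ℕ) : ∃ c, ∀ p ∈ Ioc tp ti ×ˢ (univ : Set (ℝ × V3)),
    ‖iteratedFDerivWithin ℝ k (fun q : ℝ × ℝ × V3 => f q.1 q.2.1 q.2.2) (Ioc tp ti ×ˢ univ) p‖ ≤ c := by
  obtain ⟨c1, h1⟩ := H.sys.pull_iter k
  obtain ⟨c2, h2⟩ := H.late_iter_f k
  refine ⟨max c1 c2, iter_within_of_interior uniqueDiffOn_slab (slab_sub_closure H.hti) H.hfsm fun p hp => ?_⟩
  rw [interior_slab] at hp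
  rcases le_or_gt p.1 (tm tp ti) with ht | ht
  · have he : (fun p => ev H.sys.F (H.sys.Ψ p)) =ᶠ[𝓝 p] fun q : ℝ × ℝ × V3 => f q.1 q.2.1 q.2.2 := by
      filter_upwards [isOpen_strip.mem_nhds (mem_strip.2 hp.1)] with q hq using (H.f_eq (mem_strip.1 hq) _ _).symm
    rw [← (he.iteratedFDeriv ℝ k).eq_of_nhds]
    exact (h1 p ⟨⟨hp.1.1, ht⟩, trivial⟩).trans (le_max_left _ _)
  · exact (h2 p ⟨⟨ht.le, hp.1.2⟩, trivial⟩).trans (le_max_right _ _)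

end Plain

end

theorem all_derivatives_bounded
    (tp ti : ℝ) (htp : 0 < tp) (hti : tp < ti)
    (U A ν α J K : ℝ → ℝ → ℝ) (f : ℝ → ℝ → V3 → ℝ)
    (hUsm : ContDiffOn ℝ (⊤ : ℕ∞) (fun p : ℝ × ℝ => U p.1 p.2) (Ioc tp ti ×ˢ (univ : Set ℝ)))
    (hAsm : ContDiffOn ℝ (⊤ : ℕ∞) (fun p : ℝ × ℝ => A p.1 p.2) (Ioc tp ti ×ˢ (univ : Set ℝ)))
    (hνsm : ContDiffOn ℝ (⊤ : ℕ∞) (fun p : ℝ × ℝ => ν p.1 p.2) (Ioc tp ti ×ˢ (univ : Set ℝ)))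
    (hαsm : ContDiffOn ℝ (⊤ : ℕ∞) (fun p : ℝ × ℝ => α p.1 p.2) (Ioc tp ti ×ˢ (univ : Set ℝ)))
    (hJsm : ContDiffOn ℝ (⊤ : ℕ∞) (fun p : ℝ × ℝ => J p.1 p.2) (Ioc tp ti ×ˢ (univ : Set ℝ)))
    (hKsm : ContDiffOn ℝ (⊤ : ℕ∞) (fun p : ℝ × ℝ => K p.1 p.2) (Ioc tp ti ×ˢ (univ : Set ℝ)))
    (hfsm : ContDiffOn ℝ (⊤ : ℕ∞) (fun p : ℝ × ℝ × V3 => f p.1 p.2.1 p.2.2) (Ioc tp ti ×ˢ (univ : Set (ℝ × V3))))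
    (hUper : ∀ t θ, U t (θ + 1) = U t θ)
    (hAper : ∀ t θ, A t (θ + 1) = A t θ)
    (hνper : ∀ t θ, ν t (θ + 1) = ν t θ)
    (hαper : ∀ t θ, α t (θ + 1) = α t θ)
    (hJper : ∀ t θ, J t (θ + 1) = J t θ)
    (hKper : ∀ t θ, K t (θ + 1) = K t θ)
    (hfper : ∀ t θ v, f t (θ + 1) v = f t θ v)
    (hαpos : ∀ t ∈ Ioc tp ti, ∀ θ : ℝ, 0 < α t θ)
    (hfnn : ∀ t ∈ Ioc tp ti, ∀ (θ : ℝ) (v : V3), 0 ≤ f t θ v)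
    (hfsupp : ∀ t ∈ Ioc tp ti, ∃ R : ℝ, ∀ (θ : ℝ) (v : V3), R < ‖v‖ → f t θ v = 0)
    (hvlasov :
      ∀ t ∈ Ioc tp ti, ∀ (θ : ℝ) (v : V3),
      ptf f t θ v
        = pv1 (v0 α ν U A t θ) v * pθf f t θ v
          - (deriv (fun x => v0 α ν U A t x v) θ
              + Real.sqrt (α t θ) * Real.exp (2 * ν t θ) / t ^ 3 * (K t θ - A t θ * J t θ) * (v.2.2 - A t θ * v.2.1)
              + Real.sqrt (α t θ) * Real.exp (2 * ν t θ - 4 * U t θ) / t * J t θ * v.2.1)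
            * pv1 (f t θ) v)
    (hnut :
      ∀ t ∈ Ioc tp ti, ∀ θ : ℝ,
      (pt ν t θ)
        = t * ((pt U t θ) ^ 2 + α t θ * (pθ U t θ) ^ 2
              + Real.exp (4 * U t θ) / (4 * t ^ 2) * ((pt A t θ) ^ 2 + α t θ * (pθ A t θ) ^ 2))
          + α t θ * Real.exp (2 * ν t θ - 4 * U t θ) / (4 * t) * J t θ ^ 2
          + α t θ * Real.exp (2 * ν t θ) / (4 * t ^ 3) * (K t θ - A t θ * J t θ) ^ 2
          + Real.sqrt (α t θ) * ∫ v : V3, f t θ v * |v0 α ν U A t θ v|)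
    (hnuth :
      ∀ t ∈ Ioc tp ti, ∀ θ : ℝ,
      (pθ ν t θ)
        = 2 * t * ((pt U t θ) * (pθ U t θ) + Real.exp (4 * U t θ) / (4 * t ^ 2) * (pt A t θ) * (pθ A t θ))
          - (pθ α t θ) / (2 * α t θ)
          - Real.sqrt (α t θ) * ∫ v : V3, f t θ v * v.1)
    (halt :
      ∀ t ∈ Ioc tp ti, ∀ θ : ℝ,
      (pt α t θ) / α t θ
        = - (α t θ * Real.exp (2 * ν t θ - 4 * U t θ) * J t θ ^ 2 / t)
          - α t θ * Real.exp (2 * ν t θ) * (K t θ - A t θ * J t θ) ^ 2 / t ^ 3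
          - 2 * (α t θ * Real.sqrt (α t θ)) * Real.exp (2 * ν t θ)
            * ∫ v : V3, f t θ v
                * (Real.exp (-2 * U t θ) + Real.exp (-4 * U t θ) * v.2.1 ^ 2
                    + (t ^ 2)⁻¹ * (v.2.2 - A t θ * v.2.1) ^ 2)
                / |v0 α ν U A t θ v|)
    (hjt :
      ∀ t ∈ Ioc tp ti, ∀ θ : ℝ,
      (pt J t θ) = -2 * α t θ * ∫ v : V3, f t θ v * v.1 * v.2.1 / |v0 α ν U A t θ v|)
    (hjth :
      ∀ t ∈ Ioc tp ti, ∀ θ : ℝ,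
      (pθ J t θ) = 2 * ∫ v : V3, f t θ v * v.2.1)
    (hkt :
      ∀ t ∈ Ioc tp ti, ∀ θ : ℝ,
      (pt K t θ) = -2 * α t θ * ∫ v : V3, f t θ v * v.1 * v.2.2 / |v0 α ν U A t θ v|)
    (hkth :
      ∀ t ∈ Ioc tp ti, ∀ θ : ℝ,
      (pθ K t θ) = 2 * ∫ v : V3, f t θ v * v.2.2)
    (hutt :
      ∀ t ∈ Ioc tp ti, ∀ θ : ℝ,
      (pt (pt U) t θ)
        = α t θ * (pθ (pθ U) t θ) - (pt U t θ) / t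
          + (pt α t θ) * (pt U t θ) / (2 * α t θ) + (pθ α t θ) * (pθ U t θ) / 2
          + Real.exp (4 * U t θ) / (2 * t ^ 2) * ((pt A t θ) ^ 2 - α t θ * (pθ A t θ) ^ 2)
          + α t θ * Real.exp (2 * ν t θ - 4 * U t θ) / (2 * t ^ 2) * J t θ ^ 2
          + (α t θ * Real.sqrt (α t θ)) * Real.exp (2 * ν t θ - 2 * U t θ) / (2 * t)
            * ∫ v : V3, f t θ v * (1 + 2 * Real.exp (-2 * U t θ) * v.2.1 ^ 2) / |v0 α ν U A t θ v|)
    (hatt :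
      ∀ t ∈ Ioc tp ti, ∀ θ : ℝ,
      (pt (pt A) t θ)
        = α t θ * (pθ (pθ A) t θ) + (pt A t θ) / t
          + (pt α t θ) * (pt A t θ) / (2 * α t θ) + (pθ α t θ) * (pθ A t θ) / 2
          - 4 * ((pt A t θ) * (pt U t θ) - α t θ * (pθ A t θ) * (pθ U t θ))
          + α t θ * Real.exp (2 * ν t θ - 4 * U t θ) / t ^ 2 * J t θ * (K t θ - A t θ * J t θ)
          + 2 * (α t θ * Real.sqrt (α t θ)) * Real.exp (2 * ν t θ - 4 * U t θ) / t
            * ∫ v : V3, f t θ v * v.2.1 * (v.2.2 - A t θ * v.2.1) / |v0 α ν U A t θ v|)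
    (hnutt :
      ∀ t ∈ Ioc tp ti, ∀ θ : ℝ,
      (pt (pt ν) t θ)
        = α t θ * (pθ (pθ ν) t θ)
          + (pt α t θ) * (pt ν t θ) / (2 * α t θ) + (pθ α t θ) * (pθ ν t θ) / 2
          + (pθ (pθ α) t θ) / 2 - (pθ α t θ) ^ 2 / (4 * α t θ)
          - (pt U t θ) ^ 2 + α t θ * (pθ U t θ) ^ 2
          + Real.exp (4 * U t θ) / (4 * t ^ 2) * ((pt A t θ) ^ 2 - α t θ * (pθ A t θ) ^ 2)
          - α t θ * Real.exp (2 * ν t θ - 4 * U t θ) * J t θ ^ 2 / (4 * t ^ 2)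
          - 3 * α t θ * Real.exp (2 * ν t θ) * (K t θ - A t θ * J t θ) ^ 2 / (4 * t ^ 4)
          - (α t θ * Real.sqrt (α t θ)) * Real.exp (2 * ν t θ) / t ^ 3
            * ∫ v : V3, f t θ v * (v.2.2 - A t θ * v.2.1) ^ 2 / |v0 α ν U A t θ v|)
    (hC2 : 0 < ∫ θ in (0:ℝ)..1, ∫ v : V3, f ti θ v) :
    ∀ k : ℕ, 0 < k →
      (∃ C : ℝ, ∀ p ∈ Ioc tp ti ×ˢ (univ : Set ℝ),
        ‖iteratedFDerivWithin ℝ k (fun q : ℝ × ℝ => U q.1 q.2) (Ioc tp ti ×ˢ (univ : Set ℝ)) p‖ ≤ C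
        ∧ ‖iteratedFDerivWithin ℝ k (fun q : ℝ × ℝ => A q.1 q.2) (Ioc tp ti ×ˢ (univ : Set ℝ)) p‖ ≤ C
        ∧ ‖iteratedFDerivWithin ℝ k (fun q : ℝ × ℝ => ν q.1 q.2) (Ioc tp ti ×ˢ (univ : Set ℝ)) p‖ ≤ C
        ∧ ‖iteratedFDerivWithin ℝ k (fun q : ℝ × ℝ => α q.1 q.2) (Ioc tp ti ×ˢ (univ : Set ℝ)) p‖ ≤ C
        ∧ ‖iteratedFDerivWithin ℝ k (fun q : ℝ × ℝ => J q.1 q.2) (Ioc tp ti ×ˢ (univ : Set ℝ)) p‖ ≤ C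
        ∧ ‖iteratedFDerivWithin ℝ k (fun q : ℝ × ℝ => K q.1 q.2) (Ioc tp ti ×ˢ (univ : Set ℝ)) p‖ ≤ C)
      ∧ ∃ C : ℝ, ∀ p ∈ Ioc tp ti ×ˢ (univ : Set (ℝ × V3)),
        ‖iteratedFDerivWithin ℝ k (fun q : ℝ × ℝ × V3 => f q.1 q.2.1 q.2.2)
          (Ioc tp ti ×ˢ (univ : Set (ℝ × V3))) p‖ ≤ C := by
  have : Fact (0 < tp) := ⟨htp⟩
  have H : Plain tp ti U A ν α J K f :=
    { hti, hfsm, hfper, hαpos, hfnn, hfsupp, hvlasov, hnut, hnuth, halt, hjt, hjth, hkt, hkth, hutt, hatt,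
      hnutt, hC2
      rU := ⟨hUsm, hUper⟩
      rA := ⟨hAsm, hAper⟩
      rν := ⟨hνsm, hνper⟩
      rα := ⟨hαsm, hαper⟩
      rJ := ⟨hJsm, hJper⟩
      rK := ⟨hKsm, hKper⟩ }
  intro k _
  refine ⟨?_, H.f_iter k⟩
  obtain ⟨c1, h1⟩ := H.metric_iter H.rU H.fU Sys.Mem.U k
  obtain ⟨c2, h2⟩ := H.metric_iter H.rA H.fA Sys.Mem.A k
  obtain ⟨c3, h3⟩ := H.metric_iter H.rν H.fν (Sys.Mem.β.sub (Sys.Mem.L.smul _)) k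
  obtain ⟨c4, h4⟩ := H.metric_iter H.rα H.fα Sys.Mem.L.exp k
  obtain ⟨c5, h5⟩ := H.metric_iter H.rJ H.fJ Sys.Mem.J k
  obtain ⟨c6, h6⟩ := H.metric_iter H.rK H.fK Sys.Mem.K k
  refine ⟨c1 ⊔ c2 ⊔ c3 ⊔ c4 ⊔ c5 ⊔ c6, fun p hp => ?_⟩
  refine ⟨(h1 p hp).trans ?_, (h2 p hp).trans ?_, (h3 p hp).trans ?_, (h4 p hp).trans ?_, (h5 p hp).trans ?_,
    (h6 p hp).trans ?_⟩ <;> simp [le_sup_iff]
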